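/- Let n ≥ 2 and λ ≥ 1. Let A and A' be C^∞ maps from B(0,10) ⊂ ℝⁿ to n×n real matrices, uniformly elliptic with constant λ, with A(0) = A'(0) = I. Fix N₀ > 0. Then there exists a constant D₀ > 0 (depending only on n, A, A', N₀) such that: if u and v are smooth, not identically zero solutions of div(A∇u) = 0 and div(A'∇v) = 0 on B(0,10) respectively, with Z(v) ⊆ Z(u) and β_u(0,10) ≤ N₀, then β_v(0,1) ≤ D₀. -/

import Mathlib

open MeasureTheory Metric

noncomputable section

/-- Partial derivative in the `i`-th coordinate direction. -/
def pd {n : ℕ} (i : Fin n) (u : EuclideanSpace ℝ (Fin n) → ℝ) :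
    EuclideanSpace ℝ (Fin n) → ℝ :=
  fun x => fderiv ℝ u x (EuclideanSpace.single i 1)

/-- `A` is uniformly elliptic with constant `lam` on the set `s`. -/
def UnifElliptic {n : ℕ} (A : EuclideanSpace ℝ (Fin n) → Matrix (Fin n) (Fin n) ℝ)
    (lam : ℝ) (s : Set (EuclideanSpace ℝ (Fin n))) : Prop :=
  ∀ x ∈ s, ∀ ξ : Fin n → ℝ,
    lam⁻¹ * (∑ i, ξ i ^ 2) ≤ ∑ i, ∑ j, A x i j * ξ i * ξ j ∧
    ∑ i, ∑ j, A x i j * ξ i * ξ j ≤ lam * (∑ i, ξ i ^ 2)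

/-- `u` solves `div(A ∇ u) = 0` on `s`, i.e. `Σ_{i,j} ∂_i (A_{ij} ∂_j u) = 0` on `s`. -/
def SolvesDiv {n : ℕ} (A : EuclideanSpace ℝ (Fin n) → Matrix (Fin n) (Fin n) ℝ)
    (u : EuclideanSpace ℝ (Fin n) → ℝ) (s : Set (EuclideanSpace ℝ (Fin n))) : Prop :=
  ∀ x ∈ s, ∑ i, ∑ j, pd i (fun y => A y i j * pd j u y) x = 0

/-- Almgren-type frequency function `β_u(0,r) = r·D(r)/h(r)` for `div(A ∇ u) = 0`
(assuming `A 0 = I`), where `D(r) = r^{1-n} ∫_{B(0,r)} ⟨A∇u,∇u⟩` and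
`h(r) = r^{1-n} ∫_{∂B(0,r)} μ u²` with `μ(x) = ⟨A(x)x,x⟩/|x|²`. -/
def freq {n : ℕ} (A : EuclideanSpace ℝ (Fin n) → Matrix (Fin n) (Fin n) ℝ)
    (u : EuclideanSpace ℝ (Fin n) → ℝ) (r : ℝ) : ℝ :=
  r * (r ^ (1 - (n : ℝ)) * ∫ x in closedBall (0 : EuclideanSpace ℝ (Fin n)) r,
        ∑ i, ∑ j, A x i j * pd j u x * pd i u x) /
    (r ^ (1 - (n : ℝ)) * ∫ x in sphere (0 : EuclideanSpace ℝ (Fin n)) r,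
        ((∑ i, ∑ j, A x i j * x j * x i) / ‖x‖ ^ 2) * u x ^ 2 ∂ μH[(n : ℝ) - 1])

/-- Global smoothness of real functions on Euclidean space. -/
abbrev Sm {n : ℕ} (f : EuclideanSpace ℝ (Fin n) → ℝ) : Prop := ContDiff ℝ (⊤ : ℕ∞) f

theorem two_le_smooth : (2 : WithTop ℕ∞) ≤ ((⊤ : ℕ∞) : WithTop ℕ∞) :=
  ENat.LEInfty.out

section Calculus

variable {n : ℕ} {f g : EuclideanSpace ℝ (Fin n) → ℝ} {x : EuclideanSpace ℝ (Fin n)}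

theorem Sm.differentiable (hf : Sm f) : Differentiable ℝ f :=
  ContDiff.differentiable hf (by simp)

theorem Sm.pd (hf : Sm f) (i : Fin n) : Sm (pd i f) := by
  unfold _root_.pd
  exact (hf.fderiv_right (m := (⊤ : ℕ∞)) (by simp)).clm_apply contDiff_const

theorem pd_congr_of_eventuallyEq (h : f =ᶠ[nhds x] g) (i : Fin n) : pd i f x = pd i g x := by
  unfold pd; rw [h.fderiv_eq]

theorem pd_add_at (hf : DifferentiableAt ℝ f x) (hg : DifferentiableAt ℝ g x) (i : Fin n) :
    pd i (fun y => f y + g y) x = pd i f x + pd i g x := by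
  unfold pd; rw [fderiv_fun_add hf hg]; rfl

theorem pd_sub_at (hf : DifferentiableAt ℝ f x) (hg : DifferentiableAt ℝ g x) (i : Fin n) :
    pd i (fun y => f y - g y) x = pd i f x - pd i g x := by
  unfold pd; rw [fderiv_fun_sub hf hg]; rfl

theorem pd_mul_at (hf : DifferentiableAt ℝ f x) (hg : DifferentiableAt ℝ g x) (i : Fin n) :
    pd i (fun y => f y * g y) x = pd i f x * g x + f x * pd i g x := by
  unfold pd; rw [fderiv_fun_mul hf hg]; simp; ring

theorem pd_pow_at (hf : DifferentiableAt ℝ f x) (k : ℕ) (i : Fin n) :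
    pd i (fun y => f y ^ k) x = k * f x ^ (k - 1) * pd i f x := by
  unfold pd; rw [fderiv_fun_pow k hf]; simp

theorem pd_sum_at {ι : Type*} {s : Finset ι} {F : ι → EuclideanSpace ℝ (Fin n) → ℝ}
    (hF : ∀ j ∈ s, DifferentiableAt ℝ (F j) x) (i : Fin n) :
    pd i (fun y => ∑ j ∈ s, F j y) x = ∑ j ∈ s, pd i (F j) x := by
  unfold pd
  rw [fderiv_fun_sum hF, sum_apply]

theorem pd_const (c : ℝ) (i : Fin n) : pd i (fun _ => c) x = 0 := by
  unfold pd; simp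

theorem pd_const_mul_at (hf : DifferentiableAt ℝ f x) (c : ℝ) (i : Fin n) :
    pd i (fun y => c * f y) x = c * pd i f x := by
  rw [pd_mul_at (by fun_prop) hf, pd_const]; ring

theorem pd_comp_at {φ : ℝ → ℝ} {φ' : ℝ} (hφ : HasDerivAt φ φ' (f x)) (hf : DifferentiableAt ℝ f x)
    (i : Fin n) : pd i (fun y => φ (f y)) x = φ' * pd i f x := by
  unfold pd
  have := (hφ.comp_hasFDerivAt x hf.hasFDerivAt).fderiv
  simp only [Function.comp_def] at this
  rw [this]; simp

theorem pd_coord (i j : Fin n) : pd i (fun y => y j) x = if j = i then 1 else 0 := by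
  have h : HasFDerivAt (fun y : EuclideanSpace ℝ (Fin n) => y j)
      (EuclideanSpace.proj j : EuclideanSpace ℝ (Fin n) →L[ℝ] ℝ) x :=
    (EuclideanSpace.proj j : EuclideanSpace ℝ (Fin n) →L[ℝ] ℝ).hasFDerivAt
  unfold pd
  rw [h.fderiv]
  simp

theorem sm_coord (j : Fin n) : Sm (fun y : EuclideanSpace ℝ (Fin n) => y j) :=
  (EuclideanSpace.proj j : EuclideanSpace ℝ (Fin n) →L[ℝ] ℝ).contDiff

theorem pd_pd_eq_iteratedFDeriv (hf : Sm f) (i j : Fin n) :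
    pd i (pd j f) x = fderiv ℝ (fderiv ℝ f) x (EuclideanSpace.single i 1)
      (EuclideanSpace.single j 1) := by
  have h : DifferentiableAt ℝ (fderiv ℝ f) x :=
    ((hf.fderiv_right (m := (⊤ : ℕ∞)) (by simp)).differentiable (by simp)).differentiableAt
  unfold pd
  rw [fderiv_clm_apply h (by fun_prop)]
  simp

theorem pd_comm (hf : Sm f) (i j : Fin n) : pd i (pd j f) x = pd j (pd i f) x := by
  rw [pd_pd_eq_iteratedFDeriv hf, pd_pd_eq_iteratedFDeriv hf]
  have h : IsSymmSndFDerivAt ℝ f x := by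
    apply ContDiffAt.isSymmSndFDerivAt (n := (⊤ : ℕ∞)) hf.contDiffAt
    simpa [minSmoothness] using two_le_smooth
  exact h _ _

theorem fderiv_eq_sum_pd (v : EuclideanSpace ℝ (Fin n)) :
    fderiv ℝ f x v = ∑ i, v i * pd i f x := by
  conv_lhs => rw [← (EuclideanSpace.basisFun (Fin n) ℝ).sum_repr v]
  simp [pd]

theorem abs_fderiv_le (v : EuclideanSpace ℝ (Fin n)) :
    |fderiv ℝ f x v| ≤ ‖v‖ * √(∑ i, pd i f x ^ 2) := by
  rw [fderiv_eq_sum_pd]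
  rw [EuclideanSpace.norm_eq]
  refine abs_le_of_sq_le_sq' ?_ (by positivity) |> abs_le.mpr
  rw [mul_pow, Real.sq_sqrt (by positivity), Real.sq_sqrt (by positivity)]
  simpa using Finset.sum_mul_sq_le_sq_mul_sq Finset.univ (fun i => v i) (fun i => pd i f x)

theorem norm_fderiv_le : ‖fderiv ℝ f x‖ ≤ √(∑ i, pd i f x ^ 2) := by
  refine ContinuousLinearMap.opNorm_le_bound _ (by positivity) fun v => ?_
  rw [Real.norm_eq_abs, mul_comm]
  exact abs_fderiv_le v

theorem pd_eq_zero_of_isLocalMax (h : IsLocalMax f x) (i : Fin n) : pd i f x = 0 := by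
  unfold pd; rw [h.fderiv_eq_zero]; rfl

end Calculus

/-- Second derivatives test in a direction. -/
theorem snd_deriv_nonpos_of_isLocalMax {φ : ℝ → ℝ} (hφ : ContDiff ℝ 2 φ)
    (h : IsLocalMax φ 0) : deriv (deriv φ) 0 ≤ 0 := by
  by_contra hc
  push Not at hc
  have h0 : deriv φ 0 = 0 := h.deriv_eq_zero
  have hmin := isLocalMin_of_deriv_deriv_pos hc h0 hφ.continuous.continuousAt
  have hconst : φ =ᶠ[nhds 0] fun _ => φ 0 := by
    filter_upwards [h, hmin] with t ht1 ht2
    exact le_antisymm ht1 ht2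
  have h1 : deriv φ =ᶠ[nhds 0] fun _ => 0 := by
    have := hconst.deriv
    simpa using this
  have h2 := h1.deriv_eq
  simp at h2
  linarith

theorem hess_nonpos_of_isLocalMax {n : ℕ} {f : EuclideanSpace ℝ (Fin n) → ℝ} (hf : Sm f)
    {x : EuclideanSpace ℝ (Fin n)} (h : IsLocalMax f x) (ξ : Fin n → ℝ) :
    ∑ i, ∑ j, ξ i * ξ j * pd i (pd j f) x ≤ 0 := by
  set v : EuclideanSpace ℝ (Fin n) := WithLp.toLp 2 ξ with hv
  have hline : ∀ t : ℝ, HasDerivAt (fun t : ℝ => x + t • v) v t := fun t => by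
    simpa using ((hasDerivAt_id t).smul_const v).const_add x
  have hd1 : ∀ (g : EuclideanSpace ℝ (Fin n) → ℝ), Sm g → ∀ t : ℝ,
      HasDerivAt (fun t : ℝ => g (x + t • v)) (∑ i, ξ i * pd i g (x + t • v)) t := by
    intro g hg t
    have := (hg.differentiable (x + t • v)).hasFDerivAt.comp_hasDerivAt t (hline t)
    rw [fderiv_eq_sum_pd] at this
    exact this
  have hφ2 : ContDiff ℝ 2 (fun t : ℝ => f (x + t • v)) := by
    have hf2 : ContDiff ℝ 2 f := hf.of_le two_le_smooth
    fun_prop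
  have hmax : IsLocalMax (fun t : ℝ => f (x + t • v)) 0 := by
    have hc : ContinuousAt (fun t : ℝ => x + t • v) 0 := (hline 0).continuousAt
    have h' : IsLocalMax f ((fun t : ℝ => x + t • v) 0) := by simpa using h
    exact IsLocalMax.comp_continuous (g := fun t : ℝ => x + t • v) h' hc
  have := snd_deriv_nonpos_of_isLocalMax hφ2 hmax
  have e1 : deriv (fun t : ℝ => f (x + t • v)) = fun t => ∑ i, ξ i * pd i f (x + t • v) := by
    funext t; exact (hd1 f hf t).deriv
  rw [e1] at this
  have e2 : HasDerivAt (fun t : ℝ => ∑ i, ξ i * pd i f (x + t • v))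
      (∑ i, ξ i * ∑ j, ξ j * pd j (pd i f) (x + (0:ℝ) • v)) 0 := by
    apply HasDerivAt.fun_sum
    intro i _
    exact (hd1 (pd i f) (hf.pd i) 0).const_mul _
  rw [e2.deriv] at this
  rw [Finset.sum_comm]
  simp only [zero_smul, add_zero, Finset.mul_sum] at this
  refine le_trans (le_of_eq (Finset.sum_congr rfl fun i _ => Finset.sum_congr rfl fun j _ => ?_)) this
  ring

/-- A positive semidefinite symmetric matrix pairs nonpositively with a nonpositive form. -/
theorem sum_mul_nonpos_of_psd {n : ℕ} {a h : Fin n → Fin n → ℝ} (hs : ∀ i j, a i j = a j i)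
    (ha : ∀ ξ : Fin n → ℝ, 0 ≤ ∑ i, ∑ j, a i j * ξ i * ξ j)
    (hh : ∀ ξ : Fin n → ℝ, ∑ i, ∑ j, ξ i * ξ j * h i j ≤ 0) :
    ∑ i, ∑ j, a i j * h i j ≤ 0 := by
  have hpsd : (Matrix.of a).PosSemidef := by
    refine Matrix.posSemidef_iff_dotProduct_mulVec.2 ⟨?_, fun ξ => ?_⟩
    · ext i j; simp [Matrix.conjTranspose, hs i j]
    · refine le_trans (ha ξ) (le_of_eq ?_)
      simp only [dotProduct, Matrix.mulVec, Finset.mul_sum]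
      refine Finset.sum_congr rfl fun i _ => Finset.sum_congr rfl fun j _ => ?_
      simp; ring
  obtain ⟨m, v, hB⟩ := Matrix.posSemidef_iff_eq_sum_vecMulVec.1 hpsd
  have hab : ∀ i j, a i j = ∑ k, v k i * v k j := by
    intro i j
    have := congrFun (congrFun hB i) j
    simpa [Matrix.sum_apply, Matrix.vecMulVec_apply] using this
  simp only [hab, Finset.sum_mul]
  have : ∑ i, ∑ j, ∑ k, v k i * v k j * h i j = ∑ k, ∑ i, ∑ j, v k i * v k j * h i j := by
    rw [Finset.sum_comm]
    simp_rw [fun j => Finset.sum_comm (s := Finset.univ (α := Fin n))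
      (t := Finset.univ (α := Fin m)) (f := fun i k => v k i * v k j * h i j)]
    rw [Finset.sum_comm]
    refine Finset.sum_congr rfl fun k _ => Finset.sum_comm
  rw [this]
  exact Finset.sum_nonpos fun k _ => hh (fun i => v k i)

/-- The coefficients of a second order operator with global smooth bounds. -/
structure IsOp {n : ℕ} (L : ℝ) (a : Fin n → Fin n → EuclideanSpace ℝ (Fin n) → ℝ)
    (b : Fin n → EuclideanSpace ℝ (Fin n) → ℝ) : Prop where
  one_le : 1 ≤ L
  sm_a : ∀ i j, Sm (a i j)
  sm_b : ∀ i, Sm (b i)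
  symm : ∀ i j x, a i j x = a j i x
  ell : ∀ x (ξ : Fin n → ℝ), L⁻¹ * ∑ i, ξ i ^ 2 ≤ ∑ i, ∑ j, a i j x * ξ i * ξ j
  bd_a : ∀ i j x, |a i j x| ≤ L
  bd_da : ∀ k i j x, |pd k (a i j) x| ≤ L
  bd_b : ∀ i x, |b i x| ≤ L
  bd_db : ∀ k i x, |pd k (b i) x| ≤ L

/-- The operator `Σ a_ij ∂_ij u + Σ b_j ∂_j u`. -/
def Lop {n : ℕ} (a : Fin n → Fin n → EuclideanSpace ℝ (Fin n) → ℝ)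
    (b : Fin n → EuclideanSpace ℝ (Fin n) → ℝ) (u : EuclideanSpace ℝ (Fin n) → ℝ)
    (x : EuclideanSpace ℝ (Fin n)) : ℝ :=
  ∑ i, ∑ j, a i j x * pd i (pd j u) x + ∑ j, b j x * pd j u x

section Sums

variable {n : ℕ}

theorem abs_sum_le_card {f : Fin n → ℝ} {C : ℝ} (h : ∀ i, |f i| ≤ C) : |∑ i, f i| ≤ n * C := by
  refine (Finset.abs_sum_le_sum_abs _ _).trans ?_
  refine (Finset.sum_le_sum fun i _ => h i).trans ?_
  simp

theorem abs_sum2_le_card {f : Fin n → Fin n → ℝ} {C : ℝ} (h : ∀ i j, |f i j| ≤ C) :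
    |∑ i, ∑ j, f i j| ≤ n ^ 2 * C := by
  refine (abs_sum_le_card fun i => abs_sum_le_card (h i)).trans (le_of_eq ?_)
  ring

theorem abs_mul_le {x y X Y : ℝ} (hx : |x| ≤ X) (hy : |y| ≤ Y) : |x * y| ≤ X * Y := by
  rw [abs_mul]
  exact mul_le_mul hx hy (abs_nonneg _) ((abs_nonneg _).trans hx)

theorem abs_le_sqrt_sum_sq (p : Fin n → ℝ) (k : Fin n) : |p k| ≤ √(∑ i, p i ^ 2) := by
  refine Real.abs_le_sqrt ?_
  exact Finset.single_le_sum (f := fun i => p i ^ 2) (fun i _ => sq_nonneg _) (Finset.mem_univ k)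

theorem abs_le_sqrt_sum2_sq (h : Fin n → Fin n → ℝ) (k l : Fin n) :
    |h k l| ≤ √(∑ i, ∑ j, h i j ^ 2) := by
  refine Real.abs_le_sqrt ?_
  refine (Finset.single_le_sum (f := fun j => h k j ^ 2) (fun i _ => sq_nonneg _)
    (Finset.mem_univ l)).trans ?_
  exact Finset.single_le_sum (f := fun i => ∑ j, h i j ^ 2)
    (fun i _ => Finset.sum_nonneg fun j _ => sq_nonneg _) (Finset.mem_univ k)

variable {x : EuclideanSpace ℝ (Fin n)}

theorem pd_sum_mul_at {f g : Fin n → EuclideanSpace ℝ (Fin n) → ℝ}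
    (hf : ∀ i, DifferentiableAt ℝ (f i) x) (hg : ∀ i, DifferentiableAt ℝ (g i) x) (k : Fin n) :
    pd k (fun y => ∑ i, f i y * g i y) x = ∑ i, (pd k (f i) x * g i x + f i x * pd k (g i) x) := by
  rw [pd_sum_at (F := fun i y => f i y * g i y) (fun i _ => (hf i).mul (hg i))]
  exact Finset.sum_congr rfl fun i _ => pd_mul_at (hf i) (hg i) k

theorem pd_sum2_mul_at {f g : Fin n → Fin n → EuclideanSpace ℝ (Fin n) → ℝ}
    (hf : ∀ i j, DifferentiableAt ℝ (f i j) x) (hg : ∀ i j, DifferentiableAt ℝ (g i j) x)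
    (k : Fin n) :
    pd k (fun y => ∑ i, ∑ j, f i j y * g i j y) x =
      ∑ i, ∑ j, (pd k (f i j) x * g i j x + f i j x * pd k (g i j) x) := by
  rw [pd_sum_at (F := fun i y => ∑ j, f i j y * g i j y)
    (fun i _ => DifferentiableAt.fun_sum fun j _ => (hf i j).mul (hg i j))]
  exact Finset.sum_congr rfl fun i _ => pd_sum_mul_at (hf i) (hg i) k

end Sums

section Bernstein

/-- Scalar form of the final step of the Bernstein argument. -/
theorem bernstein_scalar (K : ℝ) (hK : 1 ≤ K) : ∃ C : ℝ, 0 < C ∧ ∀ R f g : ℝ, 0 < R → 0 ≤ f →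
    0 ≤ g → f ^ 2 ≤ K * (g + R * f) →
    g ^ 2 ≤ K * (R ^ 2 * f ^ 2 + R * f * g + R * f ^ 3) → f ≤ C * R := by
  refine ⟨100 * K ^ 4, by positivity, fun R f g hR hf hg h1 h2 => ?_⟩
  by_contra hc
  push Not at hc
  have hK0 : 0 < K := by linarith
  have hfR : 100 * K ^ 4 * R < f := hc
  have hK4 : K ≤ K ^ 4 := le_self_pow₀ hK (by norm_num)
  have hK3 : K ≤ K ^ 3 := le_self_pow₀ hK (by norm_num)
  have hK34 : K ^ 3 ≤ K ^ 4 := pow_le_pow_right₀ hK (by norm_num)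
  have hK14 : 1 ≤ K ^ 4 := one_le_pow₀ hK
  have hRf : 100 * K * R ≤ f := by nlinarith
  have hf0 : 0 < f := by nlinarith
  -- `f² ≤ 2 K g`
  have hg1 : f ^ 2 ≤ 2 * K * g := by nlinarith
  -- `g² ≤ 4 K R f³ / ...`
  have e1 : R * f ^ 3 * (100 * K ^ 3) ≤ f ^ 4 := by
    have : R * (100 * K ^ 3) ≤ f := by nlinarith
    calc R * f ^ 3 * (100 * K ^ 3) = f ^ 3 * (R * (100 * K ^ 3)) := by ring
      _ ≤ f ^ 3 * f := by gcongr
      _ = f ^ 4 := by ring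
  have e2 : f ^ 4 ≤ 4 * K ^ 2 * g ^ 2 := by
    have := pow_le_pow_left₀ (by positivity) hg1 2
    nlinarith
  have hRle : R ≤ f := by nlinarith
  have e3 : R ^ 2 * f ^ 2 ≤ R * f ^ 3 := by
    have : R * (R * f ^ 2) ≤ R * (f * f ^ 2) := by gcongr
    nlinarith
  have e4 : K * (R * f * g) ≤ g ^ 2 / 2 + K ^ 2 * R ^ 2 * f ^ 2 / 2 := by
    nlinarith [sq_nonneg (g - K * R * f)]
  have e5 : K ^ 2 * (R ^ 2 * f ^ 2) ≤ K ^ 2 * (R * f ^ 3) := by gcongr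
  have e6 : g ^ 2 ≤ 5 * K ^ 2 * (R * f ^ 3) := by
    have : K * (R * f ^ 3) ≤ K ^ 2 * (R * f ^ 3) := by
      have : K ≤ K ^ 2 := le_self_pow₀ hK (by norm_num)
      gcongr
    have e3' : K * (R ^ 2 * f ^ 2) ≤ K * (R * f ^ 3) := by gcongr
    nlinarith
  have e7 : f ^ 4 ≤ 20 * K ^ 4 * (R * f ^ 3) := by
    calc f ^ 4 ≤ 4 * K ^ 2 * g ^ 2 := e2
      _ ≤ 4 * K ^ 2 * (5 * K ^ 2 * (R * f ^ 3)) := by gcongr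
      _ = _ := by ring
  have e8 : f ≤ 20 * K ^ 4 * R := by
    have h3 : 0 < f ^ 3 := by positivity
    refine le_of_mul_le_mul_left ?_ h3
    nlinarith
  nlinarith [mul_pos (show (0:ℝ) < K ^ 4 by positivity) hR]

theorem sum3_rotate {n : ℕ} (F : Fin n → Fin n → Fin n → ℝ) :
    ∑ k, ∑ i, ∑ j, F i j k = ∑ i, ∑ j, ∑ k, F i j k := by
  rw [Finset.sum_comm]
  exact Finset.sum_congr rfl fun i _ => Finset.sum_comm

theorem cutoff_term_bound {R y q yi yj ydd Qi Qj : ℝ} (hy : 0 < y) (hyR : y ≤ R ^ 2)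
    (h1 : |yi| ≤ 2 * R) (h2 : |yj| ≤ 2 * R) (h3 : |ydd| ≤ 2) (h4 : |y * Qi| ≤ 4 * R * q ^ 2)
    (h5 : |y * Qj| ≤ 4 * R * q ^ 2) :
    |2 * y * yi * Qj + 2 * y * yj * Qi + (2 * yi * yj + 2 * y * ydd) * q ^ 2| ≤
      44 * R ^ 2 * q ^ 2 := by
  have t1 := abs_mul_le h1 h5
  have t2 := abs_mul_le h2 h4
  have hq : |q ^ 2| ≤ q ^ 2 := (abs_of_nonneg (sq_nonneg q)).le
  have t3 := abs_mul_le (abs_mul_le h1 h2) hq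
  have t4 := abs_mul_le (abs_mul_le (abs_of_pos hy).le h3) hq
  have t5 : y * 2 * q ^ 2 ≤ R ^ 2 * 2 * q ^ 2 := by gcongr
  have e : 2 * y * yi * Qj + 2 * y * yj * Qi + (2 * yi * yj + 2 * y * ydd) * q ^ 2 =
    2 * (yi * (y * Qj)) + 2 * (yj * (y * Qi)) + 2 * (yi * yj * q ^ 2) + 2 * (y * ydd * q ^ 2) := by
    ring
  rw [e]
  have a1 := abs_le.1 t1
  have a2 := abs_le.1 t2
  have a3 := abs_le.1 t3
  have a4 := abs_le.1 t4
  rw [abs_le]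
  constructor <;> nlinarith only [a1, a2, a3, a4, t5]

set_option maxHeartbeats 1600000 in
theorem bernstein_algebra (n : ℕ) (L : ℝ) (hL : 1 ≤ L) : ∃ K : ℝ, 1 ≤ K ∧
    ∀ (a H : Fin n → Fin n → ℝ) (da : Fin n → Fin n → Fin n → ℝ) (b : Fin n → ℝ)
      (db : Fin n → Fin n → ℝ) (p : Fin n → ℝ) (T : Fin n → Fin n → Fin n → ℝ) (R y : ℝ)
      (yd : Fin n → ℝ) (ydd : Fin n → Fin n → ℝ) (Q q h : ℝ) (Qd : Fin n → ℝ),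
      (∀ i j, |a i j| ≤ L) → (∀ k i j, |da k i j| ≤ L) → (∀ i, |b i| ≤ L) →
      (∀ k i, |db k i| ≤ L) →
      (∀ ξ : Fin n → ℝ, L⁻¹ * ∑ i, ξ i ^ 2 ≤ ∑ i, ∑ j, a i j * ξ i * ξ j) →
      (∀ i j, H i j = H j i) → 0 < R → R ≤ 1 → 0 < y → y ≤ R ^ 2 → (∀ i, |yd i| ≤ 2 * R) →
      (∀ i j, |ydd i j| ≤ 2) →
      0 ≤ q → q ^ 2 = Q → Q = ∑ k, p k ^ 2 → 0 ≤ h → h ^ 2 = ∑ i, ∑ k, H i k ^ 2 →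
      (∀ i, Qd i = ∑ k, 2 * (p k * H i k)) →
      ∑ i, ∑ j, a i j * H i j + ∑ i, ∑ j, a i j * (p i * p j) + ∑ i, b i * p i = 0 →
      (∀ k, ∑ i, ∑ j, (da k i j * H i j + a i j * T i j k) +
        ∑ i, ∑ j, (da k i j * (p i * p j) + a i j * (H k i * p j + p i * H k j)) +
        ∑ i, (db k i * p i + b i * H k i) = 0) →
      (∀ i, y * Qd i = -2 * Q * yd i) →
      ∑ i, ∑ j, a i j * (y ^ 2 * (∑ k, 2 * (H i k * H j k + p k * T i j k)) +
        2 * y * yd i * Qd j + 2 * y * yd j * Qd i +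
        (2 * yd i * yd j + 2 * y * ydd i j) * Q) ≤ 0 →
      (y * q) ^ 2 ≤ K * (y ^ 2 * h + R * (y * q)) ∧
      (y ^ 2 * h) ^ 2 ≤ K * (R ^ 2 * (y * q) ^ 2 + R * (y * q) * (y ^ 2 * h) +
        R * (y * q) ^ 3) := by
  have hn0 : (0 : ℝ) ≤ n := Nat.cast_nonneg n
  refine ⟨1 + 100 * L ^ 2 * (n + n ^ 2 + n ^ 3), by nlinarith [show (0:ℝ) ≤ L ^ 2 * (n + n ^ 2 + n ^ 3) by positivity], ?_⟩
  intro a H da b db p T R y yd ydd Q q h Qd ha hda hb hdb hell hH hR hR1 hy hyR hyd hydd hq hqQ hQ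
    hh hhH hQd heq hdeq hcrit hsnd
  have hL0 : 0 < L := by linarith
  have hp : ∀ k, |p k| ≤ q := fun k => by
    have := abs_le_sqrt_sum_sq p k
    rwa [← hQ, ← hqQ, Real.sqrt_sq hq] at this
  have hHb : ∀ i k, |H i k| ≤ h := fun i k => by
    have := abs_le_sqrt_sum2_sq H i k
    rwa [← hhH, Real.sqrt_sq hh] at this
  have hQ0 : 0 ≤ Q := hqQ ▸ sq_nonneg q
  have hyQd : ∀ i, |y * Qd i| ≤ 4 * R * q ^ 2 := fun i => by
    rw [hcrit, abs_mul, hqQ, show |-2 * Q| = 2 * Q by rw [abs_mul, abs_of_nonneg hQ0]; norm_num]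
    nlinarith only [hyd i, hQ0, hqQ, mul_le_mul_of_nonneg_left (hyd i) hQ0]
  have hyR' : y ≤ R := hyR.trans (by nlinarith only [hR, hR1])
  have hy1 : y ≤ 1 := hyR'.trans hR1
  constructor
  · have h1 := hell p
    rw [← hQ, ← hqQ] at h1
    have e1 : ∑ i, ∑ j, a i j * p i * p j = ∑ i, ∑ j, a i j * (p i * p j) := by
      simp only [mul_assoc]
    have b1 : |∑ i, ∑ j, a i j * H i j| ≤ n ^ 2 * (L * h) :=
      abs_sum2_le_card fun i j => abs_mul_le (ha i j) (hHb i j)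
    have b2 : |∑ i, b i * p i| ≤ n * (L * q) :=
      abs_sum_le_card fun i => abs_mul_le (hb i) (hp i)
    have h2 : L⁻¹ * q ^ 2 ≤ n ^ 2 * (L * h) + n * (L * q) := by
      rw [e1] at h1
      have := (abs_le.1 b1).1
      have := (abs_le.1 b2).1
      linarith
    have h3 : q ^ 2 ≤ L * (n ^ 2 * (L * h) + n * (L * q)) := by
      have := mul_le_mul_of_nonneg_left h2 hL0.le
      rwa [← mul_assoc, mul_inv_cancel₀ hL0.ne', one_mul] at this
    have h4 : (y * q) ^ 2 ≤ L ^ 2 * n ^ 2 * (y ^ 2 * h) + L ^ 2 * n * (y * (y * q)) := by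
      have := mul_le_mul_of_nonneg_left h3 (sq_nonneg y)
      linarith only [this]
    have h5 : y * (y * q) ≤ R * (y * q) := by gcongr
    have h6 : L ^ 2 * n * (y * (y * q)) ≤ L ^ 2 * n * (R * (y * q)) := by gcongr
    refine h4.trans ?_
    have A1 : 0 ≤ y ^ 2 * h := by positivity
    have A2 : 0 ≤ R * (y * q) := by positivity
    have c1 : L ^ 2 * n ^ 2 ≤ 1 + 100 * L ^ 2 * (n + n ^ 2 + n ^ 3) := by
      have : 0 ≤ L ^ 2 * n ^ 3 := by positivity
      have : 0 ≤ L ^ 2 * n ^ 2 := by positivity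
      have : 0 ≤ L ^ 2 * n := by positivity
      linarith
    have c2 : L ^ 2 * n ≤ 1 + 100 * L ^ 2 * (n + n ^ 2 + n ^ 3) := by
      have : 0 ≤ L ^ 2 * n ^ 3 := by positivity
      have : 0 ≤ L ^ 2 * n ^ 2 := by positivity
      have : 0 ≤ L ^ 2 * n := by positivity
      linarith
    linarith [mul_le_mul_of_nonneg_right c1 A1, mul_le_mul_of_nonneg_right c2 A2]
  · -- the quadratic part
    set A1 := ∑ k, ∑ i, ∑ j, a i j * H i k * H j k with hA1
    have hA1b : L⁻¹ * h ^ 2 ≤ A1 := by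
      rw [hhH, Finset.sum_comm, Finset.mul_sum]
      exact Finset.sum_le_sum fun k _ => hell fun i => H i k
    set τ : Fin n → ℝ := fun k => ∑ i, ∑ j, a i j * T i j k with hτ
    set E1 := ∑ k, p k * ∑ i, ∑ j, da k i j * H i j with hE1
    set E2 := ∑ k, p k * ∑ i, ∑ j, da k i j * (p i * p j) with hE2
    set E3 := ∑ k, p k * ∑ i, db k i * p i with hE3
    set E4 := ∑ k, p k * ∑ i, ∑ j, a i j * (H k i * p j + p i * H k j) with hE4
    set E5 := ∑ k, p k * ∑ i, b i * H k i with hE5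
    have hsumτ : ∑ k, p k * τ k = -E1 - E2 - E3 - E4 - E5 := by
      simp only [hE1, hE2, hE3, hE4, hE5, ← Finset.sum_neg_distrib, ← Finset.sum_sub_distrib]
      refine Finset.sum_congr rfl fun k _ => ?_
      have := hdeq k
      simp only [Finset.sum_add_distrib] at this
      simp only [hτ]
      linear_combination p k * this
    have hS : ∑ i, ∑ j, a i j * (∑ k, 2 * (H i k * H j k + p k * T i j k)) =
        2 * A1 + 2 * ∑ k, p k * τ k := by
      simp only [hA1, hτ, Finset.mul_sum, ← Finset.sum_add_distrib]
      rw [← sum3_rotate]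
      refine Finset.sum_congr rfl fun k _ => Finset.sum_congr rfl fun i _ =>
        Finset.sum_congr rfl fun j _ => ?_
      ring
    have hE4' : 2 * E4 = ∑ i, ∑ j, a i j * (Qd i * p j + p i * Qd j) := by
      simp only [hE4, Finset.mul_sum]
      rw [sum3_rotate]
      refine Finset.sum_congr rfl fun i _ => Finset.sum_congr rfl fun j _ => ?_
      rw [hQd i, hQd j]
      simp only [Finset.mul_sum, Finset.sum_mul, ← Finset.sum_add_distrib]
      refine Finset.sum_congr rfl fun k _ => ?_
      rw [hH k i, hH k j]; ring
    have hE5' : 2 * E5 = ∑ i, b i * Qd i := by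
      simp only [hE5, Finset.mul_sum]
      rw [Finset.sum_comm]
      refine Finset.sum_congr rfl fun i _ => ?_
      rw [hQd i, Finset.mul_sum]
      refine Finset.sum_congr rfl fun k _ => ?_
      rw [hH k i]; ring
    have b1 : |E1| ≤ n * (q * (n ^ 2 * (L * h))) := abs_sum_le_card fun k =>
      abs_mul_le (hp k) (abs_sum2_le_card fun i j => abs_mul_le (hda k i j) (hHb i j))
    have b2 : |E2| ≤ n * (q * (n ^ 2 * (L * (q * q)))) := abs_sum_le_card fun k =>
      abs_mul_le (hp k) (abs_sum2_le_card fun i j =>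
        abs_mul_le (hda k i j) (abs_mul_le (hp i) (hp j)))
    have b3 : |E3| ≤ n * (q * (n * (L * q))) := abs_sum_le_card fun k =>
      abs_mul_le (hp k) (abs_sum_le_card fun i => abs_mul_le (hdb k i) (hp i))
    have b4 : |y * (2 * E4)| ≤ n ^ 2 * (L * (8 * R * q ^ 3)) := by
      rw [hE4', Finset.mul_sum]
      simp only [Finset.mul_sum]
      refine abs_sum2_le_card fun i j => ?_
      rw [show y * (a i j * (Qd i * p j + p i * Qd j)) =
        a i j * ((y * Qd i) * p j + p i * (y * Qd j)) by ring]
      refine abs_mul_le (ha i j) ((abs_add_le _ _).trans ?_)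
      linarith only [abs_mul_le (hyQd i) (hp j), abs_mul_le (hp i) (hyQd j)]
    have b5 : |y * (2 * E5)| ≤ n * (L * (4 * R * q ^ 2)) := by
      rw [hE5', Finset.mul_sum]
      refine abs_sum_le_card fun i => ?_
      rw [show y * (b i * Qd i) = b i * (y * Qd i) by ring]
      exact abs_mul_le (hb i) (hyQd i)
    have b6 : |∑ i, ∑ j, a i j * (2 * y * yd i * Qd j + 2 * y * yd j * Qd i +
        (2 * yd i * yd j + 2 * y * ydd i j) * Q)| ≤ n ^ 2 * (L * (44 * R ^ 2 * q ^ 2)) := by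
      refine abs_sum2_le_card fun i j => abs_mul_le (ha i j) ?_
      rw [← hqQ]
      exact cutoff_term_bound hy hyR (hyd i) (hyd j) (hydd i j) (hyQd i) (hyQd j)
    have hmain : y ^ 2 * (2 * A1 + 2 * ∑ k, p k * τ k) ≤ n ^ 2 * (L * (44 * R ^ 2 * q ^ 2)) := by
      have e : ∑ i, ∑ j, a i j * (y ^ 2 * (∑ k, 2 * (H i k * H j k + p k * T i j k)) +
        2 * y * yd i * Qd j + 2 * y * yd j * Qd i +
        (2 * yd i * yd j + 2 * y * ydd i j) * Q) =
        y ^ 2 * ∑ i, ∑ j, a i j * (∑ k, 2 * (H i k * H j k + p k * T i j k)) +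
        ∑ i, ∑ j, a i j * (2 * y * yd i * Qd j + 2 * y * yd j * Qd i +
        (2 * yd i * yd j + 2 * y * ydd i j) * Q) := by
        rw [Finset.mul_sum, ← Finset.sum_add_distrib]
        refine Finset.sum_congr rfl fun i _ => ?_
        rw [Finset.mul_sum, ← Finset.sum_add_distrib]
        refine Finset.sum_congr rfl fun j _ => ?_
        ring
      rw [e, hS] at hsnd
      have := (abs_le.1 b6).1
      linarith
    rw [hsumτ] at hmain
    set f := y * q with hf
    have hf0 : 0 ≤ f := by positivity
    set g := y ^ 2 * h with hg
    have hg0 : 0 ≤ g := by positivity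
    have m1 : y ^ 4 * |E1| ≤ n ^ 3 * L * (R * f * g) := by
      calc y ^ 4 * |E1| ≤ y ^ 4 * (n * (q * (n ^ 2 * (L * h)))) := by gcongr
        _ = n ^ 3 * L * (y * f * g) := by simp only [hf, hg]; ring
        _ ≤ _ := by gcongr
    have m2 : y ^ 4 * |E2| ≤ n ^ 3 * L * (R * f ^ 3) := by
      calc y ^ 4 * |E2| ≤ y ^ 4 * (n * (q * (n ^ 2 * (L * (q * q))))) := by gcongr
        _ = n ^ 3 * L * (y * f ^ 3) := by simp only [hf]; ring
        _ ≤ _ := by gcongr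
    have m3 : y ^ 4 * |E3| ≤ n ^ 2 * L * (R ^ 2 * f ^ 2) := by
      calc y ^ 4 * |E3| ≤ y ^ 4 * (n * (q * (n * (L * q)))) := by gcongr
        _ = n ^ 2 * L * (y ^ 2 * f ^ 2) := by simp only [hf]; ring
        _ ≤ _ := by gcongr
    have m4 : y ^ 3 * |y * (2 * E4)| ≤ n ^ 2 * L * 8 * (R * f ^ 3) := by
      calc y ^ 3 * |y * (2 * E4)| ≤ y ^ 3 * (n ^ 2 * (L * (8 * R * q ^ 3))) := by gcongr
        _ = n ^ 2 * L * 8 * (R * f ^ 3) := by simp only [hf]; ring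
    have m5 : y ^ 3 * |y * (2 * E5)| ≤ n * L * 4 * (R ^ 2 * f ^ 2) := by
      calc y ^ 3 * |y * (2 * E5)| ≤ y ^ 3 * (n * (L * (4 * R * q ^ 2))) := by gcongr
        _ = n * L * 4 * (R * y * f ^ 2) := by simp only [hf]; ring
        _ ≤ n * L * 4 * (R * R * f ^ 2) := by gcongr
        _ = _ := by ring
    have m6 : y ^ 4 * A1 ≥ L⁻¹ * g ^ 2 := by
      calc L⁻¹ * g ^ 2 = y ^ 4 * (L⁻¹ * h ^ 2) := by simp only [hg]; ring
        _ ≤ _ := by gcongr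
    have m7 := mul_le_mul_of_nonneg_left hmain (sq_nonneg y)
    have m8 : 2 * (L⁻¹ * g ^ 2) ≤ 44 * (n ^ 2 * L) * (R ^ 2 * f ^ 2) +
        2 * (n ^ 3 * L * (R * f * g)) + 2 * (n ^ 3 * L * (R * f ^ 3)) +
        2 * (n ^ 2 * L * (R ^ 2 * f ^ 2)) + n ^ 2 * L * 8 * (R * f ^ 3) +
        n * L * 4 * (R ^ 2 * f ^ 2) := by
      have q1 : y ^ 4 * E1 ≤ y ^ 4 * |E1| := by gcongr; exact le_abs_self _
      have q2 : y ^ 4 * E2 ≤ y ^ 4 * |E2| := by gcongr; exact le_abs_self _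
      have q3 : y ^ 4 * E3 ≤ y ^ 4 * |E3| := by gcongr; exact le_abs_self _
      have q4 : y ^ 3 * (y * (2 * E4)) ≤ y ^ 3 * |y * (2 * E4)| := by gcongr; exact le_abs_self _
      have q5 : y ^ 3 * (y * (2 * E5)) ≤ y ^ 3 * |y * (2 * E5)| := by gcongr; exact le_abs_self _
      have e0 : y ^ 2 * (n ^ 2 * (L * (44 * R ^ 2 * q ^ 2))) =
          44 * (n ^ 2 * L) * (R ^ 2 * f ^ 2) := by simp only [hf]; ring
      rw [e0] at m7
      linarith
    have U1 : 0 ≤ R ^ 2 * f ^ 2 := by positivity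
    have U2 : 0 ≤ R * f * g := by positivity
    have U3 : 0 ≤ R * f ^ 3 := by positivity
    have m9 : g ^ 2 ≤ L ^ 2 * (n + n ^ 2 + n ^ 3) * 50 *
        (R ^ 2 * f ^ 2 + R * f * g + R * f ^ 3) := by
      have : L⁻¹ * g ^ 2 ≤ L * (n + n ^ 2 + n ^ 3) * 50 *
        (R ^ 2 * f ^ 2 + R * f * g + R * f ^ 3) := by
        have z1 : 0 ≤ n ^ 3 * L * (R ^ 2 * f ^ 2) := by positivity
        have z2 : 0 ≤ n ^ 3 * L * (R * f * g) := by positivity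
        have z3 : 0 ≤ n ^ 3 * L * (R * f ^ 3) := by positivity
        have z4 : 0 ≤ n ^ 2 * L * (R ^ 2 * f ^ 2) := by positivity
        have z5 : 0 ≤ n ^ 2 * L * (R * f * g) := by positivity
        have z6 : 0 ≤ n ^ 2 * L * (R * f ^ 3) := by positivity
        have z7 : 0 ≤ n * L * (R ^ 2 * f ^ 2) := by positivity
        have z8 : 0 ≤ n * L * (R * f * g) := by positivity
        have z9 : 0 ≤ n * L * (R * f ^ 3) := by positivity
        linarith
      calc g ^ 2 = L * (L⁻¹ * g ^ 2) := by field_simp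
        _ ≤ L * _ := mul_le_mul_of_nonneg_left this hL0.le
        _ = _ := by ring
    refine m9.trans ?_
    have : 0 ≤ L ^ 2 * (n + n ^ 2 + n ^ 3) := by positivity
    gcongr
    linarith

end Bernstein

section BernsteinMain

variable {n : ℕ}

theorem pd_sqnorm (w : EuclideanSpace ℝ (Fin n) → ℝ) (hw : Sm w) (i : Fin n) :
    pd i (fun x => ∑ k, pd k w x ^ 2) = fun x => ∑ k, 2 * (pd k w x * pd i (pd k w) x) := by
  funext x
  rw [pd_sum_at (F := fun k x => pd k w x ^ 2)
    (fun k _ => ((hw.pd k).differentiable x).pow 2)]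
  refine Finset.sum_congr rfl fun k _ => ?_
  rw [pd_pow_at ((hw.pd k).differentiable x)]
  push_cast; ring

theorem pd_pd_sqnorm (w : EuclideanSpace ℝ (Fin n) → ℝ) (hw : Sm w) (i j : Fin n)
    (x : EuclideanSpace ℝ (Fin n)) :
    pd i (pd j (fun x => ∑ k, pd k w x ^ 2)) x =
      ∑ k, 2 * (pd i (pd k w) x * pd j (pd k w) x + pd k w x * pd i (pd j (pd k w)) x) := by
  rw [pd_sqnorm w hw j]
  rw [pd_sum_at (F := fun k x => 2 * (pd k w x * pd j (pd k w) x)) (fun k _ =>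
    (((hw.pd k).differentiable x).mul (((hw.pd k).pd j).differentiable x)).const_mul 2)]
  refine Finset.sum_congr rfl fun k _ => ?_
  rw [pd_const_mul_at (((hw.pd k).differentiable x).fun_mul (((hw.pd k).pd j).differentiable x)),
    pd_mul_at ((hw.pd k).differentiable x) (((hw.pd k).pd j).differentiable x)]

theorem pd_prod (f g : EuclideanSpace ℝ (Fin n) → ℝ) (hf : Sm f) (hg : Sm g) (i : Fin n) :
    pd i (fun x => f x * g x) = fun x => pd i f x * g x + f x * pd i g x := by
  funext x; exact pd_mul_at (hf.differentiable x) (hg.differentiable x) i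

theorem pd_pd_prod (f g : EuclideanSpace ℝ (Fin n) → ℝ) (hf : Sm f) (hg : Sm g) (i j : Fin n)
    (x : EuclideanSpace ℝ (Fin n)) :
    pd i (pd j (fun x => f x * g x)) x = pd i (pd j f) x * g x + pd j f x * pd i g x +
      (pd i f x * pd j g x + f x * pd i (pd j g) x) := by
  rw [pd_prod f g hf hg j]
  rw [pd_add_at (((hf.pd j).differentiable x).fun_mul (hg.differentiable x))
    ((hf.differentiable x).fun_mul ((hg.pd j).differentiable x)),
    pd_mul_at ((hf.pd j).differentiable x) (hg.differentiable x),
    pd_mul_at (hf.differentiable x) ((hg.pd j).differentiable x)]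

/-- The cutoff `R² - |x - x₀|²`. -/
def paraboloid (x0 : EuclideanSpace ℝ (Fin n)) (R : ℝ) (x : EuclideanSpace ℝ (Fin n)) : ℝ :=
  R ^ 2 - ∑ i, (x i - x0 i) ^ 2

theorem paraboloid_eq (x0 : EuclideanSpace ℝ (Fin n)) (R : ℝ) (x : EuclideanSpace ℝ (Fin n)) :
    paraboloid x0 R x = R ^ 2 - dist x x0 ^ 2 := by
  rw [paraboloid, EuclideanSpace.dist_eq, Real.sq_sqrt (by positivity)]
  simp [Real.dist_eq, sq_abs]

theorem sm_paraboloid (x0 : EuclideanSpace ℝ (Fin n)) (R : ℝ) : Sm (paraboloid x0 R) := by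
  unfold paraboloid
  exact contDiff_const.sub (ContDiff.sum fun i _ => ((sm_coord i).sub contDiff_const).pow 2)

theorem pd_paraboloid (x0 : EuclideanSpace ℝ (Fin n)) (R : ℝ) (i : Fin n) :
    pd i (paraboloid x0 R) = fun x => -2 * (x i - x0 i) := by
  funext x
  have hc : ∀ j, DifferentiableAt ℝ (fun y : EuclideanSpace ℝ (Fin n) => y j) x :=
    fun j => (sm_coord j).differentiable x
  have hd : ∀ j, DifferentiableAt ℝ (fun y : EuclideanSpace ℝ (Fin n) => y j - x0 j) x :=
    fun j => (hc j).sub_const _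
  have e : paraboloid x0 R = fun y => R ^ 2 - ∑ j, (y j - x0 j) ^ 2 := rfl
  rw [e, pd_sub_at (by fun_prop) (DifferentiableAt.fun_sum fun j _ => (hd j).fun_pow 2), pd_const,
    pd_sum_at (F := fun j y => (y j - x0 j) ^ 2) (fun j _ => (hd j).fun_pow 2)]
  have : ∀ j, pd i (fun y : EuclideanSpace ℝ (Fin n) => (y j - x0 j) ^ 2) x =
      if j = i then 2 * (x j - x0 j) else 0 := by
    intro j
    rw [pd_pow_at (hd j), pd_sub_at (hc j) (by fun_prop), pd_coord, pd_const]
    split_ifs <;> simp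
  simp only [this]
  simp

theorem pd_pd_paraboloid (x0 : EuclideanSpace ℝ (Fin n)) (R : ℝ) (i j : Fin n)
    (x : EuclideanSpace ℝ (Fin n)) :
    pd i (pd j (paraboloid x0 R)) x = -2 * if j = i then 1 else 0 := by
  rw [pd_paraboloid, pd_const_mul_at (((sm_coord j).differentiable x).sub_const _),
    pd_sub_at ((sm_coord j).differentiable x) (by fun_prop), pd_coord, pd_const, sub_zero]

theorem bernstein_at_max (n : ℕ) (L : ℝ) (hL : 1 ≤ L) : ∃ C : ℝ, 0 < C ∧
    ∀ a b, IsOp (n := n) L a b → ∀ w, Sm w → ∀ x0 R, 0 < R → R ≤ 1 →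
    (∀ x ∈ ball x0 R, ∑ i, ∑ j, a i j x * pd i (pd j w) x +
      ∑ i, ∑ j, a i j x * (pd i w x * pd j w x) + ∑ i, b i x * pd i w x = 0) →
    ∀ x1 ∈ ball x0 R,
      IsLocalMax (fun x => paraboloid x0 R x ^ 2 * ∑ k, pd k w x ^ 2) x1 →
      paraboloid x0 R x1 ^ 2 * ∑ k, pd k w x1 ^ 2 ≤ C * R ^ 2 := by
  obtain ⟨K, hK, hKall⟩ := bernstein_algebra n L hL
  obtain ⟨C, hC, hCall⟩ := bernstein_scalar K hK
  refine ⟨C ^ 2, by positivity, ?_⟩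
  intro a b hop w hw x0 R hR hR1 heq x1 hx1 hmax
  set y := paraboloid x0 R with hy
  have hysm : Sm y := sm_paraboloid x0 R
  set Q : EuclideanSpace ℝ (Fin n) → ℝ := fun x => ∑ k, pd k w x ^ 2 with hQ
  have hpsm := fun k => hw.pd k
  have hQsm : Sm Q := by
    rw [hQ]
    exact ContDiff.sum fun k _ => (hpsm k).pow 2
  have hdist : dist x1 x0 < R := hx1
  have hd0 : 0 ≤ dist x1 x0 := dist_nonneg
  have hy1 : y x1 = R ^ 2 - dist x1 x0 ^ 2 := paraboloid_eq x0 R x1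
  have hypos : 0 < y x1 := by rw [hy1]; nlinarith
  have hyle : y x1 ≤ R ^ 2 := by rw [hy1]; nlinarith
  have hQ0 : 0 ≤ Q x1 := Finset.sum_nonneg fun _ _ => sq_nonneg _
  have hFeq : (fun x => y x ^ 2 * Q x) = fun x => (y x * y x) * Q x := by funext x; ring
  rw [hFeq] at hmax
  have hyy : Sm (fun x => y x * y x) := hysm.mul hysm
  have hFsm : Sm (fun x => (y x * y x) * Q x) := hyy.mul hQsm
  have hpdy : ∀ i, |pd i y x1| ≤ 2 * R := by
    intro i
    rw [hy, pd_paraboloid, abs_mul, abs_neg, abs_two]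
    have : |x1 i - x0 i| ≤ dist x1 x0 := by
      have := PiLp.norm_apply_le (x1 - x0) i
      rwa [← dist_eq_norm, Real.norm_eq_abs] at this
    nlinarith
  have hcrit : ∀ i, y x1 * pd i Q x1 = -2 * Q x1 * pd i y x1 := by
    intro i
    have h0 := pd_eq_zero_of_isLocalMax hmax i
    rw [pd_prod _ _ hyy hQsm, pd_prod _ _ hysm hysm] at h0
    have : y x1 * (y x1 * pd i Q x1) = y x1 * (-2 * Q x1 * pd i y x1) := by
      linear_combination h0
    exact mul_left_cancel₀ hypos.ne' this
  have hsnd := sum_mul_nonpos_of_psd (a := fun i j => a i j x1)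
    (h := fun i j => pd i (pd j (fun x => (y x * y x) * Q x)) x1) (fun i j => hop.symm i j x1)
    (fun ξ => le_trans (by have := hop.one_le; positivity) (hop.ell x1 ξ))
    (hess_nonpos_of_isLocalMax hFsm hmax)
  have hsum : ∀ i, pd i Q x1 = ∑ k, 2 * (pd k w x1 * pd i (pd k w) x1) := fun i => by
    rw [hQ, pd_sqnorm w hw]
  have hdeq : ∀ k, ∑ i, ∑ j, (pd k (a i j) x1 * pd i (pd j w) x1 +
        a i j x1 * pd i (pd j (pd k w)) x1) +
        ∑ i, ∑ j, (pd k (a i j) x1 * (pd i w x1 * pd j w x1) +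
          a i j x1 * (pd k (pd i w) x1 * pd j w x1 + pd i w x1 * pd k (pd j w) x1)) +
        ∑ i, (pd k (b i) x1 * pd i w x1 + b i x1 * pd k (pd i w) x1) = 0 := by
    intro k
    have hev : (fun x => ∑ i, ∑ j, a i j x * pd i (pd j w) x +
      ∑ i, ∑ j, a i j x * (pd i w x * pd j w x) + ∑ i, b i x * pd i w x)
        =ᶠ[nhds x1] fun _ => 0 := by
      filter_upwards [isOpen_ball.mem_nhds hx1] with x hx using heq x hx
    have h0 := pd_congr_of_eventuallyEq hev k
    have dA := fun i j => (hop.sm_a i j).differentiable x1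
    have dB := fun i => (hop.sm_b i).differentiable x1
    have dp := fun i => (hpsm i).differentiable x1
    have dH := fun i j => ((hpsm j).pd i).differentiable x1
    rw [pd_const, pd_add_at, pd_add_at, pd_sum2_mul_at dA dH,
      pd_sum2_mul_at dA (g := fun i j x => pd i w x * pd j w x) (fun i j => (dp i).mul (dp j)),
      pd_sum_mul_at dB dp] at h0
    · rw [← h0]
      congr 2
      · refine Finset.sum_congr rfl fun i _ => Finset.sum_congr rfl fun j _ => ?_
        rw [pd_comm (hpsm j) k i]
        have : pd k (pd j w) = pd j (pd k w) := by funext x; exact pd_comm hw k j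
        rw [this]
      · refine Finset.sum_congr rfl fun i _ => Finset.sum_congr rfl fun j _ => ?_
        rw [pd_mul_at (dp i) (dp j)]
    · exact DifferentiableAt.fun_sum fun i _ => DifferentiableAt.fun_sum fun j _ =>
        (dA i j).mul (dH i j)
    · exact DifferentiableAt.fun_sum fun i _ => DifferentiableAt.fun_sum fun j _ =>
        (dA i j).mul ((dp i).mul (dp j))
    · exact (DifferentiableAt.fun_sum fun i _ => DifferentiableAt.fun_sum fun j _ =>
        (dA i j).mul (dH i j)).add (DifferentiableAt.fun_sum fun i _ =>
          DifferentiableAt.fun_sum fun j _ => (dA i j).mul ((dp i).mul (dp j)))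
    · exact DifferentiableAt.fun_sum fun i _ => (dB i).mul (dp i)
  have key := hKall (fun i j => a i j x1) (fun i j => pd i (pd j w) x1)
    (fun k i j => pd k (a i j) x1) (fun i => b i x1) (fun k i => pd k (b i) x1)
    (fun k => pd k w x1) (fun i j k => pd i (pd j (pd k w)) x1) R (y x1) (fun i => pd i y x1)
    (fun i j => pd i (pd j y) x1) (Q x1) (√(Q x1))
    (√(∑ i, ∑ k, pd i (pd k w) x1 ^ 2)) (fun i => pd i Q x1)
    (fun i j => hop.bd_a i j x1) (fun k i j => hop.bd_da k i j x1) (fun i => hop.bd_b i x1)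
    (fun k i => hop.bd_db k i x1) (hop.ell x1) (fun i j => pd_comm hw i j) hR hR1 hypos hyle
    hpdy (fun i j => by rw [hy, pd_pd_paraboloid]; split_ifs <;> norm_num)
    (Real.sqrt_nonneg _) (Real.sq_sqrt hQ0) rfl (Real.sqrt_nonneg _)
    (Real.sq_sqrt (Finset.sum_nonneg fun _ _ => Finset.sum_nonneg fun _ _ => sq_nonneg _))
    hsum (heq x1 hx1) hdeq hcrit (by
      refine le_trans (le_of_eq (Finset.sum_congr rfl fun i _ => Finset.sum_congr rfl fun j _ =>
        ?_)) hsnd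
      rw [pd_pd_prod _ _ hyy hQsm, pd_pd_prod _ _ hysm hysm, pd_prod _ _ hysm hysm,
        pd_prod _ _ hysm hysm, pd_pd_sqnorm w hw]
      ring)
  have hfin := hCall R (y x1 * √(Q x1)) (y x1 ^ 2 * √(∑ i, ∑ k, pd i (pd k w) x1 ^ 2)) hR
    (by positivity) (by positivity) key.1 key.2
  have := pow_le_pow_left₀ (by positivity) hfin 2
  rw [mul_pow, mul_pow, Real.sq_sqrt hQ0] at this
  exact this

/-- Bernstein gradient estimate for logarithms of solutions. -/
theorem bernstein_estimate (n : ℕ) (L : ℝ) (hL : 1 ≤ L) : ∃ C : ℝ, 0 < C ∧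
    ∀ a b, IsOp (n := n) L a b → ∀ w, Sm w → ∀ x0 R, 0 < R → R ≤ 1 →
    (∀ x ∈ ball x0 R, ∑ i, ∑ j, a i j x * pd i (pd j w) x +
      ∑ i, ∑ j, a i j x * (pd i w x * pd j w x) + ∑ i, b i x * pd i w x = 0) →
    ∑ k, pd k w x0 ^ 2 ≤ C / R ^ 2 := by
  obtain ⟨C, hC, hCall⟩ := bernstein_at_max n L hL
  refine ⟨C, hC, ?_⟩
  intro a b hop w hw x0 R hR hR1 heq
  set F : EuclideanSpace ℝ (Fin n) → ℝ := fun x => paraboloid x0 R x ^ 2 * ∑ k, pd k w x ^ 2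
    with hF
  have hFc : Continuous F := by
    have h1 := (sm_paraboloid x0 R).continuous
    have h2 := fun k => (hw.pd k).continuous
    rw [hF]; fun_prop
  obtain ⟨x1, hx1, hmax⟩ := (isCompact_closedBall x0 R).exists_isMaxOn
    ⟨x0, mem_closedBall_self hR.le⟩ hFc.continuousOn
  have h0 : F x0 ≤ F x1 := hmax (mem_closedBall_self hR.le)
  have hF0 : F x0 = R ^ 4 * ∑ k, pd k w x0 ^ 2 := by
    simp only [hF, paraboloid_eq, dist_self]; ring
  have hle : F x1 ≤ C * R ^ 2 := by
    rcases (mem_closedBall.1 hx1).lt_or_eq with h | h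
    · refine hCall a b hop w hw x0 R hR hR1 heq x1 h ?_
      exact hmax.isLocalMax (Filter.mem_of_superset (isOpen_ball.mem_nhds h) ball_subset_closedBall)
    · have : F x1 = 0 := by simp only [hF, paraboloid_eq, h]; ring
      rw [this]; positivity
  rw [le_div_iff₀ (by positivity)]
  have h2 : R ^ 2 * ((∑ k, pd k w x0 ^ 2) * R ^ 2) ≤ R ^ 2 * C := by
    calc _ = F x0 := by rw [hF0]; ring
      _ ≤ _ := h0.trans hle
      _ = _ := by ring
  exact le_of_mul_le_mul_left h2 (by positivity)

end BernsteinMain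

section Local

variable {n : ℕ}

/-- A function smooth on a ball agrees on a smaller ball with a globally smooth function. -/
theorem exists_smooth_ext {f : EuclideanSpace ℝ (Fin n) → ℝ} {x0 : EuclideanSpace ℝ (Fin n)}
    {r R : ℝ} (hr : 0 < r) (h : r < R) (hf : ContDiffOn ℝ (⊤ : ℕ∞) f (ball x0 R)) :
    ∃ g, Sm g ∧ ∀ x ∈ ball x0 r, g x = f x := by
  let χ : ContDiffBump x0 := ⟨r, (r + R) / 2, hr, by linarith⟩
  refine ⟨fun x => χ x * f x, ?_, fun x hx => ?_⟩
  · rw [Sm, contDiff_iff_contDiffAt]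
    intro x
    by_cases hx : x ∈ ball x0 R
    · exact χ.contDiffAt.mul (hf.contDiffAt (isOpen_ball.mem_nhds hx))
    · have hx' : x ∉ tsupport χ := by
        rw [χ.tsupport_eq]
        intro hc
        apply hx
        have : dist x x0 ≤ (r + R) / 2 := hc
        rw [mem_ball]; linarith
      have hev := notMem_tsupport_iff_eventuallyEq.1 hx'
      refine (contDiffAt_const (c := (0 : ℝ))).congr_of_eventuallyEq ?_
      filter_upwards [hev] with y hy
      simp [hy]
  · have : χ x = 1 := χ.one_of_mem_closedBall (ball_subset_closedBall hx)
    simp [this]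

theorem pd_congr_on {f g : EuclideanSpace ℝ (Fin n) → ℝ} {U : Set (EuclideanSpace ℝ (Fin n))}
    (hU : IsOpen U) (h : ∀ x ∈ U, f x = g x) (i : Fin n) : ∀ x ∈ U, pd i f x = pd i g x := by
  intro x hx
  refine pd_congr_of_eventuallyEq ?_ i
  filter_upwards [hU.mem_nhds hx] with y hy using h y hy

theorem pd_log {v : EuclideanSpace ℝ (Fin n) → ℝ} (hv : Sm v) {x : EuclideanSpace ℝ (Fin n)}
    (hx : v x ≠ 0) (i : Fin n) :
    pd i (fun y => Real.log (v y)) x = (v x)⁻¹ * pd i v x :=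
  pd_comp_at (Real.hasDerivAt_log hx) (hv.differentiable x) i

theorem pd_pd_log {v : EuclideanSpace ℝ (Fin n) → ℝ} (hv : Sm v)
    {U : Set (EuclideanSpace ℝ (Fin n))} (hU : IsOpen U) (h0 : ∀ x ∈ U, v x ≠ 0)
    {x : EuclideanSpace ℝ (Fin n)} (hx : x ∈ U) (i j : Fin n) :
    pd i (pd j (fun y => Real.log (v y))) x =
      (v x)⁻¹ * pd i (pd j v) x - ((v x)⁻¹ * pd i v x) * ((v x)⁻¹ * pd j v x) := by
  have h1 : ∀ y ∈ U, pd j (fun y => Real.log (v y)) y = (v y)⁻¹ * pd j v y :=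
    fun y hy => pd_log hv (h0 y hy) j
  rw [pd_congr_on hU h1 i x hx]
  have hd : DifferentiableAt ℝ (fun y => (v y)⁻¹) x := (hv.differentiable x).inv (h0 x hx)
  rw [pd_mul_at hd ((hv.pd j).differentiable x),
    pd_comp_at (φ := fun t => t⁻¹) (hasDerivAt_inv (h0 x hx)) (hv.differentiable x)]
  field_simp
  ring

/-- Gradient bound for nonvanishing solutions. -/
theorem grad_log_le (n : ℕ) (L : ℝ) (hL : 1 ≤ L) : ∃ C : ℝ, 0 < C ∧
    ∀ a b, IsOp (n := n) L a b → ∀ v, Sm v → ∀ x0 R, 0 < R → R ≤ 1 →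
    (∀ x ∈ ball x0 R, Lop a b v x = 0) → (∀ x ∈ ball x0 R, v x ≠ 0) →
    √(∑ k, pd k v x0 ^ 2) ≤ C / R * |v x0| := by
  obtain ⟨C, hC, hCall⟩ := bernstein_estimate n L hL
  refine ⟨2 * √C, by positivity, ?_⟩
  intro a b hop v hv x0 R hR hR1 hsol h0
  have hlog : ContDiffOn ℝ (⊤ : ℕ∞) (fun x => Real.log (v x)) (ball x0 R) :=
    hv.contDiffOn.log h0
  obtain ⟨w, hw, hwe⟩ := exists_smooth_ext (r := R / 2) (by positivity) (by linarith) hlog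
  have hsub : ball x0 (R / 2) ⊆ ball x0 R := ball_subset_ball (by linarith)
  have h1 : ∀ i, ∀ x ∈ ball x0 (R / 2), pd i w x = (v x)⁻¹ * pd i v x := fun i x hx => by
    rw [pd_congr_on isOpen_ball hwe i x hx, pd_log hv (h0 x (hsub hx))]
  have h2 : ∀ i j, ∀ x ∈ ball x0 (R / 2), pd i (pd j w) x =
      (v x)⁻¹ * pd i (pd j v) x - ((v x)⁻¹ * pd i v x) * ((v x)⁻¹ * pd j v x) := fun i j x hx => by
    rw [pd_congr_on isOpen_ball (fun y hy => pd_congr_on isOpen_ball hwe j y hy) i x hx,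
      pd_pd_log hv isOpen_ball h0 (hsub hx)]
  have h3 := hCall a b hop w hw x0 (R / 2) (by positivity) (by linarith) (by
    intro x hx
    have hs := hsol x (hsub hx)
    unfold Lop at hs
    simp only [h1 _ x hx, h2 _ _ x hx]
    have : (v x)⁻¹ * (∑ i, ∑ j, a i j x * pd i (pd j v) x + ∑ j, b j x * pd j v x) = 0 := by
      rw [hs, mul_zero]
    rw [← this, mul_add]
    simp only [Finset.mul_sum, ← Finset.sum_add_distrib]
    refine Finset.sum_congr rfl fun i _ => ?_
    congr 1
    · refine Finset.sum_congr rfl fun j _ => ?_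
      ring
    · ring)
  have hx0 : x0 ∈ ball x0 (R / 2) := mem_ball_self (by positivity)
  simp only [h1 _ x0 hx0, mul_pow, ← Finset.mul_sum] at h3
  have hv0 : 0 < |v x0| := abs_pos.2 (h0 x0 (hsub hx0))
  apply Real.sqrt_le_iff.2 ⟨by positivity, ?_⟩
  have h4 : ∑ k, pd k v x0 ^ 2 ≤ (v x0) ^ 2 * (C / (R / 2) ^ 2) := by
    have h5 := mul_le_mul_of_nonneg_left h3 (sq_nonneg (v x0))
    rwa [← mul_assoc, inv_pow, mul_inv_cancel₀ (by rw [← sq_abs]; positivity), one_mul] at h5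
  refine h4.trans (le_of_eq ?_)
  rw [mul_pow, div_pow (2 * √C), mul_pow, Real.sq_sqrt hC.le, sq_abs]
  field_simp

theorem Lop_add_const {a : Fin n → Fin n → EuclideanSpace ℝ (Fin n) → ℝ}
    {b : Fin n → EuclideanSpace ℝ (Fin n) → ℝ} {u : EuclideanSpace ℝ (Fin n) → ℝ} (hu : Sm u)
    (c : ℝ) (x : EuclideanSpace ℝ (Fin n)) : Lop a b (fun y => u y + c) x = Lop a b u x := by
  have : ∀ i, pd i (fun y => u y + c) = pd i u := fun i => by
    funext y
    rw [pd_add_at (hu.differentiable y) (by fun_prop), pd_const, add_zero]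
  unfold Lop
  simp only [this]

theorem Lop_neg {a : Fin n → Fin n → EuclideanSpace ℝ (Fin n) → ℝ}
    {b : Fin n → EuclideanSpace ℝ (Fin n) → ℝ} {u : EuclideanSpace ℝ (Fin n) → ℝ}
    (x : EuclideanSpace ℝ (Fin n)) : Lop a b (fun y => -u y) x = -Lop a b u x := by
  have h : ∀ f : EuclideanSpace ℝ (Fin n) → ℝ, ∀ i, pd i (fun y => -f y) = fun y => -pd i f y := by
    intro f i
    funext y
    unfold pd
    rw [fderiv_fun_neg]; rfl
  unfold Lop
  simp only [h, mul_neg, Finset.sum_neg_distrib]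
  ring

/-- Interior gradient estimate. -/
theorem grad_le (n : ℕ) (L : ℝ) (hL : 1 ≤ L) : ∃ C : ℝ, 0 < C ∧
    ∀ a b, IsOp (n := n) L a b → ∀ u, Sm u → ∀ x0 R M, 0 < R → R ≤ 1 →
    (∀ x ∈ ball x0 R, Lop a b u x = 0) → (∀ x ∈ ball x0 R, |u x| ≤ M) →
    √(∑ k, pd k u x0 ^ 2) ≤ C / R * M := by
  obtain ⟨C, hC, hCall⟩ := grad_log_le n L hL
  refine ⟨2 * C, by positivity, ?_⟩
  intro a b hop u hu x0 R M hR hR1 hsol hM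
  have hx0 : x0 ∈ ball x0 R := mem_ball_self hR
  have hM0 : 0 ≤ M := (abs_nonneg _).trans (hM x0 hx0)
  have key : ∀ ε > 0, √(∑ k, pd k u x0 ^ 2) ≤ C / R * (2 * M + ε) := by
    intro ε hε
    have h := hCall a b hop (fun y => u y + (M + ε)) (hu.add contDiff_const) x0 R hR hR1
      (fun x hx => by rw [Lop_add_const hu]; exact hsol x hx)
      (fun x hx => by have := (abs_le.1 (hM x hx)).1; linarith)
    have e : ∀ i, pd i (fun y => u y + (M + ε)) x0 = pd i u x0 := fun i => by
      rw [pd_add_at (hu.differentiable x0) (by fun_prop), pd_const, add_zero]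
    simp only [e] at h
    refine h.trans ?_
    gcongr
    have := abs_le.1 (hM x0 hx0)
    rw [abs_le]; constructor <;> linarith
  have hlim : Filter.Tendsto (fun ε : ℝ => C / R * (2 * M + ε)) (nhdsWithin 0 (Set.Ioi 0))
      (nhds (C / R * (2 * M + 0))) := by
    refine Filter.Tendsto.mono_left ?_ nhdsWithin_le_nhds
    exact Continuous.tendsto (by fun_prop) 0
  have := ge_of_tendsto hlim (Filter.eventually_of_mem self_mem_nhdsWithin key)
  refine this.trans (le_of_eq ?_)
  ring

/-- Harnack inequality. -/
theorem harnack (n : ℕ) (L : ℝ) (hL : 1 ≤ L) : ∃ C : ℝ, 0 < C ∧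
    ∀ a b, IsOp (n := n) L a b → ∀ v, Sm v → ∀ x0 R τ, 0 < R → R ≤ 1 → 0 < τ →
    (∀ x ∈ ball x0 R, Lop a b v x = 0) → (∀ x ∈ ball x0 R, v x ≠ 0) → τ ≤ 1 →
    ∀ x ∈ ball x0 ((1 - τ) * R), ∀ y ∈ ball x0 ((1 - τ) * R),
      |Real.log (v y) - Real.log (v x)| ≤ C / (τ * R) * dist y x := by
  obtain ⟨C, hC, hCall⟩ := grad_log_le n L hL
  refine ⟨C, hC, ?_⟩
  intro a b hop v hv x0 R τ hR hR1 hτ hsol h0 hτ1 x hx y hy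
  have hsub : ∀ z ∈ ball x0 ((1 - τ) * R), ball z (τ * R) ⊆ ball x0 R := fun z hz =>
    ball_subset_ball' (by have : dist z x0 < (1 - τ) * R := hz; linarith)
  have hmem : ∀ z ∈ ball x0 ((1 - τ) * R), z ∈ ball x0 R := fun z hz =>
    hsub z hz (mem_ball_self (by positivity))
  have hd : ∀ z ∈ ball x0 ((1 - τ) * R), DifferentiableAt ℝ (fun z => Real.log (v z)) z :=
    fun z hz => (hv.differentiable z).log (h0 z (hmem z hz))
  have hb : ∀ z ∈ ball x0 ((1 - τ) * R), ‖fderiv ℝ (fun z => Real.log (v z)) z‖ ≤ C / (τ * R) := by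
    intro z hz
    refine norm_fderiv_le.trans ?_
    simp only [pd_log hv (h0 z (hmem z hz)), mul_pow, ← Finset.mul_sum]
    rw [Real.sqrt_mul (by positivity), Real.sqrt_sq_eq_abs, abs_inv]
    have := hCall a b hop v hv z (τ * R) (by positivity) (by nlinarith)
      (fun p hp => hsol p (hsub z hz hp)) (fun p hp => h0 p (hsub z hz hp))
    have hpos : 0 < |v z| := abs_pos.2 (h0 z (hmem z hz))
    rw [inv_mul_le_iff₀ hpos]
    linarith
  have := (convex_ball x0 ((1 - τ) * R)).norm_image_sub_le_of_norm_fderiv_le (𝕜 := ℝ) hd hb hx hy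
  rwa [← dist_eq_norm y x, Real.norm_eq_abs] at this

/-- Weak maximum principle. -/
theorem max_principle {n : ℕ} (hn : 0 < n) {L : ℝ}
    {a : Fin n → Fin n → EuclideanSpace ℝ (Fin n) → ℝ}
    {b : Fin n → EuclideanSpace ℝ (Fin n) → ℝ} (hop : IsOp L a b)
    {u : EuclideanSpace ℝ (Fin n) → ℝ} (hu : Sm u) {x0 : EuclideanSpace ℝ (Fin n)} {R M : ℝ}
    (hR : 0 < R) (hsol : ∀ x ∈ ball x0 R, Lop a b u x = 0) (hM : ∀ x ∈ sphere x0 R, u x ≤ M) :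
    ∀ x ∈ closedBall x0 R, u x ≤ M := by
  have hL := hop.one_le
  have hL0 : 0 < L := by linarith
  set o : Fin n := ⟨0, hn⟩
  set γ : ℝ := 2 * L ^ 2 with hγ
  have hγ0 : 0 < γ := by positivity
  set e : EuclideanSpace ℝ (Fin n) → ℝ := fun x => Real.exp (γ * x o) with he
  have hlin : Sm (fun x : EuclideanSpace ℝ (Fin n) => γ * x o) := contDiff_const.mul (sm_coord o)
  have hesm : Sm e := hlin.exp
  have hpe : ∀ i, pd i e = fun x => (γ * if o = i then 1 else 0) * e x := by
    intro i
    funext x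
    rw [he, pd_comp_at (φ := Real.exp) (Real.hasDerivAt_exp _) (hlin.differentiable x),
      pd_const_mul_at ((sm_coord o).differentiable x), pd_coord]
    ring
  have hppe : ∀ i j x, pd i (pd j e) x =
      (γ * if o = j then 1 else 0) * ((γ * if o = i then 1 else 0) * e x) := by
    intro i j x
    rw [hpe j, pd_const_mul_at (hesm.differentiable x), hpe i]
  have hLe : ∀ x, 0 < Lop a b e x := by
    intro x
    have h1 : Lop a b e x = (a o o x * γ ^ 2 + b o x * γ) * e x := by
      unfold Lop
      simp only [hppe]
      simp only [hpe]
      simp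
      ring
    have h2 : L⁻¹ ≤ a o o x := by
      have := hop.ell x (fun i => if i = o then 1 else 0)
      simpa using this
    have h3 := (abs_le.1 (hop.bd_b o x)).1
    rw [h1]
    have h4 : 0 < e x := Real.exp_pos _
    have h5 : L⁻¹ * γ ^ 2 = 4 * L ^ 3 := by rw [hγ]; field_simp; ring
    have h6 : a o o x * γ ^ 2 ≥ 4 * L ^ 3 := by
      rw [← h5]; gcongr
    have h7 : b o x * γ ≥ -L * γ := by gcongr
    have h8 : 0 < a o o x * γ ^ 2 + b o x * γ := by
      have : -L * γ = -2 * L ^ 3 := by rw [hγ]; ring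
      have : 0 < L ^ 3 := by positivity
      linarith
    positivity
  have key : ∀ ε > 0, ∀ x ∈ closedBall x0 R,
      u x ≤ M + ε * Real.exp (γ * (|x0 o| + R)) := by
    intro ε hε x hx
    set F : EuclideanSpace ℝ (Fin n) → ℝ := fun x => u x + ε * e x with hF
    have hFsm : Sm F := hu.add (contDiff_const.mul hesm)
    obtain ⟨x1, hx1, hmax⟩ := (isCompact_closedBall x0 R).exists_isMaxOn
      ⟨x0, mem_closedBall_self hR.le⟩ hFsm.continuous.continuousOn
    have hx1s : x1 ∈ sphere x0 R := by
      rcases (mem_closedBall.1 hx1).lt_or_eq with h | h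
      · exfalso
        have hloc : IsLocalMax F x1 := hmax.isLocalMax
          (Filter.mem_of_superset (isOpen_ball.mem_nhds h) ball_subset_closedBall)
        have hd := fun i => pd_eq_zero_of_isLocalMax hloc i
        have hh := sum_mul_nonpos_of_psd (a := fun i j => a i j x1)
          (h := fun i j => pd i (pd j F) x1) (fun i j => hop.symm i j x1)
          (fun ξ => le_trans (by positivity) (hop.ell x1 ξ))
          (hess_nonpos_of_isLocalMax hFsm hloc)
        have h1 : Lop a b F x1 ≤ 0 := by
          unfold Lop
          simp only [hd, mul_zero, Finset.sum_const_zero, add_zero]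
          exact hh
        have hp : ∀ i, pd i F = fun x => pd i u x + ε * pd i e x := by
          intro i; funext y
          rw [hF, pd_add_at (hu.differentiable y) ((hesm.differentiable y).const_mul ε),
            pd_const_mul_at (hesm.differentiable y)]
        have hpp : ∀ i j y, pd i (pd j F) y = pd i (pd j u) y + ε * pd i (pd j e) y := by
          intro i j y
          rw [hp j, pd_add_at ((hu.pd j).differentiable y)
            (((hesm.pd j).differentiable y).const_mul ε),
            pd_const_mul_at ((hesm.pd j).differentiable y)]
        have h2 : Lop a b F x1 = Lop a b u x1 + ε * Lop a b e x1 := by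
          unfold Lop
          simp only [hpp]
          simp only [hp, mul_add, Finset.sum_add_distrib, Finset.mul_sum]
          have : ∀ p q r : ℝ, p * (q * r) = q * (p * r) := fun p q r => by ring
          simp only [this ε]
          abel
        rw [h2, hsol x1 h] at h1
        have := mul_pos hε (hLe x1)
        linarith
      · exact h
    have h1 : F x ≤ F x1 := hmax hx
    have h2 : 0 < e x := Real.exp_pos _
    have h3 : e x1 ≤ Real.exp (γ * (|x0 o| + R)) := by
      apply Real.exp_le_exp.2
      gcongr
      have h4 : |x1 o - x0 o| ≤ R := by
        have := PiLp.norm_apply_le (x1 - x0) o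
        rw [← dist_eq_norm, Real.norm_eq_abs] at this
        exact this.trans hx1
      have := abs_le.1 h4
      have := le_abs_self (x0 o)
      linarith
    calc u x ≤ F x := by simp only [hF]; nlinarith
      _ ≤ F x1 := h1
      _ ≤ _ := by simp only [hF]; gcongr; exact hM x1 hx1s
  intro x hx
  have hlim : Filter.Tendsto (fun ε : ℝ => M + ε * Real.exp (γ * (|x0 o| + R)))
      (nhdsWithin 0 (Set.Ioi 0)) (nhds (M + 0 * Real.exp (γ * (|x0 o| + R)))) := by
    refine Filter.Tendsto.mono_left ?_ nhdsWithin_le_nhds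
    exact Continuous.tendsto (by fun_prop) 0
  have := ge_of_tendsto hlim (Filter.eventually_of_mem self_mem_nhdsWithin
    fun ε hε => key ε hε x hx)
  linarith

theorem max_principle_abs {n : ℕ} (hn : 0 < n) {L : ℝ}
    {a : Fin n → Fin n → EuclideanSpace ℝ (Fin n) → ℝ}
    {b : Fin n → EuclideanSpace ℝ (Fin n) → ℝ} (hop : IsOp L a b)
    {u : EuclideanSpace ℝ (Fin n) → ℝ} (hu : Sm u) {x0 : EuclideanSpace ℝ (Fin n)} {R M : ℝ}
    (hR : 0 < R) (hsol : ∀ x ∈ ball x0 R, Lop a b u x = 0) (hM : ∀ x ∈ sphere x0 R, |u x| ≤ M) :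
    ∀ x ∈ closedBall x0 R, |u x| ≤ M := by
  intro x hx
  have h1 := max_principle hn hop hu hR hsol (fun y hy => (abs_le.1 (hM y hy)).2) x hx
  have h2 := max_principle hn hop (u := fun y => -u y) hu.neg (x0 := x0) (R := R) (M := M) hR
    (fun y hy => by rw [Lop_neg, hsol y hy, neg_zero])
    (fun y hy => by have := (abs_le.1 (hM y hy)).1; linarith) x hx
  exact abs_le.2 ⟨by linarith, h1⟩

end Local

section Integrals
variable {n : ℕ}

theorem integrable_of_bdd_supp {f : EuclideanSpace ℝ (Fin n) → ℝ} {ρ M : ℝ} (hf : Measurable f)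
    (hM : ∀ x, ‖x‖ ≤ ρ → |f x| ≤ M) (h0 : ∀ x, ρ < ‖x‖ → f x = 0) : Integrable f := by
  have hi : IntegrableOn f (closedBall 0 ρ) := by
    refine Measure.integrableOn_of_bounded (M := M) (measure_closedBall_lt_top.ne)
      hf.aestronglyMeasurable ?_
    refine (ae_restrict_iff' measurableSet_closedBall).2 (Filter.Eventually.of_forall ?_)
    intro x hx
    exact hM x (by simpa using hx)
  refine (integrableOn_iff_integrable_of_support_subset ?_).1 hi
  intro x hx
  by_contra h
  exact hx (h0 x (by simpa using h))

theorem pd_eq_zero_of_supp {F : EuclideanSpace ℝ (Fin n) → ℝ} {ρ : ℝ}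
    (h0 : ∀ x, ρ < ‖x‖ → F x = 0) {x : EuclideanSpace ℝ (Fin n)} (hx : ρ < ‖x‖) (i : Fin n) :
    pd i F x = 0 := by
  have : F =ᶠ[nhds x] fun _ => (0 : ℝ) := by
    filter_upwards [(isOpen_lt continuous_const continuous_norm).mem_nhds hx] with y hy
    exact h0 y hy
  rw [pd_congr_of_eventuallyEq this, pd_const]

theorem measurable_pd (F : EuclideanSpace ℝ (Fin n) → ℝ) (i : Fin n) : Measurable (pd i F) :=
  measurable_fderiv_apply_const ℝ F _

/-- The divergence theorem for one component of a compactly supported field. -/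
theorem integrable_pd_of_supp {F : EuclideanSpace ℝ (Fin n) → ℝ} {ρ M : ℝ}
    (h0 : ∀ x, ρ < ‖x‖ → F x = 0) (i : Fin n)
    (hM : ∀ x, ‖x‖ ≤ ρ → |pd i F x| ≤ M) : Integrable (pd i F) :=
  integrable_of_bdd_supp (measurable_pd F i) hM fun _ hx => pd_eq_zero_of_supp h0 hx i

theorem integral_pd_eq_zero {F : EuclideanSpace ℝ (Fin n) → ℝ} {ρ M : ℝ}
    (hF : Differentiable ℝ F) (h0 : ∀ x, ρ < ‖x‖ → F x = 0) (i : Fin n)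
    (hM : ∀ x, ‖x‖ ≤ ρ → |pd i F x| ≤ M) : ∫ x, pd i F x = 0 := by
  have hi := integrable_pd_of_supp h0 i hM
  obtain ⟨C, hC⟩ := (isCompact_closedBall (0 : EuclideanSpace ℝ (Fin n)) ρ).exists_bound_of_continuousOn
    hF.continuous.continuousOn
  have hFi : Integrable F := integrable_of_bdd_supp (M := C) hF.continuous.measurable
    (fun x hx => hC x (by simpa using hx)) h0
  have := integral_mul_fderiv_eq_neg_fderiv_mul_of_integrable (μ := volume) (𝕜 := ℝ)
    (f := fun _ : EuclideanSpace ℝ (Fin n) => (1 : ℝ)) (g := F)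
    (v := EuclideanSpace.single i 1) (by simp) (by simpa using! hi) (by simpa using hFi)
    (fun x _ => differentiableAt_const _)
    (fun x _ => hF x)
  simpa [pd] using this

/-- The Cauchy-Schwarz inequality in pointwise form. -/
theorem sq_integral_le {α : Type*} [MeasurableSpace α] {ν : Measure α} {m p q : α → ℝ}
    (hm : Integrable m ν) (hp : Integrable p ν) (hq : Integrable q ν)
    (hp0 : ∀ x, 0 ≤ p x) (hq0 : ∀ x, 0 ≤ q x) (h : ∀ x, m x ^ 2 ≤ p x * q x) :
    (∫ x, m x ∂ν) ^ 2 ≤ (∫ x, p x ∂ν) * ∫ x, q x ∂ν := by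
  have key : ∀ t : ℝ, 0 ≤ (∫ x, p x ∂ν) * (t * t) + (2 * ∫ x, m x ∂ν) * t + ∫ x, q x ∂ν := by
    intro t
    have : ∫ x, (p x * (t * t) + (2 * m x) * t + q x) ∂ν
        = (∫ x, p x ∂ν) * (t * t) + (2 * ∫ x, m x ∂ν) * t + ∫ x, q x ∂ν := by
      rw [integral_add _ hq, integral_add, integral_mul_const, integral_mul_const,
        integral_const_mul]
      · exact hp.mul_const _
      · exact (hm.const_mul _).mul_const _
      · exact (hp.mul_const _).add ((hm.const_mul _).mul_const _)
    rw [← this]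
    refine integral_nonneg fun x => ?_
    have hd : ∀ P Q N : ℝ, 0 ≤ P → 0 ≤ Q → N ^ 2 ≤ P * Q → 0 ≤ P * (t * t) + 2 * N * t + Q := by
      intro P Q N hP hQ hN
      rcases hP.eq_or_lt with rfl | hP
      · have : N = 0 := by nlinarith [sq_nonneg N]
        simp [this, hQ]
      · have h1 : 0 ≤ P * (P * (t * t) + 2 * N * t + Q) := by nlinarith [sq_nonneg (P * t + N)]
        exact nonneg_of_mul_nonneg_right h1 hP
    exact hd _ _ _ (hp0 x) (hq0 x) (h x)
  have := discrim_le_zero key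
  rw [discrim] at this
  nlinarith

theorem hasDerivAt_max_pow (k : ℕ) (t : ℝ) :
    HasDerivAt (fun t : ℝ => max t 0 ^ (k + 2)) ((k + 2 : ℕ) * max t 0 ^ (k + 1)) t := by
  rcases lt_trichotomy t 0 with h | rfl | h
  · have : (fun t : ℝ => max t 0 ^ (k + 2)) =ᶠ[nhds t] fun _ => 0 := by
      filter_upwards [gt_mem_nhds h] with s hs
      simp [max_eq_right hs.le]
    rw [max_eq_right h.le]
    simpa using (hasDerivAt_const t (0 : ℝ)).congr_of_eventuallyEq this
  · rw [hasDerivAt_iff_isLittleO]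
    simp only [max_self, sub_zero, smul_eq_mul, ne_eq, Nat.add_eq_zero_iff, OfNat.ofNat_ne_zero, and_false,
      not_false_eq_true, zero_pow, mul_zero, one_ne_zero]
    have : (fun t : ℝ => max t 0 ^ (k + 2)) =O[nhds 0] fun t : ℝ => t ^ (k + 2) := by
      refine Asymptotics.IsBigO.of_bound 1 (Filter.Eventually.of_forall fun s => ?_)
      rw [one_mul, norm_pow, norm_pow]
      refine pow_le_pow_left₀ (norm_nonneg _) ?_ _
      rw [Real.norm_eq_abs, Real.norm_eq_abs, abs_of_nonneg (le_max_right _ _)]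
      exact max_le (le_abs_self _) (abs_nonneg _)
    refine this.trans_isLittleO ?_
    simpa using! (Asymptotics.isLittleO_pow_pow (𝕜 := ℝ) (m := 1) (n := k + 2) (by omega))
  · have : (fun t : ℝ => max t 0 ^ (k + 2)) =ᶠ[nhds t] fun t => t ^ (k + 2) := by
      filter_upwards [lt_mem_nhds h] with s hs
      simp [max_eq_left hs.le]
    rw [max_eq_left h.le]
    simpa using (hasDerivAt_pow (k + 2) t).congr_of_eventuallyEq this

/-- Differentiating a truncated integral in the truncation radius. -/
theorem hasDerivAt_integral_trunc {f q : EuclideanSpace ℝ (Fin n) → ℝ} {r r1 ρ M : ℝ} (k : ℕ)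
    (hf : Measurable f) (hq : Measurable q) (hq0 : ∀ x, 0 ≤ q x) (hr : 0 < r) (hr1 : r < r1)
    (hρ : ∀ x, ρ < ‖x‖ → r1 ^ 2 ≤ q x) (hM : ∀ x, ‖x‖ ≤ ρ → |f x| ≤ M) :
    HasDerivAt (fun r => ∫ x, f x * max (r ^ 2 - q x) 0 ^ (k + 2))
      ((k + 2 : ℕ) * 2 * r * ∫ x, f x * max (r ^ 2 - q x) 0 ^ (k + 1)) r := by
  have hs : Set.Ioo 0 r1 ∈ nhds r := Ioo_mem_nhds hr hr1
  have hr1' : 0 < r1 := hr.trans hr1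
  have hw : ∀ s ∈ Set.Ioo 0 r1, ∀ x, max (s ^ 2 - q x) 0 ≤ r1 ^ 2 := by
    intro s hs x
    have : s ^ 2 ≤ r1 ^ 2 := pow_le_pow_left₀ hs.1.le hs.2.le 2
    exact max_le (by linarith [hq0 x]) (by positivity)
  have hz : ∀ s ∈ Set.Ioo 0 r1, ∀ x, ρ < ‖x‖ → max (s ^ 2 - q x) 0 = 0 := by
    intro s hs x hx
    have : s ^ 2 ≤ r1 ^ 2 := pow_le_pow_left₀ hs.1.le hs.2.le 2
    exact max_eq_right (by linarith [hρ x hx])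
  have hmeas : ∀ (s : ℝ) (j : ℕ), Measurable fun x => f x * max (s ^ 2 - q x) 0 ^ j := by
    intro s j
    exact hf.mul (((measurable_const.sub hq).max measurable_const).pow_const j)
  have hbd : ∀ s ∈ Set.Ioo 0 r1, ∀ j x, ‖x‖ ≤ ρ → |f x * max (s ^ 2 - q x) 0 ^ j| ≤ M * (r1 ^ 2) ^ j := by
    intro s hs j x hx
    rw [abs_mul, abs_of_nonneg (a := max (s ^ 2 - q x) 0 ^ j) (pow_nonneg (le_max_right _ _) j)]
    exact mul_le_mul (hM x hx) (pow_le_pow_left₀ (le_max_right _ _) (hw s hs x) j)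
      (pow_nonneg (le_max_right _ _) j) ((abs_nonneg _).trans (hM x hx))
  have h := hasDerivAt_integral_of_dominated_loc_of_deriv_le (μ := volume) (𝕜 := ℝ)
    (F := fun s x => f x * max (s ^ 2 - q x) 0 ^ (k + 2))
    (F' := fun s x => f x * ((k + 2 : ℕ) * max (s ^ 2 - q x) 0 ^ (k + 1) * (2 * s)))
    (bound := Set.indicator (closedBall 0 ρ) fun _ => (k + 2 : ℕ) * (2 * r1) * (M * (r1 ^ 2) ^ (k + 1)))
    (x₀ := r) hs
    (Filter.Eventually.of_forall fun s => (hmeas s _).aestronglyMeasurable)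
    (integrable_of_bdd_supp (hmeas r _) (hbd r ⟨hr, hr1⟩ _)
      (fun x hx => by simp [hz r ⟨hr, hr1⟩ x hx])) ?_ ?_ ?_ ?_
  · have h2 := h.2
    have e : ((k + 2 : ℕ) : ℝ) * 2 * r * ∫ x, f x * max (r ^ 2 - q x) 0 ^ (k + 1)
        = ∫ x, f x * ((k + 2 : ℕ) * max (r ^ 2 - q x) 0 ^ (k + 1) * (2 * r)) := by
      rw [← integral_const_mul]
      congr 1 with x
      ring
    rw [e]
    exact h2
  · have : Measurable fun x => f x * ((k + 2 : ℕ) * max (r ^ 2 - q x) 0 ^ (k + 1) * (2 * r)) :=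
      hf.mul (((((measurable_const.sub hq).max measurable_const).pow_const _).const_mul _).mul_const _)
    exact this.aestronglyMeasurable
  · refine Filter.Eventually.of_forall fun x s hs => ?_
    by_cases hx : ‖x‖ ≤ ρ
    · rw [Set.indicator_of_mem (by simpa using hx)]
      have h1 := hbd s hs (k + 1) x hx
      have : f x * ((k + 2 : ℕ) * max (s ^ 2 - q x) 0 ^ (k + 1) * (2 * s))
          = ((k + 2 : ℕ) * (2 * s)) * (f x * max (s ^ 2 - q x) 0 ^ (k + 1)) := by ring
      rw [this, Real.norm_eq_abs, abs_mul, abs_of_nonneg (by have := hs.1.le; positivity)]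
      refine mul_le_mul ?_ h1 (abs_nonneg _) (by positivity)
      have := hs.2.le
      gcongr
    · rw [Set.indicator_of_notMem (by simpa using hx), hz s hs x (not_le.1 hx)]
      simp
  · exact (integrable_indicator_iff measurableSet_closedBall).2
      (integrableOn_const measure_closedBall_lt_top.ne)
  · refine Filter.Eventually.of_forall fun x s _ => ?_
    have h1 := (hasDerivAt_max_pow k (s ^ 2 - q x)).comp s (((hasDerivAt_pow 2 s).sub_const (q x)))
    have h2 := h1.const_mul (f x)
    simpa using h2
end Integrals

/-- An iteration lemma: an approximate contraction with logarithmic loss is bounded. -/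
theorem contraction_bound {f : ℝ → ℝ} {s0 s1 θ B K M0 : ℝ} (h01 : s0 < s1) (hθ0 : 0 < θ) (hθ : θ < 1)
    (hK : 0 ≤ K) (hbd : ∀ s ∈ Set.Ico s0 s1, f s ≤ M0)
    (hstep : ∀ s ∈ Set.Ico s0 s1, ∀ t, 0 < t → s + t < s1 → f s ≤ θ * f (s + t) + B - K * Real.log t) :
    f s0 + K / (1 - θ) * Real.log (s1 - s0) ≤
      (B + (θ * (K / (1 - θ)) + K) * Real.log 2) / (1 - θ) := by
  set lam := K / (1 - θ) with hlam
  have h1θ : 0 < 1 - θ := by linarith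
  have hlam0 : 0 ≤ lam := div_nonneg hK h1θ.le
  have hlK : lam * (1 - θ) = K := by rw [hlam]; field_simp
  set g : ℝ → ℝ := fun s => f s + lam * Real.log (s1 - s) with hg
  have hne : (g '' Set.Ico s0 s1).Nonempty := ⟨g s0, s0, ⟨le_rfl, h01⟩, rfl⟩
  have hba : BddAbove (g '' Set.Ico s0 s1) := by
    refine ⟨M0 + lam * Real.log (s1 - s0), ?_⟩
    rintro _ ⟨s, hs, rfl⟩
    have : Real.log (s1 - s) ≤ Real.log (s1 - s0) :=
      Real.log_le_log (by linarith [hs.2]) (by linarith [hs.1])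
    exact add_le_add (hbd s hs) (mul_le_mul_of_nonneg_left this hlam0)
  set S := sSup (g '' Set.Ico s0 s1) with hS
  have hle : ∀ s ∈ Set.Ico s0 s1, g s ≤ S := fun s hs => le_csSup hba ⟨s, hs, rfl⟩
  have hS2 : S ≤ θ * S + B + (θ * lam + K) * Real.log 2 := by
    refine csSup_le hne ?_
    rintro _ ⟨s, hs, rfl⟩
    have hpos : 0 < s1 - s := by linarith [hs.2]
    have h1 := hstep s hs ((s1 - s) / 2) (by linarith) (by linarith)
    have h2 := hle (s + (s1 - s) / 2) ⟨by linarith [hs.1], by linarith⟩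
    have h3 : s1 - (s + (s1 - s) / 2) = (s1 - s) / 2 := by ring
    have h4 : Real.log ((s1 - s) / 2) = Real.log (s1 - s) - Real.log 2 :=
      Real.log_div hpos.ne' (by norm_num)
    simp only [hg] at h2 ⊢
    rw [h3, h4] at h2
    rw [h4] at h1
    have h5 := mul_le_mul_of_nonneg_left h2 hθ0.le
    have h6 : K * Real.log (s1 - s) = lam * Real.log (s1 - s) - θ * lam * Real.log (s1 - s) := by
      rw [← hlK]; ring
    linarith [h5, h1, h6]
  have := hle s0 ⟨le_rfl, h01⟩
  refine this.trans ?_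
  rw [le_div_iff₀ h1θ]
  linarith

set_option maxHeartbeats 1600000 in
/-- The algebraic core of the almost monotonicity of the frequency. -/
theorem freq_alg (m C : ℝ) (hm : 0 ≤ m) (hC : 1 ≤ C) : ∃ K : ℝ, 1 ≤ K ∧
    ∀ r h N ι ζ y φ ε₁ ε₂ ε₃ : ℝ, 0 < r → r ≤ 1 → 0 ≤ h → h ≤ 1 → 0 ≤ ι → N ^ 2 ≤ ζ → 0 ≤ y →
      |ε₁| ≤ C * r → 6 * N = ι - ε₂ → ε₂ ^ 2 ≤ C * r ^ 2 * ι → |ε₃| ≤ C * r * ι →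
      6 * y = m * ι + 12 * ζ + ε₃ → φ ^ 2 ≤ C * r ^ 2 * y →
      -(K * r) ≤ N ∧ -(K * r * (|N| + 1)) ≤ y - φ - N * (2 * N + m * h + ε₁) := by
  have hC0 : 0 ≤ C := by linarith
  obtain ⟨C1, hC1⟩ : ∃ C1 : ℝ, C1 = 12 + C := ⟨_, rfl⟩
  obtain ⟨C3, hC3⟩ : ∃ C3 : ℝ, C3 = C * ((m + C) * C1 + 12) := ⟨_, rfl⟩
  have hC1' : 1 ≤ C1 := by linarith
  have hC3' : 12 ≤ C3 := by
    rw [hC3]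
    have h := mul_nonneg (add_nonneg hm hC0) (by linarith : (0:ℝ) ≤ C1)
    nlinarith only [h, hC, mul_nonneg (sub_nonneg.2 hC) h]
  obtain ⟨C4, hC4⟩ : ∃ C4 : ℝ, C4 = C3 + 1 := ⟨_, rfl⟩
  have hC4p : 1 ≤ C4 := by linarith
  refine ⟨C4 + m * C + m * C1 * C + C * C1 + C, ?_, ?_⟩
  · have : 0 ≤ m * C := by positivity
    have : 0 ≤ m * C1 * C := by positivity
    have : 0 ≤ C * C1 := by positivity
    linarith
  intro r h N ι ζ y φ ε₁ ε₂ ε₃ hr hr1 hh0 hh1 hι hNζ hy hε₁ hN hε₂ hε₃ hyeq hφ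
  obtain ⟨T, hT⟩ : ∃ T : ℝ, T = |N| + 1 := ⟨_, rfl⟩
  have hNT : |N| ≤ T := by linarith
  have hT1 : 1 ≤ T := by linarith [abs_nonneg N]
  have hrr : r ^ 2 ≤ r := by nlinarith only [hr, hr1]
  have hCrr := mul_le_mul_of_nonneg_left hrr hC0
  have hCr1 := mul_le_mul_of_nonneg_left hr1 hC0
  have hCr0 := mul_nonneg hC0 hr.le
  have hrT : r ≤ r * T := le_mul_of_one_le_right hr.le hT1
  have e2a : |ε₂| ≤ ι / 2 + C * r ^ 2 / 2 := by
    refine abs_le_of_sq_le_sq (hε₂.trans ?_) (by positivity)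
    nlinarith only [sq_nonneg (ι - C * r ^ 2)]
  have e2b := abs_le.1 e2a
  have hNlow : -(C * r) ≤ N := by linarith
  have hιT : ι ≤ C1 * T := by
    have : ι ≤ 12 * |N| + C := by linarith [le_abs_self N]
    rw [hC1, hT]; nlinarith only [this, mul_nonneg hC0 (abs_nonneg N)]
  have e2c : |ε₂| ≤ C * C1 * r * T := by
    refine abs_le_of_sq_le_sq (hε₂.trans ?_) (by positivity)
    have : C * r ^ 2 * ι ≤ C * r ^ 2 * (C1 * T) := by gcongr
    have h2 : (C * C1 * r * T) ^ 2 = C * r ^ 2 * (C1 * T) * (C * C1 * T) := by ring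
    have h3 : 1 ≤ C * C1 * T := by
      have : 1 ≤ C * C1 := by nlinarith only [hC, hC1']
      nlinarith only [this, hT1]
    rw [h2]
    have h4 : 0 ≤ C * r ^ 2 * (C1 * T) := by positivity
    exact this.trans (le_mul_of_one_le_right h4 h3)
  have e3 : |ε₃| ≤ C * C1 * r * T := by
    refine hε₃.trans ?_
    have : C * r * ι ≤ C * r * (C1 * T) := by gcongr
    linarith
  have e1N : |N * ε₁| ≤ C * r * T := by
    rw [abs_mul, mul_comm]; exact mul_le_mul hε₁ hNT (abs_nonneg _) (by positivity)
  obtain ⟨d, hd⟩ : ∃ d : ℝ, d = ζ - N ^ 2 := ⟨_, rfl⟩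
  have hd0 : 0 ≤ d := by linarith
  have hN2 : N ^ 2 ≤ T ^ 2 := by
    rw [← sq_abs]; exact pow_le_pow_left₀ (abs_nonneg _) hNT 2
  have hyT : C * y ≤ C3 * (T ^ 2 + d) := by
    have h1 : 6 * y ≤ (m + C) * (C1 * T) + 12 * (T ^ 2 + d) := by
      have h2 : |ε₃| ≤ C * ι := hε₃.trans
        (mul_le_mul_of_nonneg_right (by linarith) hι)
      have h3 := le_abs_self ε₃
      have h4 : (m + C) * ι ≤ (m + C) * (C1 * T) := by gcongr
      rw [hd]
      linarith
    have hTT : T ≤ T ^ 2 := by nlinarith only [hT1]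
    have h5 : (m + C) * (C1 * T) ≤ (m + C) * C1 * (T ^ 2 + d) := by
      rw [mul_assoc]; gcongr; linarith
    have h6 : y ≤ ((m + C) * C1 + 12) * (T ^ 2 + d) := by linarith only [h1, h5, hy]
    rw [hC3, mul_assoc]; gcongr
  have hφT : |φ| ≤ 2 * d + C4 * r * T := by
    refine abs_le_of_sq_le_sq (hφ.trans ?_) (by positivity)
    have h1 : C * r ^ 2 * y ≤ r ^ 2 * (C3 * (T ^ 2 + d)) := by
      linarith only [mul_le_mul_of_nonneg_left hyT (sq_nonneg r)]
    have h2 : (r * T) ^ 2 * C3 ≤ (C4 * r * T) ^ 2 := by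
      have : C3 ≤ C4 ^ 2 := by rw [hC4]; nlinarith only [hC3']
      linarith only [mul_le_mul_of_nonneg_left this (sq_nonneg (r * T))]
    have h3 : r ^ 2 * C3 * d ≤ 2 * (2 * d) * (C4 * r * T) := by
      have h4 : r ^ 2 * C3 ≤ 4 * (C4 * r * T) := by
        have h5 := mul_le_mul_of_nonneg_left (hrr.trans hrT) (by linarith : 0 ≤ C3)
        have h6 : 0 ≤ C4 * (r * T) := by positivity
        have h7 : 0 ≤ r * T := by positivity
        rw [hC4] at h6 ⊢
        linarith
      linarith only [mul_le_mul_of_nonneg_right h4 hd0]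
    linarith only [h1, h2, h3, sq_nonneg d]
  have hcr : 0 ≤ C * r := by positivity
  have hother : 0 ≤ m * C + m * C1 * C + C * C1 + C4 := by positivity
  constructor
  · refine le_trans (neg_le_neg (mul_le_mul_of_nonneg_right ?_ hr.le)) hNlow
    linarith
  have hE : y - φ - N * (2 * N + m * h + ε₁)
      = 2 * d - φ + m * (N * (1 - h)) + (m * ε₂ + ε₃) / 6 - N * ε₁ := by
    linear_combination (1 / 6 : ℝ) * hyeq - (m / 6) * hN - 2 * hd
  have hNh : -(C * r) ≤ N * (1 - h) := by
    have : -(C * r) * (1 - h) ≤ N * (1 - h) := by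
      apply mul_le_mul_of_nonneg_right hNlow; linarith
    linarith [mul_nonneg hcr hh0]
  have h1 := (abs_le.1 hφT).2
  have h2 := (abs_le.1 e2c).1
  have h3 := (abs_le.1 e3).1
  have h4 := (abs_le.1 e1N).2
  have h5 : m * (-(C * r)) ≤ m * (N * (1 - h)) := by gcongr
  have h6 : m * (-(C * C1 * r * T)) ≤ m * ε₂ := by gcongr
  have h7 : m * C * r ≤ m * C * r * T := by
    exact le_mul_of_one_le_right (by positivity) hT1
  have h8 : 0 ≤ m * C * C1 * r * T := by positivity
  have h9 : 0 ≤ C * C1 * r * T := by positivity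
  rw [hE, ← hT]
  linarith

/-- If `r f'` is bounded above on `[s, 2s]` then `f (2s) - f s` is bounded. -/
theorem sub_le_of_log_deriv_le {f f' : ℝ → ℝ} {s c : ℝ} (hs : 0 < s)
    (hf : ∀ r ∈ Set.Icc s (2 * s), HasDerivAt f (f' r) r)
    (hb : ∀ r ∈ Set.Icc s (2 * s), r * f' r ≤ c) : f (2 * s) - f s ≤ c * Real.log 2 := by
  have hd : ∀ r ∈ Set.Icc s (2 * s), HasDerivAt (fun r => f r - c * Real.log r) (f' r - c * r⁻¹) r := by
    intro r hr
    exact (hf r hr).sub ((Real.hasDerivAt_log (by linarith [hr.1])).const_mul c)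
  have hanti : AntitoneOn (fun r => f r - c * Real.log r) (Set.Icc s (2 * s)) := by
    refine antitoneOn_of_deriv_nonpos (convex_Icc _ _)
      (fun r hr => (hd r hr).continuousAt.continuousWithinAt)
      (fun r hr => (hd r (interior_subset hr)).differentiableAt.differentiableWithinAt) ?_
    intro r hr
    have hr' := interior_subset hr
    have hr0 : 0 < r := by linarith [hr'.1]
    rw [(hd r hr').deriv]
    have := hb r hr'
    have h2 : f' r ≤ c * r⁻¹ := by
      rw [← div_eq_mul_inv, le_div_iff₀ hr0]; linarith
    linarith
  have := hanti (Set.left_mem_Icc.2 (by linarith)) (Set.right_mem_Icc.2 (by linarith)) (by linarith : s ≤ 2 * s)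
  simp only at this
  rw [Real.log_mul (by norm_num) hs.ne'] at this
  linarith

/-- Almost monotonicity of the frequency implies a propagation of doubling. -/
theorem frequency_ode (m C : ℝ) (hm : 0 ≤ m) (hC : 1 ≤ C) : ∃ (r₀ D : ℝ) (k : ℕ),
    0 < r₀ ∧ r₀ ≤ 1 ∧ 0 < D ∧
    ∀ (r₁ : ℝ) (H P I Y Z E F H' : ℝ → ℝ), r₁ ≤ r₀ →
      (∀ r, 0 < r → r < r₁ → 0 ≤ H r ∧ 0 ≤ I r ∧ 0 ≤ Y r ∧ 0 ≤ Z r) →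
      (∀ s t, 0 < s → s ≤ t → t < r₁ → H s ≤ H t) →
      (∀ r, 0 < r → r < r₁ → HasDerivAt H (H' r) r) →
      (∀ r, 0 < r → r < r₁ → HasDerivAt P (r * (Y r - F r)) r) →
      (∀ r, 0 < r → r < r₁ → |r * H' r - 2 * P r - m * H r| ≤ C * r * H r) →
      (∀ r, 0 < r → r < r₁ → 6 * P r = I r - E r) →
      (∀ r, 0 < r → r < r₁ → |6 * r ^ 2 * Y r - m * I r - 12 * Z r| ≤ C * r * I r) →
      (∀ r, 0 < r → r < r₁ → E r ^ 2 ≤ C * r ^ 2 * H r * I r) →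
      (∀ r, 0 < r → r < r₁ → F r ^ 2 ≤ C * H r * Y r) →
      (∀ r, 0 < r → r < r₁ → P r ^ 2 ≤ H r * Z r) →
      ∀ s t, 0 < s → 2 * s ≤ t → 2 * t < r₁ →
        H (2 * s) * H t ^ k ≤ D * H s * H (2 * t) ^ k := by
  obtain ⟨K, hK1, hK⟩ := freq_alg m C hm hC
  obtain ⟨k, hk⟩ := exists_nat_ge (Real.exp (6 * K))
  obtain ⟨B, hB⟩ : ∃ B : ℝ, B = (k * (2 + C) + (m + C)) * Real.log 2 := ⟨_, rfl⟩
  refine ⟨1 / (2 * K), Real.exp B, k, by positivity, ?_, Real.exp_pos _, ?_⟩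
  · rw [div_le_one (by positivity)]; linarith
  intro r₁ H P I Y Z E F H' hr₁ hpos hmono hH hP h1 h2 h3 h4 h5 h6 s t hs hst ht
  have hr₁1 : r₁ ≤ 1 := hr₁.trans (by rw [div_le_one (by positivity)]; linarith)
  have hKr : ∀ r, r < r₁ → K * r ≤ 1 / 2 := by
    intro r hr
    have : r ≤ 1 / (2 * K) := (hr.trans_le hr₁).le
    calc K * r ≤ K * (1 / (2 * K)) := by gcongr
      _ = 1 / 2 := by field_simp
  have hlog2 : 0 < Real.log 2 := Real.log_pos (by norm_num)
  have key : ∀ δ : ℝ, 0 < δ →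
      (H (2 * s) + δ) * (H t + δ) ^ k ≤ Real.exp B * (H s + δ) * (H (2 * t) + δ) ^ k := by
    intro δ hδ
    set N : ℝ → ℝ := fun r => P r / (H r + δ) with hN
    have hHδ : ∀ r, 0 < r → r < r₁ → 0 < H r + δ := fun r hr hr' => by linarith [(hpos r hr hr').1]
    have hNd : ∀ r, 0 < r → r < r₁ → ∃ N', HasDerivAt N N' r ∧ -(3 * K) * (N r + 1) ≤ N' ∧
        1 / 2 ≤ N r + 1 ∧ |r * (H' r / (H r + δ)) - 2 * N r - m * (H r / (H r + δ))| ≤ C * r ∧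
        0 ≤ H r / (H r + δ) ∧ H r / (H r + δ) ≤ 1 := by
      intro r hr hr'
      have hq := hHδ r hr hr'
      set Q := H r + δ with hQ
      obtain ⟨p1, p2, p3, p4⟩ := hpos r hr hr'
      have hh1 : H r / Q ≤ 1 := by rw [div_le_one hq]; linarith
      have hh0 : 0 ≤ H r / Q := by positivity
      have hHQ : H r ≤ Q := by linarith
      have e1 : |r * (H' r / Q) - 2 * N r - m * (H r / Q)| ≤ C * r := by
        have : r * (H' r / Q) - 2 * N r - m * (H r / Q) = (r * H' r - 2 * P r - m * H r) / Q := by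
          simp only [hN]; ring
        rw [this, abs_div, abs_of_pos hq, div_le_iff₀ hq]
        exact (h1 r hr hr').trans (by gcongr)
      have hNsq : N r ^ 2 ≤ Z r / Q := by
        simp only [hN, div_pow]
        rw [div_le_div_iff₀ (by positivity) hq]
        have := h6 r hr hr'
        have h7 : P r ^ 2 ≤ Q * Z r := this.trans (by gcongr)
        nlinarith
      have hr1 : r ≤ 1 := by linarith
      have hE2 : (E r / Q) ^ 2 ≤ C * r ^ 2 * (I r / Q) := by
        rw [div_pow, div_le_iff₀ (by positivity)]
        refine (h4 r hr hr').trans ?_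
        have : C * r ^ 2 * (I r / Q) * Q ^ 2 = C * r ^ 2 * Q * I r := by field_simp
        rw [this]; gcongr
      have hF2 : (r ^ 2 * F r / Q) ^ 2 ≤ C * r ^ 2 * (r ^ 2 * Y r / Q) := by
        rw [div_pow, div_le_iff₀ (by positivity)]
        have : C * r ^ 2 * (r ^ 2 * Y r / Q) * Q ^ 2 = (r ^ 2) ^ 2 * (C * Q * Y r) := by field_simp
        rw [this, mul_pow]
        refine mul_le_mul_of_nonneg_left ((h5 r hr hr').trans ?_) (by positivity)
        gcongr
      have h3' : |(6 * r ^ 2 * Y r - m * I r - 12 * Z r) / Q| ≤ C * r * (I r / Q) := by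
        rw [abs_div, abs_of_pos hq, div_le_iff₀ hq]
        refine (h3 r hr hr').trans (le_of_eq ?_)
        field_simp
      have h6N : 6 * N r = I r / Q - E r / Q := by
        simp only [hN]; rw [← sub_div, ← h2 r hr hr']; ring
      obtain ⟨a1, a2⟩ := hK r (H r / Q) (N r) (I r / Q) (Z r / Q) (r ^ 2 * Y r / Q)
        (r ^ 2 * F r / Q) (r * (H' r / Q) - 2 * N r - m * (H r / Q)) (E r / Q)
        ((6 * r ^ 2 * Y r - m * I r - 12 * Z r) / Q) hr hr1 hh0 hh1 (by positivity) hNsq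
        (by positivity) e1 h6N hE2 h3' (by ring) hF2
      have hNder : HasDerivAt N ((r * (Y r - F r) * Q - P r * H' r) / Q ^ 2) r :=
        (hP r hr hr').div ((hH r hr hr').add_const δ) hq.ne'
      have hKr' := hKr r hr'
      have hN1 : 1 / 2 ≤ N r + 1 := by linarith
      have habs : |N r| + 1 ≤ 3 * (N r + 1) := by
        have : |N r| ≤ N r + 1 := abs_le.2 ⟨by linarith, by linarith⟩
        linarith
      refine ⟨_, hNder, ?_, hN1, e1, hh0, hh1⟩
      have hid : r ^ 2 * Y r / Q - r ^ 2 * F r / Q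
          - N r * (2 * N r + m * (H r / Q) + (r * (H' r / Q) - 2 * N r - m * (H r / Q)))
          = r * ((r * (Y r - F r) * Q - P r * H' r) / Q ^ 2) := by
        simp only [hN]; field_simp; ring
      rw [hid] at a2
      have a3 : r * (-(3 * K) * (N r + 1)) ≤ r * ((r * (Y r - F r) * Q - P r * H' r) / Q ^ 2) := by
        refine le_trans ?_ a2
        have : K * r * (|N r| + 1) ≤ K * r * (3 * (N r + 1)) := by gcongr
        linarith
      exact le_of_mul_le_mul_left a3 hr
    have hmonoN : ∀ x y, 0 < x → x ≤ y → y < r₁ → N x + 1 ≤ Real.exp (3 * K) * (N y + 1) := by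
      intro x y hx hxy hy
      have hMono : MonotoneOn (fun r => Real.exp (3 * K * r) * (N r + 1)) (Set.Icc x y) := by
        have hd : ∀ r ∈ Set.Icc x y, ∃ g', HasDerivAt (fun r => Real.exp (3 * K * r) * (N r + 1)) g' r ∧
            0 ≤ g' := by
          intro r hr
          obtain ⟨N', d1, d2, -⟩ := hNd r (by linarith [hr.1]) (by linarith [hr.2])
          have e := ((hasDerivAt_id r).const_mul (3 * K)).exp
          refine ⟨_, e.mul (d1.add_const 1), ?_⟩
          have := Real.exp_pos (3 * K * r)
          simp only [id]
          nlinarith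
        refine monotoneOn_of_deriv_nonneg (convex_Icc _ _) ?_ ?_ ?_
        · intro r hr
          obtain ⟨g', d, -⟩ := hd r hr
          exact d.continuousAt.continuousWithinAt
        · intro r hr
          obtain ⟨g', d, -⟩ := hd r (interior_subset hr)
          exact d.differentiableAt.differentiableWithinAt
        · intro r hr
          obtain ⟨g', d, d2⟩ := hd r (interior_subset hr)
          rw [d.deriv]; exact d2
      have h := hMono (Set.left_mem_Icc.2 hxy) (Set.right_mem_Icc.2 hxy) hxy
      simp only at h
      obtain ⟨-, -, -, ax, -⟩ := hNd x hx (by linarith)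
      obtain ⟨-, -, -, ay, -⟩ := hNd y (by linarith) hy
      have e1 : 1 ≤ Real.exp (3 * K * x) := Real.one_le_exp (by positivity)
      have e2 : Real.exp (3 * K * y) ≤ Real.exp (3 * K) := by
        refine Real.exp_le_exp.2 ?_
        have : y ≤ 1 := by linarith
        nlinarith
      have e3 : Real.exp (3 * K * y) * (N y + 1) ≤ Real.exp (3 * K) * (N y + 1) := by
        gcongr
      nlinarith
    have hΦ : ∀ r, 0 < r → r < r₁ →
        HasDerivAt (fun r => Real.log (H r + δ)) (H' r / (H r + δ)) r := fun r hr hr' =>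
      ((hH r hr hr').add_const δ).log (hHδ r hr hr').ne'
    have ht0 : 0 < t := by linarith
    obtain ⟨-, -, -, hNt, -⟩ := hNd t ht0 (by linarith)
    have hexp : Real.exp (6 * K) = Real.exp (3 * K) * Real.exp (3 * K) := by
      rw [← Real.exp_add]; ring_nf
    have hup : Real.log (H (2 * s) + δ) - Real.log (H s + δ)
        ≤ (2 * (Real.exp (3 * K) * (N t + 1)) + (m + C)) * Real.log 2 := by
      refine sub_le_of_log_deriv_le (f := fun r => Real.log (H r + δ)) hs
        (fun r hr => hΦ r (by linarith [hr.1]) (by linarith [hr.2])) ?_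
      intro r hr
      obtain ⟨-, -, -, a0, a1, a2, a3⟩ := hNd r (by linarith [hr.1]) (by linarith [hr.2])
      have b1 := (abs_le.1 a1).2
      have b2 := hmonoN r t (by linarith [hr.1]) (by linarith [hr.2]) (by linarith)
      have b3 : m * (H r / (H r + δ)) ≤ m * 1 := by gcongr
      have b4 : C * r ≤ C := by nlinarith [hr.2]
      linarith
    have hlow : (fun r => -Real.log (H r + δ)) (2 * t) - (fun r => -Real.log (H r + δ)) t
        ≤ (-(2 * (Real.exp (-(3 * K)) * (N t + 1))) + 2 + C) * Real.log 2 := by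
      refine sub_le_of_log_deriv_le (f := fun r => -Real.log (H r + δ)) ht0
        (fun r hr => (hΦ r (by linarith [hr.1]) (by linarith [hr.2])).neg) ?_
      intro r hr
      obtain ⟨-, -, -, a0, a1, a2, a3⟩ := hNd r (by linarith [hr.1]) (by linarith [hr.2])
      have b1 := (abs_le.1 a1).1
      have b2 := hmonoN t r (by linarith [hr.1]) (by linarith [hr.1]) (by linarith [hr.2])
      have b3 : 0 ≤ m * (H r / (H r + δ)) := by positivity
      have b4 : C * r ≤ C := by nlinarith [hr.2]
      have b5 : Real.exp (-(3 * K)) * (N t + 1) ≤ N r + 1 := by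
        rw [Real.exp_neg, inv_mul_le_iff₀ (Real.exp_pos _)]; exact b2
      linarith
    simp only at hlow
    have hTt : Real.log (H t + δ) ≤ Real.log (H (2 * t) + δ) := by
      refine Real.log_le_log (hHδ t ht0 (by linarith)) ?_
      linarith [hmono t (2 * t) ht0 (by linarith) ht]
    have hlog : Real.log (H (2 * s) + δ) - Real.log (H s + δ)
        ≤ k * (Real.log (H (2 * t) + δ) - Real.log (H t + δ)) + B := by
      set U := Real.log (H (2 * t) + δ) - Real.log (H t + δ) with hU
      have c1 : 2 * (Real.exp (-(3 * K)) * (N t + 1)) * Real.log 2 ≤ U + (2 + C) * Real.log 2 := by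
        linarith
      have c2 : 2 * (Real.exp (3 * K) * (N t + 1)) * Real.log 2
          = Real.exp (6 * K) * (2 * (Real.exp (-(3 * K)) * (N t + 1)) * Real.log 2) := by
        rw [hexp, Real.exp_neg]
        have := (Real.exp_pos (3 * K)).ne'
        field_simp
      have c3 : Real.exp (6 * K) * (2 * (Real.exp (-(3 * K)) * (N t + 1)) * Real.log 2)
          ≤ k * (U + (2 + C) * Real.log 2) := by
        refine mul_le_mul hk c1 ?_ (by positivity)
        have : 0 ≤ N t + 1 := by linarith
        positivity
      rw [hB]
      linarith
    have q1 := hHδ (2 * s) (by linarith) (by linarith)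
    have q2 := hHδ s hs (by linarith)
    have q3 := hHδ (2 * t) (by linarith) (by linarith)
    have q4 := hHδ t ht0 (by linarith)
    rw [← Real.log_le_log_iff (by positivity) (by positivity), Real.log_mul q1.ne' (by positivity),
      Real.log_mul (by positivity) (by positivity), Real.log_mul (by positivity) q2.ne',
      Real.log_pow, Real.log_pow, Real.log_exp]
    linarith
  have hl : Filter.Tendsto (fun δ : ℝ => (H (2 * s) + δ) * (H t + δ) ^ k) (nhdsWithin 0 (Set.Ioi 0))
      (nhds ((H (2 * s) + 0) * (H t + 0) ^ k)) :=
    ((by fun_prop : Continuous fun δ : ℝ => (H (2 * s) + δ) * (H t + δ) ^ k).tendsto 0).mono_left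
      nhdsWithin_le_nhds
  have hr : Filter.Tendsto (fun δ : ℝ => Real.exp B * (H s + δ) * (H (2 * t) + δ) ^ k)
      (nhdsWithin 0 (Set.Ioi 0)) (nhds (Real.exp B * (H s + 0) * (H (2 * t) + 0) ^ k)) :=
    ((by fun_prop : Continuous fun δ : ℝ => Real.exp B * (H s + δ) * (H (2 * t) + δ) ^ k).tendsto 0).mono_left
      nhdsWithin_le_nhds
  have := le_of_tendsto_of_tendsto hl hr (by
    filter_upwards [self_mem_nhdsWithin] with δ hδ using key δ hδ)
  simpa using this

section Radial
variable {n : ℕ}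

/-- The linear field `x ↦ B x`. -/
def yF (B : Fin n → Fin n → ℝ) (k : Fin n) (x : EuclideanSpace ℝ (Fin n)) : ℝ := ∑ j, B k j * x j

/-- The quadratic form `⟨B x, x⟩`. -/
def qF (B : Fin n → Fin n → ℝ) (x : EuclideanSpace ℝ (Fin n)) : ℝ := ∑ k, yF B k x * x k

/-- The field `a(x) B x`. -/
def XF (a : Fin n → Fin n → EuclideanSpace ℝ (Fin n) → ℝ) (B : Fin n → Fin n → ℝ) (i : Fin n)
    (x : EuclideanSpace ℝ (Fin n)) : ℝ := ∑ j, a i j x * yF B j x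

/-- The function `⟨a(x) B x, B x⟩`. -/
def nuF (a : Fin n → Fin n → EuclideanSpace ℝ (Fin n) → ℝ) (B : Fin n → Fin n → ℝ)
    (x : EuclideanSpace ℝ (Fin n)) : ℝ := ∑ i, XF a B i x * yF B i x

/-- The field `a(x) B x` rescaled so that its product with `B x` is `⟨B x, x⟩`. -/
def betaF (a : Fin n → Fin n → EuclideanSpace ℝ (Fin n) → ℝ) (B : Fin n → Fin n → ℝ) (i : Fin n)
    (x : EuclideanSpace ℝ (Fin n)) : ℝ := XF a B i x * (qF B x / nuF a B x)

/-- `B` is the (bounded, symmetric) inverse of `a(0)`. -/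
structure IsInvAt (L : ℝ) (a : Fin n → Fin n → EuclideanSpace ℝ (Fin n) → ℝ)
    (B : Fin n → Fin n → ℝ) : Prop where
  symm : ∀ i j, B i j = B j i
  bd : ∀ i j, |B i j| ≤ L
  mul : ∀ i k, ∑ j, a i j 0 * B j k = if i = k then 1 else 0

/-- Quantitative bounds for the radial quantities attached to `a` near the origin. -/
structure RadBd (C ρ₀ : ℝ) (a : Fin n → Fin n → EuclideanSpace ℝ (Fin n) → ℝ)
    (B : Fin n → Fin n → ℝ) : Prop where
  q_low : ∀ x, ‖x‖ ^ 2 ≤ C * qF B x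
  q_up : ∀ x, qF B x ≤ C * ‖x‖ ^ 2
  pd_q : ∀ i x, pd i (qF B) x = 2 * yF B i x
  y_bd : ∀ i x, |yF B i x| ≤ C * ‖x‖
  X_bd : ∀ i x, |XF a B i x| ≤ C * ‖x‖
  nu_bd : ∀ x, ‖x‖ ≤ ρ₀ → |nuF a B x - qF B x| ≤ C * ‖x‖ * nuF a B x
  nu_low : ∀ x, ‖x‖ ≤ ρ₀ → qF B x ≤ 2 * nuF a B x
  nu_up : ∀ x, ‖x‖ ≤ ρ₀ → nuF a B x ≤ 2 * qF B x
  div_X : ∀ x, ‖x‖ ≤ ρ₀ → |∑ i, pd i (XF a B i) x - n| ≤ C * ‖x‖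
  beta_bd : ∀ i x, ‖x‖ ≤ ρ₀ → |betaF a B i x| ≤ C * ‖x‖
  beta_diff : ∀ i x, ‖x‖ ≤ ρ₀ → DifferentiableAt ℝ (betaF a B i) x
  beta_pd : ∀ k i x, ‖x‖ ≤ ρ₀ → |pd k (betaF a B i) x - if i = k then 1 else 0| ≤ C * ‖x‖

variable {B : Fin n → Fin n → ℝ} {a : Fin n → Fin n → EuclideanSpace ℝ (Fin n) → ℝ}
  {b : Fin n → EuclideanSpace ℝ (Fin n) → ℝ} {L : ℝ}

theorem sm_yF (B : Fin n → Fin n → ℝ) (k : Fin n) : Sm (yF B k) :=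
  ContDiff.sum fun j _ => contDiff_const.mul (sm_coord j)

theorem sm_qF (B : Fin n → Fin n → ℝ) : Sm (qF B) :=
  ContDiff.sum fun k _ => (sm_yF B k).mul (sm_coord k)

theorem IsOp.sm_XF (h : IsOp L a b) (B : Fin n → Fin n → ℝ) (i : Fin n) : Sm (XF a B i) :=
  ContDiff.sum fun j _ => (h.sm_a i j).mul (sm_yF B j)

theorem IsOp.sm_nuF (h : IsOp L a b) (B : Fin n → Fin n → ℝ) : Sm (nuF a B) :=
  ContDiff.sum fun i _ => (h.sm_XF B i).mul (sm_yF B i)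

theorem pd_yF (k i : Fin n) (x : EuclideanSpace ℝ (Fin n)) : pd i (yF B k) x = B k i := by
  have : yF B k = fun x => ∑ j, (fun j (y : EuclideanSpace ℝ (Fin n)) => B k j * y j) j x := rfl
  rw [this, pd_sum_at]
  · have : ∀ j, pd i (fun y : EuclideanSpace ℝ (Fin n) => B k j * y j) x = if j = i then B k j else 0 := by
      intro j
      rw [pd_const_mul_at ((sm_coord j).differentiable x), pd_coord]
      simp
    simp [this]
  · exact fun j _ => Sm.differentiable (contDiff_const.mul (sm_coord j)) x

theorem abs_coord_le (x : EuclideanSpace ℝ (Fin n)) (j : Fin n) : |x j| ≤ ‖x‖ :=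
  PiLp.norm_apply_le x j

theorem norm_sq_eq_sum (x : EuclideanSpace ℝ (Fin n)) : ‖x‖ ^ 2 = ∑ i, x i ^ 2 :=
  EuclideanSpace.real_norm_sq_eq x

theorem IsInvAt.coord_eq (hB : IsInvAt L a B) (x : EuclideanSpace ℝ (Fin n)) (i : Fin n) :
    x i = ∑ j, a i j 0 * yF B j x := by
  have : ∑ j, a i j 0 * yF B j x = ∑ k, (∑ j, a i j 0 * B j k) * x k := by
    simp only [yF, Finset.mul_sum, Finset.sum_mul]
    rw [Finset.sum_comm]
    exact Finset.sum_congr rfl fun k _ => Finset.sum_congr rfl fun j _ => by ring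
  rw [this]
  simp [hB.mul]

theorem IsOp.abs_sub_le (h : IsOp L a b) (i j : Fin n) (x y : EuclideanSpace ℝ (Fin n)) :
    |a i j x - a i j y| ≤ n * L * ‖x - y‖ := by
  have hL : 0 ≤ L := zero_le_one.trans h.one_le
  refine Convex.norm_image_sub_le_of_norm_fderiv_le (𝕜 := ℝ) (s := Set.univ)
    (fun z _ => (h.sm_a i j).differentiable z) ?_ convex_univ (Set.mem_univ _) (Set.mem_univ _)
  intro z _
  refine norm_fderiv_le.trans ?_
  rw [Real.sqrt_le_left (by positivity)]
  calc ∑ k, pd k (a i j) z ^ 2 ≤ ∑ _k : Fin n, L ^ 2 :=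
        Finset.sum_le_sum fun k _ => sq_le_sq' (abs_le.1 (h.bd_da k i j z)).1 (abs_le.1 (h.bd_da k i j z)).2
    _ = n * L ^ 2 := by simp
    _ ≤ (n * L) ^ 2 := by
      rcases Nat.eq_zero_or_pos n with hn | hn
      · subst hn; simp
      have : (1 : ℝ) ≤ n := by exact_mod_cast hn
      rw [mul_pow]
      exact mul_le_mul_of_nonneg_right (by nlinarith) (sq_nonneg L)

theorem pd_qF (hB : ∀ i j, B i j = B j i) (i : Fin n) (x : EuclideanSpace ℝ (Fin n)) :
    pd i (qF B) x = 2 * yF B i x := by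
  have : qF B = fun x => ∑ k, (fun k (y : EuclideanSpace ℝ (Fin n)) => yF B k y * y k) k x := rfl
  rw [this, pd_sum_at]
  · have : ∀ k, pd i (fun y : EuclideanSpace ℝ (Fin n) => yF B k y * y k) x
        = B k i * x k + (if k = i then yF B k x else 0) := by
      intro k
      rw [pd_mul_at ((sm_yF B k).differentiable x) ((sm_coord k).differentiable x), pd_coord, pd_yF]
      split_ifs <;> ring
    simp only [this, Finset.sum_add_distrib]
    rw [two_mul]
    congr 1
    · simp only [yF]; exact Finset.sum_congr rfl fun k _ => by rw [hB]
    · simp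
  · exact fun k _ => Sm.differentiable ((sm_yF B k).mul (sm_coord k)) x

theorem XF_sub_coord (hB : IsInvAt L a B) (i : Fin n) (x : EuclideanSpace ℝ (Fin n)) :
    XF a B i x = x i + ∑ j, (a i j x - a i j 0) * yF B j x := by
  conv_rhs => rw [hB.coord_eq x i]
  simp only [XF, sub_mul, Finset.sum_sub_distrib]
  ring

theorem nuF_eq (hB : IsInvAt L a B) (x : EuclideanSpace ℝ (Fin n)) :
    nuF a B x = qF B x + ∑ i, ∑ j, (a i j x - a i j 0) * yF B j x * yF B i x := by
  simp only [nuF, qF, ← Finset.sum_add_distrib]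
  refine Finset.sum_congr rfl fun i _ => ?_
  rw [XF_sub_coord hB, add_mul, Finset.sum_mul]
  ring

theorem pd_XF (h : IsOp L a b) (hB : IsInvAt L a B) (k i : Fin n) (x : EuclideanSpace ℝ (Fin n)) :
    pd k (XF a B i) x = (if i = k then 1 else 0)
      + ∑ j, (pd k (a i j) x * yF B j x + (a i j x - a i j 0) * B j k) := by
  have h1 : XF a B i = fun x => ∑ j, (fun j (y : EuclideanSpace ℝ (Fin n)) => a i j y * yF B j y) j x := rfl
  rw [h1, pd_sum_at]
  · rw [← hB.mul i k, ← Finset.sum_add_distrib]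
    refine Finset.sum_congr rfl fun j _ => ?_
    rw [pd_mul_at ((h.sm_a i j).differentiable x) ((sm_yF B j).differentiable x), pd_yF]
    ring
  · exact fun j _ => Sm.differentiable ((h.sm_a i j).mul (sm_yF B j)) x

theorem pd_nuF (h : IsOp L a b) (hB : IsInvAt L a B) (k : Fin n) (x : EuclideanSpace ℝ (Fin n)) :
    pd k (nuF a B) x = 2 * yF B k x + ∑ i, ∑ j, (pd k (a i j) x * yF B j x * yF B i x
      + (a i j x - a i j 0) * (B j k * yF B i x + yF B j x * B i k)) := by
  have h1 : nuF a B = fun x => ∑ i, (fun i (y : EuclideanSpace ℝ (Fin n)) => XF a B i y * yF B i y) i x := rfl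
  rw [h1, pd_sum_at]
  · have h2 : ∀ i, pd k (fun y => XF a B i y * yF B i y) x
        = ((if i = k then yF B i x else 0) + x i * B i k) + ∑ j, (pd k (a i j) x * yF B j x * yF B i x
          + (a i j x - a i j 0) * (B j k * yF B i x + yF B j x * B i k)) := by
      intro i
      rw [pd_mul_at ((h.sm_XF B i).differentiable x) ((sm_yF B i).differentiable x), pd_yF, pd_XF h hB,
        XF_sub_coord hB]
      rw [add_mul, add_mul, Finset.sum_mul, Finset.sum_mul]
      have : ∑ j, (pd k (a i j) x * yF B j x * yF B i x
          + (a i j x - a i j 0) * (B j k * yF B i x + yF B j x * B i k))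
          = ∑ j, (pd k (a i j) x * yF B j x + (a i j x - a i j 0) * B j k) * yF B i x
            + ∑ j, (a i j x - a i j 0) * yF B j x * B i k := by
        rw [← Finset.sum_add_distrib]
        exact Finset.sum_congr rfl fun j _ => by ring
      rw [this]
      split_ifs <;> ring
    simp only [h2, Finset.sum_add_distrib]
    rw [two_mul]
    congr 2
    · simp
    · simp only [yF]; exact Finset.sum_congr rfl fun j _ => by rw [hB.symm, mul_comm]
  · exact fun i _ => Sm.differentiable ((h.sm_XF B i).mul (sm_yF B i)) x

end Radial

section RadialBounds
variable {n : ℕ} {B : Fin n → Fin n → ℝ} {a : Fin n → Fin n → EuclideanSpace ℝ (Fin n) → ℝ}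
  {b : Fin n → EuclideanSpace ℝ (Fin n) → ℝ} {L : ℝ}

theorem radial_bounds (n : ℕ) (L : ℝ) (hL : 1 ≤ L) : ∃ C ρ₀ : ℝ, 1 ≤ C ∧ 0 < ρ₀ ∧ ρ₀ ≤ 1 ∧
    ∀ (a : Fin n → Fin n → EuclideanSpace ℝ (Fin n) → ℝ) (b : Fin n → EuclideanSpace ℝ (Fin n) → ℝ)
      (B : Fin n → Fin n → ℝ), IsOp L a b → IsInvAt L a B → RadBd C ρ₀ a B := by
  obtain ⟨K, hKdef⟩ : ∃ K : ℝ, K = (n + 1) * L := ⟨_, rfl⟩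
  have hn0 : (0 : ℝ) ≤ n := Nat.cast_nonneg n
  have hnK : (n : ℝ) ≤ K := by nlinarith
  have hLK : L ≤ K := by nlinarith
  have hnL : (n : ℝ) * L ≤ K := by nlinarith
  have hK : 1 ≤ K := by linarith
  have hK0 : 0 ≤ K := by linarith
  have hp : ∀ m, m ≤ 18 → K ^ m ≤ K ^ 18 := fun m hm => pow_le_pow_right₀ hK hm
  have hp1 : 1 ≤ K ^ 18 := one_le_pow₀ hK
  have hρ0 : 0 < 1 / (2 * K ^ 10) := by positivity
  refine ⟨26 * K ^ 18, 1 / (2 * K ^ 10), by linarith, hρ0, ?_, ?_⟩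
  · rw [div_le_one (by positivity)]
    linarith [one_le_pow₀ hK (n := 10)]
  intro a b B h hB
  have hy : ∀ k x, |yF B k x| ≤ K * ‖x‖ := by
    intro k x
    have := abs_sum_le_card (f := fun j => B k j * x j) (C := L * ‖x‖)
      fun j => abs_mul_le (hB.bd k j) (abs_coord_le x j)
    refine this.trans ?_
    rw [← mul_assoc]; gcongr
  have hα : ∀ i j x, |a i j x - a i j 0| ≤ K * ‖x‖ := by
    intro i j x
    refine (h.abs_sub_le i j x 0).trans ?_
    rw [sub_zero]; gcongr
  have hqell : ∀ x, ∑ k, yF B k x ^ 2 ≤ L * qF B x := by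
    intro x
    have h1 := h.ell 0 (fun k => yF B k x)
    have h2 : ∑ i, ∑ j, a i j 0 * yF B i x * yF B j x = qF B x := by
      simp only [qF]
      refine Finset.sum_congr rfl fun i _ => ?_
      rw [hB.coord_eq x i, Finset.mul_sum]
      exact Finset.sum_congr rfl fun j _ => by ring
    rw [h2] at h1
    rwa [inv_mul_le_iff₀ (by linarith)] at h1
  have hq0 : ∀ x, 0 ≤ qF B x := fun x => by
    have : 0 ≤ ∑ k, yF B k x ^ 2 := Finset.sum_nonneg fun k _ => sq_nonneg _
    nlinarith [hqell x]
  have hqlow : ∀ x, ‖x‖ ^ 2 ≤ K ^ 5 * qF B x := by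
    intro x
    have h1 : ∀ i, x i ^ 2 ≤ n * L ^ 2 * (L * qF B x) := by
      intro i
      rw [hB.coord_eq x i]
      refine (Finset.sum_mul_sq_le_sq_mul_sq _ _ _).trans ?_
      refine mul_le_mul ?_ (hqell x) (Finset.sum_nonneg fun k _ => sq_nonneg _) (by positivity)
      calc ∑ j, a i j 0 ^ 2 ≤ ∑ _j : Fin n, L ^ 2 := Finset.sum_le_sum fun j _ =>
            sq_le_sq' (abs_le.1 (h.bd_a i j 0)).1 (abs_le.1 (h.bd_a i j 0)).2
        _ = n * L ^ 2 := by simp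
    rw [norm_sq_eq_sum]
    calc ∑ i, x i ^ 2 ≤ ∑ _i : Fin n, n * L ^ 2 * (L * qF B x) := Finset.sum_le_sum fun i _ => h1 i
      _ = (n : ℝ) * (n * L ^ 2 * (L * qF B x)) := by simp
      _ = (n : ℝ) ^ 2 * L ^ 3 * qF B x := by ring
      _ ≤ K ^ 2 * K ^ 3 * qF B x := by
        have := hq0 x; gcongr
      _ = _ := by ring
  have hqup : ∀ x, qF B x ≤ K ^ 2 * ‖x‖ ^ 2 := by
    intro x
    have := abs_sum_le_card (f := fun k => yF B k x * x k) (C := K * ‖x‖ * ‖x‖)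
      fun k => abs_mul_le (hy k x) (abs_coord_le x k)
    refine (le_abs_self _).trans (this.trans ?_)
    calc (n : ℝ) * (K * ‖x‖ * ‖x‖) ≤ K * (K * ‖x‖ * ‖x‖) := by gcongr
      _ = _ := by ring
  have hX : ∀ i x, |XF a B i x| ≤ K ^ 2 * ‖x‖ := by
    intro i x
    have := abs_sum_le_card (f := fun j => a i j x * yF B j x) (C := L * (K * ‖x‖))
      fun j => abs_mul_le (h.bd_a i j x) (hy j x)
    refine this.trans ?_
    calc (n : ℝ) * (L * (K * ‖x‖)) = (n * L) * (K * ‖x‖) := by ring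
      _ ≤ K * (K * ‖x‖) := by gcongr
      _ = _ := by ring
  have hXx : ∀ i x, |XF a B i x - x i| ≤ K ^ 3 * ‖x‖ ^ 2 := by
    intro i x
    rw [XF_sub_coord hB, add_sub_cancel_left]
    refine (abs_sum_le_card fun j => abs_mul_le (hα i j x) (hy j x)).trans ?_
    calc (n : ℝ) * (K * ‖x‖ * (K * ‖x‖)) ≤ K * (K * ‖x‖ * (K * ‖x‖)) := by gcongr
      _ = _ := by ring
  have hs : ∀ x, |nuF a B x - qF B x| ≤ K ^ 10 * ‖x‖ * qF B x := by
    intro x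
    rw [nuF_eq hB, add_sub_cancel_left]
    refine (abs_sum2_le_card fun i j => abs_mul_le (abs_mul_le (hα i j x) (hy j x)) (hy i x)).trans ?_
    calc (n : ℝ) ^ 2 * (K * ‖x‖ * (K * ‖x‖) * (K * ‖x‖))
        ≤ K ^ 2 * (K * ‖x‖ * (K * ‖x‖) * (K * ‖x‖)) := by gcongr
      _ = K ^ 5 * ‖x‖ * ‖x‖ ^ 2 := by ring
      _ ≤ K ^ 5 * ‖x‖ * (K ^ 5 * qF B x) := by gcongr; exact hqlow x
      _ = _ := by ring
  have hsmall : ∀ x : EuclideanSpace ℝ (Fin n), ‖x‖ ≤ 1 / (2 * K ^ 10) → K ^ 10 * ‖x‖ ≤ 1 / 2 := by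
    intro x hx
    calc K ^ 10 * ‖x‖ ≤ K ^ 10 * (1 / (2 * K ^ 10)) := by gcongr
      _ = 1 / 2 := by field_simp
  have hν : ∀ x, ‖x‖ ≤ 1 / (2 * K ^ 10) → qF B x ≤ 2 * nuF a B x ∧ nuF a B x ≤ 2 * qF B x := by
    intro x hx
    have h1 := abs_le.1 (hs x)
    have h2 : K ^ 10 * ‖x‖ * qF B x ≤ 1 / 2 * qF B x :=
      mul_le_mul_of_nonneg_right (hsmall x hx) (hq0 x)
    have := hq0 x
    constructor <;> linarith
  have hs2 : ∀ x, ‖x‖ ≤ 1 / (2 * K ^ 10) → |nuF a B x - qF B x| ≤ 2 * K ^ 10 * ‖x‖ * nuF a B x := by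
    intro x hx
    refine (hs x).trans ?_
    calc K ^ 10 * ‖x‖ * qF B x ≤ K ^ 10 * ‖x‖ * (2 * nuF a B x) := by gcongr; exact (hν x hx).1
      _ = _ := by ring
  have hpX : ∀ k i x, |pd k (XF a B i) x - if i = k then 1 else 0| ≤ 2 * K ^ 2 * ‖x‖ := by
    intro k i x
    rw [pd_XF h hB, add_sub_cancel_left]
    have : ∀ j, |pd k (a i j) x * yF B j x + (a i j x - a i j 0) * B j k| ≤ 2 * L * K * ‖x‖ := by
      intro j
      refine (abs_add_le _ _).trans ?_
      have h1 := abs_mul_le (h.bd_da k i j x) (hy j x)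
      have h2 := abs_mul_le (hα i j x) (hB.bd j k)
      linarith
    refine (abs_sum_le_card this).trans ?_
    calc (n : ℝ) * (2 * L * K * ‖x‖) = 2 * (n * L) * K * ‖x‖ := by ring
      _ ≤ 2 * K * K * ‖x‖ := by gcongr
      _ = _ := by ring
  have hpν : ∀ k x, |pd k (nuF a B) x - 2 * yF B k x| ≤ 3 * K ^ 5 * ‖x‖ ^ 2 := by
    intro k x
    rw [pd_nuF h hB, add_sub_cancel_left]
    have : ∀ i j, |pd k (a i j) x * yF B j x * yF B i x
      + (a i j x - a i j 0) * (B j k * yF B i x + yF B j x * B i k)| ≤ 3 * L * K ^ 2 * ‖x‖ ^ 2 := by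
      intro i j
      refine (abs_add_le _ _).trans ?_
      have h1 := abs_mul_le (abs_mul_le (h.bd_da k i j x) (hy j x)) (hy i x)
      have h3 : |B j k * yF B i x + yF B j x * B i k| ≤ 2 * L * K * ‖x‖ := by
        refine (abs_add_le _ _).trans ?_
        have h1 := abs_mul_le (hB.bd j k) (hy i x)
        have h2 := abs_mul_le (hy j x) (hB.bd i k)
        linarith
      have h2 := abs_mul_le (hα i j x) h3
      nlinarith
    refine (abs_sum2_le_card this).trans ?_
    calc (n : ℝ) ^ 2 * (3 * L * K ^ 2 * ‖x‖ ^ 2) ≤ K ^ 2 * (3 * K * K ^ 2 * ‖x‖ ^ 2) := by gcongr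
      _ = _ := by ring
  have hνpos : ∀ x, ‖x‖ ≤ 1 / (2 * K ^ 10) → x ≠ 0 → 0 < nuF a B x := by
    intro x hx hx0
    have h1 : 0 < ‖x‖ ^ 2 := by positivity
    have h2 := hqlow x
    have h3 : 0 < qF B x := by
      by_contra hcon
      have : qF B x = 0 := le_antisymm (not_lt.1 hcon) (hq0 x)
      rw [this] at h2; linarith
    linarith [(hν x hx).1]
  have hquot : ∀ x, ‖x‖ ≤ 1 / (2 * K ^ 10) → x ≠ 0 → |qF B x / nuF a B x - 1| ≤ 2 * K ^ 10 * ‖x‖ ∧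
      |qF B x / nuF a B x| ≤ 2 := by
    intro x hx hx0
    have h1 := hνpos x hx hx0
    constructor
    · rw [div_sub_one h1.ne', abs_div, abs_of_pos h1, div_le_iff₀ h1, abs_sub_comm]
      exact hs2 x hx
    · rw [abs_div, abs_of_pos h1, abs_of_nonneg (hq0 x), div_le_iff₀ h1]
      exact (hν x hx).1
  have hX0 : ∀ i, XF a B i 0 = 0 := fun i => by
    have := hX i 0
    simpa using this
  have hβ0 : ∀ i, betaF a B i 0 = 0 := fun i => by simp [betaF, hX0]
  have hβx : ∀ i x, ‖x‖ ≤ 1 / (2 * K ^ 10) → |betaF a B i x - x i| ≤ 4 * K ^ 10 * ‖x‖ ^ 2 := by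
    intro i x hx
    by_cases hx0 : x = 0
    · subst hx0; simp [hβ0]
    obtain ⟨h1, h2⟩ := hquot x hx hx0
    have e : betaF a B i x - x i = (XF a B i x - x i) * (qF B x / nuF a B x)
        + x i * (qF B x / nuF a B x - 1) := by simp only [betaF]; ring
    rw [e]
    refine (abs_add_le _ _).trans ?_
    have h3 := abs_mul_le (hXx i x) h2
    have h4 := abs_mul_le (abs_coord_le x i) h1
    have h5 : K ^ 3 * ‖x‖ ^ 2 ≤ K ^ 10 * ‖x‖ ^ 2 := by
      have := pow_le_pow_right₀ hK (by norm_num : 3 ≤ 10)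
      gcongr
    linarith
  have hβder0 : ∀ i, HasFDerivAt (betaF a B i) (EuclideanSpace.proj i : EuclideanSpace ℝ (Fin n) →L[ℝ] ℝ) 0 := by
    intro i
    have h1 : HasFDerivAt (fun x => betaF a B i x - x i) (0 : EuclideanSpace ℝ (Fin n) →L[ℝ] ℝ) 0 := by
      refine Asymptotics.IsBigO.hasFDerivAt (n := 2) ?_ one_lt_two
      refine Asymptotics.IsBigO.of_bound (4 * K ^ 10) ?_
      filter_upwards [closedBall_mem_nhds (0 : EuclideanSpace ℝ (Fin n)) hρ0] with x hx
      have := hβx i x (by simpa using hx)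
      simpa using this
    have h2 := h1.add ((EuclideanSpace.proj i : EuclideanSpace ℝ (Fin n) →L[ℝ] ℝ).hasFDerivAt (x := 0))
    rw [zero_add] at h2
    refine h2.congr_of_eventuallyEq (Filter.Eventually.of_forall fun x => ?_)
    simp
  have hqd : ∀ x, ‖x‖ ≤ 1 / (2 * K ^ 10) → x ≠ 0 →
      DifferentiableAt ℝ (fun y => (nuF a B y)⁻¹) x := fun x hx hx0 =>
    ((h.sm_nuF B).differentiable x).fun_inv (hνpos x hx hx0).ne'
  have hdiff : ∀ i x, ‖x‖ ≤ 1 / (2 * K ^ 10) → DifferentiableAt ℝ (betaF a B i) x := by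
    intro i x hx
    by_cases hx0 : x = 0
    · subst hx0; exact (hβder0 i).differentiableAt
    · exact ((h.sm_XF B i).differentiable x).mul (((sm_qF B).differentiable x).mul (hqd x hx hx0))
  have hβpd : ∀ k i x, ‖x‖ ≤ 1 / (2 * K ^ 10) →
      |pd k (betaF a B i) x - if i = k then 1 else 0| ≤ 26 * K ^ 18 * ‖x‖ := by
    intro k i x hx
    by_cases hx0 : x = 0
    · subst hx0
      have : pd k (betaF a B i) 0 = if i = k then 1 else 0 := by
        simp only [pd, (hβder0 i).fderiv]
        simp
      rw [this]; simp
    have hνp := hνpos x hx hx0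
    obtain ⟨h1, h2⟩ := hquot x hx hx0
    have e1 : pd k (betaF a B i) x = pd k (XF a B i) x * (qF B x / nuF a B x)
        + XF a B i x * pd k (fun y => qF B y / nuF a B y) x := by
      have := pd_mul_at ((h.sm_XF B i).differentiable x) (((sm_qF B).differentiable x).fun_mul
        (hqd x hx hx0)) k
      exact this
    have e2 : pd k (fun y => qF B y / nuF a B y) x
        = (2 * yF B k x * (nuF a B x - qF B x) - qF B x * (pd k (nuF a B) x - 2 * yF B k x)) / nuF a B x ^ 2 := by
      have h3 := pd_mul_at ((sm_qF B).differentiable x) (hqd x hx hx0) k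
      rw [pd_comp_at (hasDerivAt_inv hνp.ne') ((h.sm_nuF B).differentiable x), pd_qF hB.symm] at h3
      refine h3.trans ?_
      field_simp
      ring
    have hR : |pd k (fun y => qF B y / nuF a B y) x| ≤ 20 * K ^ 16 := by
      rw [e2, abs_div, abs_of_pos (by positivity : 0 < nuF a B x ^ 2), div_le_iff₀ (by positivity)]
      have hq := hq0 x
      have t1 : |2 * yF B k x * (nuF a B x - qF B x)| ≤ 2 * K * ‖x‖ * (K ^ 10 * ‖x‖ * qF B x) := by
        refine abs_mul_le ?_ (hs x)
        rw [abs_mul, abs_two]; nlinarith [hy k x]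
      have t2 : |qF B x * (pd k (nuF a B) x - 2 * yF B k x)| ≤ qF B x * (3 * K ^ 5 * ‖x‖ ^ 2) :=
        abs_mul_le (abs_of_nonneg hq).le (hpν k x)
      have t3 : K ^ 5 ≤ K ^ 11 := pow_le_pow_right₀ hK (by norm_num)
      have t4 : qF B x * (3 * K ^ 5 * ‖x‖ ^ 2) ≤ qF B x * (3 * K ^ 11 * ‖x‖ ^ 2) := by gcongr
      have t5 : ‖x‖ ^ 2 ≤ K ^ 5 * (2 * nuF a B x) := (hqlow x).trans (by
        have := (hν x hx).1; gcongr)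
      calc _ ≤ _ := abs_sub _ _
        _ ≤ 5 * K ^ 11 * ‖x‖ ^ 2 * qF B x := by linarith
        _ ≤ 5 * K ^ 11 * (K ^ 5 * (2 * nuF a B x)) * (2 * nuF a B x) := by
          have := (hν x hx).1
          gcongr
        _ = _ := by ring
    have e3 : pd k (betaF a B i) x - (if i = k then 1 else 0)
        = (pd k (XF a B i) x - if i = k then 1 else 0) * (qF B x / nuF a B x)
          + (if i = k then 1 else 0) * (qF B x / nuF a B x - 1)
          + XF a B i x * pd k (fun y => qF B y / nuF a B y) x := by rw [e1]; ring
    have hδ : |(if i = k then (1:ℝ) else 0)| ≤ 1 := by split_ifs <;> simp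
    rw [e3]
    refine (abs_add_le _ _).trans ?_
    have u1 := abs_mul_le (hpX k i x) h2
    have u2 := abs_mul_le hδ h1
    have u3 := abs_mul_le (hX i x) hR
    have u4 := abs_add_le ((pd k (XF a B i) x - if i = k then 1 else 0) * (qF B x / nuF a B x))
      ((if i = k then 1 else 0) * (qF B x / nuF a B x - 1))
    have v1 := mul_le_mul_of_nonneg_right (hp 2 (by norm_num)) (norm_nonneg x)
    have v2 := mul_le_mul_of_nonneg_right (hp 10 (by norm_num)) (norm_nonneg x)
    have v3 : K ^ 2 * ‖x‖ * (20 * K ^ 16) = 20 * K ^ 18 * ‖x‖ := by ring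
    linarith
  refine ⟨?_, ?_, pd_qF hB.symm, ?_, ?_, ?_, fun x hx => (hν x hx).1, fun x hx => (hν x hx).2,
    ?_, ?_, hdiff, hβpd⟩
  · intro x
    refine (hqlow x).trans (mul_le_mul_of_nonneg_right ?_ (hq0 x))
    linarith [hp 5 (by norm_num)]
  · intro x
    refine (hqup x).trans (mul_le_mul_of_nonneg_right ?_ (sq_nonneg _))
    linarith [hp 2 (by norm_num)]
  · intro k x
    refine (hy k x).trans (mul_le_mul_of_nonneg_right ?_ (norm_nonneg _))
    have := hp 1 (by norm_num)
    rw [pow_one] at this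
    linarith
  · intro k x
    refine (hX k x).trans (mul_le_mul_of_nonneg_right ?_ (norm_nonneg _))
    linarith [hp 2 (by norm_num)]
  · intro x hx
    refine (hs2 x hx).trans ?_
    have h0 : 0 ≤ nuF a B x := by linarith [(hν x hx).1, hq0 x]
    have : 2 * K ^ 10 ≤ 26 * K ^ 18 := by linarith [hp 10 (by norm_num)]
    gcongr
  · intro x hx
    have e : ∑ i, pd i (XF a B i) x - n = ∑ i, (pd i (XF a B i) x - if i = i then 1 else 0) := by
      simp
    rw [e]
    refine (abs_sum_le_card fun i => hpX i i x).trans ?_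
    calc (n : ℝ) * (2 * K ^ 2 * ‖x‖) ≤ K * (2 * K ^ 2 * ‖x‖) := by gcongr
      _ = 2 * K ^ 3 * ‖x‖ := by ring
      _ ≤ 26 * K ^ 18 * ‖x‖ := by
        have : 2 * K ^ 3 ≤ 26 * K ^ 18 := by linarith [hp 3 (by norm_num)]
        gcongr
  · intro i x hx
    by_cases hx0 : x = 0
    · subst hx0; simp [hβ0]
    simp only [betaF]
    refine (abs_mul_le (hX i x) (hquot x hx hx0).2).trans ?_
    have : 2 * K ^ 2 ≤ 26 * K ^ 18 := by linarith [hp 2 (by norm_num)]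
    calc K ^ 2 * ‖x‖ * 2 = 2 * K ^ 2 * ‖x‖ := by ring
      _ ≤ _ := by gcongr
end RadialBounds

theorem IsOp.exists_isInvAt {n : ℕ} {a : Fin n → Fin n → EuclideanSpace ℝ (Fin n) → ℝ}
    {b : Fin n → EuclideanSpace ℝ (Fin n) → ℝ} {L : ℝ} (h : IsOp L a b) :
    ∃ B : Fin n → Fin n → ℝ, IsInvAt L a B := by
  have hL : 0 < L := by linarith [h.one_le]
  set M : Matrix (Fin n) (Fin n) ℝ := Matrix.of fun i j => a i j 0 with hM
  have hquad : ∀ ξ : Fin n → ℝ, ∑ i, ξ i ^ 2 ≤ L * ∑ i, ξ i * (M.mulVec ξ) i := by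
    intro ξ
    have h1 := h.ell 0 ξ
    have h2 : ∑ i, ∑ j, a i j 0 * ξ i * ξ j = ∑ i, ξ i * (M.mulVec ξ) i := by
      simp only [Matrix.mulVec, dotProduct, hM, Matrix.of_apply, Finset.mul_sum]
      exact Finset.sum_congr rfl fun i _ => Finset.sum_congr rfl fun j _ => by ring
    rw [h2, inv_mul_le_iff₀ hL] at h1
    exact h1
  have hdet : IsUnit M.det := by
    rw [isUnit_iff_ne_zero]
    intro h0
    obtain ⟨ξ, hξ, hξ0⟩ := Matrix.exists_mulVec_eq_zero_iff.2 h0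
    have h1 := hquad ξ
    rw [hξ0] at h1
    simp only [Pi.zero_apply, mul_zero, Finset.sum_const_zero] at h1
    have h2 : ∑ i, ξ i ^ 2 = 0 := le_antisymm h1 (Finset.sum_nonneg fun i _ => sq_nonneg _)
    rw [Finset.sum_eq_zero_iff_of_nonneg fun i _ => sq_nonneg _] at h2
    exact hξ (funext fun i => by simpa using h2 i (Finset.mem_univ i))
  have hMs : M.transpose = M := by
    ext i j; simp [hM, h.symm j i]
  have hBs : (M⁻¹).transpose = M⁻¹ := by rw [Matrix.transpose_nonsing_inv, hMs]
  have hmul : M * M⁻¹ = 1 := Matrix.mul_nonsing_inv _ hdet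
  refine ⟨fun i j => M⁻¹ i j, fun i j => ?_, fun i k => ?_, fun i k => ?_⟩
  · conv_lhs => rw [← hBs]
    rfl
  · have h1 := hquad fun i => M⁻¹ i k
    have h2 : ∀ i, (M.mulVec fun i => M⁻¹ i k) i = if i = k then 1 else 0 := by
      intro i
      have := congrFun (congrFun hmul i) k
      rw [Matrix.mul_apply, Matrix.one_apply] at this
      simpa [Matrix.mulVec, dotProduct] using this
    simp only [h2, mul_ite, mul_one, mul_zero, Finset.sum_ite_eq', Finset.mem_univ, if_true] at h1
    have h3 : M⁻¹ k k ^ 2 ≤ L * M⁻¹ k k :=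
      (Finset.single_le_sum (f := fun i => M⁻¹ i k ^ 2) (fun i _ => sq_nonneg _) (Finset.mem_univ k)).trans h1
    have h4 : M⁻¹ k k ≤ L := by
      by_contra hc
      nlinarith [not_le.1 hc]
    have h5 : M⁻¹ i k ^ 2 ≤ L * M⁻¹ k k :=
      (Finset.single_le_sum (f := fun i => M⁻¹ i k ^ 2) (fun i _ => sq_nonneg _) (Finset.mem_univ i)).trans h1
    exact abs_le_of_sq_le_sq (by nlinarith) hL.le
  · have := congrFun (congrFun hmul i) k
    rw [Matrix.mul_apply, Matrix.one_apply] at this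
    exact this

section BoundedDerivative
variable {n : ℕ} {ρ : ℝ}

/-- Differentiability with bounded derivative on a closed ball about the origin. -/
def BD (ρ : ℝ) (f : EuclideanSpace ℝ (Fin n) → ℝ) : Prop :=
  (∀ x, ‖x‖ ≤ ρ → DifferentiableAt ℝ f x) ∧
    ∃ M : ℝ, 0 ≤ M ∧ ∀ x, ‖x‖ ≤ ρ → |f x| ≤ M ∧ ∀ i, |pd i f x| ≤ M

variable {f g : EuclideanSpace ℝ (Fin n) → ℝ}

theorem Sm.bdd (hf : Sm f) (ρ : ℝ) : ∃ M : ℝ, 0 ≤ M ∧ ∀ x, ‖x‖ ≤ ρ → |f x| ≤ M := by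
  obtain ⟨C, hC⟩ := (isCompact_closedBall (0 : EuclideanSpace ℝ (Fin n)) ρ).exists_bound_of_continuousOn
    hf.continuous.continuousOn
  exact ⟨max C 0, le_max_right _ _, fun x hx => (hC x (by simpa using hx)).trans (le_max_left _ _)⟩

theorem Sm.bd (hf : Sm f) (ρ : ℝ) : BD ρ f := by
  refine ⟨fun x _ => hf.differentiable x, ?_⟩
  obtain ⟨M, hM0, hM⟩ := hf.bdd ρ
  choose N hN0 hN using fun i => (hf.pd i).bdd ρ
  have hs : 0 ≤ ∑ i, N i := Finset.sum_nonneg fun i _ => hN0 i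
  refine ⟨M + ∑ i, N i, by linarith, fun x hx => ⟨by linarith [hM x hx], fun i => ?_⟩⟩
  have := Finset.single_le_sum (fun i _ => hN0 i) (Finset.mem_univ i)
  linarith [hN i x hx]

theorem BD.mul (hf : BD ρ f) (hg : BD ρ g) : BD ρ fun x => f x * g x := by
  obtain ⟨df, M, hM0, hM⟩ := hf
  obtain ⟨dg, N, hN0, hN⟩ := hg
  refine ⟨fun x hx => (df x hx).fun_mul (dg x hx), 2 * (M * N), by positivity, fun x hx => ⟨?_, fun i => ?_⟩⟩
  · have := abs_mul_le (hM x hx).1 (hN x hx).1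
    have : 0 ≤ M * N := by positivity
    linarith
  · rw [pd_mul_at (df x hx) (dg x hx)]
    have h1 := abs_mul_le ((hM x hx).2 i) (hN x hx).1
    have h2 := abs_mul_le (hM x hx).1 ((hN x hx).2 i)
    linarith [abs_add_le (pd i f x * g x) (f x * pd i g x)]

theorem BD.sub (hf : BD ρ f) (hg : BD ρ g) : BD ρ fun x => f x - g x := by
  obtain ⟨df, M, hM0, hM⟩ := hf
  obtain ⟨dg, N, hN0, hN⟩ := hg
  refine ⟨fun x hx => (df x hx).fun_sub (dg x hx), M + N, by positivity, fun x hx => ⟨?_, fun i => ?_⟩⟩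
  · linarith [abs_sub (f x) (g x), (hM x hx).1, (hN x hx).1]
  · rw [pd_sub_at (df x hx) (dg x hx)]
    linarith [abs_sub (pd i f x) (pd i g x), (hM x hx).2 i, (hN x hx).2 i]

theorem BD.sum {F : Fin n → EuclideanSpace ℝ (Fin n) → ℝ} (hF : ∀ j, BD ρ (F j)) :
    BD ρ fun x => ∑ j, F j x := by
  choose d M hM0 hM using hF
  refine ⟨fun x hx => DifferentiableAt.fun_sum fun j _ => d j x hx, ∑ j, M j,
    Finset.sum_nonneg fun j _ => hM0 j, fun x hx => ⟨?_, fun i => ?_⟩⟩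
  · exact (Finset.abs_sum_le_sum_abs _ _).trans (Finset.sum_le_sum fun j _ => (hM j x hx).1)
  · rw [pd_sum_at fun j _ => d j x hx]
    exact (Finset.abs_sum_le_sum_abs _ _).trans (Finset.sum_le_sum fun j _ => (hM j x hx).2 i)

end BoundedDerivative

section Trunc
variable {n : ℕ}

/-- The truncation weight `(r² - ⟨Bx,x⟩)₊`. -/
def wF (B : Fin n → Fin n → ℝ) (r : ℝ) (x : EuclideanSpace ℝ (Fin n)) : ℝ := max (r ^ 2 - qF B x) 0

variable {B : Fin n → Fin n → ℝ} {a : Fin n → Fin n → EuclideanSpace ℝ (Fin n) → ℝ}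
  {C ρ r : ℝ}

theorem wF_nonneg (x : EuclideanSpace ℝ (Fin n)) : 0 ≤ wF B r x := le_max_right _ _

theorem measurable_wF : Measurable (wF B r) :=
  ((continuous_const.sub (sm_qF B).continuous).max continuous_const).measurable

theorem RadBd.q_nonneg (h : RadBd C ρ a B) (hC : 1 ≤ C) (x : EuclideanSpace ℝ (Fin n)) :
    0 ≤ qF B x := by
  have := h.q_low x
  nlinarith [sq_nonneg ‖x‖]

theorem RadBd.wF_le (h : RadBd C ρ a B) (hC : 1 ≤ C) (x : EuclideanSpace ℝ (Fin n)) :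
    wF B r x ≤ r ^ 2 :=
  max_le (by linarith [h.q_nonneg hC x]) (sq_nonneg r)

theorem RadBd.norm_le_of_wF_ne (h : RadBd C ρ a B) (hC : 1 ≤ C) (hr : 0 ≤ r)
    {x : EuclideanSpace ℝ (Fin n)} (hx : wF B r x ≠ 0) : ‖x‖ ≤ C * r := by
  have h1 : qF B x < r ^ 2 := by
    by_contra hc
    exact hx (max_eq_right (by linarith [not_lt.1 hc]))
  have h2 := h.q_low x
  have h3 : ‖x‖ ^ 2 ≤ (C * r) ^ 2 := by
    have h4 : C * qF B x ≤ C * r ^ 2 := mul_le_mul_of_nonneg_left h1.le (by linarith)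
    have h5 : C * r ^ 2 ≤ C ^ 2 * r ^ 2 :=
      mul_le_mul_of_nonneg_right (by nlinarith) (sq_nonneg r)
    nlinarith
  exact le_of_sq_le_sq h3 (by positivity)

theorem RadBd.wF_eq_zero (h : RadBd C ρ a B) (hC : 1 ≤ C) (hr : 0 ≤ r)
    {x : EuclideanSpace ℝ (Fin n)} (hx : C * r < ‖x‖) : wF B r x = 0 := by
  by_contra hc
  linarith [h.norm_le_of_wF_ne hC hr hc]

theorem RadBd.integrable_trunc (h : RadBd C ρ a B) (hC : 1 ≤ C) (hr : 0 ≤ r) (hρ : C * r ≤ ρ)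
    {f : EuclideanSpace ℝ (Fin n) → ℝ} (hf : Measurable f) {M : ℝ} (hM : ∀ x, ‖x‖ ≤ ρ → |f x| ≤ M)
    (k : ℕ) : Integrable fun x => f x * wF B r x ^ (k + 1) := by
  refine integrable_of_bdd_supp (ρ := ρ) (M := M * (r ^ 2) ^ (k + 1))
    (hf.mul (measurable_wF.pow_const _)) ?_ ?_
  · intro x hx
    refine abs_mul_le (hM x hx) ?_
    rw [abs_of_nonneg (pow_nonneg (wF_nonneg x) _)]
    exact pow_le_pow_left₀ (wF_nonneg x) (h.wF_le hC x) _
  · intro x hx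
    rw [h.wF_eq_zero hC hr (hρ.trans_lt hx)]
    simp

theorem RadBd.pd_wF_pow (h : RadBd C ρ a B) (k : ℕ) (i : Fin n) (x : EuclideanSpace ℝ (Fin n)) :
    pd i (fun x => wF B r x ^ (k + 2)) x = -(2 * (k + 2)) * (wF B r x ^ (k + 1) * yF B i x) := by
  have h1 := pd_comp_at (hasDerivAt_max_pow k (r ^ 2 - qF B x))
    ((differentiableAt_const (r ^ 2)).fun_sub ((sm_qF B).differentiable x)) i
  rw [pd_sub_at (differentiableAt_const _) ((sm_qF B).differentiable x), pd_const, h.pd_q] at h1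
  refine h1.trans ?_
  simp only [wF]
  push_cast
  ring

theorem differentiable_wF_pow (k : ℕ) : Differentiable ℝ fun x => wF B r x ^ (k + 2) := by
  intro x
  exact (hasDerivAt_max_pow k (r ^ 2 - qF B x)).differentiableAt.comp x
    ((differentiableAt_const (r ^ 2)).fun_sub ((sm_qF B).differentiable x))

/-- The divergence theorem with a truncation weight. -/
theorem RadBd.trunc_div (h : RadBd C ρ a B) (hC : 1 ≤ C) (hr : 0 ≤ r) (hρ : C * r < ρ) (k : ℕ)
    {Φ : Fin n → EuclideanSpace ℝ (Fin n) → ℝ} (hΦ : ∀ i, BD ρ (Φ i))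
    (hm : ∀ i, Measurable (Φ i)) :
    ∫ x, (∑ i, pd i (Φ i) x) * wF B r x ^ (k + 2)
      = 2 * (k + 2) * ∫ x, (∑ i, yF B i x * Φ i x) * wF B r x ^ (k + 1) := by
  choose d M hM0 hM using hΦ
  have hMs : ∀ i, M i ≤ ∑ j, M j := fun i =>
    Finset.single_le_sum (fun j _ => hM0 j) (Finset.mem_univ i)
  have hpt : ∀ i x, ‖x‖ ≤ ρ → pd i (fun x => wF B r x ^ (k + 2) * Φ i x) x
      = pd i (Φ i) x * wF B r x ^ (k + 2) - 2 * (k + 2) * (yF B i x * Φ i x * wF B r x ^ (k + 1)) := by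
    intro i x hx
    rw [pd_mul_at (differentiable_wF_pow k x) (d i x hx), h.pd_wF_pow]
    ring
  have hsupp : ∀ i x, C * r < ‖x‖ → wF B r x ^ (k + 2) * Φ i x = 0 := by
    intro i x hx
    rw [h.wF_eq_zero hC hr hx]; simp
  have hdiff : ∀ i, Differentiable ℝ fun x => wF B r x ^ (k + 2) * Φ i x := by
    intro i x
    by_cases hx : ‖x‖ ≤ ρ
    · exact (differentiable_wF_pow k x).mul (d i x hx)
    · have : (fun x => wF B r x ^ (k + 2) * Φ i x) =ᶠ[nhds x] fun _ => (0 : ℝ) := by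
        filter_upwards [(isOpen_lt continuous_const continuous_norm).mem_nhds
          (hρ.trans (not_le.1 hx))] with y hy using hsupp i y hy
      exact (differentiableAt_const 0).congr_of_eventuallyEq this
  have hyM : ∀ i, ∃ N : ℝ, ∀ x, ‖x‖ ≤ ρ → |yF B i x| ≤ N := fun i =>
    ((sm_yF B i).bdd ρ).imp fun N hN => hN.2
  choose N hN using hyM
  have hi1 : ∀ i, Integrable fun x => pd i (Φ i) x * wF B r x ^ (k + 2) := fun i =>
    h.integrable_trunc hC hr hρ.le (measurable_pd _ _) (fun x hx => (hM i x hx).2 i) (k + 1)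
  have hi2 : ∀ i, Integrable fun x => yF B i x * Φ i x * wF B r x ^ (k + 1) := fun i =>
    h.integrable_trunc hC hr hρ.le ((sm_yF B i).continuous.measurable.mul (hm i))
      (fun x hx => abs_mul_le (hN i x hx) (hM i x hx).1) k
  have hzero : ∀ i, ∫ x, pd i (fun x => wF B r x ^ (k + 2) * Φ i x) x = 0 := by
    intro i
    refine integral_pd_eq_zero (ρ := C * r) (M := M i * (r ^ 2) ^ (k + 2)
        + 2 * (k + 2) * (N i * M i * (r ^ 2) ^ (k + 1))) (hdiff i) (hsupp i) i ?_
    intro x hx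
    have hx' := hx.trans hρ.le
    rw [hpt i x hx']
    have hw : ∀ j, |wF B r x ^ j| ≤ (r ^ 2) ^ j := fun j => by
      rw [abs_of_nonneg (pow_nonneg (wF_nonneg x) _)]
      exact pow_le_pow_left₀ (wF_nonneg x) (h.wF_le hC x) _
    refine (abs_sub _ _).trans (add_le_add (abs_mul_le ((hM i x hx').2 i) (hw _)) ?_)
    rw [abs_mul, abs_of_nonneg (by positivity : (0:ℝ) ≤ 2 * (k + 2))]
    gcongr
    exact abs_mul_le (abs_mul_le (hN i x hx') (hM i x hx').1) (hw _)
  have heq : ∀ i, ∫ x, pd i (Φ i) x * wF B r x ^ (k + 2)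
      = 2 * (k + 2) * ∫ x, yF B i x * Φ i x * wF B r x ^ (k + 1) := by
    intro i
    have h1 : ∫ x, pd i (fun x => wF B r x ^ (k + 2) * Φ i x) x
        = ∫ x, (pd i (Φ i) x * wF B r x ^ (k + 2)
          - 2 * (k + 2) * (yF B i x * Φ i x * wF B r x ^ (k + 1))) := by
      refine integral_congr_ae (Filter.Eventually.of_forall fun x => ?_)
      by_cases hx : ‖x‖ ≤ ρ
      · exact hpt i x hx
      · have hx' := hρ.trans (not_le.1 hx)
        simp only
        rw [pd_eq_zero_of_supp (hsupp i) hx', h.wF_eq_zero hC hr hx']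
        simp
    rw [hzero i, integral_sub (hi1 i) ((hi2 i).const_mul _), integral_const_mul] at h1
    linarith
  simp only [Finset.sum_mul]
  rw [integral_finsetSum _ fun i _ => hi1 i, integral_finsetSum _ fun i _ => hi2 i, Finset.mul_sum]
  exact Finset.sum_congr rfl fun i _ => heq i
end Trunc

section Energy
variable {n : ℕ}

/-- The ratio `⟨a(x)Bx,Bx⟩ / ⟨Bx,x⟩`, equal to `1` at the origin. -/
def muF (a : Fin n → Fin n → EuclideanSpace ℝ (Fin n) → ℝ) (B : Fin n → Fin n → ℝ)
    (x : EuclideanSpace ℝ (Fin n)) : ℝ := if x = 0 then 1 else nuF a B x / qF B x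

/-- The flux `a ∇u`. -/
def fluxF (a : Fin n → Fin n → EuclideanSpace ℝ (Fin n) → ℝ) (u : EuclideanSpace ℝ (Fin n) → ℝ)
    (i : Fin n) (x : EuclideanSpace ℝ (Fin n)) : ℝ := ∑ j, a i j x * pd j u x

/-- The energy density `⟨a ∇u, ∇u⟩`. -/
def enF (a : Fin n → Fin n → EuclideanSpace ℝ (Fin n) → ℝ) (u : EuclideanSpace ℝ (Fin n) → ℝ)
    (x : EuclideanSpace ℝ (Fin n)) : ℝ := ∑ i, fluxF a u i x * pd i u x

/-- The first order coefficients of the operator relative to its divergence form. -/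
def driftF (a : Fin n → Fin n → EuclideanSpace ℝ (Fin n) → ℝ)
    (b : Fin n → EuclideanSpace ℝ (Fin n) → ℝ) (j : Fin n)
    (x : EuclideanSpace ℝ (Fin n)) : ℝ := b j x - ∑ i, pd i (a i j) x

/-- The first order term of the operator relative to its divergence form. -/
def kapF (a : Fin n → Fin n → EuclideanSpace ℝ (Fin n) → ℝ)
    (b : Fin n → EuclideanSpace ℝ (Fin n) → ℝ) (u : EuclideanSpace ℝ (Fin n) → ℝ)
    (x : EuclideanSpace ℝ (Fin n)) : ℝ := ∑ j, driftF a b j x * pd j u x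

/-- The derivative along the rescaled radial field. -/
def betaD (a : Fin n → Fin n → EuclideanSpace ℝ (Fin n) → ℝ) (B : Fin n → Fin n → ℝ)
    (u : EuclideanSpace ℝ (Fin n) → ℝ) (x : EuclideanSpace ℝ (Fin n)) : ℝ :=
  ∑ i, betaF a B i x * pd i u x

/-- The derivative along the radial field. -/
def XD (a : Fin n → Fin n → EuclideanSpace ℝ (Fin n) → ℝ) (B : Fin n → Fin n → ℝ)
    (u : EuclideanSpace ℝ (Fin n) → ℝ) (x : EuclideanSpace ℝ (Fin n)) : ℝ :=
  ∑ i, XF a B i x * pd i u x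

variable {B : Fin n → Fin n → ℝ} {a : Fin n → Fin n → EuclideanSpace ℝ (Fin n) → ℝ}
  {b : Fin n → EuclideanSpace ℝ (Fin n) → ℝ} {u : EuclideanSpace ℝ (Fin n) → ℝ} {C L ρ r : ℝ}

theorem IsOp.sm_fluxF (h : IsOp L a b) (hu : Sm u) (i : Fin n) : Sm (fluxF a u i) :=
  ContDiff.sum fun j _ => (h.sm_a i j).mul (hu.pd j)

theorem IsOp.sm_enF (h : IsOp L a b) (hu : Sm u) : Sm (enF a u) :=
  ContDiff.sum fun i _ => (h.sm_fluxF hu i).mul (hu.pd i)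

theorem IsOp.sm_driftF (h : IsOp L a b) (j : Fin n) : Sm (driftF a b j) :=
  (h.sm_b j).sub (ContDiff.sum fun i _ => (h.sm_a i j).pd i)

theorem IsOp.sm_kapF (h : IsOp L a b) (hu : Sm u) : Sm (kapF a b u) :=
  ContDiff.sum fun j _ => (h.sm_driftF j).mul (hu.pd j)

theorem IsOp.sm_XD (h : IsOp L a b) (hu : Sm u) : Sm (XD a B u) :=
  ContDiff.sum fun j _ => (h.sm_XF B j).mul (hu.pd j)

theorem RadBd.mono (h : RadBd C ρ a B) {ρ' : ℝ} (hρ : ρ' ≤ ρ) : RadBd C ρ' a B where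
  q_low := h.q_low
  q_up := h.q_up
  pd_q := h.pd_q
  y_bd := h.y_bd
  X_bd := h.X_bd
  nu_bd x hx := h.nu_bd x (hx.trans hρ)
  nu_low x hx := h.nu_low x (hx.trans hρ)
  nu_up x hx := h.nu_up x (hx.trans hρ)
  div_X x hx := h.div_X x (hx.trans hρ)
  beta_bd i x hx := h.beta_bd i x (hx.trans hρ)
  beta_diff i x hx := h.beta_diff i x (hx.trans hρ)
  beta_pd k i x hx := h.beta_pd k i x (hx.trans hρ)

theorem RadBd.q_pos (h : RadBd C ρ a B) (hC : 1 ≤ C) {x : EuclideanSpace ℝ (Fin n)} (hx : x ≠ 0) :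
    0 < qF B x := by
  have h1 := h.q_low x
  have h2 : 0 < ‖x‖ ^ 2 := by have := norm_pos_iff.2 hx; positivity
  by_contra hc
  nlinarith [not_lt.1 hc]

theorem RadBd.nu_pos (h : RadBd C ρ a B) (hC : 1 ≤ C) {x : EuclideanSpace ℝ (Fin n)} (hx : x ≠ 0)
    (hxρ : ‖x‖ ≤ ρ) : 0 < nuF a B x := by
  linarith [h.nu_low x hxρ, h.q_pos hC hx]

theorem RadBd.mu_low (h : RadBd C ρ a B) (hC : 1 ≤ C) {x : EuclideanSpace ℝ (Fin n)}
    (hxρ : ‖x‖ ≤ ρ) : 1 / 2 ≤ muF a B x := by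
  unfold muF
  split_ifs with hx
  · norm_num
  · rw [le_div_iff₀ (h.q_pos hC hx)]
    linarith [h.nu_low x hxρ]

theorem RadBd.mu_up (h : RadBd C ρ a B) (hC : 1 ≤ C) {x : EuclideanSpace ℝ (Fin n)}
    (hxρ : ‖x‖ ≤ ρ) : muF a B x ≤ 2 := by
  unfold muF
  split_ifs with hx
  · norm_num
  · rw [div_le_iff₀ (h.q_pos hC hx)]
    linarith [h.nu_up x hxρ]

theorem RadBd.mu_sub (h : RadBd C ρ a B) (hC : 1 ≤ C) {x : EuclideanSpace ℝ (Fin n)}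
    (hxρ : ‖x‖ ≤ ρ) : |muF a B x - 1| ≤ 2 * C * ‖x‖ := by
  have h2 := h.mu_up hC hxρ
  unfold muF at h2 ⊢
  split_ifs at h2 ⊢ with hx
  · simp [hx]
  · have hq := h.q_pos hC hx
    have h1 : nuF a B x / qF B x - 1 = (nuF a B x - qF B x) / qF B x := by field_simp
    rw [h1, abs_div, abs_of_pos hq, div_le_iff₀ hq]
    have h3 := h.nu_bd x hxρ
    have h4 := h.nu_up x hxρ
    have h5 : C * ‖x‖ * nuF a B x ≤ C * ‖x‖ * (2 * qF B x) :=
      mul_le_mul_of_nonneg_left h4 (mul_nonneg (by linarith) (norm_nonneg x))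
    linarith

theorem RadBd.zero_values (h : RadBd C ρ a B) (hρ : 0 ≤ ρ) :
    (∀ i, yF B i 0 = 0) ∧ (∀ i, XF a B i 0 = 0) ∧ (∀ i, betaF a B i 0 = 0) := by
  refine ⟨fun i => ?_, fun i => ?_, fun i => ?_⟩
  · simpa using h.y_bd i 0
  · simpa using h.X_bd i 0
  · simpa using h.beta_bd i 0 (by simpa using hρ)

theorem RadBd.mu_mul_q (h : RadBd C ρ a B) (hC : 1 ≤ C) (hρ : 0 ≤ ρ)
    (x : EuclideanSpace ℝ (Fin n)) : muF a B x * qF B x = nuF a B x := by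
  unfold muF
  split_ifs with hx
  · subst hx
    simp [nuF, qF, (h.zero_values hρ).1]
  · have := h.q_pos hC hx
    field_simp

theorem RadBd.XD_eq (h : RadBd C ρ a B) (hC : 1 ≤ C) {x : EuclideanSpace ℝ (Fin n)}
    (hxρ : ‖x‖ ≤ ρ) : XD a B u x = muF a B x * betaD a B u x := by
  have hρ : 0 ≤ ρ := (norm_nonneg x).trans hxρ
  unfold XD betaD muF
  split_ifs with hx
  · subst hx
    simp [(h.zero_values hρ).2.1, (h.zero_values hρ).2.2]
  · have h1 := h.q_pos hC hx
    have h2 := h.nu_pos hC hx hxρ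
    rw [Finset.mul_sum]
    refine Finset.sum_congr rfl fun i _ => ?_
    unfold betaF
    field_simp

theorem RadBd.sum_y_beta (h : RadBd C ρ a B) (hC : 1 ≤ C) {x : EuclideanSpace ℝ (Fin n)}
    (hxρ : ‖x‖ ≤ ρ) : ∑ i, yF B i x * betaF a B i x = qF B x := by
  have hρ : 0 ≤ ρ := (norm_nonneg x).trans hxρ
  by_cases hx : x = 0
  · subst hx
    simp [qF, (h.zero_values hρ).1]
  · have h2 := h.nu_pos hC hx hxρ
    have : ∑ i, yF B i x * betaF a B i x = nuF a B x * (qF B x / nuF a B x) := by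
      conv_rhs => rw [nuF, Finset.sum_mul]
      refine Finset.sum_congr rfl fun i _ => ?_
      unfold betaF nuF
      ring
    rw [this]
    field_simp

theorem IsOp.sum_y_flux (h : IsOp L a b) (x : EuclideanSpace ℝ (Fin n)) :
    ∑ i, yF B i x * fluxF a u i x = XD a B u x := by
  unfold fluxF XD XF
  simp only [Finset.mul_sum, Finset.sum_mul]
  rw [Finset.sum_comm]
  refine Finset.sum_congr rfl fun i _ => Finset.sum_congr rfl fun j _ => ?_
  rw [h.symm j i]
  ring

theorem IsOp.sum_pd_flux (h : IsOp L a b) (hu : Sm u) {x : EuclideanSpace ℝ (Fin n)}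
    (hx : Lop a b u x = 0) : ∑ i, pd i (fluxF a u i) x = -kapF a b u x := by
  have h1 : ∀ i, pd i (fluxF a u i) x
      = ∑ j, (pd i (a i j) x * pd j u x + a i j x * pd i (pd j u) x) := fun i =>
    pd_sum_mul_at (fun j => (h.sm_a i j).differentiable x) (fun j => (hu.pd j).differentiable x) i
  simp only [h1, Finset.sum_add_distrib]
  unfold Lop at hx
  have h2 : kapF a b u x = ∑ j, b j x * pd j u x - ∑ i, ∑ j, pd i (a i j) x * pd j u x := by
    rw [Finset.sum_comm]
    simp only [kapF, driftF, sub_mul, Finset.sum_sub_distrib, Finset.sum_mul]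
  linarith

theorem IsOp.grad_sq_le (h : IsOp L a b) (x : EuclideanSpace ℝ (Fin n)) :
    ∑ i, pd i u x ^ 2 ≤ L * enF a u x := by
  have hL : 0 < L := by linarith [h.one_le]
  have h1 := h.ell x fun i => pd i u x
  have h2 : ∑ i, ∑ j, a i j x * pd i u x * pd j u x = enF a u x := by
    unfold enF fluxF
    simp only [Finset.sum_mul]
    exact Finset.sum_congr rfl fun i _ => Finset.sum_congr rfl fun j _ => by ring
  rw [h2, inv_mul_le_iff₀ hL] at h1
  exact h1

theorem IsOp.enF_nonneg (h : IsOp L a b) (x : EuclideanSpace ℝ (Fin n)) : 0 ≤ enF a u x := by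
  have h1 := h.grad_sq_le (u := u) x
  have h2 : 0 ≤ ∑ i, pd i u x ^ 2 := Finset.sum_nonneg fun i _ => sq_nonneg _
  have hL : 0 < L := by linarith [h.one_le]
  by_contra hc
  nlinarith [not_le.1 hc]

theorem IsOp.abs_pd_mul_le (h : IsOp L a b) (x : EuclideanSpace ℝ (Fin n)) {c d p q : ℝ}
    (hp : |p| ≤ c * √(∑ i, pd i u x ^ 2)) (hq : |q| ≤ d * √(∑ i, pd i u x ^ 2))
    (hc : 0 ≤ c) (hd : 0 ≤ d) : |p * q| ≤ c * d * L * enF a u x := by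
  refine (abs_mul_le hp hq).trans ?_
  have h1 : √(∑ i, pd i u x ^ 2) * √(∑ i, pd i u x ^ 2) = ∑ i, pd i u x ^ 2 :=
    Real.mul_self_sqrt (Finset.sum_nonneg fun i _ => sq_nonneg _)
  have h2 := mul_le_mul_of_nonneg_left (h.grad_sq_le (u := u) x) (mul_nonneg hc hd)
  calc _ = c * d * (√(∑ i, pd i u x ^ 2) * √(∑ i, pd i u x ^ 2)) := by ring
    _ ≤ _ := by rw [h1]; linarith

theorem IsOp.abs_kapF_le (h : IsOp L a b) (x : EuclideanSpace ℝ (Fin n)) :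
    |kapF a b u x| ≤ n * (L + n * L) * √(∑ i, pd i u x ^ 2) := by
  rw [mul_assoc]
  refine abs_sum_le_card fun j => abs_mul_le ?_ (abs_le_sqrt_sum_sq (fun i => pd i u x) j)
  refine (abs_sub _ _).trans (add_le_add (h.bd_b j x) ?_)
  exact abs_sum_le_card fun i => h.bd_da i i j x

theorem IsOp.abs_fluxF_le (h : IsOp L a b) (i : Fin n) (x : EuclideanSpace ℝ (Fin n)) :
    |fluxF a u i x| ≤ n * L * √(∑ i, pd i u x ^ 2) := by
  rw [mul_assoc]
  exact abs_sum_le_card fun j => abs_mul_le (h.bd_a i j x) (abs_le_sqrt_sum_sq (fun i => pd i u x) j)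

theorem RadBd.abs_betaD_le (h : RadBd C ρ a B) {x : EuclideanSpace ℝ (Fin n)} (hx : ‖x‖ ≤ ρ) :
    |betaD a B u x| ≤ n * (C * ‖x‖) * √(∑ i, pd i u x ^ 2) := by
  rw [mul_assoc]
  exact abs_sum_le_card fun j => abs_mul_le (h.beta_bd j x hx) (abs_le_sqrt_sum_sq (fun i => pd i u x) j)

theorem RadBd.bd_beta (h : RadBd C ρ a B) (hC : 1 ≤ C) (hρ : 0 ≤ ρ) (i : Fin n) :
    BD ρ (betaF a B i) := by
  refine ⟨h.beta_diff i, C * ρ + 1, by positivity, fun x hx => ⟨?_, fun k => ?_⟩⟩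
  · have := mul_le_mul_of_nonneg_left hx (by linarith : (0:ℝ) ≤ C)
    linarith [h.beta_bd i x hx]
  · have h1 := mul_le_mul_of_nonneg_left hx (by linarith : (0:ℝ) ≤ C)
    have h2 := abs_le.1 (h.beta_pd k i x hx)
    rw [abs_le]
    split_ifs at h2 <;> constructor <;> linarith

theorem IsOp.measurable_beta (h : IsOp L a b) (i : Fin n) : Measurable (betaF a B i) :=
  (h.sm_XF B i).continuous.measurable.mul
    ((sm_qF B).continuous.measurable.div (h.sm_nuF B).continuous.measurable)

theorem IsOp.measurable_betaD (h : IsOp L a b) (hu : Sm u) : Measurable (betaD a B u) :=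
  Finset.measurable_fun_sum _ fun i _ => (h.measurable_beta i).mul (hu.pd i).continuous.measurable

theorem IsOp.measurable_mu (h : IsOp L a b) : Measurable (muF a B) :=
  Measurable.ite (measurableSet_singleton 0) measurable_const
    ((h.sm_nuF B).continuous.measurable.div (sm_qF B).continuous.measurable)

/-- The zeroth order part of the divergence of `Gβ - 2 (β·∇u) a∇u`. -/
def rellichF (a : Fin n → Fin n → EuclideanSpace ℝ (Fin n) → ℝ)
    (b : Fin n → EuclideanSpace ℝ (Fin n) → ℝ) (B : Fin n → Fin n → ℝ)
    (u : EuclideanSpace ℝ (Fin n) → ℝ) (x : EuclideanSpace ℝ (Fin n)) : ℝ :=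
  ∑ k, betaF a B k x * (∑ i, ∑ j, pd k (a i j) x * (pd i u x * pd j u x))
    + enF a u x * (∑ k, pd k (betaF a B k) x)
    - 2 * (∑ i, ∑ k, pd i (betaF a B k) x * (fluxF a u i x * pd k u x))
    + 2 * (betaD a B u x * kapF a b u x)

theorem IsOp.pd_enF (h : IsOp L a b) (hu : Sm u) (k : Fin n) (x : EuclideanSpace ℝ (Fin n)) :
    pd k (enF a u) x = ∑ i, ∑ j, pd k (a i j) x * (pd i u x * pd j u x)
      + 2 * ∑ i, fluxF a u i x * pd k (pd i u) x := by
  have h1 : pd k (enF a u) x = ∑ i, (pd k (fluxF a u i) x * pd i u x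
      + fluxF a u i x * pd k (pd i u) x) :=
    pd_sum_mul_at (fun i => (h.sm_fluxF hu i).differentiable x) (fun i => (hu.pd i).differentiable x) k
  have h2 : ∀ i, pd k (fluxF a u i) x
      = ∑ j, (pd k (a i j) x * pd j u x + a i j x * pd k (pd j u) x) := fun i =>
    pd_sum_mul_at (fun j => (h.sm_a i j).differentiable x) (fun j => (hu.pd j).differentiable x) k
  have h3 : ∑ i, fluxF a u i x * pd k (pd i u) x
      = ∑ i, ∑ j, a i j x * pd k (pd j u) x * pd i u x := by
    unfold fluxF
    simp only [Finset.sum_mul]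
    rw [Finset.sum_comm]
    refine Finset.sum_congr rfl fun i _ => Finset.sum_congr rfl fun j _ => ?_
    rw [h.symm j i]; ring
  rw [h1]
  simp only [h2, Finset.sum_add_distrib, add_mul, Finset.sum_mul]
  rw [two_mul, ← add_assoc]
  congr 1
  rw [h3]
  congr 1
  exact Finset.sum_congr rfl fun i _ => Finset.sum_congr rfl fun j _ => by ring

theorem RadBd.pd_betaD (h : RadBd C ρ a B) (hu : Sm u) (k : Fin n)
    {x : EuclideanSpace ℝ (Fin n)} (hx : ‖x‖ ≤ ρ) :
    pd k (betaD a B u) x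
      = ∑ i, (pd k (betaF a B i) x * pd i u x + betaF a B i x * pd k (pd i u) x) :=
  pd_sum_mul_at (fun i => h.beta_diff i x hx) (fun i => (hu.pd i).differentiable x) k

theorem RadBd.rellich_div (h : RadBd C ρ a B) (hop : IsOp L a b) (hu : Sm u)
    {x : EuclideanSpace ℝ (Fin n)} (hx : ‖x‖ ≤ ρ) (hsol : Lop a b u x = 0) :
    ∑ i, pd i (fun y => enF a u y * betaF a B i y - 2 * betaD a B u y * fluxF a u i y) x
      = rellichF a b B u x := by
  have dV : DifferentiableAt ℝ (betaD a B u) x :=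
    DifferentiableAt.fun_sum fun i _ => (h.beta_diff i x hx).fun_mul ((hu.pd i).differentiable x)
  have dG := (hop.sm_enF hu).differentiable x
  have dA := fun i => (hop.sm_fluxF hu i).differentiable x
  have h1 : ∀ i, pd i (fun y => enF a u y * betaF a B i y - 2 * betaD a B u y * fluxF a u i y) x
      = (∑ k, ∑ j, pd i (a k j) x * (pd k u x * pd j u x)) * betaF a B i x
        + 2 * (∑ k, fluxF a u k x * pd i (pd k u) x * betaF a B i x)
        + enF a u x * pd i (betaF a B i) x
        - 2 * (∑ k, pd i (betaF a B k) x * (fluxF a u i x * pd k u x))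
        - 2 * (∑ k, betaF a B k x * pd i (pd k u) x * fluxF a u i x)
        - 2 * betaD a B u x * pd i (fluxF a u i) x := by
    intro i
    rw [pd_sub_at (dG.fun_mul (h.beta_diff i x hx)) ((dV.const_mul 2).fun_mul (dA i)),
      pd_mul_at dG (h.beta_diff i x hx), pd_mul_at (dV.const_mul 2) (dA i), pd_const_mul_at dV,
      hop.pd_enF hu, h.pd_betaD hu i hx, Finset.sum_add_distrib, ← Finset.sum_mul]
    have e1 : ∑ k, pd i (betaF a B k) x * (fluxF a u i x * pd k u x)
        = (∑ k, pd i (betaF a B k) x * pd k u x) * fluxF a u i x := by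
      rw [Finset.sum_mul]; exact Finset.sum_congr rfl fun k _ => by ring
    rw [e1, ← Finset.sum_mul]
    ring
  have h2 : ∑ i, ∑ k, betaF a B k x * pd i (pd k u) x * fluxF a u i x
      = ∑ i, ∑ k, fluxF a u k x * pd i (pd k u) x * betaF a B i x := by
    rw [Finset.sum_comm]
    refine Finset.sum_congr rfl fun i _ => Finset.sum_congr rfl fun k _ => ?_
    rw [pd_comm hu k i]; ring
  simp only [h1, Finset.sum_add_distrib, Finset.sum_sub_distrib, ← Finset.mul_sum]
  rw [h2, hop.sum_pd_flux hu hsol]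
  unfold rellichF
  have h3 : ∑ i, (∑ k, ∑ j, pd i (a k j) x * (pd k u x * pd j u x)) * betaF a B i x
      = ∑ k, betaF a B k x * (∑ i, ∑ j, pd k (a i j) x * (pd i u x * pd j u x)) :=
    Finset.sum_congr rfl fun i _ => mul_comm _ _
  rw [h3]
  ring

theorem RadBd.rellich_bound (h : RadBd C ρ a B) (hop : IsOp L a b) (hC : 1 ≤ C)
    {x : EuclideanSpace ℝ (Fin n)} (hx : ‖x‖ ≤ ρ) :
    |rellichF a b B u x - (n - 2) * enF a u x|
      ≤ (n * C * (n ^ 2 * (L * L)) + n * C + 2 * (n ^ 2 * (C * (n * L * L)))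
        + 2 * (n * C * (n * (L + n * L)) * L)) * ‖x‖ * enF a u x := by
  have hL := hop.one_le
  have hL0 : 0 ≤ L := by linarith
  have hG := hop.enF_nonneg (u := u) x
  have hCx : 0 ≤ C * ‖x‖ := mul_nonneg (by linarith) (norm_nonneg x)
  have hp : ∀ i, |pd i u x| ≤ 1 * √(∑ i, pd i u x ^ 2) := fun i => by
    rw [one_mul]; exact abs_le_sqrt_sum_sq (fun i => pd i u x) i
  have t1 : |∑ k, betaF a B k x * (∑ i, ∑ j, pd k (a i j) x * (pd i u x * pd j u x))|
      ≤ n * (C * ‖x‖ * (n ^ 2 * (L * (1 * 1 * L * enF a u x)))) :=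
    abs_sum_le_card fun k => abs_mul_le (h.beta_bd k x hx) (abs_sum2_le_card fun i j =>
      abs_mul_le (hop.bd_da k i j x) (hop.abs_pd_mul_le x (hp i) (hp j) zero_le_one zero_le_one))
  have t2 : |∑ k, pd k (betaF a B k) x - n| ≤ n * (C * ‖x‖) := by
    have : ∑ k, pd k (betaF a B k) x - n = ∑ k, (pd k (betaF a B k) x - if k = k then 1 else 0) := by
      simp
    rw [this]
    exact abs_sum_le_card fun k => h.beta_pd k k x hx
  have t3 : |∑ i, ∑ k, pd i (betaF a B k) x * (fluxF a u i x * pd k u x) - enF a u x|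
      ≤ n ^ 2 * (C * ‖x‖ * (n * L * 1 * L * enF a u x)) := by
    have : ∑ i, ∑ k, pd i (betaF a B k) x * (fluxF a u i x * pd k u x) - enF a u x
        = ∑ i, ∑ k, (pd i (betaF a B k) x - if k = i then 1 else 0) * (fluxF a u i x * pd k u x) := by
      simp only [sub_mul, Finset.sum_sub_distrib, ite_mul, one_mul, zero_mul, Finset.sum_ite_eq',
        Finset.mem_univ, if_true]
      rfl
    rw [this]
    exact abs_sum2_le_card fun i k => abs_mul_le (h.beta_pd i k x hx)
      (hop.abs_pd_mul_le x (hop.abs_fluxF_le i x) (hp k) (by positivity) zero_le_one)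
  have t4 := hop.abs_pd_mul_le x (h.abs_betaD_le (u := u) hx) (hop.abs_kapF_le x) (by positivity)
    (by positivity)
  have t2' := abs_mul_le (le_of_eq (abs_of_nonneg hG)) t2
  have e : rellichF a b B u x - (n - 2) * enF a u x
      = ∑ k, betaF a B k x * (∑ i, ∑ j, pd k (a i j) x * (pd i u x * pd j u x))
        + enF a u x * (∑ k, pd k (betaF a B k) x - n)
        - 2 * (∑ i, ∑ k, pd i (betaF a B k) x * (fluxF a u i x * pd k u x) - enF a u x)
        + 2 * (betaD a B u x * kapF a b u x) := by unfold rellichF; ring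
  rw [e]
  have T1 := abs_le.1 t1
  have T2 := abs_le.1 t2'
  have T3 := abs_le.1 t3
  have T4 := abs_le.1 t4
  rw [abs_le]
  constructor
  · linarith [T1.1, T2.1, T3.2, T4.1]
  · linarith [T1.2, T2.2, T3.1, T4.2]

end Energy

section Integrals
variable {n : ℕ}

/-- Measurable and bounded on a closed ball about the origin. -/
def MB (ρ : ℝ) (f : EuclideanSpace ℝ (Fin n) → ℝ) : Prop :=
  Measurable f ∧ ∃ M : ℝ, ∀ x, ‖x‖ ≤ ρ → |f x| ≤ M

variable {ρ r C L : ℝ} {f g : EuclideanSpace ℝ (Fin n) → ℝ}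

theorem Sm.mul (hf : Sm f) (hg : Sm g) : Sm fun x => f x * g x := ContDiff.mul hf hg

theorem Sm.mb (hf : Sm f) : MB ρ f :=
  ⟨hf.continuous.measurable, (hf.bdd ρ).imp fun _ h => h.2⟩

theorem MB.mul (hf : MB ρ f) (hg : MB ρ g) : MB ρ fun x => f x * g x := by
  obtain ⟨mf, M, hM⟩ := hf
  obtain ⟨mg, N, hN⟩ := hg
  exact ⟨mf.mul mg, M * N, fun x hx => abs_mul_le (hM x hx) (hN x hx)⟩

theorem MB.sub (hf : MB ρ f) (hg : MB ρ g) : MB ρ fun x => f x - g x := by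
  obtain ⟨mf, M, hM⟩ := hf
  obtain ⟨mg, N, hN⟩ := hg
  exact ⟨mf.sub mg, M + N, fun x hx => (abs_sub _ _).trans (add_le_add (hM x hx) (hN x hx))⟩

theorem MB.const (c : ℝ) : MB ρ fun _ : EuclideanSpace ℝ (Fin n) => c :=
  ⟨measurable_const, |c|, fun _ _ => le_rfl⟩

/-- Integration against a power of the truncation weight. -/
def wInt (B : Fin n → Fin n → ℝ) (f : EuclideanSpace ℝ (Fin n) → ℝ) (k : ℕ) (r : ℝ) : ℝ :=
  ∫ x, f x * wF B r x ^ k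

variable {B : Fin n → Fin n → ℝ} {a : Fin n → Fin n → EuclideanSpace ℝ (Fin n) → ℝ}
  {b : Fin n → EuclideanSpace ℝ (Fin n) → ℝ} {u : EuclideanSpace ℝ (Fin n) → ℝ}

theorem MB.int (hf : MB ρ f) (h : RadBd C ρ a B) (hC : 1 ≤ C) (hr : 0 ≤ r) (hρ : C * r ≤ ρ)
    (k : ℕ) : Integrable fun x => f x * wF B r x ^ (k + 1) := by
  obtain ⟨mf, M, hM⟩ := hf
  exact h.integrable_trunc hC hr hρ mf hM k

theorem wInt_add (hf : MB ρ f) (hg : MB ρ g) (h : RadBd C ρ a B) (hC : 1 ≤ C) (hr : 0 ≤ r)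
    (hρ : C * r ≤ ρ) (k : ℕ) :
    wInt B (fun x => f x + g x) (k + 1) r = wInt B f (k + 1) r + wInt B g (k + 1) r := by
  unfold wInt
  rw [← integral_add (hf.int h hC hr hρ k) (hg.int h hC hr hρ k)]
  exact integral_congr_ae (Filter.Eventually.of_forall fun x => by simp only; ring)

theorem wInt_sub (hf : MB ρ f) (hg : MB ρ g) (h : RadBd C ρ a B) (hC : 1 ≤ C) (hr : 0 ≤ r)
    (hρ : C * r ≤ ρ) (k : ℕ) :
    wInt B (fun x => f x - g x) (k + 1) r = wInt B f (k + 1) r - wInt B g (k + 1) r := by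
  unfold wInt
  rw [← integral_sub (hf.int h hC hr hρ k) (hg.int h hC hr hρ k)]
  exact integral_congr_ae (Filter.Eventually.of_forall fun x => by simp only; ring)

theorem wInt_const_mul (c : ℝ) (k : ℕ) :
    wInt B (fun x => c * f x) k r = c * wInt B f k r := by
  unfold wInt
  rw [← integral_const_mul]
  exact integral_congr_ae (Filter.Eventually.of_forall fun x => by simp only; ring)

theorem wInt_congr (h : RadBd C ρ a B) (hC : 1 ≤ C) (hr : 0 ≤ r) (k : ℕ)
    (hfg : ∀ x, ‖x‖ ≤ C * r → f x = g x) : wInt B f (k + 1) r = wInt B g (k + 1) r := by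
  refine integral_congr_ae (Filter.Eventually.of_forall fun x => ?_)
  simp only
  by_cases hx : ‖x‖ ≤ C * r
  · rw [hfg x hx]
  · rw [h.wF_eq_zero hC hr (not_le.1 hx)]; simp

theorem wInt_mono (hf : MB ρ f) (hg : MB ρ g) (h : RadBd C ρ a B) (hC : 1 ≤ C) (hr : 0 ≤ r)
    (hρ : C * r ≤ ρ) (k : ℕ) (hfg : ∀ x, ‖x‖ ≤ C * r → f x ≤ g x) :
    wInt B f (k + 1) r ≤ wInt B g (k + 1) r := by
  refine integral_mono (hf.int h hC hr hρ k) (hg.int h hC hr hρ k) fun x => ?_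
  simp only
  by_cases hx : ‖x‖ ≤ C * r
  · exact mul_le_mul_of_nonneg_right (hfg x hx) (pow_nonneg (wF_nonneg x) _)
  · rw [h.wF_eq_zero hC hr (not_le.1 hx)]; simp

theorem wInt_nonneg (h : RadBd C ρ a B) (hC : 1 ≤ C) (hr : 0 ≤ r) (k : ℕ)
    (hf : ∀ x, ‖x‖ ≤ C * r → 0 ≤ f x) : 0 ≤ wInt B f (k + 1) r := by
  refine integral_nonneg fun x => ?_
  simp only [Pi.zero_apply]
  by_cases hx : ‖x‖ ≤ C * r
  · exact mul_nonneg (hf x hx) (pow_nonneg (wF_nonneg x) _)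
  · rw [h.wF_eq_zero hC hr (not_le.1 hx)]; simp

theorem wInt_abs_le (hf : MB ρ f) (hg : MB ρ g) (h : RadBd C ρ a B) (hC : 1 ≤ C) (hr : 0 ≤ r)
    (hρ : C * r ≤ ρ) (k : ℕ) (c : ℝ) (hfg : ∀ x, ‖x‖ ≤ C * r → |f x| ≤ c * g x) :
    |wInt B f (k + 1) r| ≤ c * wInt B g (k + 1) r := by
  have hcg : MB ρ fun x => c * g x := (MB.const c).mul hg
  have hcg' : MB ρ fun x => -c * g x := (MB.const (-c)).mul hg
  rw [abs_le, ← neg_mul, ← wInt_const_mul, ← wInt_const_mul]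
  exact ⟨wInt_mono hcg' hf h hC hr hρ k fun x hx => by linarith [(abs_le.1 (hfg x hx)).1],
    wInt_mono hf hcg h hC hr hρ k fun x hx => (abs_le.1 (hfg x hx)).2⟩

theorem wInt_sq_le {p q m : EuclideanSpace ℝ (Fin n) → ℝ} (hm : MB ρ m) (hp : MB ρ p) (hq : MB ρ q)
    (h : RadBd C ρ a B) (hC : 1 ≤ C) (hr : 0 ≤ r) (hρ : C * r ≤ ρ) (k : ℕ)
    (hp0 : ∀ x, ‖x‖ ≤ C * r → 0 ≤ p x) (hq0 : ∀ x, ‖x‖ ≤ C * r → 0 ≤ q x)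
    (hmpq : ∀ x, ‖x‖ ≤ C * r → m x ^ 2 ≤ p x * q x) :
    wInt B m (k + 1) r ^ 2 ≤ wInt B p (k + 1) r * wInt B q (k + 1) r := by
  refine sq_integral_le (hm.int h hC hr hρ k) (hp.int h hC hr hρ k) (hq.int h hC hr hρ k) ?_ ?_ ?_
  all_goals
    intro x
    by_cases hx : ‖x‖ ≤ C * r
    swap
    · simp [h.wF_eq_zero hC hr (not_le.1 hx)]
    have hw : 0 ≤ wF B r x ^ (k + 1) := pow_nonneg (wF_nonneg x) _
  · exact mul_nonneg (hp0 x hx) hw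
  · exact mul_nonneg (hq0 x hx) hw
  · have := mul_le_mul_of_nonneg_right (hmpq x hx) (mul_nonneg hw hw)
    nlinarith

theorem wInt_q_mul (hf : MB ρ f) (h : RadBd C ρ a B) (hC : 1 ≤ C) (hr : 0 ≤ r) (hρ : C * r ≤ ρ)
    (k : ℕ) : wInt B (fun x => qF B x * f x) (k + 1) r
      = r ^ 2 * wInt B f (k + 1) r - wInt B f (k + 2) r := by
  unfold wInt
  rw [← integral_const_mul, ← integral_sub ((hf.int h hC hr hρ k).const_mul _) (hf.int h hC hr hρ (k + 1))]
  refine integral_congr_ae (Filter.Eventually.of_forall fun x => ?_)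
  simp only
  rcases le_total (r ^ 2 - qF B x) 0 with hw | hw
  · simp [wF, max_eq_right hw]
  · rw [wF, max_eq_left hw]; ring

theorem wInt_hasDerivAt (hf : MB ρ f) (h : RadBd C ρ a B) (hC : 1 ≤ C) (hr : 0 < r)
    (hρ : C * r < ρ) (k : ℕ) :
    HasDerivAt (wInt B f (k + 2)) ((k + 2 : ℕ) * 2 * r * wInt B f (k + 1) r) r := by
  obtain ⟨mf, M, hM⟩ := hf
  have hC0 : 0 < C := by linarith
  refine hasDerivAt_integral_trunc (r1 := ρ / C) (ρ := ρ) (M := M) k mf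
    (sm_qF B).continuous.measurable (h.q_nonneg hC) hr (by rw [lt_div_iff₀ hC0]; linarith) ?_ hM
  intro x hx
  have h1 := h.q_low x
  have hρ0 : 0 < ρ := lt_trans (by positivity) hρ
  have h2 : ρ ^ 2 ≤ ‖x‖ ^ 2 := pow_le_pow_left₀ hρ0.le hx.le 2
  rw [div_pow, div_le_iff₀ (by positivity)]
  have h3 : C * qF B x ≤ C ^ 2 * qF B x :=
    mul_le_mul_of_nonneg_right (by nlinarith) (h.q_nonneg hC x)
  linarith

theorem RadBd.mb_mu (h : RadBd C ρ a B) (hop : IsOp L a b) (hC : 1 ≤ C) : MB ρ (muF a B) :=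
  ⟨hop.measurable_mu, 2, fun x hx => abs_le.2
    ⟨by linarith [h.mu_low hC hx], h.mu_up hC hx⟩⟩

theorem RadBd.mb_beta (h : RadBd C ρ a B) (hop : IsOp L a b) (hC : 1 ≤ C) (hρ : 0 ≤ ρ) (i : Fin n) :
    MB ρ (betaF a B i) :=
  ⟨hop.measurable_beta i, (h.bd_beta hC hρ i).2.imp fun _ hM x hx => (hM.2 x hx).1⟩

theorem BD.mb (hf : BD ρ f) (hm : Measurable f) : MB ρ f :=
  ⟨hm, hf.2.imp fun _ hM x hx => (hM.2 x hx).1⟩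

theorem BD.mb_pd (hf : BD ρ f) (i : Fin n) : MB ρ (pd i f) :=
  ⟨measurable_pd f i, hf.2.imp fun _ hM x hx => (hM.2 x hx).2 i⟩

theorem MB.sum {F : Fin n → EuclideanSpace ℝ (Fin n) → ℝ} (hF : ∀ j, MB ρ (F j)) :
    MB ρ fun x => ∑ j, F j x := by
  choose m M hM using hF
  exact ⟨Finset.measurable_fun_sum _ fun j _ => m j, ∑ j, M j, fun x hx =>
    (Finset.abs_sum_le_sum_abs _ _).trans (Finset.sum_le_sum fun j _ => hM j x hx)⟩

/-- The weighted height function. -/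
def hgt (a : Fin n → Fin n → EuclideanSpace ℝ (Fin n) → ℝ) (B : Fin n → Fin n → ℝ)
    (u : EuclideanSpace ℝ (Fin n) → ℝ) (r : ℝ) : ℝ := wInt B (fun x => u x ^ 2 * muF a B x) 2 r

theorem RadBd.height_identity (h : RadBd C ρ a B) (hop : IsOp L a b) (hC : 1 ≤ C) (hu : Sm u)
    (hr : 0 ≤ r) (hρ : C * r < ρ) :
    |r * (4 * r * wInt B (fun x => u x ^ 2 * muF a B x) 1 r)
        - 2 * wInt B (fun x => u x * XD a B u x) 2 r - (n + 4) * hgt a B u r|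
      ≤ (2 * (1 + 2 * n) * C * (C * r)) * hgt a B u r := by
  have hρ0 : 0 ≤ ρ := le_trans (by positivity) hρ.le
  have hu2 : Sm fun x => u x ^ 2 := hu.pow 2
  have hX := fun i => hop.sm_XF B i
  have hmu := h.mb_mu hop hC
  have hmain : MB ρ fun x => u x ^ 2 * muF a B x := hu2.mb.mul hmu
  have hdiv : MB ρ fun x => ∑ i, pd i (XF a B i) x := MB.sum fun i => ((hX i).pd i).mb
  have hXD : MB ρ fun x => u x * XD a B u x := hu.mb.mul (hop.sm_XD hu).mb
  have key := h.trunc_div hC hr hρ 0 (Φ := fun i x => u x ^ 2 * XF a B i x)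
    (fun i => (hu2.mul (hX i)).bd ρ) (fun i => (hu2.mul (hX i)).continuous.measurable)
  have e1 : ∀ x, ∑ i, pd i (fun x => u x ^ 2 * XF a B i x) x
      = 2 * (u x * XD a B u x) + u x ^ 2 * ∑ i, pd i (XF a B i) x := by
    intro x
    have : ∀ i, pd i (fun x => u x ^ 2 * XF a B i x) x
        = 2 * (u x * (XF a B i x * pd i u x)) + u x ^ 2 * pd i (XF a B i) x := by
      intro i
      rw [pd_mul_at (hu2.differentiable x) ((hX i).differentiable x), pd_pow_at (hu.differentiable x)]
      push_cast
      ring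
    simp only [this, Finset.sum_add_distrib, ← Finset.mul_sum]
    rfl
  have e2 : ∀ x, ∑ i, yF B i x * (u x ^ 2 * XF a B i x) = qF B x * (u x ^ 2 * muF a B x) := by
    intro x
    have h1 := h.mu_mul_q hC hρ0 x
    have h2 : ∑ i, yF B i x * (u x ^ 2 * XF a B i x) = u x ^ 2 * nuF a B x := by
      unfold nuF
      rw [Finset.mul_sum]
      exact Finset.sum_congr rfl fun i _ => by ring
    rw [h2, ← h1]; ring
  simp only [e1, e2] at key
  change wInt B _ (1 + 1) r = 2 * (((0 : ℕ) : ℝ) + 2) * wInt B _ (0 + 1) r at key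
  rw [wInt_add ((MB.const 2).mul hXD) (hu2.mb.mul hdiv) h hC hr hρ.le, wInt_const_mul,
    wInt_q_mul hmain h hC hr hρ.le] at key
  have e3 : wInt B (fun x => u x ^ 2 * (∑ i, pd i (XF a B i) x - n * muF a B x)) (1 + 1) r
      = wInt B (fun x => u x ^ 2 * ∑ i, pd i (XF a B i) x) (1 + 1) r - n * hgt a B u r := by
    unfold hgt
    rw [← wInt_const_mul, ← wInt_sub (hu2.mb.mul hdiv) ((MB.const _).mul hmain) h hC hr hρ.le]
    refine wInt_congr h hC hr 1 fun x _ => by ring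
  have e4 : r * (4 * r * wInt B (fun x => u x ^ 2 * muF a B x) 1 r)
        - 2 * wInt B (fun x => u x * XD a B u x) 2 r - (n + 4) * hgt a B u r
      = wInt B (fun x => u x ^ 2 * (∑ i, pd i (XF a B i) x - n * muF a B x)) (1 + 1) r := by
    rw [e3]
    unfold hgt
    norm_num at key ⊢
    linarith
  rw [e4]
  refine wInt_abs_le (hu2.mb.mul (hdiv.sub ((MB.const _).mul hmu))) hmain h hC hr hρ.le 1 _ ?_
  intro x hx
  have hxρ := hx.trans hρ.le
  have h1 := h.div_X x hxρ
  have h2 := h.mu_sub hC hxρ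
  have h3 := h.mu_low hC hxρ
  rw [abs_mul, abs_of_nonneg (sq_nonneg (u x))]
  have h4 : |∑ i, pd i (XF a B i) x - n * muF a B x| ≤ (1 + 2 * n) * C * (C * r) := by
    have e : ∑ i, pd i (XF a B i) x - n * muF a B x
      = (∑ i, pd i (XF a B i) x - n) - n * (muF a B x - 1) := by ring
    rw [e]
    refine (abs_sub _ _).trans ?_
    rw [abs_mul, abs_of_nonneg (Nat.cast_nonneg n : (0:ℝ) ≤ n)]
    have h5 := mul_le_mul_of_nonneg_left h2 (Nat.cast_nonneg n : (0:ℝ) ≤ n)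
    have h6 : C * ‖x‖ ≤ C * (C * r) := mul_le_mul_of_nonneg_left hx (by linarith)
    have h7 := mul_le_mul_of_nonneg_left h6 (by positivity : (0:ℝ) ≤ 1 + 2 * n)
    linarith
  have h5 : 0 ≤ (1 + 2 * n) * C * (C * r) := (abs_nonneg _).trans h4
  calc u x ^ 2 * |∑ i, pd i (XF a B i) x - n * muF a B x|
      ≤ u x ^ 2 * ((1 + 2 * n) * C * (C * r)) := mul_le_mul_of_nonneg_left h4 (sq_nonneg _)
    _ ≤ u x ^ 2 * ((1 + 2 * n) * C * (C * r)) * (2 * muF a B x) :=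
        le_mul_of_one_le_right (mul_nonneg (sq_nonneg _) h5) (by linarith)
    _ = _ := by ring

theorem RadBd.energy_identity (h : RadBd C ρ a B) (hop : IsOp L a b) (hC : 1 ≤ C) (hu : Sm u)
    (hr : 0 ≤ r) (hρ : C * r < ρ) (hsol : ∀ x, ‖x‖ ≤ ρ → Lop a b u x = 0) :
    6 * wInt B (fun x => u x * XD a B u x) 2 r
      = wInt B (enF a u) 3 r - wInt B (fun x => u x * kapF a b u x) 3 r := by
  have hA := fun i => hop.sm_fluxF hu i
  have key := h.trunc_div hC hr hρ 1 (Φ := fun i x => u x * fluxF a u i x)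
    (fun i => (hu.mul (hA i)).bd ρ) (fun i => (hu.mul (hA i)).continuous.measurable)
  have e2 : ∀ x, ∑ i, yF B i x * (u x * fluxF a u i x) = u x * XD a B u x := by
    intro x
    rw [← hop.sum_y_flux, Finset.mul_sum]
    exact Finset.sum_congr rfl fun i _ => by ring
  simp only [e2] at key
  change wInt B _ (2 + 1) r = 2 * (((1 : ℕ) : ℝ) + 2) * wInt B _ 2 r at key
  rw [wInt_congr (g := fun x => enF a u x - u x * kapF a b u x) h hC hr 2, wInt_sub (hop.sm_enF hu).mb
    (hu.mul (hop.sm_kapF hu)).mb h hC hr hρ.le 2] at key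
  · norm_num at key ⊢
    linarith
  · intro x hx
    have e1 : ∀ i, pd i (fun x => u x * fluxF a u i x) x
        = fluxF a u i x * pd i u x + u x * pd i (fluxF a u i) x := by
      intro i
      rw [pd_mul_at (hu.differentiable x) ((hA i).differentiable x)]
      ring
    simp only [e1, Finset.sum_add_distrib, ← Finset.mul_sum]
    rw [hop.sum_pd_flux hu (hsol x (hx.trans hρ.le))]
    unfold enF
    ring

/-- The constant in `RadBd.rellich_bound`. -/
def rellichC (n : ℕ) (C L : ℝ) : ℝ :=
  n * C * (n ^ 2 * (L * L)) + n * C + 2 * (n ^ 2 * (C * (n * L * L)))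
    + 2 * (n * C * (n * (L + n * L)) * L)

theorem RadBd.rellich_identity (h : RadBd C ρ a B) (hop : IsOp L a b) (hC : 1 ≤ C) (hu : Sm u)
    (hr : 0 ≤ r) (hρ : C * r < ρ) (hsol : ∀ x, ‖x‖ ≤ ρ → Lop a b u x = 0) :
    |6 * r ^ 2 * wInt B (enF a u) 2 r - (n + 4) * wInt B (enF a u) 3 r
        - 12 * wInt B (fun x => muF a B x * betaD a B u x ^ 2) 2 r|
      ≤ (rellichC n C L * (C * r)) * wInt B (enF a u) 3 r := by
  have hρ0 : 0 ≤ ρ := le_trans (by positivity) hρ.le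
  have hA := fun i => hop.sm_fluxF hu i
  have hG := hop.sm_enF hu
  have hmu := h.mb_mu hop hC
  have hbet := fun i => h.bd_beta hC hρ0 i
  have hV : BD ρ (betaD a B u) := BD.sum fun i => (hbet i).mul ((hu.pd i).bd ρ)
  have hVm : MB ρ (betaD a B u) := hV.mb (hop.measurable_betaD hu)
  have h2V : BD ρ fun x => 2 * betaD a B u x := (Sm.bd contDiff_const ρ).mul hV
  have hΦ : ∀ i, BD ρ fun y => enF a u y * betaF a B i y - 2 * betaD a B u y * fluxF a u i y :=
    fun i => ((hG.bd ρ).mul (hbet i)).sub (h2V.mul ((hA i).bd ρ))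
  have hΦm : ∀ i, Measurable fun y => enF a u y * betaF a B i y - 2 * betaD a B u y * fluxF a u i y :=
    fun i => (hG.continuous.measurable.mul (hop.measurable_beta i)).sub
      ((measurable_const.mul (hop.measurable_betaD hu)).mul (hA i).continuous.measurable)
  have hmuV : MB ρ fun x => muF a B x * betaD a B u x ^ 2 := by
    simp only [pow_two]
    exact hmu.mul (hVm.mul hVm)
  have hGq : MB ρ fun x => qF B x * enF a u x := ((sm_qF B).mul hG).mb
  have key := h.trunc_div hC hr hρ 1 hΦ hΦm
  change wInt B _ (2 + 1) r = 2 * (((1 : ℕ) : ℝ) + 2) * wInt B _ (1 + 1) r at key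
  rw [wInt_congr (f := fun x => ∑ i, yF B i x *
    (enF a u x * betaF a B i x - 2 * betaD a B u x * fluxF a u i x))
    (g := fun x => qF B x * enF a u x - 2 * (muF a B x * betaD a B u x ^ 2)) h hC hr 1,
    wInt_sub hGq ((MB.const 2).mul hmuV) h hC hr hρ.le, wInt_const_mul,
    wInt_q_mul hG.mb h hC hr hρ.le] at key
  swap
  · intro x hx
    have e1 := h.sum_y_beta hC (hx.trans hρ.le)
    have e2 := hop.sum_y_flux (B := B) (u := u) x
    have e3 := h.XD_eq (u := u) hC (hx.trans hρ.le)
    have : ∑ i, yF B i x * (enF a u x * betaF a B i x - 2 * betaD a B u x * fluxF a u i x)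
        = enF a u x * (∑ i, yF B i x * betaF a B i x)
          - 2 * betaD a B u x * ∑ i, yF B i x * fluxF a u i x := by
      rw [Finset.mul_sum, Finset.mul_sum, ← Finset.sum_sub_distrib]
      exact Finset.sum_congr rfl fun i _ => by ring
    rw [this, e1, e2, e3]
    ring
  have hR : MB ρ fun x => ∑ i, pd i (fun y => enF a u y * betaF a B i y
      - 2 * betaD a B u y * fluxF a u i y) x := MB.sum fun i => (hΦ i).mb_pd i
  have e4 : 6 * r ^ 2 * wInt B (enF a u) 2 r - (n + 4) * wInt B (enF a u) 3 r
        - 12 * wInt B (fun x => muF a B x * betaD a B u x ^ 2) 2 r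
      = wInt B (fun x => (∑ i, pd i (fun y => enF a u y * betaF a B i y
      - 2 * betaD a B u y * fluxF a u i y) x) - (n - 2) * enF a u x) (2 + 1) r := by
    rw [wInt_sub hR ((MB.const _).mul hG.mb) h hC hr hρ.le, wInt_const_mul, key]
    norm_num
    ring
  rw [e4]
  refine wInt_abs_le (hR.sub ((MB.const _).mul hG.mb)) hG.mb h hC hr hρ.le 2 _ ?_
  intro x hx
  have hxρ := hx.trans hρ.le
  rw [h.rellich_div hop hu hxρ (hsol x hxρ)]
  refine (h.rellich_bound hop hC hxρ).trans ?_
  have hL := hop.one_le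
  refine mul_le_mul_of_nonneg_right (mul_le_mul_of_nonneg_left hx ?_) (hop.enF_nonneg x)
  have : 0 ≤ L := by linarith
  positivity

end Integrals

section HeightDoubling
variable {n : ℕ} {ρ r C L : ℝ} {B : Fin n → Fin n → ℝ}
  {a : Fin n → Fin n → EuclideanSpace ℝ (Fin n) → ℝ}
  {b : Fin n → EuclideanSpace ℝ (Fin n) → ℝ} {u : EuclideanSpace ℝ (Fin n) → ℝ}

theorem IsOp.kapF_sq_le (h : IsOp L a b) (x : EuclideanSpace ℝ (Fin n)) :
    kapF a b u x ^ 2 ≤ (n * (L + n * L)) ^ 2 * L * enF a u x := by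
  have hL : 0 ≤ L := by linarith [h.one_le]
  have := h.abs_pd_mul_le x (h.abs_kapF_le (u := u) x) (h.abs_kapF_le x) (by positivity) (by positivity)
  rw [abs_of_nonneg (mul_self_nonneg _)] at this
  linarith

theorem RadBd.drift_energy_sq_le (h : RadBd C ρ a B) (hop : IsOp L a b) (hC : 1 ≤ C) (hu : Sm u)
    (hr : 0 ≤ r) (hρ : C * r < ρ) :
    wInt B (fun x => u x * kapF a b u x) 3 r ^ 2
      ≤ 2 * ((n * (L + n * L)) ^ 2 * L) * r ^ 2 * hgt a B u r * wInt B (enF a u) 3 r := by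
  have hL : 0 ≤ L := by linarith [hop.one_le]
  set K := (n * (L + n * L)) ^ 2 * L with hK
  have hK0 : 0 ≤ K := by positivity
  have hk := hop.sm_kapF hu
  have hG := hop.sm_enF hu
  have hmain : MB ρ fun x => u x ^ 2 * muF a B x := (Sm.mb (hu.pow 2)).mul (h.mb_mu hop hC)
  have hq : MB ρ fun x => 2 * K * r ^ 2 * enF a u x := (MB.const _).mul hG.mb
  have key := sq_integral_le (m := fun x => u x * kapF a b u x * wF B r x ^ 3)
    (p := fun x => u x ^ 2 * muF a B x * wF B r x ^ 2)
    (q := fun x => 2 * K * r ^ 2 * enF a u x * wF B r x ^ 3) ((hu.mul hk).mb.int h hC hr hρ.le 2)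
    (hmain.int h hC hr hρ.le 1) (hq.int h hC hr hρ.le 2) ?_ ?_ ?_
  · have e : wInt B (fun x => 2 * K * r ^ 2 * enF a u x) 3 r
      = 2 * K * r ^ 2 * wInt B (enF a u) 3 r := wInt_const_mul _ _
    have : wInt B (fun x => u x * kapF a b u x) 3 r ^ 2
      ≤ hgt a B u r * wInt B (fun x => 2 * K * r ^ 2 * enF a u x) 3 r := key
    rw [e] at this
    linarith
  · intro x
    by_cases hx : ‖x‖ ≤ ρ
    · exact mul_nonneg (mul_nonneg (sq_nonneg _) (by linarith [h.mu_low hC hx])) (sq_nonneg _)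
    · simp [h.wF_eq_zero hC hr (hρ.trans (not_le.1 hx))]
  · intro x
    exact mul_nonneg (mul_nonneg (by positivity) (hop.enF_nonneg x)) (pow_nonneg (wF_nonneg x) _)
  · intro x
    by_cases hx : ‖x‖ ≤ ρ
    swap
    · simp [h.wF_eq_zero hC hr (hρ.trans (not_le.1 hx))]
    have h1 := h.mu_low hC hx
    have h2 := hop.kapF_sq_le (u := u) x
    have h3 := h.wF_le (r := r) hC x
    have h4 := wF_nonneg (B := B) (r := r) x
    have hG0 := hop.enF_nonneg (u := u) x
    calc (u x * kapF a b u x * wF B r x ^ 3) ^ 2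
        = u x ^ 2 * wF B r x ^ 5 * (kapF a b u x ^ 2 * wF B r x) := by ring
      _ ≤ u x ^ 2 * wF B r x ^ 5 * ((K * enF a u x) * r ^ 2) := by gcongr
      _ ≤ u x ^ 2 * wF B r x ^ 5 * ((K * enF a u x) * r ^ 2) * (2 * muF a B x) :=
          le_mul_of_one_le_right (by positivity) (by linarith)
      _ = _ := by ring

theorem RadBd.drift_sq_le (h : RadBd C ρ a B) (hop : IsOp L a b) (hC : 1 ≤ C) (hu : Sm u)
    (hr : 0 ≤ r) (hρ : C * r < ρ) :
    wInt B (fun x => u x * kapF a b u x) 2 r ^ 2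
      ≤ 2 * ((n * (L + n * L)) ^ 2 * L) * hgt a B u r * wInt B (enF a u) 2 r := by
  have hL : 0 ≤ L := by linarith [hop.one_le]
  set K := (n * (L + n * L)) ^ 2 * L with hK
  have hK0 : 0 ≤ K := by positivity
  have hG := hop.sm_enF hu
  have hmain : MB ρ fun x => u x ^ 2 * muF a B x := (Sm.mb (hu.pow 2)).mul (h.mb_mu hop hC)
  have hq : MB ρ fun x => 2 * K * enF a u x := (MB.const _).mul hG.mb
  have key := wInt_sq_le (hu.mul (hop.sm_kapF hu)).mb hmain hq h hC hr hρ.le 1 ?_ ?_ ?_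
  · rw [wInt_const_mul] at key
    unfold hgt
    linarith
  · intro x hx
    exact mul_nonneg (sq_nonneg _) (by linarith [h.mu_low hC (hx.trans hρ.le)])
  · intro x hx
    exact mul_nonneg (by positivity) (hop.enF_nonneg x)
  · intro x hx
    have h1 := h.mu_low hC (hx.trans hρ.le)
    have h2 := hop.kapF_sq_le (u := u) x
    have hG0 := hop.enF_nonneg (u := u) x
    calc (u x * kapF a b u x) ^ 2 = u x ^ 2 * kapF a b u x ^ 2 := by ring
      _ ≤ u x ^ 2 * (K * enF a u x) := by gcongr
      _ ≤ u x ^ 2 * (K * enF a u x) * (2 * muF a B x) :=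
          le_mul_of_one_le_right (by positivity) (by linarith)
      _ = _ := by ring

theorem RadBd.radial_sq_le (h : RadBd C ρ a B) (hop : IsOp L a b) (hC : 1 ≤ C) (hu : Sm u)
    (hr : 0 ≤ r) (hρ : C * r < ρ) :
    wInt B (fun x => u x * XD a B u x) 2 r ^ 2
      ≤ hgt a B u r * wInt B (fun x => muF a B x * betaD a B u x ^ 2) 2 r := by
  have hρ0 : 0 ≤ ρ := le_trans (by positivity) hρ.le
  have hmu := h.mb_mu hop hC
  have hmain : MB ρ fun x => u x ^ 2 * muF a B x := (Sm.mb (hu.pow 2)).mul hmu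
  have hV : MB ρ (betaD a B u) := MB.sum fun i => (h.mb_beta hop hC hρ0 i).mul (hu.pd i).mb
  have hq : MB ρ fun x => muF a B x * betaD a B u x ^ 2 := by
    simp only [pow_two]
    exact hmu.mul (hV.mul hV)
  refine wInt_sq_le (hu.mul (hop.sm_XD hu)).mb hmain hq h hC hr hρ.le 1 ?_ ?_ ?_
  · intro x hx
    exact mul_nonneg (sq_nonneg _) (by linarith [h.mu_low hC (hx.trans hρ.le)])
  · intro x hx
    exact mul_nonneg (by linarith [h.mu_low hC (hx.trans hρ.le)]) (sq_nonneg _)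
  · intro x hx
    rw [h.XD_eq hC (hx.trans hρ.le)]
    exact le_of_eq (by ring)

theorem wF_mono {s t : ℝ} (hs : 0 ≤ s) (hst : s ≤ t) (x : EuclideanSpace ℝ (Fin n)) :
    wF B s x ≤ wF B t x :=
  max_le_max (sub_le_sub_right (pow_le_pow_left₀ hs hst 2) _) le_rfl

theorem RadBd.hgt_mono (h : RadBd C ρ a B) (hop : IsOp L a b) (hC : 1 ≤ C) (hu : Sm u) {s t : ℝ}
    (hs : 0 ≤ s) (hst : s ≤ t) (hρ : C * t ≤ ρ) : hgt a B u s ≤ hgt a B u t := by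
  have hmain : MB ρ fun x => u x ^ 2 * muF a B x := (Sm.mb (hu.pow 2)).mul (h.mb_mu hop hC)
  have hρs : C * s ≤ ρ := (mul_le_mul_of_nonneg_left hst (by linarith)).trans hρ
  refine integral_mono (hmain.int h hC hs hρs 1) (hmain.int h hC (hs.trans hst) hρ 1) fun x => ?_
  simp only
  by_cases hx : ‖x‖ ≤ ρ
  · exact mul_le_mul_of_nonneg_left (pow_le_pow_left₀ (wF_nonneg x) (wF_mono hs hst x) _)
      (mul_nonneg (sq_nonneg _) (by linarith [h.mu_low hC hx]))
  · rw [h.wF_eq_zero hC hs (hρs.trans_lt (not_le.1 hx)),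
      h.wF_eq_zero hC (hs.trans hst) (hρ.trans_lt (not_le.1 hx))]

theorem RadBd.hgt_nonneg (h : RadBd C ρ a B) (hC : 1 ≤ C) (hr : 0 ≤ r) (hρ : C * r ≤ ρ) :
    0 ≤ hgt a B u r :=
  wInt_nonneg h hC hr 1 fun x hx =>
    mul_nonneg (sq_nonneg _) (by linarith [h.mu_low hC (hx.trans hρ)])

/-- Quantitative doubling for the weighted height of a solution about the origin. -/
theorem hgt_doubling (n : ℕ) (L : ℝ) (hL : 1 ≤ L) : ∃ (C r₀ D : ℝ) (k : ℕ),
    1 ≤ C ∧ 0 < r₀ ∧ r₀ ≤ 1 ∧ 0 < D ∧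
    ∀ (a : Fin n → Fin n → EuclideanSpace ℝ (Fin n) → ℝ)
      (b : Fin n → EuclideanSpace ℝ (Fin n) → ℝ) (B : Fin n → Fin n → ℝ),
      IsOp L a b → IsInvAt L a B → RadBd C r₀ a B ∧
      ∀ u, Sm u → ∀ ρ, 0 < ρ → ρ ≤ r₀ → (∀ x, ‖x‖ ≤ ρ → Lop a b u x = 0) →
        ∀ s t, 0 < s → 2 * s ≤ t → C * (2 * t) < ρ →
          hgt a B u (2 * s) * hgt a B u t ^ k ≤ D * hgt a B u s * hgt a B u (2 * t) ^ k := by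
  obtain ⟨C, ρ₀, hC, hρ₀, hρ₁, hrad⟩ := radial_bounds n L hL
  have hC0 : 0 < C := by linarith
  set K := (n * (L + n * L)) ^ 2 * L with hK
  have hK0 : 0 ≤ K := by positivity
  have hR0 : 0 ≤ rellichC n C L := by unfold rellichC; positivity
  set T := 1 + 2 * (1 + 2 * n) * C * C + rellichC n C L * C + 2 * K with hT
  have hT1 : 1 ≤ T := by
    have : 0 ≤ 2 * (1 + 2 * n) * C * C + rellichC n C L * C := by positivity
    linarith
  have hTa : 2 * (1 + 2 * n) * C * C ≤ T := by
    have : 0 ≤ rellichC n C L * C := by positivity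
    linarith
  have hTb : rellichC n C L * C ≤ T := by
    have : 0 ≤ 2 * (1 + 2 * n) * C * C := by positivity
    linarith
  have hTc : 2 * K ≤ T := by
    have : 0 ≤ 2 * (1 + 2 * n) * C * C + rellichC n C L * C := by positivity
    linarith
  obtain ⟨r₀, D, k, hr₀, hr₁, hD, hode⟩ := frequency_ode (n + 4) T (by positivity) hT1
  refine ⟨C, min ρ₀ r₀, D, k, hC, lt_min hρ₀ hr₀, (min_le_left _ _).trans hρ₁, hD, ?_⟩
  intro a b B hop hB
  have hrb := hrad a b B hop hB
  refine ⟨hrb.mono (min_le_left _ _), ?_⟩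
  intro u hu ρ hρ hρr hsol s t hs hst ht
  have h := hrb.mono (hρr.trans (min_le_left _ _))
  have hlt : ∀ r, r < ρ / C → C * r < ρ := fun r hr => by
    rw [lt_div_iff₀ hC0] at hr; linarith
  have hG := hop.sm_enF hu
  have hH0 : ∀ r, 0 < r → r < ρ / C → 0 ≤ hgt a B u r := fun r hr hrr =>
    h.hgt_nonneg hC hr.le (hlt r hrr).le
  have hI0 : ∀ (k : ℕ) (r : ℝ), 0 < r → 0 ≤ wInt B (enF a u) (k + 1) r := fun k r hr =>
    wInt_nonneg h hC hr.le k fun x _ => hop.enF_nonneg x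
  have hEid : ∀ r, 0 < r → r < ρ / C → 6 * wInt B (fun x => u x * XD a B u x) 2 r
      = wInt B (enF a u) 3 r - wInt B (fun x => u x * kapF a b u x) 3 r := fun r hr hrr =>
    h.energy_identity hop hC hu hr.le (hlt r hrr) hsol
  refine hode (ρ / C) (hgt a B u) (wInt B (fun x => u x * XD a B u x) 2) (wInt B (enF a u) 3)
    (wInt B (enF a u) 2) (wInt B (fun x => muF a B x * betaD a B u x ^ 2) 2)
    (wInt B (fun x => u x * kapF a b u x) 3) (wInt B (fun x => u x * kapF a b u x) 2)
    (fun r => 4 * r * wInt B (fun x => u x ^ 2 * muF a B x) 1 r) ?_ ?_ ?_ ?_ ?_ ?_ ?_ ?_ ?_ ?_ ?_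
    s t hs hst (by rw [lt_div_iff₀ hC0]; linarith)
  · exact (div_le_self hρ.le hC).trans (hρr.trans (min_le_right _ _))
  · intro r hr hrr
    refine ⟨hH0 r hr hrr, hI0 2 r hr, hI0 1 r hr, wInt_nonneg h hC hr.le 1 fun x hx => ?_⟩
    exact mul_nonneg (by linarith [h.mu_low hC (hx.trans (hlt r hrr).le)]) (sq_nonneg _)
  · intro s t hs hst ht
    exact h.hgt_mono hop hC hu hs.le hst (hlt t ht).le
  · intro r hr hrr
    have hmain : MB ρ fun x => u x ^ 2 * muF a B x := (Sm.mb (hu.pow 2)).mul (h.mb_mu hop hC)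
    have := wInt_hasDerivAt hmain h hC hr (hlt r hrr) 0
    refine this.congr_deriv ?_
    norm_num
  · intro r hr hrr
    have h1 := (wInt_hasDerivAt hG.mb h hC hr (hlt r hrr) 1).sub
      (wInt_hasDerivAt (hu.mul (hop.sm_kapF hu)).mb h hC hr (hlt r hrr) 1)
    have h2 : wInt B (fun x => u x * XD a B u x) 2 =ᶠ[nhds r] fun r =>
        6⁻¹ * (wInt B (enF a u) (1 + 2) r - wInt B (fun x => u x * kapF a b u x) (1 + 2) r) := by
      filter_upwards [Ioo_mem_nhds hr hrr] with y hy
      have := hEid y hy.1 hy.2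
      norm_num
      linarith
    refine ((h1.const_mul 6⁻¹).congr_of_eventuallyEq h2).congr_deriv ?_
    norm_num
    ring
  · intro r hr hrr
    refine (h.height_identity hop hC hu hr.le (hlt r hrr)).trans ?_
    refine mul_le_mul_of_nonneg_right ?_ (hH0 r hr hrr)
    have := mul_le_mul_of_nonneg_right hTa hr.le
    linarith
  · exact hEid
  · intro r hr hrr
    refine (h.rellich_identity hop hC hu hr.le (hlt r hrr) hsol).trans ?_
    refine mul_le_mul_of_nonneg_right ?_ (hI0 2 r hr)
    have := mul_le_mul_of_nonneg_right hTb hr.le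
    linarith
  · intro r hr hrr
    refine (h.drift_energy_sq_le hop hC hu hr.le (hlt r hrr)).trans ?_
    have h1 := hH0 r hr hrr
    have h2 := hI0 2 r hr
    have : 2 * ((n * (L + n * L)) ^ 2 * L) ≤ T := hTc
    gcongr
  · intro r hr hrr
    refine (h.drift_sq_le hop hC hu hr.le (hlt r hrr)).trans ?_
    have h1 := hH0 r hr hrr
    have h2 := hI0 1 r hr
    have : 2 * ((n * (L + n * L)) ^ 2 * L) ≤ T := hTc
    gcongr
  · intro r hr hrr
    exact h.radial_sq_le hop hC hu hr.le (hlt r hrr)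

end HeightDoubling

section Translation
variable {n : ℕ} {L : ℝ} {a : Fin n → Fin n → EuclideanSpace ℝ (Fin n) → ℝ}
  {b : Fin n → EuclideanSpace ℝ (Fin n) → ℝ} {u : EuclideanSpace ℝ (Fin n) → ℝ}

theorem pd_translate (f : EuclideanSpace ℝ (Fin n) → ℝ) (c : EuclideanSpace ℝ (Fin n)) (i : Fin n)
    (x : EuclideanSpace ℝ (Fin n)) : pd i (fun y => f (c + y)) x = pd i f (c + x) := by
  unfold pd
  rw [fderiv_comp_add_left]

theorem Sm.translate (hu : Sm u) (c : EuclideanSpace ℝ (Fin n)) : Sm fun y => u (c + y) :=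
  hu.comp (contDiff_const.add contDiff_id)

theorem IsOp.translate (h : IsOp L a b) (c : EuclideanSpace ℝ (Fin n)) :
    IsOp L (fun i j y => a i j (c + y)) fun i y => b i (c + y) where
  one_le := h.one_le
  sm_a i j := (h.sm_a i j).translate c
  sm_b i := (h.sm_b i).translate c
  symm i j x := h.symm i j _
  ell x := h.ell _
  bd_a i j x := h.bd_a i j _
  bd_da k i j x := by rw [pd_translate]; exact h.bd_da k i j _
  bd_b i x := h.bd_b i _
  bd_db k i x := by rw [pd_translate]; exact h.bd_db k i _

theorem Lop_translate (c x : EuclideanSpace ℝ (Fin n)) :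
    Lop (fun i j y => a i j (c + y)) (fun i y => b i (c + y)) (fun y => u (c + y)) x
      = Lop a b u (c + x) := by
  have h1 : ∀ j, pd j (fun y => u (c + y)) = fun y => pd j u (c + y) := fun j =>
    funext fun y => pd_translate u c j y
  unfold Lop
  simp only [h1, pd_translate]

end Translation

section SupNorm
variable {n : ℕ}

/-- The supremum of `|u|` over a closed ball. -/
def supN (u : EuclideanSpace ℝ (Fin n) → ℝ) (x : EuclideanSpace ℝ (Fin n)) (r : ℝ) : ℝ :=
  sSup ((fun y => |u y|) '' closedBall x r)

variable {u : EuclideanSpace ℝ (Fin n) → ℝ} {x y : EuclideanSpace ℝ (Fin n)} {r s : ℝ}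

theorem le_supN (hu : Continuous u) (hy : y ∈ closedBall x r) : |u y| ≤ supN u x r :=
  le_csSup ((isCompact_closedBall x r).image hu.abs).bddAbove ⟨y, hy, rfl⟩

theorem exists_supN (hu : Continuous u) (x : EuclideanSpace ℝ (Fin n)) (hr : 0 ≤ r) :
    ∃ y ∈ closedBall x r, |u y| = supN u x r :=
  ((isCompact_closedBall x r).image hu.abs).sSup_mem
    ⟨|u x|, x, mem_closedBall_self hr, rfl⟩

theorem supN_le {M : ℝ} (hr : 0 ≤ r) (hM : ∀ y ∈ closedBall x r, |u y| ≤ M) : supN u x r ≤ M := by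
  refine csSup_le ⟨|u x|, x, mem_closedBall_self hr, rfl⟩ ?_
  rintro _ ⟨y, hy, rfl⟩
  exact hM y hy

theorem supN_nonneg (u : EuclideanSpace ℝ (Fin n) → ℝ) (x : EuclideanSpace ℝ (Fin n)) (r : ℝ) :
    0 ≤ supN u x r := by
  refine Real.sSup_nonneg ?_
  rintro _ ⟨y, -, rfl⟩
  exact abs_nonneg _

theorem supN_mono (hu : Continuous u) (hr : 0 ≤ r) (h : closedBall x r ⊆ closedBall y s) :
    supN u x r ≤ supN u y s :=
  supN_le hr fun _ hz => le_supN hu (h hz)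

theorem supN_mono_radius (hu : Continuous u) (hr : 0 ≤ r) (h : r ≤ s) :
    supN u x r ≤ supN u x s :=
  supN_mono hu hr (closedBall_subset_closedBall h)

theorem supN_translate (c : EuclideanSpace ℝ (Fin n)) :
    supN (fun y => u (c + y)) 0 r = supN u c r := by
  unfold supN
  congr 1
  ext t
  constructor
  · rintro ⟨y, hy, rfl⟩
    exact ⟨c + y, by simpa using hy, rfl⟩
  · rintro ⟨y, hy, rfl⟩
    exact ⟨y - c, by simpa [dist_eq_norm] using hy, by simp⟩

end SupNorm

theorem lip_le (n : ℕ) (L : ℝ) (hL : 1 ≤ L) : ∃ C : ℝ, 1 ≤ C ∧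
    ∀ (a : Fin n → Fin n → EuclideanSpace ℝ (Fin n) → ℝ)
      (b : Fin n → EuclideanSpace ℝ (Fin n) → ℝ), IsOp L a b →
      ∀ u, Sm u → ∀ (x : EuclideanSpace ℝ (Fin n)) (s M : ℝ), 0 < s → s ≤ 1 →
        (∀ y ∈ ball x (2 * s), Lop a b u y = 0) → (∀ y ∈ ball x (2 * s), |u y| ≤ M) →
        ∀ y ∈ ball x s, ∀ z ∈ ball x s, |u y - u z| ≤ C / s * M * dist y z := by
  obtain ⟨C, hC, hgrad⟩ := grad_le n L hL
  refine ⟨max C 1, le_max_right _ _, ?_⟩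
  intro a b hop u hu x s M hs hs1 hsol hM y hy z hz
  have hM0 : 0 ≤ M := (abs_nonneg _).trans (hM x (mem_ball_self (by linarith)))
  have hsub : ∀ w ∈ ball x s, ball w s ⊆ ball x (2 * s) := fun w hw =>
    ball_subset_ball' (by linarith [mem_ball.1 hw])
  rw [dist_eq_norm]
  refine Convex.norm_image_sub_le_of_norm_fderiv_le (𝕜 := ℝ) (s := ball x s)
    (fun w _ => hu.differentiable w) ?_ (convex_ball x s) hz hy
  intro w hw
  refine norm_fderiv_le.trans ((hgrad a b hop u hu w s M hs hs1 (fun y hy => hsol y (hsub w hw hy))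
    fun y hy => hM y (hsub w hw hy)).trans ?_)
  gcongr
  exact le_max_left _ _

section LTwo

/-- The sup norm of a solution is controlled by its `L²` norm on a larger ball. -/
theorem sup_le_ltwo (n : ℕ) (hn : 0 < n) (L : ℝ) (hL : 1 ≤ L) : ∃ C : ℝ, 0 < C ∧
    ∀ (a : Fin n → Fin n → EuclideanSpace ℝ (Fin n) → ℝ)
      (b : Fin n → EuclideanSpace ℝ (Fin n) → ℝ), IsOp L a b →
      ∀ u, Sm u → ∀ (x : EuclideanSpace ℝ (Fin n)) (d : ℝ), 0 < d → d ≤ 1 →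
        (∀ y ∈ ball x (2 * d), Lop a b u y = 0) →
        supN u x d ^ 2 * d ^ n ≤ C * ∫ y in ball x (2 * d), u y ^ 2 := by
  obtain ⟨C₁, hC₁, hlip⟩ := lip_le n L hL
  set ω := volume.real (ball (0 : EuclideanSpace ℝ (Fin n)) 1) with hω
  have hω0 : 0 < ω := ENNReal.toReal_pos (measure_ball_pos _ _ one_pos).ne' measure_ball_lt_top.ne
  have hn' : (0 : ℝ) < n := by exact_mod_cast hn
  have hC₁0 : 0 < C₁ := by linarith
  set A : ℝ := 4 * (4 * C₁) ^ n / ω with hA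
  have hA0 : 0 < A := by positivity
  set θ : ℝ := n / (n + 2) with hθ
  have hθ0 : 0 < θ := by positivity
  have hθ1 : θ < 1 := by rw [hθ, div_lt_one (by positivity)]; linarith
  have h1θ : 1 - θ = 2 / (n + 2) := by rw [hθ]; field_simp; ring
  set E : ℝ := 2 * ((θ * (θ / (1 - θ)) + θ) * Real.log 2) / (1 - θ) with hE
  refine ⟨A * Real.exp E, by positivity, ?_⟩
  intro a b hop u hu x d hd hd1 hsol
  have hc := hu.continuous
  set I := ∫ y in ball x (2 * d), u y ^ 2 with hI
  have hI0 : 0 ≤ I := integral_nonneg fun y => sq_nonneg _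
  rcases (supN_nonneg u x d).eq_or_lt with h0 | hpos
  · rw [← h0]
    have : 0 ≤ A * Real.exp E * I := by positivity
    simpa using this
  have hintg : IntegrableOn (fun y => u y ^ 2) (ball x (2 * d)) :=
    ((hc.pow 2).continuousOn.integrableOn_compact (isCompact_closedBall x (2 * d))).mono_set
      ball_subset_closedBall
  have hmono : ∀ s, d ≤ s → 0 < supN u x s := fun s hs =>
    hpos.trans_le (supN_mono_radius hc hd.le hs)
  have hstep0 : ∀ s, d ≤ s → ∀ t, 0 < t → s + t < 2 * d →
      supN u x s ^ (n + 2) * t ^ n ≤ A * I * supN u x (s + t) ^ n := by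
    intro s hs t ht hst
    have hs0 : 0 ≤ s := hd.le.trans hs
    have hMs := hmono s hs
    have hMt := hmono (s + t) (by linarith)
    have hle : supN u x s ≤ supN u x (s + t) := supN_mono_radius hc hs0 (by linarith)
    obtain ⟨z, hz, hzM⟩ := exists_supN hc x hs0
    rw [mem_closedBall] at hz
    have hsub : ball z (2 * (t / 2)) ⊆ closedBall x (s + t) := fun y hy => by
      rw [mem_ball] at hy; rw [mem_closedBall]
      linarith [dist_triangle y z x]
    set σ := t * supN u x s / (4 * C₁ * supN u x (s + t)) with hσ
    have hσ0 : 0 < σ := by positivity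
    have hσt : σ ≤ t / 4 := by
      rw [hσ, div_le_iff₀ (by positivity)]
      have h1 : t * supN u x s ≤ t * supN u x (s + t) := mul_le_mul_of_nonneg_left hle ht.le
      have h2 : t * supN u x (s + t) ≤ C₁ * (t * supN u x (s + t)) :=
        le_mul_of_one_le_left (by positivity) hC₁
      linarith
    have hlow : ∀ y ∈ ball z σ, (supN u x s / 2) ^ 2 ≤ u y ^ 2 := by
      intro y hy
      have hys := mem_ball.1 hy
      have h1 := hlip a b hop u hu z (t / 2) (supN u x (s + t)) (by linarith) (by linarith)
        (fun w hw => hsol w (mem_ball.2 ((mem_closedBall.1 (hsub hw)).trans_lt hst)))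
        (fun w hw => le_supN hc (hsub hw)) y (ball_subset_ball (by linarith) hy) z
        (mem_ball_self (by linarith))
      have h2 : C₁ / (t / 2) * supN u x (s + t) * dist y z ≤ C₁ / (t / 2) * supN u x (s + t) * σ :=
        mul_le_mul_of_nonneg_left hys.le (by positivity)
      have h3 : C₁ / (t / 2) * supN u x (s + t) * σ = supN u x s / 2 := by
        rw [hσ]; field_simp; ring
      have h4 : |u z| - |u y| ≤ |u y - u z| := by
        rw [abs_sub_comm]; exact abs_sub_abs_le_abs_sub _ _
      rw [← sq_abs (u y)]
      exact pow_le_pow_left₀ (by positivity) (by linarith) 2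
    have hsub2 : ball z σ ⊆ ball x (2 * d) := fun y hy => by
      rw [mem_ball] at hy ⊢
      linarith [dist_triangle y z x]
    have hvol : volume.real (ball z σ) = σ ^ n * ω := by
      rw [measureReal_def, Measure.addHaar_ball_of_pos volume z hσ0, ENNReal.toReal_mul,
        ENNReal.toReal_ofReal (by positivity), hω, measureReal_def, finrank_euclideanSpace_fin]
    have hlb : (supN u x s / 2) ^ 2 * (σ ^ n * ω) ≤ I := by
      have h1 : ∫ y in ball z σ, u y ^ 2 ≤ I :=
        setIntegral_mono_set hintg (Filter.Eventually.of_forall fun y => sq_nonneg _)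
          hsub2.eventuallyLE
      have h2 := setIntegral_mono_on (μ := volume) (f := fun _ => (supN u x s / 2) ^ 2)
        (g := fun y => u y ^ 2) (s := ball z σ) (integrableOn_const measure_ball_lt_top.ne)
        (hintg.mono_set hsub2) measurableSet_ball hlow
      rw [setIntegral_const, hvol, smul_eq_mul] at h2
      linarith
    have e1 : supN u x s ^ (n + 2) * t ^ n
        = A * supN u x (s + t) ^ n * ((supN u x s / 2) ^ 2 * (σ ^ n * ω)) := by
      rw [hA, hσ, div_pow (t * supN u x s), mul_pow t, mul_pow (4 * C₁)]
      field_simp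
      ring
    rw [e1]
    calc _ ≤ A * supN u x (s + t) ^ n * I := mul_le_mul_of_nonneg_left hlb (by positivity)
      _ = _ := by ring
  have hIpos : 0 < I := by
    have h1 := hstep0 d le_rfl (d / 2) (by linarith) (by linarith)
    have h2 := hmono (d + d / 2) (by linarith)
    have h3 : 0 < supN u x d ^ (n + 2) * (d / 2) ^ n := by positivity
    by_contra hcon
    have : I = 0 := le_antisymm (not_lt.1 hcon) hI0
    rw [this] at h1
    simp at h1
    linarith
  have key := contraction_bound (f := fun s => Real.log (supN u x s)) (s0 := d) (s1 := 2 * d)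
    (θ := θ) (B := Real.log (A * I) / (n + 2)) (K := θ) (M0 := Real.log (supN u x (2 * d)))
    (by linarith) hθ0 hθ1 hθ0.le ?_ ?_
  · rw [show 2 * d - d = d by ring] at key
    have e0 : θ / (1 - θ) = n / 2 := by rw [h1θ, hθ]; field_simp
    have e2 : 2 * ((Real.log (A * I) / (n + 2) + (θ * (θ / (1 - θ)) + θ) * Real.log 2) / (1 - θ))
        = Real.log (A * I) + E := by
      rw [hE, h1θ]; field_simp
    rw [e0] at key
    have e3 : Real.log (supN u x d ^ 2 * d ^ n) ≤ Real.log (A * I) + E := by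
      rw [Real.log_mul (by positivity) (by positivity), Real.log_pow, Real.log_pow, ← e2, e0]
      push_cast
      linarith
    have e4 : Real.log (A * I) + E = Real.log (A * Real.exp E * I) := by
      rw [show A * Real.exp E * I = A * I * Real.exp E by ring, Real.log_mul (by positivity)
        (Real.exp_pos _).ne', Real.log_exp]
    rw [e4] at e3
    exact (Real.log_le_log_iff (by positivity) (by positivity)).1 e3
  · intro s hs
    exact Real.log_le_log (hmono s hs.1) (supN_mono_radius hc (hd.le.trans hs.1) hs.2.le)
  · intro s hs t ht hst
    have h1 := hstep0 s hs.1 t ht hst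
    have hMs := hmono s hs.1
    have hMt := hmono (s + t) (by linarith [hs.1])
    have h2 := Real.log_le_log (by positivity) h1
    rw [Real.log_mul (by positivity) (by positivity), Real.log_mul (by positivity) (by positivity),
      Real.log_pow, Real.log_pow, Real.log_pow] at h2
    push_cast at h2
    have h3 : Real.log (supN u x s) ≤ (n * Real.log (supN u x (s + t)) + Real.log (A * I)
        - n * Real.log t) / (n + 2) := by
      rw [le_div_iff₀ (by positivity)]; linarith
    refine h3.trans (le_of_eq ?_)
    rw [hθ]; ring

end LTwo

section HeightComparison
variable {n : ℕ} {C L ρ s : ℝ} {a : Fin n → Fin n → EuclideanSpace ℝ (Fin n) → ℝ}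
  {b : Fin n → EuclideanSpace ℝ (Fin n) → ℝ} {B : Fin n → Fin n → ℝ}
  {u : EuclideanSpace ℝ (Fin n) → ℝ}

theorem RadBd.hgt_le (h : RadBd C ρ a B) (hop : IsOp L a b) (hC : 1 ≤ C) (hu : Sm u) (hs : 0 < s)
    (hρ : C * s ≤ ρ) :
    hgt a B u s ≤ 2 * C ^ n * volume.real (ball (0 : EuclideanSpace ℝ (Fin n)) 1) * s ^ (n + 4)
      * supN u 0 (C * s) ^ 2 := by
  have hmain : MB ρ fun x => u x ^ 2 * muF a B x := (Sm.mb (hu.pow 2)).mul (h.mb_mu hop hC)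
  have hCs : 0 < C * s := by positivity
  set M := supN u 0 (C * s) with hM
  have hle : hgt a B u s ≤ ∫ x, (closedBall (0 : EuclideanSpace ℝ (Fin n)) (C * s)).indicator
      (fun _ => M ^ 2 * 2 * (s ^ 2) ^ 2) x := by
    refine integral_mono (hmain.int h hC hs.le hρ 1) ?_ fun x => ?_
    · exact (integrable_indicator_iff measurableSet_closedBall).2
        (integrableOn_const measure_closedBall_lt_top.ne)
    · by_cases hx : ‖x‖ ≤ C * s
      · have hxm : x ∈ closedBall (0 : EuclideanSpace ℝ (Fin n)) (C * s) := by simpa using hx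
        simp only [Set.indicator_of_mem hxm]
        have h1 : u x ^ 2 ≤ M ^ 2 := by
          rw [← sq_abs]
          exact pow_le_pow_left₀ (abs_nonneg _) (le_supN hu.continuous hxm) 2
        have h2 := h.mu_up hC (hx.trans hρ)
        have h3 := h.mu_low hC (hx.trans hρ)
        have h4 := h.wF_le hC (r := s) x
        have h5 := wF_nonneg (B := B) (r := s) x
        gcongr
      · have hxm : x ∉ closedBall (0 : EuclideanSpace ℝ (Fin n)) (C * s) := by simpa using hx
        simp only [Set.indicator_of_notMem hxm]
        rw [h.wF_eq_zero hC hs.le (not_le.1 hx)]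
        simp
  refine hle.trans (le_of_eq ?_)
  rw [integral_indicator measurableSet_closedBall, setIntegral_const, measureReal_def,
    Measure.addHaar_closedBall volume _ hCs.le,
    ENNReal.toReal_mul, ENNReal.toReal_ofReal (by positivity), finrank_euclideanSpace_fin,
    smul_eq_mul, measureReal_def]
  ring

theorem RadBd.integral_sq_le_hgt (h : RadBd C ρ a B) (hop : IsOp L a b) (hC : 1 ≤ C) (hu : Sm u)
    (hs : 0 < s) (hρ : C * s ≤ ρ) :
    s ^ 4 / 8 * ∫ y in ball (0 : EuclideanSpace ℝ (Fin n)) (s / (2 * C)), u y ^ 2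
      ≤ hgt a B u s := by
  have hC0 : 0 < C := by linarith
  have hmain : MB ρ fun x => u x ^ 2 * muF a B x := (Sm.mb (hu.pow 2)).mul (h.mb_mu hop hC)
  have hintg := hmain.int h hC hs.le hρ 1
  rw [← integral_const_mul]
  refine le_trans ?_ (setIntegral_le_integral (s := ball (0 : EuclideanSpace ℝ (Fin n))
    (s / (2 * C))) hintg (Filter.Eventually.of_forall fun x => ?_))
  · refine setIntegral_mono_on ?_ hintg.integrableOn measurableSet_ball fun x hx => ?_
    · exact (((hu.continuous).pow 2).const_mul (s ^ 4 / 8)).continuousOn.integrableOn_compact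
        (isCompact_closedBall _ _) |>.mono_set ball_subset_closedBall
    · have hx1 : ‖x‖ < s / (2 * C) := by simpa using hx
      have hxs : ‖x‖ ≤ C * s := by
        refine hx1.le.trans ?_
        rw [div_le_iff₀ (by positivity)]
        nlinarith [mul_pos hC0 hs, mul_le_mul_of_nonneg_left hC hC0.le, mul_pos (mul_pos hC0 hC0) hs]
      have h3 := h.mu_low hC (hxs.trans hρ)
      have hq : qF B x ≤ s ^ 2 / 2 := by
        refine (h.q_up x).trans ?_
        have : ‖x‖ ^ 2 ≤ (s / (2 * C)) ^ 2 := pow_le_pow_left₀ (norm_nonneg _) hx1.le 2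
        calc C * ‖x‖ ^ 2 ≤ C * (s / (2 * C)) ^ 2 := by gcongr
          _ = s ^ 2 / 4 / C := by field_simp; ring
          _ ≤ s ^ 2 / 4 := div_le_self (by positivity) hC
          _ ≤ _ := by nlinarith [sq_nonneg s]
      have hw : s ^ 2 / 2 ≤ wF B s x := le_trans (by linarith) (le_max_left _ _)
      calc s ^ 4 / 8 * u x ^ 2 = u x ^ 2 * (1 / 2) * (s ^ 2 / 2) ^ 2 := by ring
        _ ≤ _ := by
          have : 0 ≤ muF a B x := by linarith
          simp only
          gcongr
  · simp only [Pi.zero_apply]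
    by_cases hx : ‖x‖ ≤ ρ
    · exact mul_nonneg (mul_nonneg (sq_nonneg _) (by linarith [h.mu_low hC hx]))
        (pow_nonneg (wF_nonneg x) _)
    · rw [h.wF_eq_zero hC hs.le (hρ.trans_lt (not_le.1 hx))]
      simp

end HeightComparison

theorem hgt_doubling_iterate {H : ℝ → ℝ} {C ρ D : ℝ} {k : ℕ} (hD : 0 ≤ D)
    (hH : ∀ s, 0 < s → C * s ≤ ρ → 0 ≤ H s) (hC : 0 ≤ C)
    (hdbl : ∀ s t, 0 < s → 2 * s ≤ t → C * (2 * t) < ρ →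
      H (2 * s) * H t ^ k ≤ D * H s * H (2 * t) ^ k) (j : ℕ) :
    ∀ s t, 0 < s → 2 ^ j * s ≤ t → C * (2 * t) < ρ →
      H (2 ^ j * s) * H t ^ (k * j) ≤ D ^ j * H s * H (2 * t) ^ (k * j) := by
  induction j with
  | zero => intro s t _ _ _; simp
  | succ j ih =>
    intro s t hs hst ht
    have h2 : 2 * (2 ^ j * s) ≤ t := by rw [← mul_assoc, ← pow_succ']; exact hst
    have hp : 0 < 2 ^ j * s := by positivity
    have htp : 0 < t := by linarith
    have e1 := hdbl (2 ^ j * s) t hp h2 ht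
    have e2 := ih s t hs (by linarith) ht
    have hHt : 0 ≤ H t := hH t htp (by nlinarith)
    have hH2t : 0 ≤ H (2 * t) := hH (2 * t) (by linarith) ht.le
    calc H (2 ^ (j + 1) * s) * H t ^ (k * (j + 1))
        = (H (2 * (2 ^ j * s)) * H t ^ k) * H t ^ (k * j) := by
          rw [pow_succ', mul_assoc 2, Nat.mul_add, mul_one, pow_add]; ring
      _ ≤ (D * H (2 ^ j * s) * H (2 * t) ^ k) * H t ^ (k * j) :=
          mul_le_mul_of_nonneg_right e1 (by positivity)
      _ = D * H (2 * t) ^ k * (H (2 ^ j * s) * H t ^ (k * j)) := by ring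
      _ ≤ D * H (2 * t) ^ k * (D ^ j * H s * H (2 * t) ^ (k * j)) :=
          mul_le_mul_of_nonneg_left e2 (by positivity)
      _ = _ := by ring

set_option maxHeartbeats 1000000 in
/-- Doubling at small scales in terms of the ratio at a fixed scale, for suprema. -/
theorem sup_doubling (n : ℕ) (hn : 0 < n) (L : ℝ) (hL : 1 ≤ L) : ∃ (C K r₀ : ℝ) (m : ℕ),
    1 ≤ C ∧ 2 ≤ K ∧ 0 < r₀ ∧ r₀ ≤ 1 ∧
    ∀ (a : Fin n → Fin n → EuclideanSpace ℝ (Fin n) → ℝ)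
      (b : Fin n → EuclideanSpace ℝ (Fin n) → ℝ), IsOp L a b →
      ∀ u, Sm u → ∀ (x : EuclideanSpace ℝ (Fin n)) (ρ τ : ℝ), 0 < ρ → K * ρ ≤ τ → K * τ ≤ r₀ →
        (∀ y ∈ closedBall x (K * τ), Lop a b u y = 0) →
        supN u x (2 * ρ) * supN u x τ ^ m ≤ C * supN u x ρ * supN u x (K * τ) ^ m := by
  obtain ⟨C, r₀, D, k, hC, hr₀, hr₁, hD, hdbl⟩ := hgt_doubling n L hL
  obtain ⟨S, hS, hsup⟩ := sup_le_ltwo n hn L hL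
  have hC0 : 0 < C := by linarith
  set ω := volume.real (ball (0 : EuclideanSpace ℝ (Fin n)) 1) with hω
  have hω0 : 0 ≤ ω := measureReal_nonneg
  obtain ⟨j, hj⟩ := pow_unbounded_of_one_lt (8 * C ^ 2) (one_lt_two : (1 : ℝ) < 2)
  set c₁ := 2 * C ^ n * ω with hc₁
  set c₂ := (4 * C) ^ n * S * 8 with hc₂
  have hc₁0 : 0 ≤ c₁ := by positivity
  have hc₂0 : 0 < c₂ := by positivity
  set m := k * j with hm
  set E := D ^ j * c₂ * c₁ * (c₂ * c₁ * 2 ^ (n + 4)) ^ m with hE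
  have hE0 : 0 ≤ E := by positivity
  set K := 8 * C ^ 2 + 2 ^ j with hK
  refine ⟨max (Real.sqrt E) 1, K, r₀, m, le_max_right _ _, ?_, hr₀, hr₁, ?_⟩
  · have : (1 : ℝ) ≤ 2 ^ j := one_le_pow₀ one_le_two
    nlinarith [sq_nonneg C]
  intro a' b' hop' u' hu' x ρ τ hρ hρτ hτ hsol'
  set a := fun i j y => a' i j (x + y)
  set b := fun i y => b' i (x + y)
  set u := fun y => u' (x + y)
  have hop : IsOp L a b := hop'.translate x
  have hu : Sm u := hu'.translate x
  have hsol : ∀ y, ‖y‖ ≤ K * τ → Lop a b u y = 0 := fun y hy => by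
    rw [Lop_translate]
    exact hsol' _ (by simpa using hy)
  simp only [← supN_translate (u := u') x]
  have hc := hu.continuous
  obtain ⟨B, hB⟩ := hop.exists_isInvAt
  obtain ⟨hrad, hd⟩ := hdbl a b B hop hB
  have hj0 : (0 : ℝ) < 2 ^ j := by positivity
  have hK0 : 0 < K := by positivity
  have hτ0 : 0 < τ := lt_of_lt_of_le (by positivity) hρτ
  have hdb := hgt_doubling_iterate (H := hgt a B u) hD.le
    (fun s hs h1 => hrad.hgt_nonneg hC hs.le (h1.trans hτ)) hC0.le
    (hd u hu (K * τ) (by positivity) hτ hsol) j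
  have hup : ∀ s, 0 < s → C * s ≤ K * τ →
      hgt a B u s ≤ c₁ * s ^ (n + 4) * supN u 0 (C * s) ^ 2 := fun s hs h1 =>
    hrad.hgt_le hop hC hu hs (h1.trans hτ)
  have hlo : ∀ s, 0 < s → C * s ≤ K * τ →
      s ^ (n + 4) * supN u 0 (s / (4 * C)) ^ 2 ≤ c₂ * hgt a B u s := by
    intro s hs h1
    have h2 := hrad.integral_sq_le_hgt hop hC hu hs (h1.trans hτ)
    have hsr : s ≤ 1 := by nlinarith
    have hd1 : s / (4 * C) ≤ s := div_le_self hs.le (by linarith)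
    have e1 : 2 * (s / (4 * C)) = s / (2 * C) := by field_simp; ring
    have h3 := hsup a b hop u hu 0 (s / (4 * C)) (by positivity) (by linarith) (fun y hy => by
      refine hsol y ?_
      rw [mem_ball_zero_iff, e1] at hy
      have : s / (2 * C) ≤ s := div_le_self hs.le (by linarith)
      nlinarith)
    rw [e1] at h3
    have h4 : s ^ (n + 4) = (4 * C) ^ n * s ^ 4 * (s / (4 * C)) ^ n := by
      rw [div_pow]; field_simp; ring
    calc _ = (4 * C) ^ n * s ^ 4 * (supN u 0 (s / (4 * C)) ^ 2 * (s / (4 * C)) ^ n) := by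
          rw [h4]; ring
      _ ≤ (4 * C) ^ n * s ^ 4 * (S * ∫ y in ball (0 : EuclideanSpace ℝ (Fin n)) (s / (2 * C)),
          u y ^ 2) := by gcongr
      _ = (4 * C) ^ n * S * 8 * (s ^ 4 / 8 * ∫ y in ball (0 : EuclideanSpace ℝ (Fin n))
          (s / (2 * C)), u y ^ 2) := by ring
      _ ≤ _ := mul_le_mul_of_nonneg_left h2 hc₂0.le
  set s := ρ / C with hs
  set t := 4 * C * τ with ht
  have hs0 : 0 < s := by positivity
  have ht0 : 0 < t := by positivity
  have hCs : C * s = ρ := by rw [hs]; field_simp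
  have hsρ : s ≤ ρ := div_le_self hρ.le hC
  have h2t : C * (2 * t) < K * τ := by
    rw [ht, hK]; nlinarith [mul_pos hj0 hτ0]
  have hst : 2 ^ j * s ≤ t := by
    calc 2 ^ j * s ≤ 2 ^ j * ρ := by gcongr
      _ ≤ K * ρ := by gcongr; nlinarith [sq_nonneg C]
      _ ≤ τ := hρτ
      _ ≤ t := by rw [ht]; nlinarith
  have hmain := hdb s t hs0 hst h2t
  have hjs : C * (2 ^ j * s) ≤ K * τ := by nlinarith
  have l1 := hlo (2 ^ j * s) (by positivity) hjs
  have l2 := hlo t ht0 (by nlinarith)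
  have u1 := hup s hs0 (by rw [hCs]; nlinarith [mul_pos hK0 hτ0, mul_pos hj0 hτ0])
  have u2 := hup (2 * t) (by positivity) h2t.le
  rw [hCs] at u1
  have ets : t / (4 * C) = τ := by rw [ht]; field_simp
  rw [ets] at l2
  have m1 : supN u 0 (2 * ρ) ≤ supN u 0 (2 ^ j * s / (4 * C)) := by
    refine supN_mono_radius hc (by positivity) ?_
    rw [hs, le_div_iff₀ (by positivity), mul_div_assoc', le_div_iff₀ hC0]
    nlinarith [mul_le_mul_of_nonneg_right hj.le hρ.le]
  have m2 : supN u 0 (C * (2 * t)) ≤ supN u 0 (K * τ) :=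
    supN_mono_radius hc (by positivity) h2t.le
  have p1 : s ^ (n + 4) * supN u 0 (2 * ρ) ^ 2 ≤ c₂ * hgt a B u (2 ^ j * s) := by
    refine le_trans ?_ l1
    have := supN_nonneg u 0 (2 * ρ)
    have h1 : s ≤ 2 ^ j * s := le_mul_of_one_le_left hs0.le (one_le_pow₀ one_le_two)
    gcongr
  have p2 : hgt a B u (2 * t) ≤ c₁ * 2 ^ (n + 4) * t ^ (n + 4) * supN u 0 (K * τ) ^ 2 := by
    refine u2.trans ?_
    rw [mul_pow 2 t]
    have := supN_nonneg u 0 (C * (2 * t))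
    calc _ ≤ c₁ * (2 ^ (n + 4) * t ^ (n + 4)) * supN u 0 (K * τ) ^ 2 := by gcongr
      _ = _ := by ring
  have hHs : 0 ≤ hgt a B u s := hrad.hgt_nonneg hC hs0.le (by rw [hCs]; nlinarith)
  have hHt : 0 ≤ hgt a B u t := hrad.hgt_nonneg hC ht0.le (by nlinarith)
  have hHj : 0 ≤ hgt a B u (2 ^ j * s) := hrad.hgt_nonneg hC (by positivity) (hjs.trans hτ)
  have hH2 : 0 ≤ hgt a B u (2 * t) := hrad.hgt_nonneg hC (by positivity) (h2t.le.trans hτ)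
  have hfin : (supN u 0 (2 * ρ) * supN u 0 τ ^ m) ^ 2
      ≤ E * (supN u 0 ρ * supN u 0 (K * τ) ^ m) ^ 2 := by
    have hpos : 0 < s ^ (n + 4) * (t ^ (n + 4)) ^ m := by positivity
    refine le_of_mul_le_mul_left ?_ hpos
    calc s ^ (n + 4) * (t ^ (n + 4)) ^ m * (supN u 0 (2 * ρ) * supN u 0 τ ^ m) ^ 2
        = (s ^ (n + 4) * supN u 0 (2 * ρ) ^ 2) * (t ^ (n + 4) * supN u 0 τ ^ 2) ^ m := by
          rw [mul_pow (t ^ (n + 4))]; ring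
      _ ≤ (c₂ * hgt a B u (2 ^ j * s)) * (c₂ * hgt a B u t) ^ m := by
          have := supN_nonneg u 0 τ
          gcongr
      _ = c₂ * c₂ ^ m * (hgt a B u (2 ^ j * s) * hgt a B u t ^ m) := by rw [mul_pow]; ring
      _ ≤ c₂ * c₂ ^ m * (D ^ j * hgt a B u s * hgt a B u (2 * t) ^ m) := by gcongr
      _ ≤ c₂ * c₂ ^ m * (D ^ j * (c₁ * s ^ (n + 4) * supN u 0 ρ ^ 2)
          * (c₁ * 2 ^ (n + 4) * t ^ (n + 4) * supN u 0 (K * τ) ^ 2) ^ m) := by gcongr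
      _ = _ := by rw [hE]; simp only [mul_pow]; ring
  have hn1 := supN_nonneg u 0 ρ
  have hn2 := supN_nonneg u 0 (K * τ)
  have := Real.le_sqrt_of_sq_le hfin
  rw [Real.sqrt_mul hE0, Real.sqrt_sq (by positivity)] at this
  refine this.trans ?_
  rw [← mul_assoc]
  gcongr
  exact le_max_left _ _

theorem exists_pos_chain {C c : ℝ} (hC : 0 < C) (hc : 0 < c) (m J : ℕ) : ∃ c' > 0,
    ∀ f : ℕ → ℝ, (∀ i < J, f (i + 1) ^ (m + 1) ≤ C * f i) → c ≤ f J → c' ≤ f 0 := by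
  induction J with
  | zero => exact ⟨c, hc, fun f _ h => h⟩
  | succ J ih =>
    obtain ⟨c', hc', h⟩ := ih
    refine ⟨c' ^ (m + 1) / C, by positivity, fun f hf hJ => ?_⟩
    have h1 := h (fun i => f (i + 1)) (fun i hi => hf (i + 1) (by omega)) hJ
    rw [div_le_iff₀ hC, mul_comm]
    exact (pow_le_pow_left₀ hc'.le h1 _).trans (hf 0 (by omega))

/-- Quantitative propagation of smallness: a solution with controlled growth is not too small on
any small ball. -/
theorem chain_lower (n : ℕ) (hn : 0 < n) (L : ℝ) (hL : 1 ≤ L) (δ ρ C₁ : ℝ) (hδ : 0 < δ)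
    (hρ : 0 < ρ) (hC₁ : 0 < C₁) : ∃ c > 0,
    ∀ (a : Fin n → Fin n → EuclideanSpace ℝ (Fin n) → ℝ)
      (b : Fin n → EuclideanSpace ℝ (Fin n) → ℝ), IsOp L a b →
      ∀ u, Sm u → ∀ R, 0 ≤ R → R ≤ 10 →
        (∀ y ∈ closedBall (0 : EuclideanSpace ℝ (Fin n)) (R + δ), Lop a b u y = 0) →
        supN u 0 (R + δ) ≤ C₁ * supN u 0 R →
        ∀ x ∈ closedBall (0 : EuclideanSpace ℝ (Fin n)) R,
          c * supN u 0 (R + δ) ≤ supN u x ρ := by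
  obtain ⟨C, K, r₀, m, hC, hK, hr₀, hr₁, hdbl⟩ := sup_doubling n hn L hL
  set σ := min ρ (min (δ / K ^ 2) (r₀ / K ^ 2)) with hσ
  have hK0 : 0 < K := by linarith
  have hσ0 : 0 < σ := by positivity
  have hσδ : K * (K * σ) ≤ δ := by
    have : σ ≤ δ / K ^ 2 := (min_le_right _ _).trans (min_le_left _ _)
    rw [le_div_iff₀ (by positivity)] at this
    linarith
  have hσr : K * (K * σ) ≤ r₀ := by
    have : σ ≤ r₀ / K ^ 2 := (min_le_right _ _).trans (min_le_right _ _)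
    rw [le_div_iff₀ (by positivity)] at this
    linarith
  obtain ⟨J, hJ⟩ := exists_nat_gt (20 / σ)
  have hJ0 : (0 : ℝ) < J := lt_trans (by positivity) hJ
  obtain ⟨c, hc, hchain⟩ := exists_pos_chain (C := C) (c := 1 / C₁) (by linarith) (by positivity) m J
  refine ⟨c, hc, ?_⟩
  intro a b hop u hu R hR hR10 hsol hgrow x hx
  have hcu := hu.continuous
  rcases (supN_nonneg u 0 (R + δ)).eq_or_lt with hM | hM
  · rw [← hM]; simpa using supN_nonneg u x ρ
  set M := supN u 0 (R + δ)
  refine le_trans ?_ (supN_mono_radius hcu hσ0.le (min_le_left _ _))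
  obtain ⟨y, hy, hyM⟩ := exists_supN hcu 0 hR
  set p : ℕ → EuclideanSpace ℝ (Fin n) := fun i => AffineMap.lineMap x y ((i : ℝ) / J) with hp
  have hdist : ∀ i, dist (p (i + 1)) (p i) ≤ σ := by
    intro i
    rw [hp, dist_lineMap_lineMap, Real.dist_eq]
    have e : ((i + 1 : ℕ) : ℝ) / J - (i : ℝ) / J = 1 / J := by push_cast; ring
    rw [e, abs_of_pos (by positivity)]
    have : dist x y ≤ 20 := by
      have := dist_triangle_right x y 0
      rw [mem_closedBall] at hx hy
      linarith
    rw [div_lt_iff₀ hσ0] at hJ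
    rw [one_div, inv_mul_le_iff₀ hJ0]
    linarith
  have hmem : ∀ i ≤ J, p i ∈ closedBall (0 : EuclideanSpace ℝ (Fin n)) R := fun i hi =>
    (convex_closedBall _ _).lineMap_mem hx hy ⟨by positivity, by
      rw [div_le_one hJ0]; exact_mod_cast hi⟩
  have key := hchain (fun i => supN u (p i) σ / M) ?_ ?_
  · have e0 : p 0 = x := by simp [hp]
    simp only [e0] at key
    rwa [le_div_iff₀ hM] at key
  · intro i hi
    have hpi := mem_closedBall.1 (hmem i hi.le)
    have hsub : closedBall (p i) (K * (K * σ)) ⊆ closedBall 0 (R + δ) :=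
      closedBall_subset_closedBall' (by linarith)
    have h1 := hdbl a b hop u hu (p i) σ (K * σ) hσ0 le_rfl hσr (fun y hy => hsol y (hsub hy))
    have h2 : supN u (p (i + 1)) σ ≤ supN u (p i) (2 * σ) := supN_mono hcu hσ0.le
      (closedBall_subset_closedBall' (by linarith [hdist i]))
    have h3 : supN u (p (i + 1)) σ ≤ supN u (p i) (K * σ) :=
      h2.trans (supN_mono_radius hcu (by positivity) (by gcongr))
    have h4 : supN u (p i) (K * (K * σ)) ≤ M := supN_mono hcu (by positivity) hsub
    have n1 := supN_nonneg u (p (i + 1)) σ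
    have n2 := supN_nonneg u (p i) σ
    have n3 := supN_nonneg u (p i) (K * (K * σ))
    have n4 := supN_nonneg u (p i) (2 * σ)
    rw [div_pow, div_le_iff₀ (by positivity)]
    calc supN u (p (i + 1)) σ ^ (m + 1) = supN u (p (i + 1)) σ * supN u (p (i + 1)) σ ^ m := by ring
      _ ≤ supN u (p i) (2 * σ) * supN u (p i) (K * σ) ^ m := by gcongr
      _ ≤ C * supN u (p i) σ * supN u (p i) (K * (K * σ)) ^ m := h1
      _ ≤ C * supN u (p i) σ * M ^ m := by gcongr
      _ = _ := by field_simp; ring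
  · have e1 : p J = y := by simp [hp, hJ0.ne']
    simp only [e1]
    rw [le_div_iff₀ hM, div_mul_eq_mul_div, one_mul, div_le_iff₀ hC₁, mul_comm]
    refine hgrow.trans ?_
    gcongr
    rw [← hyM]
    exact le_supN hcu (mem_closedBall_self hσ0.le)

/-- Normalised functions with uniform doubling and a uniform order of vanishing. -/
structure Tame {n : ℕ} (c r₁ D : ℝ) (k : ℕ) (u : EuclideanSpace ℝ (Fin n) → ℝ) : Prop where
  le_one : ∀ x ∈ closedBall (0 : EuclideanSpace ℝ (Fin n)) (8 + 1 / 2), |u x| ≤ 1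
  doubling : ∀ x ∈ closedBall (0 : EuclideanSpace ℝ (Fin n)) 8, ∀ r, 0 < r → r ≤ r₁ →
    supN u x (2 * r) ≤ D * supN u x r
  order : ∀ x ∈ closedBall (0 : EuclideanSpace ℝ (Fin n)) 8, ∀ r, 0 < r → r ≤ r₁ →
    c * r ^ k ≤ supN u x r

theorem tame_of_growth (n : ℕ) (hn : 0 < n) (L : ℝ) (hL : 1 ≤ L) (C₁ : ℝ) (hC₁ : 0 < C₁) :
    ∃ (c r₁ D : ℝ) (k : ℕ), 0 < c ∧ 0 < r₁ ∧ r₁ ≤ 1 / 8 ∧ 1 ≤ D ∧ 1 ≤ k ∧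
    ∀ (a : Fin n → Fin n → EuclideanSpace ℝ (Fin n) → ℝ)
      (b : Fin n → EuclideanSpace ℝ (Fin n) → ℝ), IsOp L a b →
      ∀ u, Sm u →
        (∀ y ∈ closedBall (0 : EuclideanSpace ℝ (Fin n)) (8 + 1 / 2), Lop a b u y = 0) →
        supN u 0 (8 + 1 / 2) ≤ C₁ * supN u 0 8 → supN u 0 (8 + 1 / 2) = 1 →
        Tame c r₁ D k u := by
  obtain ⟨C, K, r₀, m, hC, hK, hr₀, hr₁, hdbl⟩ := sup_doubling n hn L hL
  have hK0 : 0 < K := by linarith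
  set τ := min r₀ (1 / 8) / K with hτ
  have hτ0 : 0 < τ := by positivity
  have hKτ : K * τ = min r₀ (1 / 8) := by rw [hτ]; field_simp
  obtain ⟨c₁, hc₁, hch₁⟩ := chain_lower n hn L hL (1 / 2) τ C₁ (by norm_num) hτ0 hC₁
  set r₁ := τ / K with hr₁'
  have hr₁0 : 0 < r₁ := by positivity
  have hKr : K * r₁ = τ := by rw [hr₁']; field_simp
  obtain ⟨c₂, hc₂, hch₂⟩ := chain_lower n hn L hL (1 / 2) (r₁ / 2) C₁ (by norm_num)
    (by positivity) hC₁
  set D := max (C / c₁ ^ m) 1 with hD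
  obtain ⟨k, hk⟩ := pow_unbounded_of_one_lt D (one_lt_two : (1 : ℝ) < 2)
  have hD1 : 1 ≤ D := le_max_right _ _
  have hk1 : 1 ≤ k := by
    by_contra h
    have : k = 0 := by omega
    rw [this, pow_zero] at hk
    linarith
  have hτ8 : K * τ ≤ 1 / 8 := hKτ ▸ min_le_right _ _
  have hr8 : r₁ ≤ 1 / 8 := by nlinarith
  refine ⟨c₂ / r₁ ^ k, r₁, D, k, by positivity, hr₁0, hr8, hD1, hk1, ?_⟩
  intro a b hop u hu hsol hgrow hM
  have hcu := hu.continuous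
  have hlow₁ := hch₁ a b hop u hu 8 (by norm_num) (by norm_num) hsol hgrow
  have hlow₂ := hch₂ a b hop u hu 8 (by norm_num) (by norm_num) hsol hgrow
  rw [hM, mul_one] at hlow₁ hlow₂
  have hdb : ∀ x ∈ closedBall (0 : EuclideanSpace ℝ (Fin n)) 8, ∀ r, 0 < r → r ≤ r₁ →
      supN u x (2 * r) ≤ D * supN u x r := by
    intro x hx r hr hrr
    have hsub : closedBall x (K * τ) ⊆ closedBall 0 (8 + 1 / 2) :=
      closedBall_subset_closedBall' (by linarith [mem_closedBall.1 hx])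
    have h1 := hdbl a b hop u hu x r τ hr (by rw [← hKr]; gcongr) (hKτ ▸ min_le_left _ _)
      fun y hy => hsol y (hsub hy)
    have h2 : supN u x (K * τ) ≤ 1 := hM ▸ supN_mono hcu (by positivity) hsub
    have h3 := hlow₁ x hx
    have n1 := supN_nonneg u x (2 * r)
    have n2 := supN_nonneg u x r
    have n3 := supN_nonneg u x (K * τ)
    have h4 : supN u x (2 * r) * c₁ ^ m ≤ C * supN u x r * 1 ^ m :=
      calc _ ≤ supN u x (2 * r) * supN u x τ ^ m := by gcongr
        _ ≤ _ := h1
        _ ≤ _ := by gcongr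
    rw [one_pow, mul_one, ← le_div_iff₀ (by positivity)] at h4
    refine h4.trans ?_
    rw [mul_div_right_comm]
    gcongr
    exact le_max_left _ _
  refine ⟨fun x hx => hM ▸ le_supN hcu hx, hdb, ?_⟩
  intro x hx
  have hstep : ∀ j : ℕ, ∀ r, r₁ / 2 ^ j ≤ r → r ≤ r₁ → c₂ * (r / r₁) ^ k ≤ supN u x r := by
    intro j
    induction j with
    | zero =>
      intro r h1 h2
      have : r = r₁ := le_antisymm h2 (by simpa using h1)
      rw [this, div_self hr₁0.ne', one_pow, mul_one]
      exact (hlow₂ x hx).trans (supN_mono_radius hcu (by positivity) (by linarith))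
    | succ j ih =>
      intro r h1 h2
      have hr : 0 < r := lt_of_lt_of_le (by positivity) h1
      rcases le_total (r₁ / 2) r with h | h
      · refine le_trans ?_ ((hlow₂ x hx).trans (supN_mono_radius hcu (by positivity) h))
        refine mul_le_of_le_one_right hc₂.le (pow_le_one₀ (by positivity) ?_)
        rwa [div_le_one hr₁0]
      · have h3 := ih (2 * r) (by
          rw [pow_succ, ← div_div] at h1
          linarith) (by linarith)
        have h4 := hdb x hx r hr h2
        have h5 : c₂ * (2 * r / r₁) ^ k = 2 ^ k * (c₂ * (r / r₁) ^ k) := by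
          rw [mul_div_assoc, mul_pow]; ring
        rw [h5] at h3
        have h6 : D * (c₂ * (r / r₁) ^ k) ≤ 2 ^ k * (c₂ * (r / r₁) ^ k) := by gcongr
        exact le_of_mul_le_mul_left (h6.trans (h3.trans h4)) (by linarith)
  intro r hr hrr
  obtain ⟨j, hj⟩ := pow_unbounded_of_one_lt (r₁ / r) (one_lt_two : (1 : ℝ) < 2)
  have := hstep j r (by
    rw [div_le_iff₀ (by positivity)]
    rw [div_lt_iff₀ hr] at hj
    linarith) hrr
  rwa [div_pow, mul_div_assoc', mul_div_right_comm] at this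

theorem supN_neg {n : ℕ} (u : EuclideanSpace ℝ (Fin n) → ℝ) (x : EuclideanSpace ℝ (Fin n)) (r : ℝ) :
    supN (fun y => -u y) x r = supN u x r := by
  simp only [supN, abs_neg]

theorem Tame.neg {n : ℕ} {c r₁ D : ℝ} {k : ℕ} {u : EuclideanSpace ℝ (Fin n) → ℝ}
    (h : Tame c r₁ D k u) : Tame c r₁ D k fun y => -u y where
  le_one x hx := by simpa using h.le_one x hx
  doubling x hx r := by simpa only [supN_neg] using h.doubling x hx r
  order x hx r := by simpa only [supN_neg] using h.order x hx r

set_option maxHeartbeats 1000000 in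
/-- Near its zero set, a tame solution grows by a fixed factor within a nodal domain, along a step
over which any other solution with a smaller nodal set varies by a bounded factor. -/
theorem growth_step_of_pos (n : ℕ) (L : ℝ) (hL : 1 ≤ L) (c r₁ D : ℝ) (k : ℕ) (hc : 0 < c)
    (hr₁ : 0 < r₁) (hr8 : r₁ ≤ 1 / 8) (hD : 1 ≤ D) : ∃ (C q κ : ℝ),
    0 < C ∧ 0 < q ∧ 0 < κ ∧
    ∀ (a : Fin n → Fin n → EuclideanSpace ℝ (Fin n) → ℝ)
      (b : Fin n → EuclideanSpace ℝ (Fin n) → ℝ)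
      (a' : Fin n → Fin n → EuclideanSpace ℝ (Fin n) → ℝ)
      (b' : Fin n → EuclideanSpace ℝ (Fin n) → ℝ), IsOp L a b → IsOp L a' b' →
      ∀ u v, Sm u → Sm v →
        (∀ y ∈ closedBall (0 : EuclideanSpace ℝ (Fin n)) (8 + 1 / 2), Lop a b u y = 0) →
        (∀ y ∈ closedBall (0 : EuclideanSpace ℝ (Fin n)) (8 + 1 / 2), Lop a' b' v y = 0) →
        (∀ y ∈ closedBall (0 : EuclideanSpace ℝ (Fin n)) (8 + 1 / 2), v y = 0 → u y = 0) →
        Tame c r₁ D k u →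
        ∀ x ∈ closedBall (0 : EuclideanSpace ℝ (Fin n)) 7, 0 < u x → u x < κ →
          ∃ x', (1 + q) * u x ≤ u x' ∧ dist x' x ^ k ≤ C * u x ∧
            |Real.log (v x') - Real.log (v x)| ≤ C := by
  obtain ⟨CH, hCH, hhar⟩ := harnack n L hL
  obtain ⟨Cl, hCl, hlip⟩ := lip_le n L hL
  set H := Real.exp CH with hH
  have hH0 : 0 < H := Real.exp_pos _
  set G := Cl * (D ^ 4 * H) / 2 with hG
  have hG0 : 0 < G := by positivity
  set τ := min (1 / 6) (1 / (6 * G)) with hτ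
  have hτ0 : 0 < τ := by positivity
  have hτ6 : τ ≤ 1 / 6 := min_le_left _ _
  have hτG : 3 * G * τ ≤ 1 / 2 := by
    have : τ ≤ 1 / (6 * G) := min_le_right _ _
    rw [le_div_iff₀ (by positivity)] at this
    linarith
  set q := Real.exp (-(CH / τ)) / 4 with hq
  have hq0 : 0 < q := by positivity
  refine ⟨max (4 ^ k * H / c) (CH / τ), q, c * (r₁ / 8) ^ k / H, by positivity, hq0,
    by positivity, ?_⟩
  intro a b a' b' hop hop' u v hu hv hsol hsol' hzero ht x hx hux hκ
  have hcu := hu.continuous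
  have hx0 := mem_closedBall.1 hx
  have hsub : ∀ r ≤ 1, closedBall x r ⊆ closedBall 0 (8 + 1 / 2) := fun r hr =>
    closedBall_subset_closedBall' (by linarith)
  have hx8 : x ∈ closedBall (0 : EuclideanSpace ℝ (Fin n)) 8 :=
    closedBall_subset_closedBall (by norm_num) hx
  have hN : ∀ r, 0 < r → r ≤ 1 → (∀ y ∈ ball x r, u y ≠ 0) → supN u x (r / 4) ≤ H * u x := by
    intro r hr hr1 hne
    refine supN_le (by positivity) fun y hy => ?_
    rw [mem_closedBall] at hy
    have hyb : dist y x < r := by linarith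
    have h1 := hhar a b hop u hu x r (1 / 2) hr hr1 (by norm_num)
      (fun z hz => hsol z (hsub r hr1 (ball_subset_closedBall hz))) hne (by norm_num) x
      (mem_ball_self (by positivity)) y (mem_ball.2 (by linarith))
    have h2 : CH / (1 / 2 * r) * dist y x ≤ CH := by
      rw [div_mul_eq_mul_div, div_le_iff₀ (by positivity)]
      exact mul_le_mul_of_nonneg_left (by linarith) hCH.le
    have h3 : Real.log (u y) ≤ CH + Real.log (u x) := by
      linarith [le_abs_self (Real.log (u y) - Real.log (u x))]
    have hy0 : 0 < |u y| := abs_pos.2 (hne y (mem_ball.2 hyb))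
    rw [← Real.log_abs, ← Real.log_exp CH, ← Real.log_mul (Real.exp_pos _).ne' hux.ne'] at h3
    exact (Real.log_le_log_iff hy0 (by positivity)).1 h3
  obtain ⟨z₀, hz₀, hz₀u⟩ : ∃ z ∈ ball x (r₁ / 2), u z = 0 := by
    by_contra! hcon
    have h1 := hN (r₁ / 2) (by positivity) (by linarith) hcon
    have h2 := ht.order x hx8 (r₁ / 2 / 4) (by positivity) (by linarith)
    rw [lt_div_iff₀ hH0, show r₁ / 8 = r₁ / 2 / 4 by ring] at hκ
    linarith
  set Z := {y | u y = 0} ∩ closedBall x (r₁ / 2) with hZ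
  have hZc : IsCompact Z := (isCompact_closedBall _ _).inter_left (isClosed_eq hcu continuous_const)
  obtain ⟨z, hzZ, hzd⟩ := hZc.exists_infDist_eq_dist ⟨z₀, hz₀u, ball_subset_closedBall hz₀⟩ x
  set d := dist x z with hd
  have hd0 : 0 < d := by
    refine dist_pos.2 fun h => ?_
    have : u x = 0 := by rw [h]; exact hzZ.1
    linarith
  have hdr : 2 * d ≤ r₁ := by
    have := mem_closedBall'.1 hzZ.2
    linarith
  have hne : ∀ y ∈ ball x d, u y ≠ 0 := by
    intro y hy h0
    have h1 : y ∈ Z := ⟨h0, mem_closedBall.2 (by linarith [mem_ball.1 hy])⟩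
    have h2 := infDist_le_dist_of_mem (x := x) h1
    rw [hzd, dist_comm x y] at h2
    linarith [mem_ball.1 hy]
  have hNd := hN d hd0 (by linarith) hne
  have hdk : d ^ k ≤ 4 ^ k * H / c * u x := by
    have h1 := (ht.order x hx8 (d / 4) (by positivity) (by linarith)).trans hNd
    rw [div_pow, mul_div_assoc', div_le_iff₀ (by positivity)] at h1
    rw [div_mul_eq_mul_div, le_div_iff₀ hc]
    linarith
  have hN4 : supN u x (4 * d) ≤ D ^ 4 * H * u x := by
    have e1 := ht.doubling x hx8 (2 * d) (by positivity) (by linarith)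
    have e2 := ht.doubling x hx8 d (by positivity) (by linarith)
    have e3 := ht.doubling x hx8 (d / 2) (by positivity) (by linarith)
    have e4 := ht.doubling x hx8 (d / 4) (by positivity) (by linarith)
    rw [show 2 * (2 * d) = 4 * d by ring] at e1
    rw [show 2 * (d / 2) = d by ring] at e3
    rw [show 2 * (d / 4) = d / 2 by ring] at e4
    calc _ ≤ D * (D * (D * (D * (H * u x)))) := by
          refine e1.trans ?_; gcongr; refine e2.trans ?_; gcongr; refine e3.trans ?_; gcongr
          refine e4.trans ?_; gcongr
      _ = _ := by ring
  have hL' : ∀ y ∈ ball x (2 * d), ∀ z ∈ ball x (2 * d), |u y - u z| ≤ G / d * u x * dist y z := by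
    intro y hy z hz
    have h1 := hlip a b hop u hu x (2 * d) (D ^ 4 * H * u x) (by positivity) (by linarith)
      (fun w hw => hsol w (hsub (2 * (2 * d)) (by linarith) (ball_subset_closedBall hw)))
      (fun w hw => (le_supN hcu (closedBall_subset_closedBall (by linarith)
        (ball_subset_closedBall hw))).trans hN4) y hy z hz
    refine h1.trans (le_of_eq ?_)
    rw [hG]; field_simp
  have hR0 : 0 < (1 - τ) * d := mul_pos (by linarith) hd0
  obtain ⟨x', hx', hgr⟩ : ∃ x' ∈ ball x ((1 - τ) * d), (1 + q) * u x ≤ u x' := by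
    by_contra! hcon
    set y := AffineMap.lineMap x z (1 - 3 * τ) with hy
    have hyx : dist y x = (1 - 3 * τ) * d := by
      rw [hy, dist_lineMap_left, Real.norm_of_nonneg (by linarith), hd]
    have hyz : dist y z = 3 * τ * d := by
      rw [hy, dist_lineMap_right, hd]
      rw [show 1 - (1 - 3 * τ) = 3 * τ by ring, Real.norm_of_nonneg (by linarith)]
    set w : EuclideanSpace ℝ (Fin n) → ℝ := fun y => -u y + (1 + q) * u x with hw
    have hws : Sm w := hu.neg.add contDiff_const
    have hwsol : ∀ y ∈ ball x ((1 - τ) * d), Lop a b w y = 0 := by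
      intro y hy
      rw [hw, Lop_add_const hu.neg, Lop_neg, hsol y (hsub d (by linarith)
        (ball_subset_closedBall (ball_subset_ball (by nlinarith) hy))), neg_zero]
    have hwpos : ∀ y ∈ ball x ((1 - τ) * d), 0 < w y := fun y hy => by
      have := hcon y hy
      simp only [hw]; linarith
    have hyR : y ∈ ball x ((1 - τ) * ((1 - τ) * d)) := by
      rw [mem_ball, hyx]; nlinarith [mul_pos hτ0 hd0, mul_pos (mul_pos hτ0 hτ0) hd0]
    have hxR : x ∈ ball x ((1 - τ) * ((1 - τ) * d)) := mem_ball_self (mul_pos (by linarith) hR0)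
    have h1 := hhar a b hop w hws x ((1 - τ) * d) τ hR0 (by nlinarith) hτ0 hwsol
      (fun y hy => (hwpos y hy).ne') (by linarith) x hxR y hyR
    have h2 : CH / (τ * ((1 - τ) * d)) * dist y x ≤ CH / τ := by
      rw [hyx, div_mul_eq_mul_div, div_le_div_iff₀ (by positivity) hτ0]
      have : (1 - 3 * τ) * d ≤ (1 - τ) * d := by gcongr; linarith
      calc CH * ((1 - 3 * τ) * d) * τ ≤ CH * ((1 - τ) * d) * τ := by gcongr
        _ = _ := by ring
    have hyb : y ∈ ball x ((1 - τ) * d) := by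
      rw [mem_ball, hyx]; nlinarith [mul_pos hτ0 hd0]
    have hwy := hwpos y hyb
    have hwx : w x = q * u x := by simp only [hw]; ring
    have h3 : Real.log (w y) ≤ CH / τ + Real.log (w x) := by
      linarith [le_abs_self (Real.log (w y) - Real.log (w x))]
    rw [← Real.log_exp (CH / τ), hwx, ← Real.log_mul (Real.exp_pos _).ne' (by positivity)] at h3
    have h4 := (Real.log_le_log_iff hwy (by positivity)).1 h3
    have h5 : Real.exp (CH / τ) * (q * u x) = u x / 4 := by
      rw [hq, Real.exp_neg]; field_simp
    rw [h5] at h4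
    have h6 := hL' y (mem_ball.2 (by rw [hyx]; nlinarith)) z
      (mem_ball'.2 (by linarith))
    have hz0 : u z = 0 := hzZ.1
    rw [hz0, sub_zero, hyz] at h6
    have h7 : G / d * u x * (3 * τ * d) = 3 * G * τ * u x := by field_simp
    have h8 : 3 * G * τ * u x ≤ 1 / 2 * u x := by gcongr
    have h9 := le_abs_self (u y)
    simp only [hw] at h4
    nlinarith [mul_pos hq0 hux]
  refine ⟨x', hgr, ?_, ?_⟩
  · have h1 : dist x' x ^ k ≤ d ^ k := by
      refine pow_le_pow_left₀ dist_nonneg ?_ k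
      nlinarith [mem_ball.1 hx']
    refine h1.trans (hdk.trans ?_)
    gcongr
    exact le_max_left _ _
  · have h1 := hhar a' b' hop' v hv x d τ hd0 (by linarith) hτ0
      (fun y hy => hsol' y (hsub d (by linarith) (ball_subset_closedBall hy)))
      (fun y hy h => hne y hy (hzero y (hsub d (by linarith) (ball_subset_closedBall hy)) h))
      (by linarith) x (mem_ball_self hR0) x' hx'
    refine h1.trans (le_trans ?_ (le_max_right _ _))
    rw [div_mul_eq_mul_div, div_le_div_iff₀ (by positivity) hτ0]
    have : dist x' x ≤ d := by nlinarith [mem_ball.1 hx']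
    calc CH * dist x' x * τ ≤ CH * d * τ := by gcongr
      _ = _ := by ring

theorem growth_step (n : ℕ) (L : ℝ) (hL : 1 ≤ L) (c r₁ D : ℝ) (k : ℕ) (hc : 0 < c)
    (hr₁ : 0 < r₁) (hr8 : r₁ ≤ 1 / 8) (hD : 1 ≤ D) : ∃ (C q κ : ℝ),
    0 < C ∧ 0 < q ∧ 0 < κ ∧
    ∀ (a : Fin n → Fin n → EuclideanSpace ℝ (Fin n) → ℝ)
      (b : Fin n → EuclideanSpace ℝ (Fin n) → ℝ)
      (a' : Fin n → Fin n → EuclideanSpace ℝ (Fin n) → ℝ)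
      (b' : Fin n → EuclideanSpace ℝ (Fin n) → ℝ), IsOp L a b → IsOp L a' b' →
      ∀ u v, Sm u → Sm v →
        (∀ y ∈ closedBall (0 : EuclideanSpace ℝ (Fin n)) (8 + 1 / 2), Lop a b u y = 0) →
        (∀ y ∈ closedBall (0 : EuclideanSpace ℝ (Fin n)) (8 + 1 / 2), Lop a' b' v y = 0) →
        (∀ y ∈ closedBall (0 : EuclideanSpace ℝ (Fin n)) (8 + 1 / 2), v y = 0 → u y = 0) →
        Tame c r₁ D k u →
        ∀ x ∈ closedBall (0 : EuclideanSpace ℝ (Fin n)) 7, u x ≠ 0 → |u x| < κ →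
          ∃ x', (1 + q) * |u x| ≤ |u x'| ∧ dist x' x ^ k ≤ C * |u x| ∧
            |Real.log (v x') - Real.log (v x)| ≤ C := by
  obtain ⟨C, q, κ, hC, hq, hκ, h⟩ := growth_step_of_pos n L hL c r₁ D k hc hr₁ hr8 hD
  refine ⟨C, q, κ, hC, hq, hκ, ?_⟩
  intro a b a' b' hop hop' u v hu hv hsol hsol' hzero ht x hx hux hxκ
  rcases lt_or_gt_of_ne hux with hneg | hpos
  · rw [abs_of_neg hneg] at hxκ ⊢
    obtain ⟨x', h1, h2, h3⟩ := h a b a' b' hop hop' (fun y => -u y) v hu.neg hv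
      (fun y hy => by rw [Lop_neg, hsol y hy, neg_zero]) hsol'
      (fun y hy h0 => by rw [hzero y hy h0, neg_zero]) ht.neg x hx (by linarith) hxκ
    exact ⟨x', h1.trans (neg_le_abs _), h2, h3⟩
  · rw [abs_of_pos hpos] at hxκ ⊢
    obtain ⟨x', h1, h2, h3⟩ := h a b a' b' hop hop' u v hu hv hsol hsol' hzero ht x hx hpos hxκ
    exact ⟨x', h1.trans (le_abs_self _), h2, h3⟩

/-- A tame solution `u` together with a solution `v` of another equation whose nodal set is
contained in that of `u`. -/
structure NodalPair {n : ℕ} (L c r₁ D : ℝ) (k : ℕ)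
    (a : Fin n → Fin n → EuclideanSpace ℝ (Fin n) → ℝ) (b : Fin n → EuclideanSpace ℝ (Fin n) → ℝ)
    (a' : Fin n → Fin n → EuclideanSpace ℝ (Fin n) → ℝ) (b' : Fin n → EuclideanSpace ℝ (Fin n) → ℝ)
    (u v : EuclideanSpace ℝ (Fin n) → ℝ) : Prop where
  op : IsOp L a b
  op' : IsOp L a' b'
  sm : Sm u
  sm' : Sm v
  sol : ∀ y ∈ closedBall (0 : EuclideanSpace ℝ (Fin n)) (8 + 1 / 2), Lop a b u y = 0
  sol' : ∀ y ∈ closedBall (0 : EuclideanSpace ℝ (Fin n)) (8 + 1 / 2), Lop a' b' v y = 0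
  zero : ∀ y ∈ closedBall (0 : EuclideanSpace ℝ (Fin n)) (8 + 1 / 2), v y = 0 → u y = 0
  tame : Tame c r₁ D k u

/-- Any point off the nodal set can be joined to a nearby point where `u` has a fixed size, with
control on the variation of `v`. -/
theorem growth_chain (n : ℕ) (L : ℝ) (hL : 1 ≤ L) (c r₁ D : ℝ) (k : ℕ) (hc : 0 < c)
    (hr₁ : 0 < r₁) (hr8 : r₁ ≤ 1 / 8) (hD : 1 ≤ D) (hk : 1 ≤ k) (δ : ℝ) (hδ : 0 < δ)
    (hδ1 : δ ≤ 1) : ∃ κ C : ℝ, 0 < κ ∧ κ ≤ 1 ∧ 0 < C ∧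
    ∀ (a : Fin n → Fin n → EuclideanSpace ℝ (Fin n) → ℝ)
      (b : Fin n → EuclideanSpace ℝ (Fin n) → ℝ)
      (a' : Fin n → Fin n → EuclideanSpace ℝ (Fin n) → ℝ)
      (b' : Fin n → EuclideanSpace ℝ (Fin n) → ℝ) (u v : EuclideanSpace ℝ (Fin n) → ℝ),
      NodalPair L c r₁ D k a b a' b' u v →
        ∀ x ∈ closedBall (0 : EuclideanSpace ℝ (Fin n)) 6, u x ≠ 0 →
          ∃ y, κ ≤ |u y| ∧ dist y x ≤ δ ∧
            |Real.log (v y) - Real.log (v x)| ≤ C * (1 - Real.log |u x|) := by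
  obtain ⟨C, q, κ₀, hC, hq, hκ₀, hstep⟩ := growth_step n L hL c r₁ D k hc hr₁ hr8 hD
  have hk0 : (0 : ℝ) < k := by exact_mod_cast hk
  have hkne : k ≠ 0 := by omega
  set p : ℝ := (k : ℝ)⁻¹ with hp
  have hp0 : 0 < p := by positivity
  set ψ : ℝ → ℝ := fun t => (C * t) ^ p with hψ
  have hψ0 : ∀ t, 0 ≤ t → 0 ≤ ψ t := fun t ht => by positivity
  have hψmono : ∀ s t, 0 ≤ s → s ≤ t → ψ s ≤ ψ t := fun s t hs hst =>
    Real.rpow_le_rpow (by positivity) (by gcongr) hp0.le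
  set γ : ℝ := (1 + q) ^ p with hγ
  have hγ1 : 1 < γ := Real.one_lt_rpow (by linarith) hp0
  have hψγ : ∀ t, 0 ≤ t → ψ ((1 + q) * t) = γ * ψ t := fun t ht => by
    simp only [hψ, hγ]
    rw [← Real.mul_rpow (by positivity) (by positivity)]
    ring_nf
  set C' := max 1 (1 / (γ - 1)) with hC'
  have hC'1 : 1 ≤ C' := le_max_left _ _
  have hC'γ : 1 ≤ C' * (γ - 1) := by
    have : 1 / (γ - 1) ≤ C' := le_max_right _ _
    rwa [div_le_iff₀ (by linarith)] at this
  set e := δ / (2 * C') with he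
  have he0 : 0 < e := by positivity
  set κ := min κ₀ (min 1 (e ^ k / C)) with hκ
  have hκ0 : 0 < κ := by positivity
  have hκ1 : κ ≤ 1 := (min_le_right _ _).trans (min_le_left _ _)
  have hκe : ψ κ ≤ e := by
    have h1 : κ ≤ e ^ k / C := (min_le_right _ _).trans (min_le_right _ _)
    rw [le_div_iff₀ hC] at h1
    calc ψ κ ≤ (e ^ k) ^ p := Real.rpow_le_rpow (by positivity) (by linarith) hp0.le
      _ = e := by rw [hp]; exact Real.pow_rpow_inv_natCast he0.le hkne
  have hδe : C' * (2 * e) = δ := by rw [he]; field_simp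
  have hlogq : 0 < Real.log (1 + q) := Real.log_pos (by linarith)
  refine ⟨κ, C * (1 + 1 / Real.log (1 + q)), hκ0, hκ1, by positivity, ?_⟩
  intro a b a' b' u v hP x₀ hx₀ hux₀
  have claim : ∀ i : ℕ, ∀ x, u x ≠ 0 → dist x 0 + C' * max 0 (2 * ψ κ - ψ |u x|) ≤ 7 →
      κ ≤ (1 + q) ^ i * |u x| → ∃ y, κ ≤ |u y| ∧ dist y x ≤ C' * max 0 (2 * ψ κ - ψ |u x|) ∧
        |Real.log (v y) - Real.log (v x)| ≤ C * i := by
    intro i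
    induction i with
    | zero =>
      intro x _ _ hx
      refine ⟨x, by simpa using hx, ?_, by simp⟩
      rw [dist_self]
      positivity
    | succ i ih =>
      intro x hux hx7 hx
      by_cases hκx : κ ≤ |u x|
      · refine ⟨x, hκx, ?_, by simp; positivity⟩
        rw [dist_self]
        positivity
      have hκx := not_le.1 hκx
      have hpos : 0 < |u x| := abs_pos.2 hux
      have hψκ := hψmono _ _ hpos.le hκx.le
      have hψx := hψ0 _ hpos.le
      have hmx : max 0 (2 * ψ κ - ψ |u x|) = 2 * ψ κ - ψ |u x| :=
        max_eq_right (by linarith [hψ0 κ hκ0.le])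
      have hxb : x ∈ closedBall (0 : EuclideanSpace ℝ (Fin n)) 7 := by
        rw [mem_closedBall]
        have : 0 ≤ C' * max 0 (2 * ψ κ - ψ |u x|) := by positivity
        linarith
      obtain ⟨x', h1, h2, h3⟩ := hstep a b a' b' hP.op hP.op' u v hP.sm hP.sm' hP.sol hP.sol'
        hP.zero hP.tame x hxb hux (hκx.trans_le (min_le_left _ _))
      have hd : dist x' x ≤ ψ |u x| := by
        calc dist x' x = (dist x' x ^ k) ^ p := (Real.pow_rpow_inv_natCast dist_nonneg hkne).symm
          _ ≤ _ := Real.rpow_le_rpow (by positivity) h2 hp0.le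
      have hψx' : γ * ψ |u x| ≤ ψ |u x'| := by
        rw [← hψγ _ hpos.le]
        exact hψmono _ _ (by positivity) h1
      have hpos' : 0 < |u x'| := lt_of_lt_of_le (by positivity) h1
      have hbudget : ψ |u x| + C' * max 0 (2 * ψ κ - ψ |u x'|)
          ≤ C' * max 0 (2 * ψ κ - ψ |u x|) := by
        rw [hmx]
        rcases le_total (2 * ψ κ - ψ |u x'|) 0 with h | h
        · rw [max_eq_left h, mul_zero, add_zero]
          nlinarith
        · rw [max_eq_right h]
          have e1 : C' * (γ * ψ |u x|) ≤ C' * ψ |u x'| := by gcongr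
          have e2 : 1 * ψ |u x| ≤ C' * (γ - 1) * ψ |u x| := by gcongr
          linarith
      have htri := dist_triangle x' x 0
      obtain ⟨y, hy1, hy2, hy3⟩ := ih x' (abs_pos.1 hpos') (by linarith) (by
        refine hx.trans ?_
        rw [pow_succ, mul_assoc]
        gcongr)
      refine ⟨y, hy1, by linarith [dist_triangle y x' x], ?_⟩
      have := abs_sub_le (Real.log (v y)) (Real.log (v x')) (Real.log (v x))
      push_cast
      linarith
  have hpos : 0 < |u x₀| := abs_pos.2 hux₀
  have hone : |u x₀| ≤ 1 := hP.tame.le_one x₀ (closedBall_subset_closedBall (by norm_num) hx₀)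
  have hlog : Real.log |u x₀| ≤ 0 := Real.log_nonpos hpos.le hone
  set i := ⌈-Real.log |u x₀| / Real.log (1 + q)⌉₊ with hi
  have hbd : C' * max 0 (2 * ψ κ - ψ |u x₀|) ≤ δ := by
    rw [← hδe]
    gcongr
    exact max_le (by positivity) (by linarith [hψ0 _ hpos.le])
  obtain ⟨y, hy1, hy2, hy3⟩ := claim i x₀ hux₀ (by linarith [mem_closedBall.1 hx₀]) (by
    refine hκ1.trans ?_
    have h1 := Nat.le_ceil (-Real.log |u x₀| / Real.log (1 + q))
    rw [div_le_iff₀ hlogq, ← hi] at h1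
    have h2 : 0 ≤ Real.log ((1 + q) ^ i * |u x₀|) := by
      rw [Real.log_mul (by positivity) hpos.ne', Real.log_pow]
      linarith
    exact (Real.log_nonneg_iff (by positivity)).1 h2)
  refine ⟨y, hy1, hy2.trans hbd, hy3.trans ?_⟩
  have h1 := (Nat.ceil_lt_add_one (a := -Real.log |u x₀| / Real.log (1 + q))
    (div_nonneg (by linarith) hlogq.le)).le
  rw [← hi] at h1
  rw [mul_assoc]
  refine mul_le_mul_of_nonneg_left (h1.trans ?_) hC.le
  have h2 : 0 ≤ 1 / Real.log (1 + q) := by positivity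
  rw [div_eq_mul_one_div (-Real.log |u x₀|)]
  linarith

section Carleson
variable {n : ℕ} {L c r₁ D : ℝ} {k : ℕ} {a : Fin n → Fin n → EuclideanSpace ℝ (Fin n) → ℝ}
  {b : Fin n → EuclideanSpace ℝ (Fin n) → ℝ} {a' : Fin n → Fin n → EuclideanSpace ℝ (Fin n) → ℝ}
  {b' : Fin n → EuclideanSpace ℝ (Fin n) → ℝ} {u v : EuclideanSpace ℝ (Fin n) → ℝ}

theorem NodalPair.exists_ne (hP : NodalPair L c r₁ D k a b a' b' u v)
    {x : EuclideanSpace ℝ (Fin n)} (hx : x ∈ closedBall (0 : EuclideanSpace ℝ (Fin n)) 8) {r : ℝ}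
    (hr : 0 < r) (hrr : r ≤ r₁) : ∃ y ∈ closedBall x r, c * r ^ k ≤ |u y| := by
  obtain ⟨y, hy, hyN⟩ := exists_supN hP.sm.continuous x hr.le
  exact ⟨y, hy, hyN ▸ hP.tame.order x hx r hr hrr⟩

theorem NodalPair.ne' (hP : NodalPair L c r₁ D k a b a' b' u v) {x : EuclideanSpace ℝ (Fin n)}
    (hx : dist x 0 ≤ 8 + 1 / 2) (hux : 0 < |u x|) : 0 < |v x| :=
  abs_pos.2 fun h => abs_pos.1 hux (hP.zero x (mem_closedBall.2 hx) h)

theorem NodalPair.supN_pos (hP : NodalPair L c r₁ D k a b a' b' u v) (hc : 0 < c) (hr₁ : 0 < r₁)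
    (hr8 : r₁ ≤ 1 / 8) {s : ℝ} (hs : 1 ≤ s) : 0 < supN v 0 s := by
  obtain ⟨y, hy, hyu⟩ := hP.exists_ne (x := 0) (mem_closedBall_self (by norm_num)) hr₁ le_rfl
  have hy0 := mem_closedBall.1 hy
  exact (hP.ne' (by linarith) (lt_of_lt_of_le (by positivity) hyu)).trans_le
    (le_supN hP.sm'.continuous (mem_closedBall.2 (by linarith)))

end Carleson

set_option maxHeartbeats 1000000 in
/-- The maximum of `v` over a ball is controlled by its values, on a slightly larger ball, at
points where `u` is not too small. -/
theorem carleson (n : ℕ) (L : ℝ) (hL : 1 ≤ L) (c r₁ D : ℝ) (k : ℕ) (hc : 0 < c)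
    (hr₁ : 0 < r₁) (hr8 : r₁ ≤ 1 / 8) (hD : 1 ≤ D) (hk : 1 ≤ k) (δ : ℝ) (hδ : 0 < δ)
    (hδ1 : δ ≤ 1) : ∃ κ C : ℝ, 0 < κ ∧ κ ≤ 1 ∧
    ∀ (a : Fin n → Fin n → EuclideanSpace ℝ (Fin n) → ℝ)
      (b : Fin n → EuclideanSpace ℝ (Fin n) → ℝ)
      (a' : Fin n → Fin n → EuclideanSpace ℝ (Fin n) → ℝ)
      (b' : Fin n → EuclideanSpace ℝ (Fin n) → ℝ) (u v : EuclideanSpace ℝ (Fin n) → ℝ),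
      NodalPair L c r₁ D k a b a' b' u v → ∀ r, 1 ≤ r → r ≤ 4 →
        ∃ y ∈ closedBall (0 : EuclideanSpace ℝ (Fin n)) (r + 2 * δ), κ ≤ |u y| ∧
          Real.log (supN v 0 r) ≤ Real.log (v y) + C := by
  obtain ⟨κ, C, hκ, hκ1, hC, hchain⟩ := growth_chain n L hL c r₁ D k hc hr₁ hr8 hD hk δ hδ hδ1
  obtain ⟨Cl, hCl, hlip⟩ := lip_le n L hL
  set A := -Real.log c - k * Real.log r₁ + k * Real.log (4 * Cl) with hA
  set E := Real.log 2 + C * (1 + A) with hE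
  set θ := C * k / (1 + C * k) with hθ
  have hk0 : (0 : ℝ) < k := by exact_mod_cast hk
  have hθ0 : 0 < θ := by positivity
  have h1θ : 1 - θ = 1 / (1 + C * k) := by rw [hθ]; field_simp; ring
  have hθ1 : θ < 1 := by
    have : 0 < 1 - θ := by rw [h1θ]; positivity
    linarith
  refine ⟨κ, E + (θ * (θ / (1 - θ)) + θ) * Real.log 2 / (1 - θ) - θ / (1 - θ) * Real.log δ,
    hκ, hκ1, ?_⟩
  intro a b a' b' u v hP r hr hr4
  have hcu := hP.sm.continuous
  have hcv := hP.sm'.continuous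
  have hMpos := fun s (hs : 1 ≤ s) => hP.supN_pos hc hr₁ hr8 hs
  set S := {y | κ ≤ |u y|} ∩ closedBall (0 : EuclideanSpace ℝ (Fin n)) (r + 2 * δ) with hS
  have hSc : IsCompact S :=
    (isCompact_closedBall _ _).inter_left (isClosed_le continuous_const hcu.abs)
  have hSne : S.Nonempty := by
    obtain ⟨y, hy, hyu⟩ := hP.exists_ne (x := 0) (mem_closedBall_self (by norm_num)) hr₁
      le_rfl
    have hy0 := mem_closedBall.1 hy
    obtain ⟨w, hw1, hw2, -⟩ := hchain a b a' b' u v hP y (mem_closedBall.2 (by linarith))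
      (abs_pos.1 (lt_of_lt_of_le (by positivity) hyu))
    exact ⟨w, hw1, mem_closedBall.2 (by linarith [dist_triangle w y 0])⟩
  obtain ⟨y₀, hy₀, hmax⟩ := hSc.exists_isMaxOn hSne hcv.abs.continuousOn
  refine ⟨y₀, hy₀.2, hy₀.1, ?_⟩
  have hball : ∀ y ∈ S, dist y 0 ≤ 8 + 1 / 2 := fun y hy => by
    have := mem_closedBall.1 hy.2
    linarith
  set g := Real.log (v y₀) with hg
  have hlogmax : ∀ y ∈ S, Real.log (v y) ≤ g := fun y hy => by
    rw [hg, ← Real.log_abs (v y), ← Real.log_abs (v y₀)]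
    exact Real.log_le_log (hP.ne' (hball y hy) (hκ.trans_le hy.1)) (hmax hy)
  have key := contraction_bound (f := fun s => Real.log (supN v 0 s)) (s0 := r) (s1 := r + δ)
    (θ := θ) (B := (1 - θ) * (g + E)) (K := θ) (M0 := Real.log (supN v 0 (r + δ)))
    (by linarith) hθ0 hθ1 hθ0.le ?_ ?_
  · rw [add_sub_cancel_left, add_div, mul_div_cancel_left₀ _ (by linarith)] at key
    linarith
  · intro s hs
    exact Real.log_le_log (hMpos s (hr.trans hs.1)) (supN_mono_radius hcv (by linarith [hs.1]) hs.2.le)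
  · intro s hs t ht hst
    have hs1 : 1 ≤ s := hr.trans hs.1
    have hMs := hMpos s hs1
    have hMt := hMpos (s + t) (by linarith)
    have hle : supN v 0 s ≤ supN v 0 (s + t) := supN_mono_radius hcv (by linarith) (by linarith)
    have ht1 : t ≤ 1 := by linarith [hs.1]
    obtain ⟨z, hz, hzM⟩ := exists_supN hcv (0 : EuclideanSpace ℝ (Fin n)) (r := s) (by linarith)
    rw [mem_closedBall] at hz
    have hsub : ball z (2 * (t / 2)) ⊆ closedBall 0 (s + t) := fun y hy => by
      rw [mem_ball] at hy; rw [mem_closedBall]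
      linarith [dist_triangle y z 0]
    set σ := t * supN v 0 s / (4 * Cl * supN v 0 (s + t)) with hσ
    have hσ0 : 0 < σ := by positivity
    have hσt : σ ≤ t / 4 := by
      rw [hσ, div_le_iff₀ (by positivity)]
      have h1 : t * supN v 0 s ≤ t * supN v 0 (s + t) := mul_le_mul_of_nonneg_left hle ht.le
      have h2 : t * supN v 0 (s + t) ≤ Cl * (t * supN v 0 (s + t)) :=
        le_mul_of_one_le_left (by positivity) hCl
      linarith
    obtain ⟨y, hy, hyu⟩ := hP.exists_ne (x := z) (mem_closedBall.2 (by linarith [hs.1]))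
      (mul_pos hr₁ hσ0) (mul_le_of_le_one_right hr₁.le (by linarith))
    have hyz : dist y z < σ := by
      have := mem_closedBall.1 hy
      nlinarith
    have hlow : supN v 0 s / 2 ≤ |v y| := by
      have h1 := hlip a' b' hP.op' v hP.sm' z (t / 2) (supN v 0 (s + t)) (by linarith) (by linarith)
        (fun w hw => hP.sol' w (closedBall_subset_closedBall (by linarith) (hsub hw)))
        (fun w hw => le_supN hcv (hsub hw)) y (mem_ball.2 (by linarith)) z
        (mem_ball_self (by linarith))
      have h2 : Cl / (t / 2) * supN v 0 (s + t) * dist y z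
          ≤ Cl / (t / 2) * supN v 0 (s + t) * σ :=
        mul_le_mul_of_nonneg_left hyz.le (by positivity)
      have h3 : Cl / (t / 2) * supN v 0 (s + t) * σ = supN v 0 s / 2 := by
        rw [hσ]; field_simp; ring
      have h4 : |v z| - |v y| ≤ |v y - v z| := by
        rw [abs_sub_comm]; exact abs_sub_abs_le_abs_sub _ _
      linarith
    have hyu0 : 0 < |u y| := lt_of_lt_of_le (by positivity) hyu
    have hy0 : dist y 0 ≤ s + σ := by linarith [dist_triangle y z 0]
    obtain ⟨w, hw1, hw2, hw3⟩ := hchain a b a' b' u v hP y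
      (mem_closedBall.2 (by linarith [hs.1])) (abs_pos.1 hyu0)
    have hwS : w ∈ S := ⟨hw1, mem_closedBall.2 (by linarith [dist_triangle w y 0])⟩
    have hwg := hlogmax w hwS
    have hlogu : -Real.log |u y| ≤ A - k * Real.log t - k * Real.log (supN v 0 s)
        + k * Real.log (supN v 0 (s + t)) := by
      have h1 := Real.log_le_log (by positivity) hyu
      rw [Real.log_mul hc.ne' (by positivity), Real.log_pow, Real.log_mul hr₁.ne' hσ0.ne', hσ,
        Real.log_div (by positivity) (by positivity), Real.log_mul ht.ne' hMs.ne',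
        Real.log_mul (by positivity) hMt.ne'] at h1
      rw [hA]
      linarith
    have hlogv : Real.log (supN v 0 s) - Real.log 2 ≤ Real.log (v y) := by
      rw [← Real.log_div hMs.ne' two_ne_zero, ← Real.log_abs (v y)]
      exact Real.log_le_log (by positivity) hlow
    have h5 : Real.log (v y) - Real.log (v w) ≤ C * (1 - Real.log |u y|) :=
      (le_abs_self _).trans (by rwa [abs_sub_comm])
    have h6 : C * (1 - Real.log |u y|) ≤ C * (1 + (A - k * Real.log t - k * Real.log (supN v 0 s)
        + k * Real.log (supN v 0 (s + t)))) := mul_le_mul_of_nonneg_left (by linarith) hC.le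
    have h7 : (1 + C * k) * Real.log (supN v 0 s)
        ≤ C * k * Real.log (supN v 0 (s + t)) + (g + E) - C * k * Real.log t := by
      rw [hE]
      linarith
    rw [h1θ, hθ]
    rw [show C * k / (1 + C * k) * Real.log (supN v 0 (s + t)) + 1 / (1 + C * k) * (g + E)
      - C * k / (1 + C * k) * Real.log t = (C * k * Real.log (supN v 0 (s + t)) + (g + E)
        - C * k * Real.log t) / (1 + C * k) by ring, le_div_iff₀ (by positivity)]
    linarith

theorem exists_subset_of_pigeonhole {α : Type*} (t : Finset α) (f : ℕ → Finset α)
    (hf : ∀ j, f j ⊆ t) (hm : Monotone f) : ∃ j ≤ t.card, f (j + 1) ⊆ f j := by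
  by_contra! hcon
  have : ∀ j, j ≤ t.card + 1 → j ≤ (f j).card := by
    intro j
    induction j with
    | zero => intro _; exact Nat.zero_le _
    | succ j ih =>
      intro hj
      have h1 : f j ⊂ f (j + 1) := ⟨hm (Nat.le_succ j), hcon j (by omega)⟩
      have := Finset.card_lt_card h1
      have := ih (by omega)
      omega
  have h1 := this (t.card + 1) le_rfl
  have h2 := Finset.card_le_card (hf (t.card + 1))
  omega

set_option maxHeartbeats 1000000 in
open Classical in
/-- Doubling for a solution whose nodal set is contained in that of a tame solution. -/
theorem nodal_comparison (n : ℕ) (hn : 0 < n) (L : ℝ) (hL : 1 ≤ L) (c r₁ D : ℝ) (k : ℕ) (hc : 0 < c)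
    (hr₁ : 0 < r₁) (hr8 : r₁ ≤ 1 / 8) (hD : 1 ≤ D) (hk : 1 ≤ k) : ∃ C > 0,
    ∀ (a : Fin n → Fin n → EuclideanSpace ℝ (Fin n) → ℝ)
      (b : Fin n → EuclideanSpace ℝ (Fin n) → ℝ)
      (a' : Fin n → Fin n → EuclideanSpace ℝ (Fin n) → ℝ)
      (b' : Fin n → EuclideanSpace ℝ (Fin n) → ℝ) (u v : EuclideanSpace ℝ (Fin n) → ℝ),
      NodalPair L c r₁ D k a b a' b' u v → supN v 0 2 ≤ C * supN v 0 1 := by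
  obtain ⟨κb, Cb, hκb, hκb1, hCb, hchain⟩ := growth_chain n L hL c r₁ D k hc hr₁ hr8 hD hk 1
    one_pos le_rfl
  obtain ⟨Cl, hCl, hlip⟩ := lip_le n L hL
  obtain ⟨CH, hCH, hhar⟩ := harnack n L hL
  set ε := min (1 / 2) (κb / (4 * Cl)) with hε
  have hε0 : 0 < ε := by positivity
  have hε2 : ε ≤ 1 / 2 := min_le_left _ _
  have hεκ : 2 * Cl * ε ≤ κb / 2 := by
    have : ε ≤ κb / (4 * Cl) := min_le_right _ _
    rw [le_div_iff₀ (by positivity)] at this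
    linarith
  obtain ⟨t', -, ht'fin, ht'cov⟩ := (isCompact_closedBall (0 : EuclideanSpace ℝ (Fin n)) 7).finite_cover_balls
    (e := ε / 5) (by positivity)
  obtain ⟨t, rfl⟩ := ht'fin.exists_finset_coe
  set J := t.card with hJ
  set δ : ℝ := 1 / (3 * (J + 2)) with hδ
  have hδ0 : 0 < δ := by positivity
  have hδJ : 3 * (J + 2) * δ = 1 := by rw [hδ]; field_simp
  have hJ0 : (0 : ℝ) ≤ J := Nat.cast_nonneg _
  have hδ1 : δ ≤ 1 / 6 := by nlinarith
  obtain ⟨κ, C, hκ, hκ1, hcarl⟩ := carleson n L hL c r₁ D k hc hr₁ hr8 hD hk δ hδ0 (by linarith)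
  set Cκ := Cb * (1 - Real.log κ) with hCκ
  obtain ⟨c', hc', hlow⟩ := chain_lower n hn L hL δ 1 (Real.exp (C + 2 * Cκ + CH)) hδ0 one_pos
    (Real.exp_pos _)
  refine ⟨1 / c', by positivity, ?_⟩
  intro a b a' b' u v hP
  have hcu := hP.sm.continuous
  have hcv := hP.sm'.continuous
  set ρ : ℕ → ℝ := fun j => 2 + 3 * δ * j with hρ
  have hρ2 : ∀ j, 2 ≤ ρ j := fun j => by simp only [hρ]; nlinarith [Nat.cast_nonneg (α := ℝ) j]
  set link : EuclideanSpace ℝ (Fin n) → EuclideanSpace ℝ (Fin n) → Prop := fun x p =>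
    ∃ y ∈ ball p (ε / 5), y ∈ closedBall (0 : EuclideanSpace ℝ (Fin n)) 7 ∧ κb ≤ |u y| ∧
      |Real.log (v y) - Real.log (v x)| ≤ Cκ with hlink
  have hlinked : ∀ x ∈ closedBall (0 : EuclideanSpace ℝ (Fin n)) 6, κ ≤ |u x| →
      ∃ p ∈ t, link x p := by
    intro x hx hux
    obtain ⟨y, hy1, hy2, hy3⟩ := hchain a b a' b' u v hP x hx (abs_pos.1 (hκ.trans_le hux))
    have hy7 : y ∈ closedBall (0 : EuclideanSpace ℝ (Fin n)) 7 := by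
      rw [mem_closedBall] at hx ⊢
      linarith [dist_triangle y x 0]
    obtain ⟨p, hp, hyp⟩ := Set.mem_iUnion₂.1 (ht'cov hy7)
    refine ⟨p, hp, y, hyp, hy7, hy1, hy3.trans ?_⟩
    rw [hCκ]
    have := Real.log_le_log hκ hux
    gcongr
  have hsame : ∀ x x' p, link x p → link x' p →
      |Real.log (v x) - Real.log (v x')| ≤ 2 * Cκ + CH := by
    rintro x x' p ⟨y, hy, hy7, hyu, hyx⟩ ⟨y', hy', -, -, hyx'⟩
    have hdist : dist y' y < 1 / 2 * ε := by
      have := dist_triangle_right y' y p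
      rw [mem_ball] at hy hy'
      linarith
    have hy0 := mem_closedBall.1 hy7
    have hsub : ball y 1 ⊆ closedBall 0 (8 + 1 / 2) := fun w hw => by
      rw [mem_ball] at hw
      rw [mem_closedBall]
      linarith [dist_triangle w y 0]
    have hne : ∀ w ∈ ball y ε, u w ≠ 0 := by
      intro w hw h0
      have h1 := hlip a b hP.op u hP.sm y (1 / 2) 1 (by norm_num) (by norm_num)
        (fun w hw => hP.sol w (hsub (by simpa using hw)))
        (fun w hw => hP.tame.le_one w (hsub (by simpa using hw))) w
        (ball_subset_ball hε2 hw) y (mem_ball_self (by norm_num))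
      rw [h0, zero_sub, abs_neg] at h1
      have h2 : Cl / (1 / 2) * 1 * dist w y ≤ 2 * Cl * ε := by
        have := (mem_ball.1 hw).le
        calc _ = 2 * Cl * dist w y := by ring
          _ ≤ _ := by gcongr
      linarith
    have hsubε : ball y ε ⊆ closedBall 0 (8 + 1 / 2) :=
      (ball_subset_ball (by linarith)).trans hsub
    have h3 := hhar a' b' hP.op' v hP.sm' y ε (1 / 2) hε0 (by linarith) (by norm_num)
      (fun w hw => hP.sol' w (hsubε hw)) (fun w hw h => hne w hw (hP.zero w (hsubε hw) h))
      (by norm_num) y (mem_ball_self (by positivity)) y' (mem_ball.2 (by linarith))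
    have h4 : CH / (1 / 2 * ε) * dist y' y ≤ CH := by
      rw [div_mul_eq_mul_div, div_le_iff₀ (by positivity)]
      exact mul_le_mul_of_nonneg_left hdist.le hCH.le
    have h5 := abs_le.1 (h3.trans h4)
    have h6 := abs_le.1 hyx
    have h7 := abs_le.1 hyx'
    exact abs_le.2 ⟨by linarith, by linarith⟩
  set I : ℕ → Finset (EuclideanSpace ℝ (Fin n)) := fun j =>
    t.filter fun p => ∃ x ∈ closedBall (0 : EuclideanSpace ℝ (Fin n)) (ρ j), κ ≤ |u x| ∧ link x p
    with hI
  have hImono : Monotone I := by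
    intro i j hij p hp
    rw [hI, Finset.mem_filter] at hp ⊢
    obtain ⟨hpt, x, hx, hx'⟩ := hp
    refine ⟨hpt, x, closedBall_subset_closedBall ?_ hx, hx'⟩
    have : (i : ℝ) ≤ j := by exact_mod_cast hij
    simp only [hρ]
    gcongr
  obtain ⟨j, hjJ, hj⟩ := exists_subset_of_pigeonhole t I (fun j => Finset.filter_subset _ _) hImono
  have hjJ' : (j : ℝ) ≤ J := by exact_mod_cast hjJ
  have hρj : ρ j + 3 * δ ≤ 3 := by simp only [hρ]; nlinarith
  have hρj2 := hρ2 j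
  obtain ⟨y, hy, hyu, hyv⟩ := hcarl a b a' b' u v hP (ρ j + δ) (by linarith) (by linarith)
  have hy6 : y ∈ closedBall (0 : EuclideanSpace ℝ (Fin n)) 6 :=
    closedBall_subset_closedBall (by linarith) hy
  obtain ⟨p, hpt, hyp⟩ := hlinked y hy6 hyu
  have hp1 : p ∈ I (j + 1) := by
    rw [hI, Finset.mem_filter]
    refine ⟨hpt, y, closedBall_subset_closedBall ?_ hy, hyu, hyp⟩
    simp only [hρ]; push_cast; linarith
  have hp2 := hj hp1
  rw [hI, Finset.mem_filter] at hp2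
  obtain ⟨-, x, hx, hxu, hxp⟩ := hp2
  have h1 := hsame y x p hyp hxp
  have hM1 := hP.supN_pos hc hr₁ hr8 (s := ρ j) (by linarith)
  have hM2 := hP.supN_pos hc hr₁ hr8 (s := ρ j + δ) (by linarith)
  have hx0 := mem_closedBall.1 hx
  have h2 : Real.log (v x) ≤ Real.log (supN v 0 (ρ j)) := by
    rw [← Real.log_abs]
    exact Real.log_le_log (hP.ne' (by linarith) (hκ.trans_le hxu)) (le_supN hcv hx)
  have hgrow : supN v 0 (ρ j + δ) ≤ Real.exp (C + 2 * Cκ + CH) * supN v 0 (ρ j) := by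
    rw [← Real.log_le_log_iff hM2 (by positivity), Real.log_mul (Real.exp_pos _).ne' hM1.ne',
      Real.log_exp]
    linarith [le_abs_self (Real.log (v y) - Real.log (v x))]
  have h3 := hlow a' b' hP.op' v hP.sm' (ρ j) (by linarith) (by linarith)
    (fun w hw => hP.sol' w (closedBall_subset_closedBall (by linarith) hw)) hgrow 0
    (mem_closedBall_self (by linarith))
  have h4 : supN v 0 2 ≤ supN v 0 (ρ j + δ) := supN_mono_radius hcv (by norm_num) (by linarith)
  rw [one_div, ← div_eq_inv_mul, le_div_iff₀ hc']
  calc _ = c' * supN v 0 2 := mul_comm _ _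
    _ ≤ c' * supN v 0 (ρ j + δ) := by gcongr
    _ ≤ _ := h3

section UniformMeasures
open Filter Topology
open scoped ENNReal NNReal

variable {X : Type*} [MetricSpace X] [MeasurableSpace X] [BorelSpace X] [SecondCountableTopology X]

theorem measure_open_le_of_frequently (μ ν : Measure X) [IsFiniteMeasure μ] [IsFiniteMeasure ν]
    {g h : ℕ → ℝ≥0∞} (hg : ∀ x (k : ℕ), μ (ball x (1 / ((k : ℝ) + 1))) = g k)
    (hh : ∀ x (k : ℕ), ν (ball x (1 / ((k : ℝ) + 1))) = h k) (hpos : ∀ k, h k ≠ 0) (hfin : ∀ k, h k ≠ ∞)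
    {K : ℝ≥0∞} (hK : ∃ᶠ k in atTop, g k ≤ K * h k) {U : Set X} (hU : IsOpen U) :
    μ U ≤ K * ν U := by
  have hmeas : ∀ k : ℕ, MeasurableSet {p : X × X | p.2 ∈ U ∧ dist p.2 p.1 < 1 / ((k : ℝ) + 1)} :=
    fun k => ((hU.preimage continuous_snd).inter
      (isOpen_lt (continuous_snd.dist continuous_fst) continuous_const)).measurableSet
  have hm1 : ∀ k : ℕ, Measurable fun x => ν (U ∩ ball x (1 / ((k : ℝ) + 1))) := fun k => by
    simpa [Set.preimage, Set.inter_def, mem_ball] using measurable_measure_prodMk_left (ν := ν) (hmeas k)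
  have hfub : ∀ k : ℕ, ∫⁻ x, ν (U ∩ ball x (1 / ((k : ℝ) + 1))) ∂μ = g k * ν U := by
    intro k
    have h1 := Measure.prod_apply (μ := μ) (ν := ν) (hmeas k)
    have h2 := Measure.prod_apply_symm (μ := μ) (ν := ν) (hmeas k)
    have e1 : ∀ x : X, Prod.mk x ⁻¹' {p : X × X | p.2 ∈ U ∧ dist p.2 p.1 < 1 / ((k : ℝ) + 1)}
        = U ∩ ball x (1 / ((k : ℝ) + 1)) := fun x => rfl
    have e2 : ∀ y : X, μ ((fun x => (x, y)) ⁻¹'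
        {p : X × X | p.2 ∈ U ∧ dist p.2 p.1 < 1 / ((k : ℝ) + 1)}) = U.indicator (fun _ => g k) y := by
      intro y
      by_cases hy : y ∈ U
      · rw [Set.indicator_of_mem hy, ← hg y k]
        congr 1
        ext x
        simp [hy, mem_ball, dist_comm]
      · rw [Set.indicator_of_notMem hy]
        simp [Set.preimage, hy]
    simp_rw [e1] at h1
    simp_rw [e2] at h2
    rw [← h1, h2, lintegral_indicator hU.measurableSet, setLIntegral_const]
  have hlow : ∀ x, U.indicator (fun _ => (1 : ℝ≥0∞)) x
      ≤ liminf (fun k : ℕ => ν (U ∩ ball x (1 / ((k : ℝ) + 1))) / h k) atTop := by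
    intro x
    by_cases hx : x ∈ U
    · rw [Set.indicator_of_mem hx]
      obtain ⟨ε, hε, hεU⟩ := Metric.isOpen_iff.1 hU x hx
      refine le_liminf_of_le (by isBoundedDefault) ?_
      obtain ⟨N, hN⟩ := exists_nat_one_div_lt hε
      filter_upwards [eventually_ge_atTop N] with k hk
      have hsub : ball x (1 / ((k : ℝ) + 1)) ⊆ U :=
        (ball_subset_ball ((Nat.one_div_le_one_div hk).trans hN.le)).trans hεU
      rw [Set.inter_eq_right.2 hsub, hh, ENNReal.div_self (hpos k) (hfin k)]
    · rw [Set.indicator_of_notMem hx]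
      exact zero_le
  calc μ U = ∫⁻ x, U.indicator (fun _ => (1 : ℝ≥0∞)) x ∂μ := by
        rw [lintegral_indicator hU.measurableSet, setLIntegral_const, one_mul]
    _ ≤ ∫⁻ x, liminf (fun k : ℕ => ν (U ∩ ball x (1 / ((k : ℝ) + 1))) / h k) atTop ∂μ :=
        lintegral_mono hlow
    _ ≤ liminf (fun k : ℕ => ∫⁻ x, ν (U ∩ ball x (1 / ((k : ℝ) + 1))) / h k ∂μ) atTop :=
        lintegral_liminf_le fun k => (hm1 k).div_const _
    _ ≤ K * ν U := by
        refine liminf_le_of_frequently_le' (hK.mono fun k hk => ?_)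
        simp_rw [ENNReal.div_eq_inv_mul]
        rw [lintegral_const_mul _ (hm1 k), hfub, ← mul_assoc, ← ENNReal.div_eq_inv_mul]
        gcongr
        exact ENNReal.div_le_of_le_mul hk

theorem exists_measure_le_of_uniform (μ ν : Measure X) [IsFiniteMeasure μ] [IsFiniteMeasure ν]
    [μ.IsOpenPosMeasure] [ν.IsOpenPosMeasure] [Nonempty X]
    (hμ : ∀ x y r, μ (ball x r) = μ (ball y r)) (hν : ∀ x y r, ν (ball x r) = ν (ball y r)) :
    ∃ K : ℝ≥0, μ ≤ K • ν := by
  obtain ⟨x₀⟩ := ‹Nonempty X›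
  have hr : ∀ k : ℕ, 0 < 1 / ((k : ℝ) + 1) := fun k => by positivity
  have hpμ : ∀ k : ℕ, μ (ball x₀ (1 / ((k : ℝ) + 1))) ≠ 0 :=
    fun k => (measure_ball_pos μ x₀ (hr k)).ne'
  have hpν : ∀ k : ℕ, ν (ball x₀ (1 / ((k : ℝ) + 1))) ≠ 0 :=
    fun k => (measure_ball_pos ν x₀ (hr k)).ne'
  have hfreq : ∃ N : ℕ, 0 < N ∧ ∃ᶠ k : ℕ in atTop,
      μ (ball x₀ (1 / ((k : ℝ) + 1))) ≤ (N : ℝ≥0∞) * ν (ball x₀ (1 / ((k : ℝ) + 1))) := by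
    by_contra! hcon
    have hle : ∀ N : ℕ, 0 < N → (N : ℝ≥0∞) * ν Set.univ ≤ μ Set.univ := by
      intro N hN
      have hN0 : (N : ℝ≥0∞) ≠ 0 := by exact_mod_cast hN.ne'
      have h1 := measure_open_le_of_frequently ν μ (K := (N : ℝ≥0∞)⁻¹)
        (g := fun k => ν (ball x₀ (1 / ((k : ℝ) + 1)))) (h := fun k => μ (ball x₀ (1 / ((k : ℝ) + 1))))
        (fun x k => hν _ _ _) (fun x k => hμ _ _ _) hpμ (fun k => measure_ne_top _ _)
        (by
          have h2 := hcon N hN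
          refine Eventually.frequently (h2.mono fun k hk => ?_)
          rw [mul_comm, ← div_eq_mul_inv]
          refine (ENNReal.le_div_iff_mul_le (Or.inl hN0) (Or.inl (by simp))).2 ?_
          rw [mul_comm]
          exact hk.le) isOpen_univ
      rw [mul_comm, ← div_eq_mul_inv] at h1
      rw [mul_comm]
      exact (ENNReal.le_div_iff_mul_le (Or.inl hN0) (Or.inl (by simp))).1 h1
    have hνpos : ν Set.univ ≠ 0 := (isOpen_univ.measure_pos ν ⟨x₀, trivial⟩).ne'
    obtain ⟨N, hN⟩ := ENNReal.exists_nat_mul_gt hνpos (measure_ne_top μ Set.univ)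
    rcases Nat.eq_zero_or_pos N with h0 | h0
    · simp [h0] at hN
    · exact absurd (hle N h0) (not_le.2 hN)
  obtain ⟨N, -, hN⟩ := hfreq
  refine ⟨N, Measure.le_iff.2 fun s _ => ?_⟩
  refine le_of_forall_gt fun c hc => ?_
  obtain ⟨U, hsU, hU, hUc⟩ := Set.exists_isOpen_lt_of_lt s c hc
  refine lt_of_le_of_lt (measure_mono hsU) (lt_of_le_of_lt ?_ hUc)
  have := measure_open_le_of_frequently μ ν (K := (N : ℝ≥0∞))
    (g := fun k => μ (ball x₀ (1 / ((k : ℝ) + 1)))) (h := fun k => ν (ball x₀ (1 / ((k : ℝ) + 1))))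
    (fun x k => hμ _ _ _) (fun x k => hν _ _ _) hpν (fun k => measure_ne_top _ _) hN hU
  simpa using this

end UniformMeasures

section SphereMeasure
open Filter Topology
open scoped ENNReal NNReal Pointwise

variable {n : ℕ}

/-- The `(n-1)`-dimensional Hausdorff measure of the sphere of radius `r`, pulled back to the
unit sphere. -/
def sphMeas (n : ℕ) (r : ℝ) : Measure (sphere (0 : EuclideanSpace ℝ (Fin n)) 1) :=
  (μH[(n : ℝ) - 1]).comap fun θ => r • (θ : EuclideanSpace ℝ (Fin n))

theorem smul_sphere_embedding {r : ℝ} (hr : r ≠ 0) :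
    MeasurableEmbedding fun θ : sphere (0 : EuclideanSpace ℝ (Fin n)) 1 =>
      r • (θ : EuclideanSpace ℝ (Fin n)) :=
  (Homeomorph.smulOfNeZero r hr).measurableEmbedding.comp
    (MeasurableEmbedding.subtype_coe isClosed_sphere.measurableSet)

theorem sphMeas_apply {r : ℝ} (hr : r ≠ 0) (s : Set (sphere (0 : EuclideanSpace ℝ (Fin n)) 1)) :
    sphMeas n r s = μH[(n : ℝ) - 1] ((fun θ : sphere (0 : EuclideanSpace ℝ (Fin n)) 1 =>
      r • (θ : EuclideanSpace ℝ (Fin n))) '' s) :=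
  (smul_sphere_embedding hr).comap_apply _ _

theorem smul_sphere_range {r : ℝ} (hr : 0 < r) :
    Set.range (fun θ : sphere (0 : EuclideanSpace ℝ (Fin n)) 1 =>
      r • (θ : EuclideanSpace ℝ (Fin n))) = sphere 0 r := by
  ext x
  constructor
  · rintro ⟨θ, rfl⟩
    have := norm_eq_of_mem_sphere θ
    simp [norm_smul, this, hr.le]
  · intro hx
    have hx' : ‖x‖ = r := mem_sphere_zero_iff_norm.1 hx
    refine ⟨⟨r⁻¹ • x, ?_⟩, ?_⟩
    · rw [mem_sphere_zero_iff_norm, norm_smul, norm_inv, hx', Real.norm_of_nonneg hr.le,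
        inv_mul_cancel₀ hr.ne']
    · simp [smul_smul, hr.ne']

theorem setIntegral_sphere {r : ℝ} (hr : 0 < r) (f : EuclideanSpace ℝ (Fin n) → ℝ) :
    ∫ x in sphere 0 r, f x ∂μH[(n : ℝ) - 1]
      = ∫ θ : sphere (0 : EuclideanSpace ℝ (Fin n)) 1, f (r • (θ : EuclideanSpace ℝ (Fin n)))
        ∂(sphMeas n r) := by
  rw [← (smul_sphere_embedding hr.ne').integral_map, sphMeas,
    (smul_sphere_embedding hr.ne').map_comap, smul_sphere_range hr]

theorem hausdorff_sphere_lt_top (hn : 2 ≤ n) {r : ℝ} (hr : 0 < r) :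
    μH[(n : ℝ) - 1] (sphere (0 : EuclideanSpace ℝ (Fin n)) r) < ∞ := by
  classical
  have hcard : ∀ i : Fin n, ((Fintype.card {j : Fin n // j ≠ i} : ℕ) : ℝ) = (n : ℝ) - 1 := by
    intro i
    rw [Fintype.card_subtype_compl]
    simp [Nat.cast_sub (show 1 ≤ n by omega)]
  set G : (i : Fin n) → ℝ → ({j : Fin n // j ≠ i} → ℝ) → EuclideanSpace ℝ (Fin n) :=
    fun i ε y => WithLp.toLp 2 fun j => if h : j = i then ε else y ⟨j, h⟩ with hG
  have hGi : ∀ i ε y, G i ε y i = ε := fun i ε y => by simp [hG]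
  have hG0 : ∀ i ε y, ε ≠ 0 → G i ε y ≠ 0 := fun i ε y hε h => hε (by rw [← hGi i ε y, h]; simp)
  have hGc : ∀ i ε, ContDiff ℝ 1 (G i ε) := by
    intro i ε
    rw [contDiff_euclidean]
    intro j
    by_cases h : j = i
    · have : (fun y => G i ε y j) = fun _ => ε := by ext y; simp [hG, h]
      rw [this]
      exact contDiff_const
    · have : (fun y => G i ε y j) = fun y => y ⟨j, h⟩ := by ext y; simp [hG, h]
      rw [this]
      exact contDiff_apply ℝ ℝ _
  set F : (i : Fin n) → ℝ → ({j : Fin n // j ≠ i} → ℝ) → EuclideanSpace ℝ (Fin n) :=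
    fun i ε y => r • (‖G i ε y‖⁻¹ • G i ε y) with hF
  have hFc : ∀ i ε, ε ≠ 0 → ContDiff ℝ 1 (F i ε) := by
    intro i ε hε
    have h1 : ContDiff ℝ 1 fun y => ‖G i ε y‖⁻¹ :=
      ((hGc i ε).norm ℝ fun y => hG0 i ε y hε).inv fun y => norm_ne_zero_iff.2 (hG0 i ε y hε)
    exact (contDiff_const (c := r)).smul (h1.smul (hGc i ε))
  have hfin : ∀ i ε, ε ≠ 0 →
      μH[(n : ℝ) - 1] (F i ε '' closedBall (0 : {j : Fin n // j ≠ i} → ℝ) 1) < ∞ := by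
    intro i ε hε
    obtain ⟨K, hK⟩ := (hFc i ε hε).locallyLipschitz.locallyLipschitzOn.exists_lipschitzOnWith_of_compact
      (isCompact_closedBall (0 : {j : Fin n // j ≠ i} → ℝ) 1)
    refine (hK.hausdorffMeasure_image_le (d := (n : ℝ) - 1) (by rw [← hcard i]; positivity)).trans_lt ?_
    rw [← hcard i, hausdorffMeasure_pi_real]
    refine ENNReal.mul_lt_top (ENNReal.rpow_lt_top_of_nonneg (by positivity) (by simp)) ?_
    exact (isCompact_closedBall _ _).measure_lt_top
  have hcover : sphere (0 : EuclideanSpace ℝ (Fin n)) r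
      ⊆ ⋃ i : Fin n, (F i 1 '' closedBall 0 1 ∪ F i (-1) '' closedBall 0 1) := by
    intro x hx
    have hx' : ‖x‖ = r := mem_sphere_zero_iff_norm.1 hx
    obtain ⟨i, -, hi⟩ := Finset.exists_max_image Finset.univ (fun j => |x j|)
      ⟨(⟨0, by omega⟩ : Fin n), Finset.mem_univ _⟩
    have hi0 : 0 < |x i| := by
      by_contra! h
      have : x = 0 := by
        ext j
        simpa using abs_nonpos_iff.1 ((hi j (Finset.mem_univ j)).trans h)
      rw [this, norm_zero] at hx'
      exact hr.ne hx'
    have key : ∀ ε : ℝ, x i = ε * |x i| → x ∈ F i ε '' closedBall 0 1 := by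
      intro ε hε
      refine ⟨fun j => x j / |x i|, ?_, ?_⟩
      · rw [mem_closedBall, dist_zero_right, pi_norm_le_iff_of_nonneg zero_le_one]
        intro j
        rw [Real.norm_eq_abs, abs_div, abs_abs, div_le_one hi0]
        exact hi j (Finset.mem_univ _)
      · have hGx : G i ε (fun j => x j / |x i|) = |x i|⁻¹ • x := by
          ext j
          by_cases h : j = i
          · subst h
            simp only [hGi, PiLp.smul_apply, smul_eq_mul]
            rw [inv_mul_eq_div, eq_div_iff hi0.ne']
            exact hε.symm
          · simp only [hG, h, dite_false, PiLp.smul_apply, smul_eq_mul]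
            rw [inv_mul_eq_div]
        simp only [hF]
        rw [hGx, norm_smul, norm_inv, Real.norm_eq_abs, abs_abs, hx', smul_smul, smul_smul]
        have : r * (|x i|⁻¹ * r)⁻¹ * |x i|⁻¹ = 1 := by field_simp
        rw [this, one_smul]
    refine Set.mem_iUnion.2 ⟨i, ?_⟩
    rcases le_total 0 (x i) with h | h
    · exact Or.inl (key 1 (by rw [abs_of_nonneg h]; ring))
    · exact Or.inr (key (-1) (by rw [abs_of_nonpos h]; ring))
  refine (measure_mono hcover).trans_lt ((measure_iUnion_fintype_le _ _).trans_lt ?_)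
  refine ENNReal.sum_lt_top.2 fun i _ => (measure_union_le _ _).trans_lt ?_
  exact ENNReal.add_lt_top.2 ⟨hfin i 1 one_ne_zero, hfin i (-1) (by norm_num)⟩

theorem hausdorff_sphere_pos (hn : 2 ≤ n) {r : ℝ} (hr : 0 < r) :
    0 < μH[(n : ℝ) - 1] (sphere (0 : EuclideanSpace ℝ (Fin n)) r) := by
  classical
  set i : Fin n := ⟨0, by omega⟩ with hi
  have hcard : ((Fintype.card {j : Fin n // j ≠ i} : ℕ) : ℝ) = (n : ℝ) - 1 := by
    rw [Fintype.card_subtype_compl]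
    simp [Nat.cast_sub (show 1 ≤ n by omega)]
  set P : EuclideanSpace ℝ (Fin n) → ({j : Fin n // j ≠ i} → ℝ) := fun x j => x j with hP
  have hPL : LipschitzWith 1 P := by
    refine LipschitzWith.of_dist_le_mul fun x y => ?_
    rw [NNReal.coe_one, one_mul, dist_pi_le_iff dist_nonneg]
    intro j
    rw [dist_eq_norm, dist_eq_norm]
    exact PiLp.norm_apply_le (x - y) j
  have hn0 : (0 : ℝ) < n := by positivity
  have hsub : ball (0 : {j : Fin n // j ≠ i} → ℝ) (r / n) ⊆ P '' sphere 0 r := by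
    intro y hy
    have hyj : ∀ j, |y j| ≤ r / n := by
      intro j
      have := (norm_le_pi_norm y j).trans (mem_ball_zero_iff.1 hy).le
      simpa using this
    have hS : ∑ j, y j ^ 2 ≤ r ^ 2 := by
      have h1 : ∀ j ∈ Finset.univ, y j ^ 2 ≤ (r / n) ^ 2 := fun j _ => by
        rw [← sq_abs (y j)]
        exact pow_le_pow_left₀ (abs_nonneg _) (hyj j) 2
      have h2 := Finset.sum_le_card_nsmul _ _ _ h1
      rw [Finset.card_univ, nsmul_eq_mul, hcard] at h2
      refine h2.trans ?_
      rw [div_pow, mul_div_assoc']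
      rw [div_le_iff₀ (by positivity)]
      have : (2 : ℝ) ≤ n := by exact_mod_cast hn
      nlinarith [sq_nonneg r, sq_nonneg ((n : ℝ) - 1)]
    refine ⟨WithLp.toLp 2 fun j => if h : j = i then √(r ^ 2 - ∑ j, y j ^ 2) else y ⟨j, h⟩, ?_, ?_⟩
    · rw [mem_sphere_zero_iff_norm, EuclideanSpace.norm_eq, Real.sqrt_eq_iff_eq_sq (by positivity) hr.le]
      rw [← Finset.add_sum_erase _ _ (Finset.mem_univ i)]
      have h3 : ∑ x ∈ Finset.univ.erase i, ‖(WithLp.toLp 2 fun j => if h : j = i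
          then √(r ^ 2 - ∑ j, y j ^ 2) else y ⟨j, h⟩ : EuclideanSpace ℝ (Fin n)) x‖ ^ 2
          = ∑ j, y j ^ 2 := by
        rw [Finset.sum_subtype (p := fun j => j ≠ i) _ (by simp)]
        refine Finset.sum_congr rfl fun j _ => ?_
        simp [j.2]
      rw [h3]
      simp only [dite_true, Real.norm_eq_abs, sq_abs]
      rw [Real.sq_sqrt (by linarith)]
      ring
    · ext j
      simp [hP, j.2]
  have h1 := (hPL.lipschitzOnWith (s := sphere 0 r)).hausdorffMeasure_image_le (d := (n : ℝ) - 1)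
    (by rw [← hcard]; positivity)
  have h2 : 0 < μH[(n : ℝ) - 1] (P '' sphere 0 r) := by
    refine lt_of_lt_of_le ?_ (measure_mono hsub)
    rw [← hcard, hausdorffMeasure_pi_real]
    exact measure_ball_pos _ _ (by positivity)
  simp only [ENNReal.coe_one, ENNReal.one_rpow, one_mul] at h1
  exact h2.trans_le h1

theorem exists_isometry_sphere (x y : sphere (0 : EuclideanSpace ℝ (Fin n)) 1) :
    ∃ φ : EuclideanSpace ℝ (Fin n) ≃ₗᵢ[ℝ] EuclideanSpace ℝ (Fin n), ∀ ρ,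
      φ '' ((fun z : sphere (0 : EuclideanSpace ℝ (Fin n)) 1 => (z : EuclideanSpace ℝ (Fin n)))
        '' ball x ρ) = (fun z : sphere (0 : EuclideanSpace ℝ (Fin n)) 1 =>
          (z : EuclideanSpace ℝ (Fin n))) '' ball y ρ := by
  have hxy : ‖(x : EuclideanSpace ℝ (Fin n))‖ = ‖(y : EuclideanSpace ℝ (Fin n))‖ := by simp
  refine ⟨(ℝ ∙ ((x : EuclideanSpace ℝ (Fin n)) - y))ᗮ.reflection, fun ρ => ?_⟩
  have hφ := Submodule.reflection_sub hxy
  set φ := (ℝ ∙ ((x : EuclideanSpace ℝ (Fin n)) - y))ᗮ.reflection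
  have hs : ∀ w : sphere (0 : EuclideanSpace ℝ (Fin n)) 1, ∀ ρ,
      (fun z : sphere (0 : EuclideanSpace ℝ (Fin n)) 1 => (z : EuclideanSpace ℝ (Fin n))) '' ball w ρ
        = {z : EuclideanSpace ℝ (Fin n) | ‖z‖ = 1 ∧ dist z w < ρ} := by
    intro w ρ
    ext z
    constructor
    · rintro ⟨z', hz', rfl⟩
      exact ⟨by simp, hz'⟩
    · rintro ⟨h1, h2⟩
      exact ⟨⟨z, by simpa using h1⟩, h2, rfl⟩
  rw [hs, hs]
  ext z
  constructor
  · rintro ⟨w, ⟨h1, h2⟩, rfl⟩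
    refine ⟨by rw [φ.norm_map, h1], ?_⟩
    rw [← hφ, φ.dist_map]
    exact h2
  · rintro ⟨h1, h2⟩
    refine ⟨φ.symm z, ⟨by rw [φ.symm.norm_map, h1], ?_⟩, by simp⟩
    rw [← φ.dist_map, φ.apply_symm_apply, hφ]
    exact h2

theorem sphMeas_ball {r : ℝ} (hr : r ≠ 0) (x y : sphere (0 : EuclideanSpace ℝ (Fin n)) 1) (ρ : ℝ) :
    sphMeas n r (ball x ρ) = sphMeas n r (ball y ρ) := by
  obtain ⟨φ, hφ⟩ := exists_isometry_sphere x y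
  rw [sphMeas_apply hr, sphMeas_apply hr]
  have h1 : ∀ w : sphere (0 : EuclideanSpace ℝ (Fin n)) 1,
      (fun θ : sphere (0 : EuclideanSpace ℝ (Fin n)) 1 => r • (θ : EuclideanSpace ℝ (Fin n))) '' ball w ρ
      = (fun z => r • z) '' ((fun z : sphere (0 : EuclideanSpace ℝ (Fin n)) 1 =>
          (z : EuclideanSpace ℝ (Fin n))) '' ball w ρ) := fun w => by rw [Set.image_image]
  rw [h1 x, h1 y, ← hφ ρ, ← φ.toIsometryEquiv.hausdorffMeasure_image]
  congr 1
  simp only [Set.image_image]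
  refine Set.image_congr fun z _ => ?_
  simp

theorem toSphere_ball (x y : sphere (0 : EuclideanSpace ℝ (Fin n)) 1) (ρ : ℝ) :
    (volume : Measure (EuclideanSpace ℝ (Fin n))).toSphere (ball x ρ)
      = (volume : Measure (EuclideanSpace ℝ (Fin n))).toSphere (ball y ρ) := by
  obtain ⟨φ, hφ⟩ := exists_isometry_sphere x y
  rw [Measure.toSphere_apply' _ measurableSet_ball, Measure.toSphere_apply' _ measurableSet_ball,
    ← hφ ρ]
  congr 1
  have h2 : Set.Ioo (0 : ℝ) 1 • (φ '' ((fun z : sphere (0 : EuclideanSpace ℝ (Fin n)) 1 =>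
      (z : EuclideanSpace ℝ (Fin n))) '' ball x ρ)) = φ '' (Set.Ioo (0 : ℝ) 1 •
      ((fun z : sphere (0 : EuclideanSpace ℝ (Fin n)) 1 => (z : EuclideanSpace ℝ (Fin n)))
        '' ball x ρ)) := by
    ext z
    simp only [Set.mem_smul, Set.mem_image]
    constructor
    · rintro ⟨t, ht, -, ⟨w, hw, rfl⟩, rfl⟩
      exact ⟨t • w, ⟨t, ht, w, hw, rfl⟩, by simp⟩
    · rintro ⟨-, ⟨t, ht, w, hw, rfl⟩, rfl⟩
      exact ⟨t, ht, φ w, ⟨w, hw, rfl⟩, by simp⟩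
  rw [h2]
  have h3 := φ.symm.measurePreserving.measure_preimage_emb
    φ.symm.toHomeomorph.measurableEmbedding (Set.Ioo (0 : ℝ) 1 •
      ((fun z : sphere (0 : EuclideanSpace ℝ (Fin n)) 1 => (z : EuclideanSpace ℝ (Fin n))) '' ball x ρ))
  rw [← h3]
  congr 1
  ext z
  simp only [Set.mem_preimage, Set.mem_image]
  constructor
  · intro h
    exact ⟨_, h, φ.apply_symm_apply z⟩
  · rintro ⟨w, hw, rfl⟩
    rwa [φ.symm_apply_apply]

theorem isFiniteMeasure_sphMeas (hn : 2 ≤ n) {r : ℝ} (hr : 0 < r) : IsFiniteMeasure (sphMeas n r) :=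
  ⟨by
    rw [sphMeas_apply hr.ne', Set.image_univ, smul_sphere_range hr]
    exact hausdorff_sphere_lt_top hn hr⟩

theorem isOpenPosMeasure_sphMeas (hn : 2 ≤ n) {r : ℝ} (hr : 0 < r) :
    (sphMeas n r).IsOpenPosMeasure := by
  refine ⟨fun U hU ⟨x, hx⟩ h0 => ?_⟩
  obtain ⟨ε, hε, hεU⟩ := Metric.isOpen_iff.1 hU x hx
  have h1 : sphMeas n r Set.univ = 0 := by
    refine measure_null_of_locally_null _ fun y _ => ⟨ball y ε, ?_, ?_⟩
    · rw [nhdsWithin_univ]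
      exact ball_mem_nhds y hε
    · rw [sphMeas_ball hr.ne' y x]
      exact measure_mono_null hεU h0
  rw [sphMeas_apply hr.ne', Set.image_univ, smul_sphere_range hr] at h1
  exact (hausdorff_sphere_pos hn hr).ne' h1

theorem sphMeas_comparable (hn : 2 ≤ n) {r : ℝ} (hr : 0 < r) :
    ∃ K : ℝ, 0 < K ∧ ∀ f : sphere (0 : EuclideanSpace ℝ (Fin n)) 1 → ℝ, Continuous f → (∀ θ, 0 ≤ f θ) →
      ∫ θ, f θ ∂(sphMeas n r)
        ≤ K * ∫ θ, f θ ∂(volume : Measure (EuclideanSpace ℝ (Fin n))).toSphere ∧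
      ∫ θ, f θ ∂(volume : Measure (EuclideanSpace ℝ (Fin n))).toSphere
        ≤ K * ∫ θ, f θ ∂(sphMeas n r) := by
  have := isFiniteMeasure_sphMeas hn hr
  have := isOpenPosMeasure_sphMeas hn hr
  have : Nonempty (Fin n) := ⟨⟨0, by omega⟩⟩
  have : Nonempty (sphere (0 : EuclideanSpace ℝ (Fin n)) 1) :=
    (NormedSpace.sphere_nonempty.2 zero_le_one).to_subtype
  obtain ⟨K₁, hK₁⟩ := exists_measure_le_of_uniform (sphMeas n r)
    (volume : Measure (EuclideanSpace ℝ (Fin n))).toSphere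
    (fun x y ρ => sphMeas_ball hr.ne' x y ρ) (fun x y ρ => toSphere_ball x y ρ)
  obtain ⟨K₂, hK₂⟩ := exists_measure_le_of_uniform
    (volume : Measure (EuclideanSpace ℝ (Fin n))).toSphere (sphMeas n r)
    (fun x y ρ => toSphere_ball x y ρ) (fun x y ρ => sphMeas_ball hr.ne' x y ρ)
  have key : ∀ (μ ν : Measure (sphere (0 : EuclideanSpace ℝ (Fin n)) 1)) [IsFiniteMeasure μ]
      [IsFiniteMeasure ν] (K : ℝ≥0), μ ≤ K • ν → ∀ f : sphere (0 : EuclideanSpace ℝ (Fin n)) 1 → ℝ,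
      Continuous f → (∀ θ, 0 ≤ f θ) → ∫ θ, f θ ∂μ ≤ K * ∫ θ, f θ ∂ν := by
    intro μ ν _ _ K hK f hf h0
    have h1 := integral_mono_measure hK (ae_of_all _ h0)
      ((hf.integrable_of_hasCompactSupport (HasCompactSupport.of_compactSpace f)))
    rwa [integral_smul_nnreal_measure, NNReal.smul_def, smul_eq_mul] at h1
  refine ⟨K₁ + K₂ + 1, by positivity, fun f hf h0 => ⟨?_, ?_⟩⟩
  · refine (key _ _ K₁ hK₁ f hf h0).trans (mul_le_mul_of_nonneg_right ?_ (integral_nonneg h0))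
    linarith [K₂.coe_nonneg]
  · refine (key _ _ K₂ hK₂ f hf h0).trans (mul_le_mul_of_nonneg_right ?_ (integral_nonneg h0))
    linarith [K₁.coe_nonneg]

end SphereMeasure

section Polar
open Filter Topology
open scoped ENNReal NNReal

variable {n : ℕ}

theorem lintegral_polar {F : EuclideanSpace ℝ (Fin n) → ℝ≥0∞} (hn : 2 ≤ n) (hF : Measurable F) :
    ∫⁻ x, F x = ∫⁻ θ : sphere (0 : EuclideanSpace ℝ (Fin n)) 1,
      (∫⁻ r in Set.Ioi (0 : ℝ), ENNReal.ofReal (r ^ (n - 1)) * F (r • (θ : EuclideanSpace ℝ (Fin n))))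
        ∂(volume : Measure (EuclideanSpace ℝ (Fin n))).toSphere := by
  have : Nonempty (Fin n) := ⟨⟨0, by omega⟩⟩
  have hmp := (volume : Measure (EuclideanSpace ℝ (Fin n))).measurePreserving_homeomorphUnitSphereProd
  have h1 := hmp.symm (homeomorphUnitSphereProd (EuclideanSpace ℝ (Fin n))).toMeasurableEquiv
  have h2 := h1.lintegral_comp (f := fun x => F (x : EuclideanSpace ℝ (Fin n)))
    (hF.comp measurable_subtype_coe)
  have h3 : ∫⁻ x, F x = ∫⁻ x : ({0}ᶜ : Set (EuclideanSpace ℝ (Fin n))), F x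
      ∂(volume.comap Subtype.val) := by
    rw [lintegral_subtype_comap (measurableSet_singleton _).compl, restrict_compl_singleton]
  rw [h3, ← h2, lintegral_prod]
  · refine lintegral_congr fun θ => ?_
    rw [Measure.volumeIoiPow, lintegral_withDensity_eq_lintegral_mul₀]
    · rw [← lintegral_subtype_comap measurableSet_Ioi]
      refine lintegral_congr fun r => ?_
      simp only [Pi.mul_apply, finrank_euclideanSpace, Fintype.card_fin]
      rfl
    · exact (by fun_prop : Measurable fun r : Set.Ioi (0 : ℝ) => ENNReal.ofReal
        (r.1 ^ (Module.finrank ℝ (EuclideanSpace ℝ (Fin n)) - 1))).aemeasurable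
    · exact ((hF.comp measurable_subtype_coe).comp (h1.measurable.comp
        measurable_prodMk_left)).aemeasurable
  · exact ((hF.comp measurable_subtype_coe).comp h1.measurable).aemeasurable

theorem polar_shell (hn : 2 ≤ n) {f : EuclideanSpace ℝ (Fin n) → ℝ} (hf : Continuous f)
    (h0 : ∀ x, 0 ≤ f x) {a b : ℝ} (ha : 0 < a) (hab : a ≤ b) :
    a ^ (n - 1) * ∫ θ : sphere (0 : EuclideanSpace ℝ (Fin n)) 1,
      (∫ r in a..b, f (r • (θ : EuclideanSpace ℝ (Fin n))))
        ∂(volume : Measure (EuclideanSpace ℝ (Fin n))).toSphere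
      ≤ ∫ x in closedBall 0 b \ closedBall 0 a, f x ∧
    ∫ x in closedBall 0 b \ closedBall 0 a, f x
      ≤ b ^ (n - 1) * ∫ θ : sphere (0 : EuclideanSpace ℝ (Fin n)) 1,
      (∫ r in a..b, f (r • (θ : EuclideanSpace ℝ (Fin n))))
        ∂(volume : Measure (EuclideanSpace ℝ (Fin n))).toSphere := by
  set τ := (volume : Measure (EuclideanSpace ℝ (Fin n))).toSphere with hτ
  set N := closedBall (0 : EuclideanSpace ℝ (Fin n)) b \ closedBall 0 a with hN
  have hNm : MeasurableSet N := measurableSet_closedBall.diff measurableSet_closedBall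
  have hfr : ∀ θ : sphere (0 : EuclideanSpace ℝ (Fin n)) 1,
      Continuous fun r : ℝ => f (r • (θ : EuclideanSpace ℝ (Fin n))) := fun θ => by fun_prop
  have hgc : Continuous fun θ : sphere (0 : EuclideanSpace ℝ (Fin n)) 1 =>
      ∫ r in a..b, f (r • (θ : EuclideanSpace ℝ (Fin n))) :=
    intervalIntegral.continuous_parametric_intervalIntegral_of_continuous' (by fun_prop) _ _
  have hg0 : ∀ θ : sphere (0 : EuclideanSpace ℝ (Fin n)) 1,
      0 ≤ ∫ r in a..b, f (r • (θ : EuclideanSpace ℝ (Fin n))) :=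
    fun θ => intervalIntegral.integral_nonneg hab fun r _ => h0 _
  have hI : ENNReal.ofReal (∫ θ : sphere (0 : EuclideanSpace ℝ (Fin n)) 1,
      (∫ r in a..b, f (r • (θ : EuclideanSpace ℝ (Fin n)))) ∂τ)
      = ∫⁻ θ : sphere (0 : EuclideanSpace ℝ (Fin n)) 1, (∫⁻ r in Set.Ioc a b,
        ENNReal.ofReal (f (r • (θ : EuclideanSpace ℝ (Fin n))))) ∂τ := by
    rw [ofReal_integral_eq_lintegral_ofReal
      (hgc.integrable_of_hasCompactSupport (HasCompactSupport.of_compactSpace _)) (ae_of_all _ hg0)]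
    refine lintegral_congr fun θ => ?_
    rw [intervalIntegral.integral_of_le hab, ofReal_integral_eq_lintegral_ofReal
      ((hfr θ).integrableOn_Ioc) (ae_of_all _ fun r => h0 _)]
  have hfN : IntegrableOn f N :=
    (hf.continuousOn.integrableOn_compact (isCompact_closedBall 0 b)).mono_set Set.sdiff_subset
  have hJ : ENNReal.ofReal (∫ x in N, f x) = ∫⁻ θ : sphere (0 : EuclideanSpace ℝ (Fin n)) 1,
      (∫⁻ r in Set.Ioc a b, ENNReal.ofReal (r ^ (n - 1)) *
        ENNReal.ofReal (f (r • (θ : EuclideanSpace ℝ (Fin n))))) ∂τ := by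
    rw [ofReal_integral_eq_lintegral_ofReal hfN (ae_of_all _ fun r => h0 _),
      ← lintegral_indicator hNm, lintegral_polar hn ((by fun_prop : Measurable fun x =>
        ENNReal.ofReal (f x)).indicator hNm)]
    refine lintegral_congr fun θ => ?_
    rw [← lintegral_indicator measurableSet_Ioi, ← lintegral_indicator measurableSet_Ioc]
    refine lintegral_congr fun r => ?_
    have hiff : 0 < r → (r • (θ : EuclideanSpace ℝ (Fin n)) ∈ N ↔ r ∈ Set.Ioc a b) := by
      intro hr
      have hθ : ‖(θ : EuclideanSpace ℝ (Fin n))‖ = 1 := norm_eq_of_mem_sphere θ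
      simp [hN, norm_smul, abs_of_pos hr, and_comm, hθ]
    by_cases hr : 0 < r
    · rw [Set.indicator_of_mem (Set.mem_Ioi.2 hr)]
      by_cases hr2 : r ∈ Set.Ioc a b
      · rw [Set.indicator_of_mem hr2, Set.indicator_of_mem ((hiff hr).2 hr2)]
      · rw [Set.indicator_of_notMem hr2, Set.indicator_of_notMem fun h => hr2 ((hiff hr).1 h), mul_zero]
    · rw [Set.indicator_of_notMem (by simpa using hr),
        Set.indicator_of_notMem fun h => hr (ha.trans h.1)]
  have hI0 : 0 ≤ ∫ θ : sphere (0 : EuclideanSpace ℝ (Fin n)) 1,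
      (∫ r in a..b, f (r • (θ : EuclideanSpace ℝ (Fin n)))) ∂τ := integral_nonneg hg0
  have hJ0 : 0 ≤ ∫ x in N, f x := integral_nonneg h0
  have hmeas : ∀ θ : sphere (0 : EuclideanSpace ℝ (Fin n)) 1, Measurable fun r : ℝ =>
      ENNReal.ofReal (f (r • (θ : EuclideanSpace ℝ (Fin n)))) := fun θ =>
    (hfr θ).measurable.ennreal_ofReal
  have hb : 0 < b := ha.trans_le hab
  constructor
  · rw [← ENNReal.ofReal_le_ofReal_iff hJ0, ENNReal.ofReal_mul (by positivity), hI, hJ,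
      ← lintegral_const_mul' _ _ ENNReal.ofReal_ne_top]
    refine lintegral_mono fun θ => ?_
    dsimp only
    rw [← lintegral_const_mul _ (hmeas θ)]
    refine setLIntegral_mono' measurableSet_Ioc fun r hr => ?_
    gcongr
    exact hr.1.le
  · rw [← ENNReal.ofReal_le_ofReal_iff (by positivity), ENNReal.ofReal_mul (by positivity), hI, hJ,
      ← lintegral_const_mul' _ _ ENNReal.ofReal_ne_top]
    refine lintegral_mono fun θ => ?_
    dsimp only
    rw [← lintegral_const_mul _ (hmeas θ)]
    refine setLIntegral_mono' measurableSet_Ioc fun r hr => ?_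
    have hr0 : 0 ≤ r := (ha.trans hr.1).le
    have := hr.2
    gcongr

end Polar

section Energy
open Filter Topology

variable {n : ℕ}

theorem radial_sq_sub_le {w : EuclideanSpace ℝ (Fin n) → ℝ} (hw : Sm w)
    (θ : sphere (0 : EuclideanSpace ℝ (Fin n)) 1) {a t R : ℝ} (hat : a ≤ t) (htR : t ≤ R) :
    (w (R • (θ : EuclideanSpace ℝ (Fin n))) - w (t • (θ : EuclideanSpace ℝ (Fin n)))) ^ 2
      ≤ (R - t) * ∫ r in a..R, ∑ i, pd i w (r • (θ : EuclideanSpace ℝ (Fin n))) ^ 2 := by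
  have hpc : ∀ i, Continuous (pd i w) := fun i => (hw.pd i).continuous
  have hθ : ‖(θ : EuclideanSpace ℝ (Fin n))‖ = 1 := norm_eq_of_mem_sphere θ
  set p : ℝ → ℝ := fun r => ∑ i, pd i w (r • (θ : EuclideanSpace ℝ (Fin n))) ^ 2 with hp
  set m : ℝ → ℝ := fun r => fderiv ℝ w (r • (θ : EuclideanSpace ℝ (Fin n))) θ with hm
  have hpcont : Continuous p := by fun_prop
  have hmcont : Continuous m := by
    have : Continuous (fderiv ℝ w) := hw.continuous_fderiv (by simp)
    fun_prop
  have hp0 : ∀ r, 0 ≤ p r := fun r => Finset.sum_nonneg fun i _ => sq_nonneg _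
  have hftc : ∫ r in t..R, m r
      = w (R • (θ : EuclideanSpace ℝ (Fin n))) - w (t • (θ : EuclideanSpace ℝ (Fin n))) := by
    refine intervalIntegral.integral_eq_sub_of_hasDerivAt (f := fun r : ℝ =>
      w (r • (θ : EuclideanSpace ℝ (Fin n)))) (fun r _ => ?_) (hmcont.intervalIntegrable _ _)
    have h1 := (hw.differentiable (r • (θ : EuclideanSpace ℝ (Fin n)))).hasFDerivAt
    have h2 : HasDerivAt (fun r : ℝ => r • (θ : EuclideanSpace ℝ (Fin n))) θ r := by
      simpa using (hasDerivAt_id r).smul_const (θ : EuclideanSpace ℝ (Fin n))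
    exact h1.comp_hasDerivAt r h2
  have hmp : ∀ r, m r ^ 2 ≤ p r * 1 := by
    intro r
    have h1 := abs_fderiv_le (f := w) (x := r • (θ : EuclideanSpace ℝ (Fin n))) θ
    rw [hθ, one_mul] at h1
    rw [mul_one, ← sq_abs]
    calc |m r| ^ 2 ≤ √(∑ i, pd i w (r • (θ : EuclideanSpace ℝ (Fin n))) ^ 2) ^ 2 :=
          pow_le_pow_left₀ (abs_nonneg _) h1 2
      _ = p r := Real.sq_sqrt (hp0 r)
  have hcs := sq_integral_le (ν := volume.restrict (Set.Ioc t R)) (m := m) (p := p) (q := fun _ => 1)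
    hmcont.integrableOn_Ioc hpcont.integrableOn_Ioc (integrable_const _) hp0
    (fun _ => zero_le_one) hmp
  rw [← intervalIntegral.integral_of_le htR, ← intervalIntegral.integral_of_le htR,
    ← intervalIntegral.integral_of_le htR, hftc, intervalIntegral.integral_const, smul_eq_mul,
    mul_one] at hcs
  refine hcs.trans ?_
  rw [mul_comm]
  refine mul_le_mul_of_nonneg_left ?_ (by linarith)
  exact intervalIntegral.integral_mono_interval hat htR le_rfl (ae_of_all _ hp0)
    (hpcont.intervalIntegrable _ _)

theorem shell_bounds (hn : 2 ≤ n) {w : EuclideanSpace ℝ (Fin n) → ℝ} (hw : Sm w) {R : ℝ}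
    (hR5 : 5 ≤ R) (hR10 : R ≤ 10) :
    (∀ t, 5 ≤ t → t ≤ R →
      ∫ θ : sphere (0 : EuclideanSpace ℝ (Fin n)) 1, w (R • (θ : EuclideanSpace ℝ (Fin n))) ^ 2
        ∂(volume : Measure (EuclideanSpace ℝ (Fin n))).toSphere
      ≤ 2 * ∫ θ : sphere (0 : EuclideanSpace ℝ (Fin n)) 1, w (t • (θ : EuclideanSpace ℝ (Fin n))) ^ 2
        ∂(volume : Measure (EuclideanSpace ℝ (Fin n))).toSphere
        + 2 * (R - t) * ∫ x in closedBall (0 : EuclideanSpace ℝ (Fin n)) R, ∑ i, pd i w x ^ 2) ∧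
    ∫ x in closedBall (0 : EuclideanSpace ℝ (Fin n)) R \ closedBall 0 5, w x ^ 2
      ≤ 10 ^ (n - 1) * (10 *
        ∫ θ : sphere (0 : EuclideanSpace ℝ (Fin n)) 1, w (R • (θ : EuclideanSpace ℝ (Fin n))) ^ 2
          ∂(volume : Measure (EuclideanSpace ℝ (Fin n))).toSphere
        + 50 * ∫ x in closedBall (0 : EuclideanSpace ℝ (Fin n)) R, ∑ i, pd i w x ^ 2) := by
  set τ := (volume : Measure (EuclideanSpace ℝ (Fin n))).toSphere with hτ
  have hpc : ∀ i, Continuous (pd i w) := fun i => (hw.pd i).continuous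
  have hwc : Continuous w := hw.continuous
  set g : sphere (0 : EuclideanSpace ℝ (Fin n)) 1 → ℝ := fun θ =>
    ∫ r in (5 : ℝ)..R, ∑ i, pd i w (r • (θ : EuclideanSpace ℝ (Fin n))) ^ 2 with hg
  have hgc : Continuous g :=
    intervalIntegral.continuous_parametric_intervalIntegral_of_continuous' (by fun_prop) _ _
  have hintg : ∀ f : sphere (0 : EuclideanSpace ℝ (Fin n)) 1 → ℝ, Continuous f → Integrable f τ :=
    fun f hf => hf.integrable_of_hasCompactSupport (HasCompactSupport.of_compactSpace _)
  have hG0 : ∀ x, 0 ≤ ∑ i, pd i w x ^ 2 := fun x => Finset.sum_nonneg fun i _ => sq_nonneg _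
  have hg0 : 0 ≤ ∫ θ, g θ ∂τ :=
    integral_nonneg fun θ => intervalIntegral.integral_nonneg hR5 fun r _ => hG0 _
  have hgG : ∫ θ, g θ ∂τ ≤ ∫ x in closedBall (0 : EuclideanSpace ℝ (Fin n)) R, ∑ i, pd i w x ^ 2 := by
    have h1 := (polar_shell hn (f := fun x => ∑ i, pd i w x ^ 2) (by fun_prop) hG0
      (show (0 : ℝ) < 5 by norm_num) hR5).1
    have h2 : ∫ x in closedBall (0 : EuclideanSpace ℝ (Fin n)) R \ closedBall 0 5, ∑ i, pd i w x ^ 2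
        ≤ ∫ x in closedBall (0 : EuclideanSpace ℝ (Fin n)) R, ∑ i, pd i w x ^ 2 :=
      setIntegral_mono_set ((by fun_prop : Continuous fun x => ∑ i, pd i w x ^ 2).continuousOn.integrableOn_compact
        (isCompact_closedBall _ _)) (ae_of_all _ hG0) Set.sdiff_subset.eventuallyLE
    have h3 : (1 : ℝ) ≤ 5 ^ (n - 1) := one_le_pow₀ (by norm_num)
    calc ∫ θ, g θ ∂τ ≤ 5 ^ (n - 1) * ∫ θ, g θ ∂τ := le_mul_of_one_le_left hg0 h3
      _ ≤ _ := h1.trans h2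
  constructor
  · intro t ht htR
    have hpt : ∀ θ : sphere (0 : EuclideanSpace ℝ (Fin n)) 1,
        w (R • (θ : EuclideanSpace ℝ (Fin n))) ^ 2
          ≤ 2 * w (t • (θ : EuclideanSpace ℝ (Fin n))) ^ 2 + 2 * (R - t) * g θ := by
      intro θ
      have h1 := radial_sq_sub_le hw θ ht htR
      nlinarith [sq_nonneg (w (R • (θ : EuclideanSpace ℝ (Fin n)))
        - 2 * w (t • (θ : EuclideanSpace ℝ (Fin n))))]
    have h2 := integral_mono (hintg _ (by fun_prop)) (hintg _ (by fun_prop)) hpt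
    rw [integral_add (hintg _ (by fun_prop)) (hintg _ (by fun_prop)), integral_const_mul,
      integral_const_mul] at h2
    refine h2.trans (add_le_add le_rfl ?_)
    exact mul_le_mul_of_nonneg_left hgG (by linarith)
  · have h1 := (polar_shell hn (f := fun x => w x ^ 2) (by fun_prop) (fun x => sq_nonneg _)
      (show (0 : ℝ) < 5 by norm_num) hR5).2
    have hpt : ∀ θ : sphere (0 : EuclideanSpace ℝ (Fin n)) 1,
        (∫ r in (5 : ℝ)..R, w (r • (θ : EuclideanSpace ℝ (Fin n))) ^ 2)
          ≤ 10 * w (R • (θ : EuclideanSpace ℝ (Fin n))) ^ 2 + 50 * g θ := by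
      intro θ
      have hgθ : 0 ≤ g θ := intervalIntegral.integral_nonneg hR5 fun r _ => hG0 _
      have h2 : ∀ r ∈ Set.Icc (5 : ℝ) R, w (r • (θ : EuclideanSpace ℝ (Fin n))) ^ 2
          ≤ 2 * w (R • (θ : EuclideanSpace ℝ (Fin n))) ^ 2 + 10 * g θ := by
        intro r hr
        have h3 := radial_sq_sub_le hw θ hr.1 hr.2
        have h4 : (R - r) * g θ ≤ 5 * g θ :=
          mul_le_mul_of_nonneg_right (by linarith [hr.1]) hgθ
        nlinarith [sq_nonneg (2 * w (R • (θ : EuclideanSpace ℝ (Fin n)))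
          - w (r • (θ : EuclideanSpace ℝ (Fin n))))]
      have h5 := intervalIntegral.integral_mono_on (μ := volume) hR5
        ((by fun_prop : Continuous fun r : ℝ => w (r • (θ : EuclideanSpace ℝ (Fin n))) ^ 2).intervalIntegrable _ _)
        (continuous_const.intervalIntegrable _ _) h2
      rw [intervalIntegral.integral_const, smul_eq_mul] at h5
      refine h5.trans ?_
      have : 0 ≤ 2 * w (R • (θ : EuclideanSpace ℝ (Fin n))) ^ 2 + 10 * g θ := by positivity
      nlinarith [mul_le_mul_of_nonneg_right (show R - 5 ≤ 5 by linarith) this]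
    have hwi : Continuous fun θ : sphere (0 : EuclideanSpace ℝ (Fin n)) 1 =>
        ∫ r in (5 : ℝ)..R, w (r • (θ : EuclideanSpace ℝ (Fin n))) ^ 2 :=
      intervalIntegral.continuous_parametric_intervalIntegral_of_continuous' (by fun_prop) _ _
    have h2 := integral_mono (hintg _ hwi) (hintg _ (by fun_prop)) hpt
    rw [integral_add (hintg _ (by fun_prop)) (hintg _ (by fun_prop)), integral_const_mul,
      integral_const_mul] at h2
    have hI0 : 0 ≤ ∫ θ : sphere (0 : EuclideanSpace ℝ (Fin n)) 1,
        (∫ r in (5 : ℝ)..R, w (r • (θ : EuclideanSpace ℝ (Fin n))) ^ 2) ∂τ :=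
      integral_nonneg fun θ => intervalIntegral.integral_nonneg hR5 fun r _ => sq_nonneg _
    refine h1.trans (mul_le_mul (pow_le_pow_left₀ (by linarith) hR10 _) ?_ hI0 (by positivity))
    linarith

theorem growth_of_energy (n : ℕ) (hn : 2 ≤ n) (C₁ : ℝ) (hC₁ : 0 < C₁) :
    ∃ s : ℝ, 0 < s ∧ s ≤ 1 ∧ ∀ L, 1 ≤ L → ∃ C : ℝ, 0 < C ∧
      ∀ (a : Fin n → Fin n → EuclideanSpace ℝ (Fin n) → ℝ)
        (b : Fin n → EuclideanSpace ℝ (Fin n) → ℝ), IsOp L a b →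
        ∀ w, Sm w → ∀ R, 10 - s / 8 ≤ R → R ≤ 10 →
          (∀ x ∈ ball (0 : EuclideanSpace ℝ (Fin n)) (10 - s / 8), Lop a b w x = 0) →
          ∫ x in closedBall (0 : EuclideanSpace ℝ (Fin n)) R, ∑ i, pd i w x ^ 2
            ≤ C₁ * ∫ θ : sphere (0 : EuclideanSpace ℝ (Fin n)) 1,
              w (R • (θ : EuclideanSpace ℝ (Fin n))) ^ 2
                ∂(volume : Measure (EuclideanSpace ℝ (Fin n))).toSphere →
          0 < ∫ θ : sphere (0 : EuclideanSpace ℝ (Fin n)) 1,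
              w (R • (θ : EuclideanSpace ℝ (Fin n))) ^ 2
                ∂(volume : Measure (EuclideanSpace ℝ (Fin n))).toSphere →
          supN w 0 (8 + 1 / 2) ≤ C * supN w 0 8 ∧ 0 < supN w 0 8 := by
  set τ := (volume : Measure (EuclideanSpace ℝ (Fin n))).toSphere with hτ
  refine ⟨min 1 (1 / (8 * C₁)), by positivity, min_le_left _ _, ?_⟩
  set s := min 1 (1 / (8 * C₁)) with hs
  have hs0 : 0 < s := by positivity
  have hs1 : s ≤ 1 := min_le_left _ _
  have hsC : s * C₁ ≤ 1 / 8 := by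
    have : s ≤ 1 / (8 * C₁) := min_le_right _ _
    rw [le_div_iff₀ (by positivity)] at this
    linarith
  intro L hL
  obtain ⟨C₂, hC₂, hL2⟩ := sup_le_ltwo n (by omega) L hL
  set T := τ.real Set.univ with hT
  set K := C₂ * (10 ^ (n - 1) * (10 + 50 * C₁)) * (4 * T) / (s / 16) ^ n with hK
  have hK0 : 0 ≤ K := by positivity
  obtain ⟨c, hc, hchain⟩ := chain_lower n (by omega) L hL (3 * s / 4) 8 (√K + 1) (by positivity)
    (by norm_num) (by positivity)
  refine ⟨c⁻¹, by positivity, ?_⟩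
  intro a b hop w hw R hR hR10 hsol hE hHpos
  obtain ⟨hb1, hb2⟩ := shell_bounds hn hw (R := R) (by linarith) hR10
  set H := ∫ θ : sphere (0 : EuclideanSpace ℝ (Fin n)) 1,
    w (R • (θ : EuclideanSpace ℝ (Fin n))) ^ 2 ∂τ with hH
  set G := ∫ x in closedBall (0 : EuclideanSpace ℝ (Fin n)) R, ∑ i, pd i w x ^ 2 with hG
  have hH0 : 0 ≤ H := integral_nonneg fun θ => sq_nonneg _
  have hG0 : 0 ≤ G := integral_nonneg fun x => Finset.sum_nonneg fun i _ => sq_nonneg _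
  have hwc : Continuous w := hw.continuous
  set N := supN w 0 (10 - s) with hN
  have hN0 : 0 ≤ N := supN_nonneg _ _ _
  have hHN : H ≤ 4 * T * N ^ 2 := by
    have h1 := hb1 (10 - s) (by linarith) (by linarith)
    have h2 : ∫ θ : sphere (0 : EuclideanSpace ℝ (Fin n)) 1,
        w ((10 - s) • (θ : EuclideanSpace ℝ (Fin n))) ^ 2 ∂τ ≤ T * N ^ 2 := by
      have h3 : ∀ θ : sphere (0 : EuclideanSpace ℝ (Fin n)) 1,
          w ((10 - s) • (θ : EuclideanSpace ℝ (Fin n))) ^ 2 ≤ N ^ 2 := by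
        intro θ
        rw [← sq_abs]
        refine pow_le_pow_left₀ (abs_nonneg _) (le_supN hwc ?_) 2
        have hθ : ‖(θ : EuclideanSpace ℝ (Fin n))‖ = 1 := norm_eq_of_mem_sphere θ
        rw [mem_closedBall_zero_iff, norm_smul, hθ, mul_one,
          Real.norm_of_nonneg (by linarith)]
      have h4 := integral_mono (μ := τ) ((by fun_prop : Continuous
        fun θ : sphere (0 : EuclideanSpace ℝ (Fin n)) 1 =>
          w ((10 - s) • (θ : EuclideanSpace ℝ (Fin n))) ^ 2).integrable_of_hasCompactSupport
            (HasCompactSupport.of_compactSpace _)) (integrable_const _) h3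
      rwa [integral_const, smul_eq_mul] at h4
    have h5 : (R - (10 - s)) * G ≤ s * (C₁ * H) :=
      mul_le_mul (by linarith) hE hG0 hs0.le
    have h6 : s * C₁ * H ≤ 1 / 8 * H := mul_le_mul_of_nonneg_right hsC hH0
    have h7 : 0 ≤ T * N ^ 2 := by positivity
    nlinarith
  have hshell : ∫ x in closedBall (0 : EuclideanSpace ℝ (Fin n)) R \ closedBall 0 5, w x ^ 2
      ≤ 10 ^ (n - 1) * (10 + 50 * C₁) * (4 * T * N ^ 2) := by
    refine hb2.trans ?_
    calc 10 ^ (n - 1) * (10 * H + 50 * G) ≤ 10 ^ (n - 1) * (10 * H + 50 * (C₁ * H)) := by gcongr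
      _ = 10 ^ (n - 1) * (10 + 50 * C₁) * H := by ring
      _ ≤ _ := by gcongr
  have hsphere : ∀ x ∈ sphere (0 : EuclideanSpace ℝ (Fin n)) (10 - s / 4), |w x| ≤ √K * N := by
    intro x hx
    have hx' : dist x 0 = 10 - s / 4 := hx
    have h1 := hL2 a b hop w hw x (s / 16) (by positivity) (by linarith) fun y hy => hsol y (by
      have := dist_triangle y x 0
      have := mem_ball.1 hy
      exact mem_ball.2 (by linarith))
    have hsub : ball x (2 * (s / 16)) ⊆ closedBall (0 : EuclideanSpace ℝ (Fin n)) R \ closedBall 0 5 := by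
      intro y hy
      have h2 := dist_triangle y x 0
      have h3 := dist_triangle x y 0
      have h4 := mem_ball.1 hy
      have h5 : dist x y < 2 * (s / 16) := by rwa [dist_comm]
      exact ⟨mem_closedBall.2 (by linarith), fun h6 => by
        have := mem_closedBall.1 h6
        linarith⟩
    have h2 : ∫ y in ball x (2 * (s / 16)), w y ^ 2
        ≤ ∫ x in closedBall (0 : EuclideanSpace ℝ (Fin n)) R \ closedBall 0 5, w x ^ 2 :=
      setIntegral_mono_set (((by fun_prop : Continuous fun x => w x ^ 2).continuousOn.integrableOn_compact
        (isCompact_closedBall 0 R)).mono_set Set.sdiff_subset) (ae_of_all _ fun x => sq_nonneg _)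
        hsub.eventuallyLE
    have h3 : |w x| ≤ supN w x (s / 16) := le_supN hwc (mem_closedBall_self (by positivity))
    refine abs_le_of_sq_le_sq' ?_ (by positivity) |> abs_le.mpr
    rw [mul_pow, Real.sq_sqrt hK0, hK, div_mul_eq_mul_div, le_div_iff₀ (by positivity)]
    calc w x ^ 2 * (s / 16) ^ n ≤ supN w x (s / 16) ^ 2 * (s / 16) ^ n := by
          rw [← sq_abs]
          gcongr
      _ ≤ C₂ * (10 ^ (n - 1) * (10 + 50 * C₁) * (4 * T * N ^ 2)) :=
          h1.trans (mul_le_mul_of_nonneg_left (h2.trans hshell) hC₂.le)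
      _ = _ := by ring
  have hmax := max_principle_abs (by omega) hop hw (by linarith)
    (fun x hx => hsol x (ball_subset_ball (by linarith) hx)) hsphere
  have hsup : supN w 0 (10 - s / 4) ≤ √K * N := supN_le (by linarith) hmax
  have h1 := hchain a b hop w hw (10 - s) (by linarith) (by linarith)
    (fun y hy => hsol y (by
      have := mem_closedBall.1 hy
      exact mem_ball.2 (by linarith)))
    (by
      rw [show 10 - s + 3 * s / 4 = 10 - s / 4 by ring]
      linarith) 0 (mem_closedBall_self (by linarith))
  rw [show 10 - s + 3 * s / 4 = 10 - s / 4 by ring] at h1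
  have h2 : supN w 0 (8 + 1 / 2) ≤ supN w 0 (10 - s / 4) :=
    supN_mono_radius hwc (by norm_num) (by linarith)
  have h3 : N ≤ supN w 0 (10 - s / 4) := supN_mono_radius hwc (by linarith) (by linarith)
  have hNpos : 0 < N := hN0.lt_of_ne fun h => by
    rw [← h] at hHN
    have : 0 < H := hHpos
    linarith
  refine ⟨?_, lt_of_lt_of_le (mul_pos hc (hNpos.trans_le h3)) (by linarith)⟩
  rw [inv_mul_eq_div, le_div_iff₀ hc]
  calc supN w 0 (8 + 1 / 2) * c ≤ supN w 0 (10 - s / 4) * c := by gcongr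
    _ ≤ supN w 0 8 := by linarith

end Energy

section Extension

variable {n : ℕ}

theorem IsOp.mono {L L' : ℝ} {a : Fin n → Fin n → EuclideanSpace ℝ (Fin n) → ℝ}
    {b : Fin n → EuclideanSpace ℝ (Fin n) → ℝ} (h : IsOp L a b) (hL : L ≤ L') : IsOp L' a b where
  one_le := h.one_le.trans hL
  sm_a := h.sm_a
  sm_b := h.sm_b
  symm := h.symm
  ell x ξ := by
    refine le_trans ?_ (h.ell x ξ)
    have := h.one_le
    gcongr
  bd_a i j x := (h.bd_a i j x).trans hL
  bd_da k i j x := (h.bd_da k i j x).trans hL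
  bd_b i x := (h.bd_b i x).trans hL
  bd_db k i x := (h.bd_db k i x).trans hL

theorem exists_bound_of_hasCompactSupport {f : EuclideanSpace ℝ (Fin n) → ℝ} (hf : Sm f)
    (hs : HasCompactSupport f) : ∃ C, ∀ x, |f x| ≤ C ∧ ∀ k, |pd k f x| ≤ C := by
  obtain ⟨C₀, hC₀⟩ := hf.continuous.bounded_above_of_compact_support hs
  have h1 : ∀ k, ∃ C, ∀ x, ‖pd k f x‖ ≤ C := fun k =>
    (hf.pd k).continuous.bounded_above_of_compact_support (hs.fderiv_apply ℝ _)
  choose C hC using h1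
  obtain ⟨M, hM⟩ := Finite.exists_le C
  exact ⟨max C₀ M, fun x => ⟨(hC₀ x).trans (le_max_left _ _),
    fun k => ((hC k x).trans (hM k)).trans (le_max_right _ _)⟩⟩

theorem sum_one_mul_sq (ξ : Fin n → ℝ) :
    ∑ i, ∑ j, (1 : Matrix (Fin n) (Fin n) ℝ) i j * ξ i * ξ j = ∑ i, ξ i ^ 2 := by
  refine Finset.sum_congr rfl fun i _ => ?_
  simp [Matrix.one_apply, ite_mul, sq]

theorem Lop_eq_div {α : Fin n → Fin n → EuclideanSpace ℝ (Fin n) → ℝ} (hα : ∀ i j, Sm (α i j))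
    {w : EuclideanSpace ℝ (Fin n) → ℝ} (hw : Sm w) (x : EuclideanSpace ℝ (Fin n)) :
    Lop (fun i j y => (α i j y + α j i y) / 2) (fun j y => ∑ i, pd i (α i j) y) w x
      = ∑ i, ∑ j, pd i (fun y => α i j y * pd j w y) x := by
  have h1 : ∀ i j, pd i (fun y => α i j y * pd j w y) x
      = pd i (α i j) x * pd j w x + α i j x * pd i (pd j w) x := fun i j =>
    pd_mul_at ((hα i j).differentiable x) ((hw.pd j).differentiable x) i
  have h2 : ∑ i, ∑ j, α j i x * pd i (pd j w) x = ∑ i, ∑ j, α i j x * pd i (pd j w) x := by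
    rw [Finset.sum_comm]
    refine Finset.sum_congr rfl fun i _ => Finset.sum_congr rfl fun j _ => ?_
    rw [pd_comm hw j i]
  have h3 : ∑ j, (∑ i, pd i (α i j) x) * pd j w x = ∑ i, ∑ j, pd i (α i j) x * pd j w x := by
    rw [Finset.sum_comm]
    exact Finset.sum_congr rfl fun j _ => Finset.sum_mul _ _ _
  have h4 : ∑ i, ∑ j, (α i j x + α j i x) / 2 * pd i (pd j w) x
      = ∑ i, ∑ j, α i j x * pd i (pd j w) x := by
    have : ∀ i j, (α i j x + α j i x) / 2 * pd i (pd j w) x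
      = 1 / 2 * (α i j x * pd i (pd j w) x) + 1 / 2 * (α j i x * pd i (pd j w) x) := by
      intro i j; ring
    simp only [this, Finset.sum_add_distrib, ← Finset.mul_sum]
    rw [h2]; ring
  simp only [Lop, h1, Finset.sum_add_distrib, h3, h4]
  ring

theorem exists_isOp_ext {A : EuclideanSpace ℝ (Fin n) → Matrix (Fin n) (Fin n) ℝ} {lam : ℝ}
    (hlam : 1 ≤ lam) (hA : ∀ i j, ContDiffOn ℝ (⊤ : ℕ∞) (fun x => A x i j)
      (closedBall (0 : EuclideanSpace ℝ (Fin n)) 10))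
    (hell : UnifElliptic A lam (closedBall (0 : EuclideanSpace ℝ (Fin n)) 10))
    {R : ℝ} (hR : 0 < R) (hR10 : R < 10) :
    ∃ (L : ℝ) (a : Fin n → Fin n → EuclideanSpace ℝ (Fin n) → ℝ)
      (b : Fin n → EuclideanSpace ℝ (Fin n) → ℝ), IsOp L a b ∧
      ∀ u : EuclideanSpace ℝ (Fin n) → ℝ, SolvesDiv A u (closedBall 0 10) →
        ∀ w, Sm w → (∀ x ∈ ball 0 R, w x = u x) → ∀ x ∈ ball 0 R, Lop a b w x = 0 := by
  set R₁ := (R + 10) / 2 with hR₁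
  have h1 : ∀ i j, ∃ g, Sm g ∧ ∀ x ∈ ball (0 : EuclideanSpace ℝ (Fin n)) R₁, g x = A x i j :=
    fun i j => exists_smooth_ext (by linarith) (by linarith : R₁ < 10)
      ((hA i j).mono ball_subset_closedBall)
  choose α hα hαA using h1
  let χ : ContDiffBump (0 : EuclideanSpace ℝ (Fin n)) := ⟨R, R₁, hR, by linarith⟩
  have hχ : Sm (fun x => χ x) := χ.contDiff
  have hχs : HasCompactSupport (fun x => χ x) := χ.hasCompactSupport
  let γ : Fin n → Fin n → EuclideanSpace ℝ (Fin n) → ℝ := fun i j x =>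
    χ x * ((α i j x + α j i x) / 2 - (1 : Matrix (Fin n) (Fin n) ℝ) i j)
  let b : Fin n → EuclideanSpace ℝ (Fin n) → ℝ := fun j x => χ x * ∑ i, pd i (α i j) x
  let a : Fin n → Fin n → EuclideanSpace ℝ (Fin n) → ℝ := fun i j x =>
    γ i j x + (1 : Matrix (Fin n) (Fin n) ℝ) i j
  have hγ : ∀ i j, Sm (γ i j) := fun i j =>
    hχ.mul ((((hα i j).add (hα j i)).div_const 2).sub contDiff_const)
  have hb : ∀ j, Sm (b j) := fun j => hχ.mul (ContDiff.sum fun i _ => (hα i j).pd i)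
  have hγb := fun i j => exists_bound_of_hasCompactSupport (hγ i j) hχs.mul_right
  have hbb := fun j => exists_bound_of_hasCompactSupport (hb j) hχs.mul_right
  choose Ca hCa using hγb
  choose Cb hCb using hbb
  obtain ⟨Ma, hMa⟩ := Finite.exists_le (fun p : Fin n × Fin n => Ca p.1 p.2)
  obtain ⟨Mb, hMb⟩ := Finite.exists_le Cb
  have hone : ∀ i j, |(1 : Matrix (Fin n) (Fin n) ℝ) i j| ≤ 1 := by
    intro i j
    rw [Matrix.one_apply]
    split_ifs <;> simp
  have hpa : ∀ k i j x, pd k (a i j) x = pd k (γ i j) x := by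
    intro k i j x
    rw [pd_add_at ((hγ i j).differentiable x) (by fun_prop), pd_const, add_zero]
  have hlamL : lam ≤ max lam (max (Ma + 1) Mb) := le_max_left _ _
  have hMaL : Ma + 1 ≤ max lam (max (Ma + 1) Mb) := (le_max_left _ _).trans (le_max_right _ _)
  have hMbL : Mb ≤ max lam (max (Ma + 1) Mb) := (le_max_right _ _).trans (le_max_right _ _)
  refine ⟨max lam (max (Ma + 1) Mb), a, b, ?_, ?_⟩
  · generalize max lam (max (Ma + 1) Mb) = L at *
    refine ⟨by linarith, fun i j => (hγ i j).add contDiff_const, hb, ?_, ?_, ?_, ?_, ?_, ?_⟩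
    · intro i j x
      simp only [a, γ]
      rw [add_comm (α i j x), ← Matrix.transpose_apply (1 : Matrix (Fin n) (Fin n) ℝ) i j,
        Matrix.transpose_one]
    · intro x ξ
      set S := ∑ i, ξ i ^ 2 with hS
      have hS0 : 0 ≤ S := Finset.sum_nonneg fun i _ => sq_nonneg _
      have hL0 : 0 < L := by linarith
      have hL1 : L⁻¹ ≤ 1 := inv_le_one_of_one_le₀ (by linarith)
      have heq : ∑ i, ∑ j, a i j x * ξ i * ξ j
          = χ x * ∑ i, ∑ j, (α i j x + α j i x) / 2 * ξ i * ξ j + (1 - χ x) * S := by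
        rw [hS, ← sum_one_mul_sq]
        simp only [Finset.mul_sum, ← Finset.sum_add_distrib]
        refine Finset.sum_congr rfl fun i _ => Finset.sum_congr rfl fun j _ => ?_
        simp only [a, γ]; ring
      have hχ0 : 0 ≤ χ x := χ.nonneg
      have hχ1 : χ x ≤ 1 := χ.le_one
      rw [heq]
      by_cases hx : x ∈ ball (0 : EuclideanSpace ℝ (Fin n)) R₁
      · have h2 : ∑ i, ∑ j, (α i j x + α j i x) / 2 * ξ i * ξ j
            = ∑ i, ∑ j, A x i j * ξ i * ξ j := by
          have h3 : ∑ i, ∑ j, α j i x * ξ i * ξ j = ∑ i, ∑ j, α i j x * ξ i * ξ j := by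
            rw [Finset.sum_comm]
            refine Finset.sum_congr rfl fun i _ => Finset.sum_congr rfl fun j _ => ?_
            ring
          have h4 : ∀ i j, (α i j x + α j i x) / 2 * ξ i * ξ j
              = 1 / 2 * (α i j x * ξ i * ξ j) + 1 / 2 * (α j i x * ξ i * ξ j) := by
            intro i j; ring
          simp only [h4, Finset.sum_add_distrib, ← Finset.mul_sum]
          rw [h3]
          simp only [hαA _ _ x hx]
          ring
        have h5 := (hell x (ball_subset_closedBall (ball_subset_ball (by linarith) hx)) ξ).1
        have h6 : L⁻¹ ≤ lam⁻¹ := inv_anti₀ (by linarith) hlamL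
        rw [h2]
        have h7 : L⁻¹ * S ≤ ∑ i, ∑ j, A x i j * ξ i * ξ j :=
          (mul_le_mul_of_nonneg_right h6 hS0).trans h5
        have h8 : L⁻¹ * S ≤ S := mul_le_of_le_one_left hS0 hL1
        nlinarith [mul_le_mul_of_nonneg_left h7 hχ0,
          mul_le_mul_of_nonneg_left h8 (sub_nonneg.2 hχ1)]
      · have : χ x = 0 := χ.zero_of_le_dist (not_lt.1 hx)
        rw [this]
        simpa using mul_le_of_le_one_left hS0 hL1
    · intro i j x
      have h2 := (hCa i j x).1
      have h3 := hMa (i, j)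
      refine (abs_add_le _ _).trans ?_
      have := hone i j
      dsimp only at h3
      linarith
    · intro k i j x
      rw [hpa]
      have h2 := (hCa i j x).2 k
      have h3 := hMa (i, j)
      dsimp only at h3
      linarith
    · exact fun i x => ((hCb i x).1.trans (hMb i)).trans hMbL
    · exact fun k i x => (((hCb i x).2 k).trans (hMb i)).trans hMbL
  · intro u hu w hw hwu x hx
    have hx10 : x ∈ closedBall (0 : EuclideanSpace ℝ (Fin n)) 10 :=
      ball_subset_closedBall (ball_subset_ball hR10.le hx)
    have hχ1 : χ x = 1 := χ.one_of_mem_closedBall (ball_subset_closedBall hx)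
    have h2 : Lop a b w x
        = Lop (fun i j y => (α i j y + α j i y) / 2) (fun j y => ∑ i, pd i (α i j) y) w x := by
      simp only [Lop, a, b, γ, hχ1, one_mul, sub_add_cancel]
    rw [h2, Lop_eq_div hα hw, ← hu x hx10]
    refine Finset.sum_congr rfl fun i _ => Finset.sum_congr rfl fun j _ => ?_
    refine pd_congr_on isOpen_ball (fun y hy => ?_) i x hx
    rw [hαA i j y (ball_subset_ball (by linarith) hy), pd_congr_on isOpen_ball hwu j y hy]

end Extension

section Frequency
open Filter Topology

variable {n : ℕ}

theorem closedBall_ae_eq_ball_zero {r : ℝ} (hr : r ≠ 0) :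
    closedBall (0 : EuclideanSpace ℝ (Fin n)) r =ᵐ[volume] ball 0 r := by
  refine ae_eq_set.2 ⟨?_, ?_⟩
  · rw [closedBall_sdiff_ball]
    exact Measure.addHaar_sphere_of_ne_zero volume 0 hr
  · rw [Set.sdiff_eq_empty.2 ball_subset_closedBall, measure_empty]

theorem exists_pd_extension {u : EuclideanSpace ℝ (Fin n) → ℝ} {r : ℝ} (hr : 0 < r)
    (hu : ContDiffOn ℝ (⊤ : ℕ∞) u (closedBall (0 : EuclideanSpace ℝ (Fin n)) r)) (i : Fin n) :
    ∃ p : EuclideanSpace ℝ (Fin n) → ℝ, ContinuousOn p (closedBall 0 r) ∧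
      ∀ x ∈ ball 0 r, pd i u x = p x := by
  refine ⟨fun x => fderivWithin ℝ u (closedBall 0 r) x (EuclideanSpace.single i 1), ?_, ?_⟩
  · refine (hu.continuousOn_fderivWithin (uniqueDiffOn_convex (convex_closedBall _ _) ?_)
      (by simp)).clm_apply continuousOn_const
    rw [interior_closedBall _ hr.ne']
    exact ⟨0, mem_ball_self hr⟩
  · intro x hx
    have : closedBall (0 : EuclideanSpace ℝ (Fin n)) r ∈ 𝓝 x :=
      mem_of_superset (isOpen_ball.mem_nhds hx) ball_subset_closedBall
    simp only [pd, fderivWithin_of_mem_nhds this]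

theorem energy_bounds {A : EuclideanSpace ℝ (Fin n) → Matrix (Fin n) (Fin n) ℝ} {lam : ℝ}
    (hA : ∀ i j, ContDiffOn ℝ (⊤ : ℕ∞) (fun x => A x i j)
      (closedBall (0 : EuclideanSpace ℝ (Fin n)) 10))
    (hell : UnifElliptic A lam (closedBall (0 : EuclideanSpace ℝ (Fin n)) 10))
    {u : EuclideanSpace ℝ (Fin n) → ℝ}
    (hu : ContDiffOn ℝ (⊤ : ℕ∞) u (closedBall (0 : EuclideanSpace ℝ (Fin n)) 10)) :
    IntegrableOn (fun x => ∑ i, pd i u x ^ 2) (ball (0 : EuclideanSpace ℝ (Fin n)) 10) ∧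
    ∀ r, 0 < r → r ≤ 10 →
      lam⁻¹ * ∫ x in ball (0 : EuclideanSpace ℝ (Fin n)) r, ∑ i, pd i u x ^ 2
        ≤ ∫ x in closedBall (0 : EuclideanSpace ℝ (Fin n)) r,
          ∑ i, ∑ j, A x i j * pd j u x * pd i u x ∧
      ∫ x in closedBall (0 : EuclideanSpace ℝ (Fin n)) r,
          ∑ i, ∑ j, A x i j * pd j u x * pd i u x
        ≤ lam * ∫ x in ball (0 : EuclideanSpace ℝ (Fin n)) r, ∑ i, pd i u x ^ 2 := by
  choose p hp hpu using fun i => exists_pd_extension (by norm_num : (0 : ℝ) < 10) hu i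
  have hAc : ∀ i j, ContinuousOn (fun x => A x i j)
      (closedBall (0 : EuclideanSpace ℝ (Fin n)) 10) := fun i j => (hA i j).continuousOn
  have hI1 : IntegrableOn (fun x => ∑ i, pd i u x ^ 2)
      (ball (0 : EuclideanSpace ℝ (Fin n)) 10) := by
    have h1 : ContinuousOn (fun x => ∑ i, p i x ^ 2)
        (closedBall (0 : EuclideanSpace ℝ (Fin n)) 10) :=
      continuousOn_finsetSum _ fun i _ => (hp i).pow 2
    refine ((h1.integrableOn_compact (isCompact_closedBall _ _)).mono_set
      ball_subset_closedBall).congr_fun (fun x hx => ?_) measurableSet_ball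
    simp only [hpu _ x hx]
  have hI2 : IntegrableOn (fun x => ∑ i, ∑ j, A x i j * pd j u x * pd i u x)
      (ball (0 : EuclideanSpace ℝ (Fin n)) 10) := by
    have h1 : ContinuousOn (fun x => ∑ i, ∑ j, A x i j * p j x * p i x)
        (closedBall (0 : EuclideanSpace ℝ (Fin n)) 10) :=
      continuousOn_finsetSum _ fun i _ => continuousOn_finsetSum _ fun j _ =>
        ((hAc i j).mul (hp j)).mul (hp i)
    refine ((h1.integrableOn_compact (isCompact_closedBall _ _)).mono_set
      ball_subset_closedBall).congr_fun (fun x hx => ?_) measurableSet_ball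
    simp only [hpu _ x hx]
  refine ⟨hI1, fun r hr hr10 => ?_⟩
  have hsub : ball (0 : EuclideanSpace ℝ (Fin n)) r ⊆ ball 0 10 := ball_subset_ball hr10
  have hpt : ∀ x ∈ ball (0 : EuclideanSpace ℝ (Fin n)) r,
      lam⁻¹ * (∑ i, pd i u x ^ 2) ≤ ∑ i, ∑ j, A x i j * pd j u x * pd i u x ∧
      ∑ i, ∑ j, A x i j * pd j u x * pd i u x ≤ lam * ∑ i, pd i u x ^ 2 := by
    intro x hx
    have h1 := hell x (ball_subset_closedBall (hsub hx)) fun i => pd i u x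
    have h2 : ∑ i, ∑ j, A x i j * pd j u x * pd i u x
        = ∑ i, ∑ j, A x i j * pd i u x * pd j u x :=
      Finset.sum_congr rfl fun i _ => Finset.sum_congr rfl fun j _ => by ring
    rw [h2]
    exact h1
  rw [setIntegral_congr_set (closedBall_ae_eq_ball_zero hr.ne'), ← integral_const_mul,
    ← integral_const_mul]
  exact ⟨setIntegral_mono_on ((hI1.mono_set hsub).const_mul _) (hI2.mono_set hsub)
      measurableSet_ball fun x hx => (hpt x hx).1,
    setIntegral_mono_on (hI2.mono_set hsub) ((hI1.mono_set hsub).const_mul _)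
      measurableSet_ball fun x hx => (hpt x hx).2⟩

theorem sphere_weight_bounds (hn : 2 ≤ n) {r : ℝ} (hr : 0 < r) (hr10 : r ≤ 10) :
    ∃ K : ℝ, 0 < K ∧ ∀ (A : EuclideanSpace ℝ (Fin n) → Matrix (Fin n) (Fin n) ℝ) (lam : ℝ),
      1 ≤ lam → (∀ i j, ContDiffOn ℝ (⊤ : ℕ∞) (fun x => A x i j)
        (closedBall (0 : EuclideanSpace ℝ (Fin n)) 10)) →
      UnifElliptic A lam (closedBall (0 : EuclideanSpace ℝ (Fin n)) 10) →
      ∀ u : EuclideanSpace ℝ (Fin n) → ℝ,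
      ContDiffOn ℝ (⊤ : ℕ∞) u (closedBall (0 : EuclideanSpace ℝ (Fin n)) 10) →
      ∫ x in sphere (0 : EuclideanSpace ℝ (Fin n)) r,
        ((∑ i, ∑ j, A x i j * x j * x i) / ‖x‖ ^ 2) * u x ^ 2 ∂ μH[(n : ℝ) - 1]
        ≤ K * lam * ∫ θ : sphere (0 : EuclideanSpace ℝ (Fin n)) 1,
          u (r • (θ : EuclideanSpace ℝ (Fin n))) ^ 2
            ∂(volume : Measure (EuclideanSpace ℝ (Fin n))).toSphere ∧
      ∫ θ : sphere (0 : EuclideanSpace ℝ (Fin n)) 1,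
          u (r • (θ : EuclideanSpace ℝ (Fin n))) ^ 2
            ∂(volume : Measure (EuclideanSpace ℝ (Fin n))).toSphere
        ≤ K * lam * ∫ x in sphere (0 : EuclideanSpace ℝ (Fin n)) r,
        ((∑ i, ∑ j, A x i j * x j * x i) / ‖x‖ ^ 2) * u x ^ 2 ∂ μH[(n : ℝ) - 1] := by
  obtain ⟨K, hK, hKf⟩ := sphMeas_comparable hn hr
  refine ⟨K, hK, fun A lam hlam hA hell u hu => ?_⟩
  set τ := (volume : Measure (EuclideanSpace ℝ (Fin n))).toSphere with hτ
  rw [setIntegral_sphere hr]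
  have hnorm : ∀ θ : sphere (0 : EuclideanSpace ℝ (Fin n)) 1,
      ‖r • (θ : EuclideanSpace ℝ (Fin n))‖ = r := by
    intro θ
    rw [norm_smul, norm_eq_of_mem_sphere θ, mul_one, Real.norm_of_nonneg hr.le]
  have hmem : ∀ θ : sphere (0 : EuclideanSpace ℝ (Fin n)) 1,
      r • (θ : EuclideanSpace ℝ (Fin n)) ∈ closedBall (0 : EuclideanSpace ℝ (Fin n)) 10 := by
    intro θ
    rw [mem_closedBall_zero_iff, hnorm]
    exact hr10
  have hφ : Continuous fun θ : sphere (0 : EuclideanSpace ℝ (Fin n)) 1 =>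
      r • (θ : EuclideanSpace ℝ (Fin n)) := by fun_prop
  have huc : Continuous fun θ : sphere (0 : EuclideanSpace ℝ (Fin n)) 1 =>
      u (r • (θ : EuclideanSpace ℝ (Fin n))) := hu.continuousOn.comp_continuous hφ hmem
  have hAc : ∀ i j, Continuous fun θ : sphere (0 : EuclideanSpace ℝ (Fin n)) 1 =>
      A (r • (θ : EuclideanSpace ℝ (Fin n))) i j := fun i j =>
    (hA i j).continuousOn.comp_continuous hφ hmem
  have hc : ∀ i : Fin n, Continuous fun θ : sphere (0 : EuclideanSpace ℝ (Fin n)) 1 =>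
      (r • (θ : EuclideanSpace ℝ (Fin n))) i := fun i =>
    (sm_coord i).continuous.comp hφ
  set f : sphere (0 : EuclideanSpace ℝ (Fin n)) 1 → ℝ := fun θ =>
    ((∑ i, ∑ j, A (r • (θ : EuclideanSpace ℝ (Fin n))) i j *
      (r • (θ : EuclideanSpace ℝ (Fin n))) j * (r • (θ : EuclideanSpace ℝ (Fin n))) i) /
        ‖r • (θ : EuclideanSpace ℝ (Fin n))‖ ^ 2) * u (r • (θ : EuclideanSpace ℝ (Fin n))) ^ 2
    with hf
  have hfc : Continuous f := by
    simp only [hf, hnorm]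
    refine Continuous.mul (Continuous.div_const ?_ _) (huc.pow 2)
    exact continuous_finsetSum _ fun i _ => continuous_finsetSum _ fun j _ =>
      ((hAc i j).mul (hc j)).mul (hc i)
  have hlam0 : 0 < lam := by linarith
  have hpt : ∀ θ : sphere (0 : EuclideanSpace ℝ (Fin n)) 1,
      lam⁻¹ * u (r • (θ : EuclideanSpace ℝ (Fin n))) ^ 2 ≤ f θ ∧
      f θ ≤ lam * u (r • (θ : EuclideanSpace ℝ (Fin n))) ^ 2 := by
    intro θ
    have h1 := hell _ (hmem θ) fun i => (r • (θ : EuclideanSpace ℝ (Fin n))) i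
    have h2 : ∑ i, (r • (θ : EuclideanSpace ℝ (Fin n))) i ^ 2 = r ^ 2 := by
      rw [← EuclideanSpace.real_norm_sq_eq, hnorm]
    have h3 : ∑ i, ∑ j, A (r • (θ : EuclideanSpace ℝ (Fin n))) i j *
        (r • (θ : EuclideanSpace ℝ (Fin n))) j * (r • (θ : EuclideanSpace ℝ (Fin n))) i
        = ∑ i, ∑ j, A (r • (θ : EuclideanSpace ℝ (Fin n))) i j *
        (r • (θ : EuclideanSpace ℝ (Fin n))) i * (r • (θ : EuclideanSpace ℝ (Fin n))) j :=
      Finset.sum_congr rfl fun i _ => Finset.sum_congr rfl fun j _ => by ring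
    rw [h2, ← h3] at h1
    simp only [hf, hnorm]
    have hr2 : 0 < r ^ 2 := by positivity
    exact ⟨mul_le_mul_of_nonneg_right ((le_div_iff₀ hr2).2 h1.1) (sq_nonneg _),
      mul_le_mul_of_nonneg_right ((div_le_iff₀ hr2).2 h1.2) (sq_nonneg _)⟩
  have hintg : ∀ f : sphere (0 : EuclideanSpace ℝ (Fin n)) 1 → ℝ, Continuous f → Integrable f τ :=
    fun f hf => hf.integrable_of_hasCompactSupport (HasCompactSupport.of_compactSpace _)
  have hf0 : ∀ θ, 0 ≤ f θ := fun θ => le_trans (by positivity) (hpt θ).1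
  obtain ⟨h1, h2⟩ := hKf f hfc hf0
  have h3 : ∫ θ, f θ ∂τ ≤ lam * ∫ θ : sphere (0 : EuclideanSpace ℝ (Fin n)) 1,
      u (r • (θ : EuclideanSpace ℝ (Fin n))) ^ 2 ∂τ := by
    rw [← integral_const_mul]
    exact integral_mono (hintg _ hfc) (hintg _ ((huc.pow 2).const_mul _)) fun θ => (hpt θ).2
  have h4 : lam⁻¹ * ∫ θ : sphere (0 : EuclideanSpace ℝ (Fin n)) 1,
      u (r • (θ : EuclideanSpace ℝ (Fin n))) ^ 2 ∂τ ≤ ∫ θ, f θ ∂τ := by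
    rw [← integral_const_mul]
    exact integral_mono (hintg _ ((huc.pow 2).const_mul _)) (hintg _ hfc) fun θ => (hpt θ).1
  constructor
  · calc _ ≤ K * ∫ θ, f θ ∂τ := h1
      _ ≤ K * (lam * _) := mul_le_mul_of_nonneg_left h3 hK.le
      _ = _ := by ring
  · rw [inv_mul_le_iff₀ hlam0] at h4
    calc _ ≤ lam * ∫ θ, f θ ∂τ := h4
      _ ≤ lam * (K * _) := mul_le_mul_of_nonneg_left h2 hlam0.le
      _ = _ := by ring

theorem freq_eq {A : EuclideanSpace ℝ (Fin n) → Matrix (Fin n) (Fin n) ℝ}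
    {u : EuclideanSpace ℝ (Fin n) → ℝ} {r : ℝ} (hr : 0 < r) :
    freq A u r = r * (∫ x in closedBall (0 : EuclideanSpace ℝ (Fin n)) r,
        ∑ i, ∑ j, A x i j * pd j u x * pd i u x) /
      ∫ x in sphere (0 : EuclideanSpace ℝ (Fin n)) r,
        ((∑ i, ∑ j, A x i j * x j * x i) / ‖x‖ ^ 2) * u x ^ 2 ∂ μH[(n : ℝ) - 1] := by
  have h : r ^ (1 - (n : ℝ)) ≠ 0 := (Real.rpow_pos_of_pos hr _).ne'
  rw [freq, mul_left_comm, mul_div_mul_left _ _ h]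

theorem energy_of_freq (hn : 2 ≤ n) {lam : ℝ} (hlam : 1 ≤ lam) {N₀ : ℝ} (hN₀ : 0 < N₀) :
    ∃ C : ℝ, 0 < C ∧ ∀ A : EuclideanSpace ℝ (Fin n) → Matrix (Fin n) (Fin n) ℝ,
      (∀ i j, ContDiffOn ℝ (⊤ : ℕ∞) (fun x => A x i j)
        (closedBall (0 : EuclideanSpace ℝ (Fin n)) 10)) →
      UnifElliptic A lam (closedBall (0 : EuclideanSpace ℝ (Fin n)) 10) →
      ∀ u : EuclideanSpace ℝ (Fin n) → ℝ,
      ContDiffOn ℝ (⊤ : ℕ∞) u (closedBall (0 : EuclideanSpace ℝ (Fin n)) 10) →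
      0 < ∫ θ : sphere (0 : EuclideanSpace ℝ (Fin n)) 1,
          u ((10 : ℝ) • (θ : EuclideanSpace ℝ (Fin n))) ^ 2
            ∂(volume : Measure (EuclideanSpace ℝ (Fin n))).toSphere →
      freq A u 10 ≤ N₀ →
      ∫ x in ball (0 : EuclideanSpace ℝ (Fin n)) 10, ∑ i, pd i u x ^ 2
        ≤ C * ∫ θ : sphere (0 : EuclideanSpace ℝ (Fin n)) 1,
          u ((10 : ℝ) • (θ : EuclideanSpace ℝ (Fin n))) ^ 2
            ∂(volume : Measure (EuclideanSpace ℝ (Fin n))).toSphere := by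
  have h10 : (0 : ℝ) < 10 := by norm_num
  obtain ⟨K, hK, hKf⟩ := sphere_weight_bounds hn h10 le_rfl
  have hlam0 : 0 < lam := by linarith
  refine ⟨lam * (N₀ * (K * lam)), by positivity, fun A hA hell u hu hpos hfreq => ?_⟩
  obtain ⟨h1, h2⟩ := hKf A lam hlam hA hell u hu
  have h3 := ((energy_bounds hA hell hu).2 10 h10 le_rfl).1
  rw [freq_eq h10] at hfreq
  set H := ∫ θ : sphere (0 : EuclideanSpace ℝ (Fin n)) 1,
    u ((10 : ℝ) • (θ : EuclideanSpace ℝ (Fin n))) ^ 2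
      ∂(volume : Measure (EuclideanSpace ℝ (Fin n))).toSphere
  set h := ∫ x in sphere (0 : EuclideanSpace ℝ (Fin n)) 10,
        ((∑ i, ∑ j, A x i j * x j * x i) / ‖x‖ ^ 2) * u x ^ 2 ∂ μH[(n : ℝ) - 1]
  have hh : 0 < h := pos_of_mul_pos_right (hpos.trans_le h2) (by positivity)
  rw [div_le_iff₀ hh] at hfreq
  rw [inv_mul_le_iff₀ hlam0] at h3
  refine h3.trans ?_
  rw [mul_assoc]
  refine mul_le_mul_of_nonneg_left ?_ hlam0.le
  have h4 : N₀ * h ≤ N₀ * (K * lam) * H := by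
    rw [mul_assoc]
    exact mul_le_mul_of_nonneg_left h1 hN₀.le
  have h5 : 0 ≤ N₀ * (K * lam) * H := by positivity
  linarith

end Frequency

section Growth
open Filter Topology

variable {n : ℕ}

theorem Lop_const_mul {a : Fin n → Fin n → EuclideanSpace ℝ (Fin n) → ℝ}
    {b : Fin n → EuclideanSpace ℝ (Fin n) → ℝ} {w : EuclideanSpace ℝ (Fin n) → ℝ} (hw : Sm w)
    (c : ℝ) (x : EuclideanSpace ℝ (Fin n)) :
    Lop a b (fun y => c * w y) x = c * Lop a b w x := by
  have h1 : ∀ j, pd j (fun y => c * w y) = fun y => c * pd j w y := fun j =>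
    funext fun y => pd_const_mul_at (hw.differentiable y) c j
  have h2 : ∀ i j, pd i (fun y => c * pd j w y) x = c * pd i (pd j w) x := fun i j =>
    pd_const_mul_at ((hw.pd j).differentiable x) c i
  simp only [Lop, h1, h2, mul_add, Finset.mul_sum]
  congr 1
  · exact Finset.sum_congr rfl fun i _ => Finset.sum_congr rfl fun j _ => by ring
  · exact Finset.sum_congr rfl fun i _ => by ring

theorem supN_const_mul {w : EuclideanSpace ℝ (Fin n) → ℝ} (hw : Continuous w) {c : ℝ} (hc : 0 ≤ c)
    {x : EuclideanSpace ℝ (Fin n)} {r : ℝ} (hr : 0 ≤ r) :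
    supN (fun y => c * w y) x r = c * supN w x r := by
  refine le_antisymm (supN_le hr fun y hy => ?_) ?_
  · rw [abs_mul, abs_of_nonneg hc]
    exact mul_le_mul_of_nonneg_left (le_supN hw hy) hc
  · obtain ⟨y, hy, hyw⟩ := exists_supN hw x hr
    rw [← hyw, ← abs_of_nonneg hc, ← abs_mul, abs_of_nonneg hc]
    exact le_supN (u := fun y => c * w y) (by fun_prop) hy

theorem norm_smul_sphere {r : ℝ} (hr : 0 ≤ r) (θ : sphere (0 : EuclideanSpace ℝ (Fin n)) 1) :
    ‖r • (θ : EuclideanSpace ℝ (Fin n))‖ = r := by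
  rw [norm_smul, norm_eq_of_mem_sphere θ, mul_one, Real.norm_of_nonneg hr]

theorem exists_radial_modulus {u : EuclideanSpace ℝ (Fin n) → ℝ} {R : ℝ} (hR : 0 < R)
    (hu : ContinuousOn u (closedBall (0 : EuclideanSpace ℝ (Fin n)) R)) {ε : ℝ} (hε : 0 < ε) :
    ∃ δ, 0 < δ ∧ δ < R ∧ ∀ t, R - δ ≤ t → t ≤ R →
      ∀ θ : sphere (0 : EuclideanSpace ℝ (Fin n)) 1,
        |u (R • (θ : EuclideanSpace ℝ (Fin n))) - u (t • (θ : EuclideanSpace ℝ (Fin n)))| ≤ ε := by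
  obtain ⟨δ, hδ, h⟩ := Metric.uniformContinuousOn_iff.1
    ((isCompact_closedBall _ _).uniformContinuousOn_of_continuous hu) ε hε
  refine ⟨min (δ / 2) (R / 2), by positivity, ?_, fun t ht htR θ => ?_⟩
  · linarith [min_le_right (δ / 2) (R / 2)]
  have h1 := min_le_left (δ / 2) (R / 2)
  have h2 := min_le_right (δ / 2) (R / 2)
  have ht0 : 0 ≤ t := by linarith
  refine (h _ ?_ _ ?_ ?_).le
  · rw [mem_closedBall_zero_iff, norm_smul_sphere hR.le]
  · rw [mem_closedBall_zero_iff, norm_smul_sphere ht0]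
    exact htR
  · rw [dist_eq_norm, ← sub_smul, norm_smul_sphere (by linarith)]
    linarith

theorem exists_smul_sphere {x : EuclideanSpace ℝ (Fin n)} {r : ℝ} (hr : 0 < r)
    (hx : x ∈ sphere (0 : EuclideanSpace ℝ (Fin n)) r) :
    ∃ θ : sphere (0 : EuclideanSpace ℝ (Fin n)) 1, x = r • (θ : EuclideanSpace ℝ (Fin n)) := by
  refine ⟨⟨r⁻¹ • x, ?_⟩, ?_⟩
  · rw [mem_sphere_zero_iff_norm, norm_smul, mem_sphere_zero_iff_norm.1 hx, norm_inv,
      Real.norm_of_nonneg hr.le, inv_mul_cancel₀ hr.ne']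
  · rw [smul_smul, mul_inv_cancel₀ hr.ne', one_smul]

theorem eq_zero_of_sphere (hn : 2 ≤ n) {A : EuclideanSpace ℝ (Fin n) → Matrix (Fin n) (Fin n) ℝ}
    {lam : ℝ} (hlam : 1 ≤ lam) (hA : ∀ i j, ContDiffOn ℝ (⊤ : ℕ∞) (fun x => A x i j)
      (closedBall (0 : EuclideanSpace ℝ (Fin n)) 10))
    (hell : UnifElliptic A lam (closedBall (0 : EuclideanSpace ℝ (Fin n)) 10))
    {u : EuclideanSpace ℝ (Fin n) → ℝ}
    (hu : ContDiffOn ℝ (⊤ : ℕ∞) u (closedBall (0 : EuclideanSpace ℝ (Fin n)) 10))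
    (hsol : SolvesDiv A u (closedBall (0 : EuclideanSpace ℝ (Fin n)) 10))
    (h0 : ∀ θ : sphere (0 : EuclideanSpace ℝ (Fin n)) 1,
      u ((10 : ℝ) • (θ : EuclideanSpace ℝ (Fin n))) = 0) :
    ∀ x ∈ closedBall (0 : EuclideanSpace ℝ (Fin n)) 10, u x = 0 := by
  intro x hx
  by_cases hx10 : x ∈ sphere (0 : EuclideanSpace ℝ (Fin n)) 10
  · obtain ⟨θ, rfl⟩ := exists_smul_sphere (by norm_num) hx10
    exact h0 θ
  have hxlt : ‖x‖ < 10 := lt_of_le_of_ne (mem_closedBall_zero_iff.1 hx)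
    fun h => hx10 (mem_sphere_zero_iff_norm.2 h)
  have key : ∀ ε : ℝ, 0 < ε → |u x| ≤ ε := by
    intro ε hε
    obtain ⟨δ, hδ, hδ10, hmod⟩ := exists_radial_modulus (by norm_num) hu.continuousOn hε
    set t := max ‖x‖ (10 - δ) with ht
    have ht0 : 0 < t := lt_max_of_lt_right (by linarith)
    have ht10 : t < 10 := max_lt hxlt (by linarith)
    obtain ⟨L, a, b, hop, hext⟩ := exists_isOp_ext hlam hA hell
      (R := (t + 10) / 2) (by linarith) (by linarith)
    obtain ⟨w, hw, hwu⟩ := exists_smooth_ext (x0 := (0 : EuclideanSpace ℝ (Fin n)))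
      (r := (t + 10) / 2) (R := 10) (by linarith) (by linarith) (hu.mono ball_subset_closedBall)
    have hLop := hext u hsol w hw hwu
    have hin : closedBall (0 : EuclideanSpace ℝ (Fin n)) t ⊆ ball 0 ((t + 10) / 2) :=
      closedBall_subset_ball (by linarith)
    have hxt : x ∈ closedBall (0 : EuclideanSpace ℝ (Fin n)) t :=
      mem_closedBall_zero_iff.2 (le_max_left _ _)
    have := max_principle_abs (by omega) hop hw (M := ε) ht0
      (fun y hy => hLop y (hin (ball_subset_closedBall hy))) (fun y hy => by
        rw [hwu y (hin (sphere_subset_closedBall hy))]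
        obtain ⟨θ, rfl⟩ := exists_smul_sphere ht0 hy
        have := hmod t (le_max_right _ _) ht10.le θ
        rwa [h0, zero_sub, abs_neg] at this) x hxt
    rwa [hwu x (hin hxt)] at this
  exact abs_nonpos_iff.1 (le_of_forall_pos_le_add fun ε hε => by simpa using key ε hε)

theorem exists_growth (hn : 2 ≤ n) {A : EuclideanSpace ℝ (Fin n) → Matrix (Fin n) (Fin n) ℝ}
    {lam : ℝ} (hlam : 1 ≤ lam) (hA : ∀ i j, ContDiffOn ℝ (⊤ : ℕ∞) (fun x => A x i j)
      (closedBall (0 : EuclideanSpace ℝ (Fin n)) 10))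
    (hell : UnifElliptic A lam (closedBall (0 : EuclideanSpace ℝ (Fin n)) 10))
    {N₀ : ℝ} (hN₀ : 0 < N₀) :
    ∃ (L : ℝ) (a : Fin n → Fin n → EuclideanSpace ℝ (Fin n) → ℝ)
      (b : Fin n → EuclideanSpace ℝ (Fin n) → ℝ) (C : ℝ), 0 < C ∧ IsOp L a b ∧
      ∀ u : EuclideanSpace ℝ (Fin n) → ℝ,
        ContDiffOn ℝ (⊤ : ℕ∞) u (closedBall (0 : EuclideanSpace ℝ (Fin n)) 10) →
        SolvesDiv A u (closedBall (0 : EuclideanSpace ℝ (Fin n)) 10) →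
        (∃ x ∈ closedBall (0 : EuclideanSpace ℝ (Fin n)) 10, u x ≠ 0) →
        freq A u 10 ≤ N₀ →
        ∃ w, Sm w ∧ (∀ x ∈ ball 0 9, u x = 0 → w x = 0) ∧ (∀ x ∈ ball 0 9, Lop a b w x = 0) ∧
          supN w 0 (8 + 1 / 2) ≤ C * supN w 0 8 ∧ supN w 0 (8 + 1 / 2) = 1 := by
  set τ := (volume : Measure (EuclideanSpace ℝ (Fin n))).toSphere with hτ
  obtain ⟨C₁, hC₁, henergy⟩ := energy_of_freq hn hlam hN₀
  obtain ⟨s, hs, hs1, hgrowth⟩ := growth_of_energy n hn (4 * C₁) (by positivity)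
  obtain ⟨L, a, b, hop, hext⟩ := exists_isOp_ext hlam hA hell
    (R := 10 - s / 8) (by linarith) (by linarith)
  obtain ⟨C, hC, hgr⟩ := hgrowth L hop.one_le
  refine ⟨L, a, b, C, hC, hop, fun u hu hsol hne hfreq => ?_⟩
  have huc := hu.continuousOn
  have hcont : ∀ R : ℝ, 0 < R → R ≤ 10 → Continuous fun θ : sphere (0 : EuclideanSpace ℝ (Fin n)) 1 =>
      u (R • (θ : EuclideanSpace ℝ (Fin n))) := by
    intro R hR hR10
    have hφ : Continuous fun θ : sphere (0 : EuclideanSpace ℝ (Fin n)) 1 =>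
      R • (θ : EuclideanSpace ℝ (Fin n)) := by fun_prop
    exact huc.comp_continuous hφ fun θ =>
      mem_closedBall_zero_iff.2 ((norm_smul_sphere hR.le θ).trans_le hR10)
  have hintg : ∀ f : sphere (0 : EuclideanSpace ℝ (Fin n)) 1 → ℝ, Continuous f → Integrable f τ :=
    fun f hf => hf.integrable_of_hasCompactSupport (HasCompactSupport.of_compactSpace _)
  set H := fun R : ℝ => ∫ θ : sphere (0 : EuclideanSpace ℝ (Fin n)) 1,
    u (R • (θ : EuclideanSpace ℝ (Fin n))) ^ 2 ∂τ with hH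
  have hH0 : ∀ R, 0 ≤ H R := fun R => integral_nonneg fun θ => sq_nonneg _
  have hHpos : 0 < H 10 := by
    refine (hH0 10).lt_of_ne fun h => ?_
    obtain ⟨x, hx, hxu⟩ := hne
    refine hxu (eq_zero_of_sphere hn hlam hA hell hu hsol (fun θ₀ => ?_) x hx)
    by_contra hne0
    have h2 := (hcont 10 (by norm_num) le_rfl).pow 2
    have h3 := h2.integral_pos_of_hasCompactSupport_nonneg_nonzero (μ := τ)
      (HasCompactSupport.of_compactSpace _) (fun θ => sq_nonneg _) (x := θ₀) (by simpa using hne0)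
    exact h3.ne h
  have hen := henergy A hA hell u hu hHpos hfreq
  set T := τ.real Set.univ with hT
  have hT0 : 0 ≤ T := measureReal_nonneg
  obtain ⟨δ, hδ, hδ10, hmod⟩ := exists_radial_modulus (by norm_num) huc
    (show 0 < √(H 10 / (4 * (T + 1))) by positivity)
  set R := max (10 - s / 8) (10 - δ) with hR
  have hR10 : R < 10 := max_lt (by linarith) (by linarith)
  have hRs : 10 - s / 8 ≤ R := le_max_left _ _
  have hHR : H 10 ≤ 4 * H R := by
    have hpt : ∀ θ : sphere (0 : EuclideanSpace ℝ (Fin n)) 1,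
        u ((10 : ℝ) • (θ : EuclideanSpace ℝ (Fin n))) ^ 2
          ≤ 2 * u (R • (θ : EuclideanSpace ℝ (Fin n))) ^ 2 + 2 * (H 10 / (4 * (T + 1))) := by
      intro θ
      have h1 := hmod R (le_max_right _ _) hR10.le θ
      have h2 := pow_le_pow_left₀ (abs_nonneg _) h1 2
      rw [sq_abs, Real.sq_sqrt (by positivity)] at h2
      nlinarith [sq_nonneg (u ((10 : ℝ) • (θ : EuclideanSpace ℝ (Fin n)))
        - 2 * u (R • (θ : EuclideanSpace ℝ (Fin n))))]
    have hc1 := (hcont 10 (by norm_num) le_rfl).pow 2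
    have hc2 := ((hcont R (by linarith) hR10.le).pow 2).const_mul 2
    have h1 := integral_mono (hintg _ hc1) ((hintg _ hc2).add (integrable_const _)) hpt
    rw [integral_add' (hintg _ hc2) (integrable_const _), integral_const_mul, integral_const,
      smul_eq_mul] at h1
    have h2 : T * (2 * (H 10 / (4 * (T + 1)))) ≤ H 10 / 2 := by
      rw [show T * (2 * (H 10 / (4 * (T + 1)))) = H 10 / 2 * (T / (T + 1)) by field_simp; norm_num]
      refine mul_le_of_le_one_right (by positivity) ?_
      rw [div_le_one (by positivity)]
      linarith
    have h3 : H 10 ≤ 2 * H R + T * (2 * (H 10 / (4 * (T + 1)))) := h1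
    linarith
  obtain ⟨w, hw, hwu⟩ := exists_smooth_ext (x0 := (0 : EuclideanSpace ℝ (Fin n)))
    (r := (R + 10) / 2) (R := 10) (by linarith) (by linarith) (hu.mono ball_subset_closedBall)
  have hin : closedBall (0 : EuclideanSpace ℝ (Fin n)) R ⊆ ball 0 ((R + 10) / 2) :=
    closedBall_subset_ball (by linarith)
  have hLop := hext u hsol w hw fun x hx => hwu x (hin (ball_subset_closedBall
    (ball_subset_ball hRs hx)))
  have hHw : ∫ θ : sphere (0 : EuclideanSpace ℝ (Fin n)) 1,
      w (R • (θ : EuclideanSpace ℝ (Fin n))) ^ 2 ∂τ = H R := by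
    refine integral_congr_ae (ae_of_all _ fun θ => ?_)
    dsimp only
    rw [hwu _ (hin (mem_closedBall_zero_iff.2 (norm_smul_sphere (by linarith) θ).le))]
  have hGw : ∫ x in closedBall (0 : EuclideanSpace ℝ (Fin n)) R, ∑ i, pd i w x ^ 2
      ≤ ∫ x in ball (0 : EuclideanSpace ℝ (Fin n)) 10, ∑ i, pd i u x ^ 2 := by
    rw [setIntegral_congr_fun (g := fun x => ∑ i, pd i u x ^ 2) measurableSet_closedBall
      (fun x hx => by simp only [pd_congr_on isOpen_ball hwu _ x (hin hx)])]
    exact setIntegral_mono_set (energy_bounds hA hell hu).1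
      (ae_of_all _ fun x => Finset.sum_nonneg fun i _ => sq_nonneg _)
      (closedBall_subset_ball hR10).eventuallyLE
  obtain ⟨h1, h2⟩ := hgr a b hop w hw R hRs hR10.le hLop (by
    rw [hHw]
    calc _ ≤ C₁ * H 10 := hGw.trans hen
      _ ≤ C₁ * (4 * H R) := mul_le_mul_of_nonneg_left hHR hC₁.le
      _ = 4 * C₁ * H R := by ring) (by
    rw [hHw]
    linarith)
  have hM : 0 < supN w 0 (8 + 1 / 2) :=
    h2.trans_le (supN_mono_radius hw.continuous (by norm_num) (by norm_num))
  set M := supN w 0 (8 + 1 / 2) with hMdef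
  have h9 : ball (0 : EuclideanSpace ℝ (Fin n)) 9 ⊆ ball 0 (10 - s / 8) :=
    ball_subset_ball (by linarith)
  refine ⟨fun x => M⁻¹ * w x, contDiff_const.mul hw, fun x hx hux => ?_, fun x hx => ?_, ?_, ?_⟩
  · show M⁻¹ * w x = 0
    rw [hwu x (hin (ball_subset_closedBall (ball_subset_ball hRs (h9 hx)))), hux, mul_zero]
  · rw [Lop_const_mul hw, hLop x (h9 hx), mul_zero]
  · rw [supN_const_mul hw.continuous (by positivity) (by norm_num),
      supN_const_mul hw.continuous (by positivity) (by norm_num), mul_left_comm]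
    exact mul_le_mul_of_nonneg_left h1 (by positivity)
  · rw [supN_const_mul hw.continuous (by positivity) (by norm_num)]
    exact inv_mul_cancel₀ hM.ne'

end Growth

section Frequency

variable {n : ℕ}

theorem exists_sphere_supN_le (hn : 2 ≤ n) {L : ℝ}
    {a : Fin n → Fin n → EuclideanSpace ℝ (Fin n) → ℝ}
    {b : Fin n → EuclideanSpace ℝ (Fin n) → ℝ} (hop : IsOp L a b)
    {w : EuclideanSpace ℝ (Fin n) → ℝ} (hw : Sm w)
    (hsol : ∀ x ∈ ball (0 : EuclideanSpace ℝ (Fin n)) 1, Lop a b w x = 0) :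
    ∃ θ : sphere (0 : EuclideanSpace ℝ (Fin n)) 1, supN w 0 1 ≤ |w θ| := by
  have : Nontrivial (Fin n) := Fin.nontrivial_iff_two_le.2 hn
  obtain ⟨θ, hθ, hmax⟩ := (isCompact_sphere (0 : EuclideanSpace ℝ (Fin n)) 1).exists_isMaxOn
    (NormedSpace.sphere_nonempty.2 zero_le_one) hw.continuous.abs.continuousOn
  exact ⟨⟨θ, hθ⟩, supN_le zero_le_one
    (max_principle_abs (by omega) hop hw one_pos hsol fun x hx => hmax hx)⟩

theorem sphere_mass_lower {w : EuclideanSpace ℝ (Fin n) → ℝ} (hw : Continuous w) {ε m : ℝ}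
    (hε : 0 < ε) (hm : 0 ≤ m) (θ₀ : sphere (0 : EuclideanSpace ℝ (Fin n)) 1)
    (h : ∀ y ∈ ball (θ₀ : EuclideanSpace ℝ (Fin n)) ε, m ≤ |w y|) :
    Measure.toSphereBallBound n ε *
      (volume : Measure (EuclideanSpace ℝ (Fin n))).real (ball 0 1) * m ^ 2
      ≤ ∫ θ : sphere (0 : EuclideanSpace ℝ (Fin n)) 1, w θ ^ 2
          ∂(volume : Measure (EuclideanSpace ℝ (Fin n))).toSphere := by
  have hb := Measure.toSphereBallBound_mul_measureReal_unitBall_le_toSphere_ball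
    (volume : Measure (EuclideanSpace ℝ (Fin n))) hε θ₀
  rw [finrank_euclideanSpace_fin] at hb
  set τ := (volume : Measure (EuclideanSpace ℝ (Fin n))).toSphere
  have hintg : Integrable (fun θ : sphere (0 : EuclideanSpace ℝ (Fin n)) 1 =>
      w (θ : EuclideanSpace ℝ (Fin n)) ^ 2) τ :=
    (Continuous.integrable_of_hasCompactSupport (by fun_prop)
      (HasCompactSupport.of_compactSpace _))
  calc _ ≤ τ.real (ball θ₀ ε) * m ^ 2 := mul_le_mul_of_nonneg_right hb (sq_nonneg _)
    _ = ∫ _ in ball θ₀ ε, m ^ 2 ∂τ := by rw [setIntegral_const, smul_eq_mul]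
    _ ≤ ∫ θ in ball θ₀ ε, w θ ^ 2 ∂τ :=
        setIntegral_mono_on (integrableOn_const (measure_ne_top _ _)) hintg.integrableOn
          measurableSet_ball fun θ hθ => by
            rw [← sq_abs (w θ)]
            exact pow_le_pow_left₀ hm (h θ hθ) 2
    _ ≤ _ := setIntegral_le_integral hintg (ae_of_all _ fun θ => sq_nonneg _)

/-- A doubling inequality at scale one bounds the frequency at radius one. -/
theorem freq_le_of_doubling (hn : 2 ≤ n) {lam : ℝ} (hlam : 1 ≤ lam) {L : ℝ} (hL : 1 ≤ L) {C : ℝ}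
    (hC : 0 < C) :
    ∃ D₀ : ℝ, 0 < D₀ ∧ ∀ A : EuclideanSpace ℝ (Fin n) → Matrix (Fin n) (Fin n) ℝ,
      (∀ i j, ContDiffOn ℝ (⊤ : ℕ∞) (fun x => A x i j)
        (closedBall (0 : EuclideanSpace ℝ (Fin n)) 10)) →
      UnifElliptic A lam (closedBall (0 : EuclideanSpace ℝ (Fin n)) 10) →
      ∀ v : EuclideanSpace ℝ (Fin n) → ℝ,
        ContDiffOn ℝ (⊤ : ℕ∞) v (closedBall (0 : EuclideanSpace ℝ (Fin n)) 10) →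
      ∀ a b, IsOp (n := n) L a b → ∀ w, Sm w →
        (∀ x ∈ ball (0 : EuclideanSpace ℝ (Fin n)) 9, w x = v x) →
        (∀ x ∈ ball (0 : EuclideanSpace ℝ (Fin n)) 9, Lop a b w x = 0) →
        0 < supN w 0 1 → supN w 0 2 ≤ C * supN w 0 1 → freq A v 1 ≤ D₀ := by
  obtain ⟨K, hK, hsph⟩ := sphere_weight_bounds hn (r := 1) one_pos (by norm_num)
  obtain ⟨Cg, hCg, hgrad⟩ := grad_le n L hL
  obtain ⟨Cl, hCl, hlip⟩ := lip_le n L hL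
  have hCl0 : 0 < Cl := by linarith
  set ε := 1 / (4 * Cl * C + 4) with hε
  have hε0 : 0 < ε := by positivity
  have hε4 : ε ≤ 1 / 4 := by
    rw [hε]
    exact one_div_le_one_div_of_le (by norm_num) (by linarith [mul_pos hCl0 hC])
  have hεC : 2 * Cl * C * ε ≤ 1 / 2 := by
    rw [hε, mul_one_div, div_le_iff₀ (by positivity)]
    linarith
  set V := (volume : Measure (EuclideanSpace ℝ (Fin n))).real (ball 0 1) with hV
  have hV0 : 0 < V := ENNReal.toReal_pos (measure_ball_pos _ _ one_pos).ne' measure_ball_lt_top.ne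
  set t := (Measure.toSphereBallBound n ε : ℝ) * V with ht
  have ht0 : 0 < t := mul_pos (NNReal.coe_pos.2 (Measure.toSphereBallBound_pos n ε)) hV0
  refine ⟨lam * (V * (Cg * C) ^ 2) * (K * lam) * 4 / t, by positivity, ?_⟩
  intro A hA hell v hv a b hop w hw hwv hsol hM hdbl
  set M := supN w 0 1 with hMdef
  have hcl {x : EuclideanSpace ℝ (Fin n)} (hx : ‖x‖ ≤ 1) : ball x 1 ⊆ closedBall 0 2 :=
    fun y hy => by
      rw [mem_closedBall_zero_iff]
      have := norm_le_norm_add_norm_sub' y x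
      rw [mem_ball, dist_eq_norm] at hy
      linarith
  have hb2 : closedBall (0 : EuclideanSpace ℝ (Fin n)) 2 ⊆ ball 0 9 :=
    closedBall_subset_ball (by norm_num)
  have hw2 : ∀ y ∈ closedBall (0 : EuclideanSpace ℝ (Fin n)) 2, |w y| ≤ C * M := fun y hy =>
    (le_supN hw.continuous hy).trans hdbl
  have hnum : ∫ x in closedBall (0 : EuclideanSpace ℝ (Fin n)) 1,
      ∑ i, ∑ j, A x i j * pd j v x * pd i v x ≤ lam * (V * (Cg * C) ^ 2 * M ^ 2) := by
    refine ((energy_bounds hA hell hv).2 1 one_pos (by norm_num)).2.trans ?_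
    refine mul_le_mul_of_nonneg_left ?_ (by linarith)
    have h19 : ball (0 : EuclideanSpace ℝ (Fin n)) 1 ⊆ ball 0 9 := ball_subset_ball (by norm_num)
    refine (Real.le_norm_self _).trans ((norm_setIntegral_le_of_norm_le_const
      (C := (Cg * C * M) ^ 2) measure_ball_lt_top fun x hx => ?_).trans_eq ?_)
    · have hg := hgrad a b hop w hw x 1 (C * M) one_pos le_rfl
        (fun y hy => hsol y (hb2 (hcl (mem_ball_zero_iff.1 hx).le hy)))
        (fun y hy => hw2 y (hcl (mem_ball_zero_iff.1 hx).le hy))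
      rw [div_one, ← mul_assoc] at hg
      rw [Real.norm_of_nonneg (Finset.sum_nonneg fun i _ => sq_nonneg _)]
      rw [Real.sqrt_le_left (by positivity)] at hg
      refine le_trans (le_of_eq ?_) hg
      exact Finset.sum_congr rfl fun i _ => by
        rw [pd_congr_on isOpen_ball hwv i x (h19 hx)]
    · rw [← hV]
      ring
  obtain ⟨θ₀, hθ₀⟩ := exists_sphere_supN_le hn hop hw
    fun x hx => hsol x (ball_subset_ball (by norm_num) hx)
  have hn1 : ‖(θ₀ : EuclideanSpace ℝ (Fin n))‖ ≤ 1 := (norm_eq_of_mem_sphere θ₀).le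
  have hlow : ∀ y ∈ ball (θ₀ : EuclideanSpace ℝ (Fin n)) ε, M / 2 ≤ |w y| := fun y hy => by
    have h2 : ball (θ₀ : EuclideanSpace ℝ (Fin n)) (2 * (1 / 2)) ⊆ closedBall 0 2 := by
      rw [mul_one_div, div_self two_ne_zero]
      exact hcl hn1
    have h := hlip a b hop w hw θ₀ (1 / 2) (C * M) (by norm_num) (by norm_num)
      (fun y hy => hsol y (hb2 (h2 hy))) (fun y hy => hw2 y (h2 hy)) θ₀
      (mem_ball_self (by norm_num)) y (ball_subset_ball (by linarith) hy)
    have h3 : Cl / (1 / 2) * (C * M) * dist (θ₀ : EuclideanSpace ℝ (Fin n)) y ≤ M / 2 := by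
      calc _ ≤ Cl / (1 / 2) * (C * M) * ε :=
            mul_le_mul_of_nonneg_left (by rw [dist_comm]; exact (mem_ball.1 hy).le) (by positivity)
        _ = 2 * Cl * C * ε * M := by ring
        _ ≤ 1 / 2 * M := mul_le_mul_of_nonneg_right hεC hM.le
        _ = M / 2 := by ring
    linarith [abs_sub_abs_le_abs_sub (w θ₀) (w y)]
  have hmass := sphere_mass_lower hw.continuous hε0 (by positivity) θ₀ hlow
  have hden := (hsph A lam hlam hA hell v hv).2
  have hvw : ∫ θ : sphere (0 : EuclideanSpace ℝ (Fin n)) 1,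
      v ((1 : ℝ) • (θ : EuclideanSpace ℝ (Fin n))) ^ 2
        ∂(volume : Measure (EuclideanSpace ℝ (Fin n))).toSphere
      = ∫ θ : sphere (0 : EuclideanSpace ℝ (Fin n)) 1, w θ ^ 2
        ∂(volume : Measure (EuclideanSpace ℝ (Fin n))).toSphere := by
    refine integral_congr_ae (ae_of_all _ fun θ => ?_)
    have hθ : (θ : EuclideanSpace ℝ (Fin n)) ∈ ball 0 9 := by
      rw [mem_ball_zero_iff, norm_eq_of_mem_sphere θ]
      norm_num
    simp only [one_smul, hwv _ hθ]
  rw [hvw] at hden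
  rw [freq_eq one_pos, one_mul]
  set h := ∫ x in sphere (0 : EuclideanSpace ℝ (Fin n)) 1,
    ((∑ i, ∑ j, A x i j * x j * x i) / ‖x‖ ^ 2) * v x ^ 2 ∂ μH[(n : ℝ) - 1]
  have hKh : t * (M / 2) ^ 2 ≤ K * lam * h := hmass.trans hden
  have hh : 0 < h := by
    have h1 : 0 < K * lam * h := lt_of_lt_of_le (by positivity) hKh
    exact pos_of_mul_pos_right h1 (by positivity)
  rw [div_le_iff₀ hh]
  refine hnum.trans ?_
  rw [div_mul_eq_mul_div, le_div_iff₀ ht0]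
  calc _ = lam * (V * (Cg * C) ^ 2) * 4 * (t * (M / 2) ^ 2) := by ring
    _ ≤ lam * (V * (Cg * C) ^ 2) * 4 * (K * lam * h) :=
        mul_le_mul_of_nonneg_left hKh (by positivity)
    _ = _ := by ring

end Frequency

/-- Theorem 1.14 of the paper: if `Z(v) ⊆ Z(u)` and the frequency of `u` is bounded,
then the frequency of `v` is bounded. -/
theorem stmt_9 (n : ℕ) (hn : 2 ≤ n) (lam : ℝ) (hlam : 1 ≤ lam)
    (A A' : EuclideanSpace ℝ (Fin n) → Matrix (Fin n) (Fin n) ℝ)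
    (hA : ∀ i j, ContDiffOn ℝ (⊤ : ℕ∞) (fun x => A x i j)
      (closedBall (0 : EuclideanSpace ℝ (Fin n)) 10))
    (hA' : ∀ i j, ContDiffOn ℝ (⊤ : ℕ∞) (fun x => A' x i j)
      (closedBall (0 : EuclideanSpace ℝ (Fin n)) 10))
    (hellA : UnifElliptic A lam (closedBall (0 : EuclideanSpace ℝ (Fin n)) 10))
    (hellA' : UnifElliptic A' lam (closedBall (0 : EuclideanSpace ℝ (Fin n)) 10))
    (hA0 : A 0 = 1) (hA'0 : A' 0 = 1)
    (N₀ : ℝ) (hN₀ : 0 < N₀) :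
    ∃ D₀ : ℝ, 0 < D₀ ∧
      ∀ u v : EuclideanSpace ℝ (Fin n) → ℝ,
        ContDiffOn ℝ (⊤ : ℕ∞) u (closedBall (0 : EuclideanSpace ℝ (Fin n)) 10) →
        ContDiffOn ℝ (⊤ : ℕ∞) v (closedBall (0 : EuclideanSpace ℝ (Fin n)) 10) →
        SolvesDiv A u (closedBall (0 : EuclideanSpace ℝ (Fin n)) 10) →
        SolvesDiv A' v (closedBall (0 : EuclideanSpace ℝ (Fin n)) 10) →
        (∃ x ∈ closedBall (0 : EuclideanSpace ℝ (Fin n)) 10, u x ≠ 0) →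
        (∃ x ∈ closedBall (0 : EuclideanSpace ℝ (Fin n)) 10, v x ≠ 0) →
        {x | v x = 0} ⊆ {x | u x = 0} →
        freq A u 10 ≤ N₀ →
        freq A' v 1 ≤ D₀ := by
  obtain ⟨L₁, a, b, C₁, hC₁, hop₁, hgrow⟩ := exists_growth hn hlam hA hellA hN₀
  obtain ⟨L₂, a', b', hop₂, hext⟩ := exists_isOp_ext hlam hA' hellA' (R := 9) (by norm_num)
    (by norm_num)
  have hop := hop₁.mono (le_max_left L₁ L₂)
  have hop' := hop₂.mono (le_max_right L₁ L₂)
  set L := max L₁ L₂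
  have hn0 : 0 < n := by omega
  obtain ⟨c, r₁, D, k, hc, hr₁, hr8, hD, hk, htame⟩ := tame_of_growth n hn0 L hop.one_le C₁ hC₁
  obtain ⟨C, hC, hcomp⟩ := nodal_comparison n hn0 L hop.one_le c r₁ D k hc hr₁ hr8 hD hk
  obtain ⟨D₀, hD₀, hfreq⟩ := freq_le_of_doubling hn hlam hop.one_le hC
  refine ⟨D₀, hD₀, fun u v hu hv hsolu hsolv hneu _ hZ hfu => ?_⟩
  obtain ⟨w, hw, hwz, hwL, hwg, hw1⟩ := hgrow u hu hsolu hneu hfu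
  obtain ⟨w', hw', hwv⟩ := exists_smooth_ext (x0 := (0 : EuclideanSpace ℝ (Fin n)))
    (by norm_num : (0 : ℝ) < 9) (by norm_num : (9 : ℝ) < 10) (hv.mono ball_subset_closedBall)
  have hwL' := hext v hsolv w' hw' hwv
  have h9 : closedBall (0 : EuclideanSpace ℝ (Fin n)) (8 + 1 / 2) ⊆ ball 0 9 :=
    closedBall_subset_ball (by norm_num)
  have hP : NodalPair L c r₁ D k a b a' b' w w' :=
    { op := hop
      op' := hop'
      sm := hw
      sm' := hw'
      sol := fun y hy => hwL y (h9 hy)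
      sol' := fun y hy => hwL' y (h9 hy)
      zero := fun y hy hy0 => hwz y (h9 hy) (hZ ((hwv y (h9 hy)).symm.trans hy0))
      tame := htame a b hop w hw (fun y hy => hwL y (h9 hy)) hwg hw1 }
  exact hfreq A' hA' hellA' v hv a' b' hop' w' hw' hwv hwL' (hP.supN_pos hc hr₁ hr8 le_rfl)
    (hcomp a b a' b' w w' hP)
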